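/- Let D ⊆ ℂ^N be a strictly pseudoconvex domain. For every x ∈ bD there exist an open ball B_x centred at x and a map k_x, holomorphic and injective on a neighborhood of cl(D), with k_x(cl(D)) ⊆ cl(𝔹_N), k_x(D) ⊆ 𝔹_N, and k_x(x) = (1, 0) ∈ ℂ × ℂ^{N−1}, such that each point of k_x(B_x ∩ bD) is a point of strict convexity of k_x(D). -/

import Mathlib

open Set Filter Topology Metric MeasureTheory
open scoped ENNReal NNReal InnerProductSpace ComplexConjugate

noncomputable section

/-- `ℂ^N` with the Euclidean structure. -/
abbrev EN (N : ℕ) := EuclideanSpace ℂ (Fin N)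

instance {N : ℕ} : MeasurableSpace (EN N) := borel _
instance {N : ℕ} : BorelSpace (EN N) := ⟨rfl⟩

/-- A domain: a nonempty open connected subset. -/
def IsDomainSet {N : ℕ} (D : Set (EN N)) : Prop := IsOpen D ∧ IsConnected D

/-- `u` is plurisubharmonic on `D`: upper semicontinuous on `D`, and its restriction to
every complex affine line satisfies the sub-mean value inequality on every closed disc
(of that line) contained in `D`. -/
def PlurisubharmonicOn {N : ℕ} (u : EN N → ℝ) (D : Set (EN N)) : Prop :=
  UpperSemicontinuousOn u D ∧
  ∀ (a b : EN N) (t₀ : ℂ) (r : ℝ), 0 < r →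
    (fun t : ℂ => a + t • b) '' Metric.closedBall t₀ r ⊆ D →
    u (a + t₀ • b) ≤ (2 * Real.pi)⁻¹ *
      ∫ θ in (0:ℝ)..(2 * Real.pi), u (a + (t₀ + r * Complex.exp (θ * Complex.I)) • b)

/-- `D` is a pseudoconvex domain: a domain carrying a continuous plurisubharmonic
exhaustion function. -/
def Pseudoconvex {N : ℕ} (D : Set (EN N)) : Prop :=
  IsDomainSet D ∧ ∃ u : EN N → ℝ, ContinuousOn u D ∧ PlurisubharmonicOn u D ∧
    ∀ c : ℝ, IsCompact (closure {z ∈ D | u z < c}) ∧ closure {z ∈ D | u z < c} ⊆ D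

/-- The space `𝒪(D)` of holomorphic functions on `D`, as a submodule of `ℂ^N → ℂ`. -/
def Hol {N : ℕ} (D : Set (EN N)) : Submodule ℂ (EN N → ℂ) where
  carrier := {f | DifferentiableOn ℂ f D}
  add_mem' hf hg := hf.add hg
  zero_mem' := differentiableOn_const 0
  smul_mem' c f hf := hf.const_smul c

/-- The topology of uniform convergence on compact subsets of `D`, on `𝒪(D)`. -/
instance holTopology {N : ℕ} (D : Set (EN N)) : TopologicalSpace ↥(Hol D) :=
  TopologicalSpace.induced
    (fun f => UniformOnFun.ofFun {K : Set (EN N) | K ⊆ D ∧ IsCompact K} f.1)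
    inferInstance

/-- A set is residual if it contains a dense `G_δ` set. -/
def ResidualIn {X : Type*} [TopologicalSpace X] (S : Set X) : Prop :=
  ∃ T : Set X, T ⊆ S ∧ IsGδ T ∧ Dense T

/-- `S` is densely lineable: `S ∪ {0}` contains a dense vector subspace. -/
def DenselyLineableIn {X : Type*} [TopologicalSpace X] [AddCommMonoid X] [Module ℂ X]
    (S : Set X) : Prop :=
  ∃ p : Submodule ℂ X, Dense (p : Set X) ∧ (p : Set X) ⊆ S ∪ {0}

/-- `S` is spaceable: `S ∪ {0}` contains a closed infinite-dimensional vector subspace. -/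
def SpaceableIn {X : Type*} [TopologicalSpace X] [AddCommMonoid X] [Module ℂ X]
    (S : Set X) : Prop :=
  ∃ p : Submodule ℂ X, IsClosed (p : Set X) ∧ ¬ Module.Finite ℂ ↥p ∧ (p : Set X) ⊆ S ∪ {0}

/-- A finite length path to `bD`: continuous and piecewise `C¹` on `[0,1)`, with values in `D`,
finite length (total variation), converging to a boundary point of `D` as `r → 1`. -/
def FiniteLengthPathTo {N : ℕ} (D : Set (EN N)) (γ : ℝ → EN N) : Prop :=
  MapsTo γ (Ico (0:ℝ) 1) D ∧ ContinuousOn γ (Ico (0:ℝ) 1) ∧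
  (∃ u : ℕ → ℝ, u 0 = 0 ∧ StrictMono u ∧ (∀ n, u n < 1) ∧ Tendsto u atTop (𝓝 1) ∧
    ∀ n, ContDiffOn ℝ 1 γ (Icc (u n) (u (n+1)))) ∧
  eVariationOn γ (Ico (0:ℝ) 1) < ⊤ ∧
  ∃ ζ ∈ frontier D, Tendsto γ (𝓝[<] (1:ℝ)) (𝓝 ζ)

/-- The set of `f ∈ 𝒪(D)` with maximal cluster set along every finite length path to `bD`. -/
def WildSet {N : ℕ} (D : Set (EN N)) : Set ↥(Hol D) :=
  {f | ∀ γ : ℝ → EN N, FiniteLengthPathTo D γ → ∀ c : ℂ,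
    ∃ r : ℕ → ℝ, (∀ n, r n ∈ Ico (0:ℝ) 1) ∧ Tendsto r atTop (𝓝 1) ∧
      Tendsto (fun n => f.1 (γ (r n))) atTop (𝓝 c)}

/-- The `𝒪(D)`-hull of `K`. -/
def holHull {N : ℕ} (D K : Set (EN N)) : Set (EN N) :=
  {z ∈ D | ∀ φ : EN N → ℂ, DifferentiableOn ℂ φ D → ‖φ z‖ ≤ ⨆ w ∈ K, ‖φ w‖}

/-- `K` is `𝒪(D)`-convex. -/
def HolConvexIn {N : ℕ} (D K : Set (EN N)) : Prop := K ⊆ D ∧ holHull D K = K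

/-- The polynomial hull of a compact subset of `ℂ`. -/
def polyHull1 (E : Set ℂ) : Set ℂ :=
  {z | ∀ p : Polynomial ℂ, ‖p.eval z‖ ≤ ⨆ w ∈ E, ‖p.eval w‖}

/-- The polynomial hull of a subset of `ℂ^N`. -/
def polyHull {N : ℕ} (E : Set (EN N)) : Set (EN N) :=
  {z | ∀ p : MvPolynomial (Fin N) ℂ,
    ‖MvPolynomial.eval (fun j => z j) p‖ ≤ ⨆ w ∈ E, ‖MvPolynomial.eval (fun j => w j) p‖}

/-- `E ⊆ ℂ^N` is polynomially convex. -/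
def PolynomiallyConvex {N : ℕ} (E : Set (EN N)) : Prop := polyHull E = E

/-- The (real) Hessian of `ρ` at `p`, applied to the pair `(v, w)`. -/
def Hess {N : ℕ} (ρ : EN N → ℝ) (p v w : EN N) : ℝ :=
  fderiv ℝ (fderiv ℝ ρ) p v w

/-- The Levi form `∑_{j,k} ∂²ρ/∂z_j∂z̄_k (p) w_j w̄_k`, expressed through the real Hessian. -/
def LeviForm {N : ℕ} (ρ : EN N → ℝ) (p w : EN N) : ℝ :=
  (Hess ρ p w w + Hess ρ p (Complex.I • w) (Complex.I • w)) / 4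

/-- `w` belongs to the complex tangent space `{w : ∑_j ∂ρ/∂z_j(p) w_j = 0}` at `p`. -/
def ComplexTangent {N : ℕ} (ρ : EN N → ℝ) (p w : EN N) : Prop :=
  fderiv ℝ ρ p w = 0 ∧ fderiv ℝ ρ p (Complex.I • w) = 0

/-- `ρ` is a `C²` defining function for `D` on the open neighborhood `V` of `cl D`. -/
def IsDefiningFunctionOn {N : ℕ} (D : Set (EN N)) (ρ : EN N → ℝ) (V : Set (EN N)) : Prop :=
  IsOpen V ∧ closure D ⊆ V ∧ ContDiffOn ℝ 2 ρ V ∧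
  D = {z ∈ V | ρ z < 0} ∧ ∀ p ∈ frontier D, fderiv ℝ ρ p ≠ 0

/-- `D` is a strictly pseudoconvex domain with defining function `ρ`. -/
def StrictPSCWith {N : ℕ} (D : Set (EN N)) (ρ : EN N → ℝ) : Prop :=
  IsDomainSet D ∧ Bornology.IsBounded D ∧ (∃ V, IsDefiningFunctionOn D ρ V) ∧
  ∀ p ∈ frontier D, ∀ w : EN N, w ≠ 0 → ComplexTangent ρ p w → 0 < LeviForm ρ p w

/-- `D` is a strictly pseudoconvex domain. -/
def StrictlyPseudoconvex {N : ℕ} (D : Set (EN N)) : Prop := ∃ ρ, StrictPSCWith D ρ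

/-- `ρ` and `σ` are at `C²`-distance `< ε` on `V`. -/
def C2DistLt {N : ℕ} (V : Set (EN N)) (ρ σ : EN N → ℝ) (ε : ℝ) : Prop :=
  ∀ z ∈ V, |ρ z - σ z| + ‖fderiv ℝ ρ z - fderiv ℝ σ z‖ +
    ‖fderiv ℝ (fderiv ℝ ρ) z - fderiv ℝ (fderiv ℝ σ) z‖ < ε

/-- The standing assumptions on the map `γ : bD × [0,1] → cl D`: it is `C^k`, maps
`bD × [0,1)` into `D`, satisfies `γ(x,1) = x`, and the curves `r ↦ γ(x,r)` hit `bD`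
transversally at `x` (the `r`-derivative at `1` is not annihilated by `dρ(x)`,
i.e. it is not tangent to `bD` at `x`). -/
def GammaMap {N : ℕ} (D : Set (EN N)) (ρ : EN N → ℝ) (γ : EN N × ℝ → EN N) (k : ℕ) : Prop :=
  ContDiffOn ℝ k γ ((frontier D) ×ˢ Icc (0:ℝ) 1) ∧
  (∀ x ∈ frontier D, ∀ r ∈ Ico (0:ℝ) 1, γ (x, r) ∈ D) ∧
  (∀ x ∈ frontier D, γ (x, 1) = x) ∧
  ∀ x ∈ frontier D, fderiv ℝ ρ x (derivWithin (fun r => γ (x, r)) (Icc (0:ℝ) 1) 1) ≠ 0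

/-- Assumption (†): for all `r` close enough to `1`, `bD_r := γ(bD × {r})` bounds a strictly
pseudoconvex domain `D_r ⊆ D` whose defining function converges to `ρ` in `C²` norm on a
neighborhood `V` of `cl D` as `r → 1`. -/
def Dagger {N : ℕ} (D : Set (EN N)) (ρ : EN N → ℝ) (γ : EN N × ℝ → EN N) : Prop :=
  ∃ V : Set (EN N), IsOpen V ∧ closure D ⊆ V ∧
  ∃ (Dr : ℝ → Set (EN N)) (ρr : ℝ → EN N → ℝ),
    ∀ ε > 0, ∃ r₀ ∈ Ico (0:ℝ) 1, ∀ r ∈ Ioo r₀ 1,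
      StrictPSCWith (Dr r) (ρr r) ∧ Dr r ⊆ D ∧
      frontier (Dr r) = (fun x => γ (x, r)) '' frontier D ∧
      C2DistLt V (ρr r) ρ ε

/-- The `(2N-1)`-dimensional Hausdorff (surface) measure on `bD`. -/
def surfMeasure {N : ℕ} (D : Set (EN N)) : Measure (EN N) :=
  (Measure.hausdorffMeasure (2 * (N:ℝ) - 1)).restrict (frontier D)

/-- The normalized surface measure on `bD`. -/
def surfMeasureNorm {N : ℕ} (D : Set (EN N)) : Measure (EN N) :=
  ((Measure.hausdorffMeasure (2 * (N:ℝ) - 1) : Measure (EN N)) (frontier D))⁻¹ • surfMeasure D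

/-- The set `𝒲((r_j))` of `f ∈ 𝒪(D)` such that every measurable function on `bD` is an
a.e. limit of `f ∘ γ(·, r_{j_k})` along some subsequence of `(r_j)`. -/
def WSet {N : ℕ} (D : Set (EN N)) (γ : EN N × ℝ → EN N) (r : ℕ → ℝ) : Set ↥(Hol D) :=
  {f | ∀ h : EN N → ℂ, Measurable h → ∃ φ : ℕ → ℕ, StrictMono φ ∧
    ∀ᵐ x ∂ surfMeasure D, Tendsto (fun k => f.1 (γ (x, r (φ k)))) atTop (𝓝 (h x))}

/-- `Γ` is a closed cap of a convex set `V`: the closure of a connected component of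
`V \ H` for some real affine hyperplane `H` (for convex `V`, a nonempty open half-space
slice of `V`). -/
def IsClosedCap {N : ℕ} (V : Set (EN N)) (Γ : Set (EN N)) : Prop :=
  ∃ (l : EN N →L[ℝ] ℝ) (c : ℝ), l ≠ 0 ∧ (V ∩ {z | c < l z}).Nonempty ∧
    Γ = closure (V ∩ {z | c < l z})

/-- `V` is a strictly convex domain: a bounded convex domain with `C²` boundary whose
defining function has positive definite real Hessian on the real tangent space. -/
def StrictlyConvexDomain {N : ℕ} (V : Set (EN N)) : Prop :=
  IsDomainSet V ∧ Bornology.IsBounded V ∧ Convex ℝ V ∧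
  ∃ (ρ : EN N → ℝ) (W : Set (EN N)), IsDefiningFunctionOn V ρ W ∧
    ∀ p ∈ frontier V, ∀ w : EN N, w ≠ 0 → fderiv ℝ ρ p w = 0 → 0 < Hess ρ p w w

/-- The defining function `‖z‖² - 1` of the unit ball. -/
def ballRho {N : ℕ} : EN N → ℝ := fun z => ‖z‖ ^ 2 - 1

/-- The normalized surface measure on the unit sphere of `ℂ^N`. -/
def sphMeasure (N : ℕ) : Measure (EN N) :=
  ((Measure.hausdorffMeasure (2 * (N:ℝ) - 1) : Measure (EN N)) (Metric.sphere 0 1))⁻¹ •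
    (Measure.hausdorffMeasure (2 * (N:ℝ) - 1)).restrict (Metric.sphere 0 1)

/-- `v` is a weight: increasing on `[0,∞)`, nonnegative, and tending to `∞`. -/
def IsWeight (v : ℝ → ℝ) : Prop :=
  (∀ x ∈ Ici (0:ℝ), 0 ≤ v x) ∧ MonotoneOn v (Ici 0) ∧ Tendsto v atTop atTop

/-- The norm `‖f‖ = sup_{z ∈ 𝔹_N} |f z| / v(|z|)` of `H_v^0`. -/
def hvNorm {N : ℕ} (v : ℝ → ℝ) (f : EN N → ℂ) : ℝ :=
  ⨆ z ∈ Metric.ball (0:EN N) 1, ‖f z‖ / v ‖z‖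

/-- Membership in `H_v^0`: `f` is holomorphic on `𝔹_N` and `sup_{|z|=r} |f z| / v(r) → 0`
as `r → 1⁻`. -/
def MemHv {N : ℕ} (v : ℝ → ℝ) (f : EN N → ℂ) : Prop :=
  DifferentiableOn ℂ f (Metric.ball 0 1) ∧
  Tendsto (fun r : ℝ => ⨆ z ∈ Metric.sphere (0:EN N) r, ‖f z‖ / v r) (𝓝[<] 1) (𝓝 0)

/-- `S` contains, relatively to `H_v^0` with its norm topology, a dense `G_δ` subset:
there are countably many relatively norm-open sets `U n` whose intersection with `H_v^0`
is norm-dense in `H_v^0` and contained in `S`. -/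
def ResidualInHv {N : ℕ} (v : ℝ → ℝ) (S : Set (EN N → ℂ)) : Prop :=
  ∃ U : ℕ → Set (EN N → ℂ),
    (∀ n, ∀ f, MemHv v f → f ∈ U n →
      ∃ δ > 0, ∀ g, MemHv v g → hvNorm v (g - f) < δ → g ∈ U n) ∧
    (∀ f, MemHv v f → ∀ δ > 0, ∃ g, MemHv v g ∧ (∀ n, g ∈ U n) ∧ hvNorm v (g - f) < δ) ∧
    ∀ f, MemHv v f → (∀ n, f ∈ U n) → f ∈ S

/-- `S` is densely lineable in `H_v^0`: `S ∪ {0}` contains a norm-dense subspace of `H_v^0`. -/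
def DenselyLineableInHv {N : ℕ} (v : ℝ → ℝ) (S : Set (EN N → ℂ)) : Prop :=
  ∃ p : Submodule ℂ (EN N → ℂ), (↑p ⊆ {f : EN N → ℂ | MemHv v f}) ∧ (↑p ⊆ S ∪ {0}) ∧
    ∀ f, MemHv v f → ∀ δ > 0, ∃ g ∈ p, hvNorm v (g - f) < δ

/-- `S` is spaceable in `H_v^0`: `S ∪ {0}` contains a norm-closed infinite-dimensional
subspace of `H_v^0`. -/
def SpaceableInHv {N : ℕ} (v : ℝ → ℝ) (S : Set (EN N → ℂ)) : Prop :=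
  ∃ p : Submodule ℂ (EN N → ℂ), (↑p ⊆ {f : EN N → ℂ | MemHv v f}) ∧ (↑p ⊆ S ∪ {0}) ∧
    ¬ Module.Finite ℂ ↥p ∧
    ∀ f, MemHv v f → (∀ δ > 0, ∃ g ∈ p, hvNorm v (g - f) < δ) → f ∈ p

/-- The standing assumptions on the family `{γ_z : z ∈ 𝔹_N}`: each `γ_z` is a `C¹` map
`b𝔹_N × [0,1] → cl 𝔹_N` into `𝔹_N` for `r < 1` with `γ_z(x,1) = x`, transversal approach
and (†), with joint continuity of `(z,x,r) ↦ γ_z(x,r)` and of `(z,r) ↦ ∂γ_z(x,r)/∂r`. -/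
def BallGammaFamily {N : ℕ} (γ : EN N → EN N × ℝ → EN N) : Prop :=
  (∀ z ∈ Metric.ball (0:EN N) 1,
    GammaMap (Metric.ball 0 1) ballRho (γ z) 1 ∧ Dagger (Metric.ball 0 1) ballRho (γ z)) ∧
  ContinuousOn (fun p : EN N × (EN N × ℝ) => γ p.1 p.2)
    (Metric.ball 0 1 ×ˢ (Metric.sphere 0 1 ×ˢ Icc (0:ℝ) 1)) ∧
  ∀ x ∈ Metric.sphere (0:EN N) 1,
    ContinuousOn (fun p : EN N × ℝ => derivWithin (fun r => γ p.1 (x, r)) (Icc (0:ℝ) 1) p.2)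
      (Metric.ball 0 1 ×ˢ Icc (0:ℝ) 1)

/-- The set of `f` such that for every `z ∈ 𝔹_N`, every measurable function on `b𝔹_N` is an
a.e. limit of `f ∘ γ_z(·, r_{j_k})` along some subsequence of `(r_j)`. -/
def WSetHv {N : ℕ} (γ : EN N → EN N × ℝ → EN N) (r : ℕ → ℝ) : Set (EN N → ℂ) :=
  {f | ∀ z ∈ Metric.ball (0:EN N) 1, ∀ h : EN N → ℂ, Measurable h →
    ∃ φ : ℕ → ℕ, StrictMono φ ∧
      ∀ᵐ x ∂ sphMeasure N, Tendsto (fun k => f (γ z (x, r (φ k)))) atTop (𝓝 (h x))}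

/-- The set `E_L^* = {γ_z(x,r) : x ∈ E, r ∈ [0,1], z ∈ L}`. -/
def EStarSet {N : ℕ} (γ : EN N → EN N × ℝ → EN N) (L E : Set (EN N)) : Set (EN N) :=
  {w | ∃ z ∈ L, ∃ x ∈ E, ∃ r ∈ Icc (0:ℝ) 1, w = γ z (x, r)}

/-- The Korányi approach region `D_α(x)`. -/
def Koranyi {N : ℕ} (α : ℝ) (x : EN N) : Set (EN N) :=
  {z ∈ Metric.ball (0:EN N) 1 | ‖1 - (⟪x, z⟫_ℂ : ℂ)‖ < α / 2 * (1 - ‖z‖ ^ 2)}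

/-- `h` has a `K`-limit at `x`: for every `α > 1` the values of `h` converge along every
sequence in `D_α(x)` converging to `x`. -/
def HasKLimitAt {N : ℕ} (h : EN N → ℂ) (x : EN N) : Prop :=
  ∀ α > (1:ℝ), ∃ c : ℂ, ∀ z : ℕ → EN N, (∀ i, z i ∈ Koranyi α x) →
    Tendsto z atTop (𝓝 x) → Tendsto (fun i => h (z i)) atTop (𝓝 c)

/-- The circle `bL_x = L_x ∩ b𝔹_N` cut out on the complex line through `x` and `0`. -/
def lineCircle {N : ℕ} (x : EN N) : Set (EN N) :=
  {z | ∃ t : ℂ, z = t • x} ∩ Metric.sphere 0 1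

end
open Set Filter Topology Metric MeasureTheory
open scoped ENNReal NNReal InnerProductSpace ComplexConjugate
noncomputable section
namespace DFW

/-- standard basis vector -/
def bv {N : ℕ} (j : Fin N) : EN N := EuclideanSpace.single j 1

/-- Wirtinger derivative `∂/∂z_j`. -/
def dz {N : ℕ} (j : Fin N) (f : EN N → ℂ) (z : EN N) : ℂ :=
  (fderiv ℝ f z (bv j) - Complex.I * fderiv ℝ f z (Complex.I • bv j)) / 2

/-- Wirtinger derivative `∂/∂z̄_j`. -/
def db {N : ℕ} (j : Fin N) (f : EN N → ℂ) (z : EN N) : ℂ :=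
  (fderiv ℝ f z (bv j) + Complex.I * fderiv ℝ f z (Complex.I • bv j)) / 2

section basic
variable {N : ℕ} {j k : Fin N} {f g : EN N → ℂ} {z : EN N}

lemma dz_add (hf : DifferentiableAt ℝ f z) (hg : DifferentiableAt ℝ g z) :
    dz j (fun z => f z + g z) z = dz j f z + dz j g z := by
  simp only [dz, fderiv_fun_add hf hg, add_apply]; ring
lemma db_add (hf : DifferentiableAt ℝ f z) (hg : DifferentiableAt ℝ g z) :
    db j (fun z => f z + g z) z = db j f z + db j g z := by
  simp only [db, fderiv_fun_add hf hg, add_apply]; ring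
lemma dz_sub (hf : DifferentiableAt ℝ f z) (hg : DifferentiableAt ℝ g z) :
    dz j (fun z => f z - g z) z = dz j f z - dz j g z := by
  simp only [dz, fderiv_fun_sub hf hg, sub_apply]; ring
lemma db_sub (hf : DifferentiableAt ℝ f z) (hg : DifferentiableAt ℝ g z) :
    db j (fun z => f z - g z) z = db j f z - db j g z := by
  simp only [db, fderiv_fun_sub hf hg, sub_apply]; ring
lemma dz_mul (hf : DifferentiableAt ℝ f z) (hg : DifferentiableAt ℝ g z) :
    dz j (fun z => f z * g z) z = dz j f z * g z + f z * dz j g z := by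
  simp only [dz, fderiv_fun_mul hf hg, add_apply,
    smul_apply, smul_eq_mul]; ring
lemma db_mul (hf : DifferentiableAt ℝ f z) (hg : DifferentiableAt ℝ g z) :
    db j (fun z => f z * g z) z = db j f z * g z + f z * db j g z := by
  simp only [db, fderiv_fun_mul hf hg, add_apply,
    smul_apply, smul_eq_mul]; ring
lemma fderiv_conj' (hf : DifferentiableAt ℝ f z) (v : EN N) :
    fderiv ℝ (fun z => conj (f z)) z v = conj (fderiv ℝ f z v) := by
  have := (Complex.conjCLE.toContinuousLinearMap.hasFDerivAt (x := f z)).comp z hf.hasFDerivAt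
  have h2 : HasFDerivAt (fun z => conj (f z))
    (Complex.conjCLE.toContinuousLinearMap.comp (fderiv ℝ f z)) z := this
  rw [h2.fderiv]; simp
lemma dz_conj (hf : DifferentiableAt ℝ f z) :
    dz j (fun z => conj (f z)) z = conj (db j f z) := by
  simp only [dz, db, fderiv_conj' hf, map_div₀, map_add, map_mul, Complex.conj_I, Complex.conj_ofNat]
  ring
lemma db_conj (hf : DifferentiableAt ℝ f z) :
    db j (fun z => conj (f z)) z = conj (dz j f z) := by
  simp only [dz, db, fderiv_conj' hf, map_div₀, map_sub, map_mul, Complex.conj_I, Complex.conj_ofNat]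
  ring
lemma dz_cexp (hf : DifferentiableAt ℝ f z) :
    dz j (fun z => Complex.exp (f z)) z = Complex.exp (f z) * dz j f z := by
  have h := ((Complex.hasDerivAt_exp (f z)).hasFDerivAt.restrictScalars ℝ).comp z hf.hasFDerivAt
  have h2 : fderiv ℝ (fun z => Complex.exp (f z)) z = _ := h.fderiv
  simp only [dz, h2]; simp; ring
lemma db_cexp (hf : DifferentiableAt ℝ f z) :
    db j (fun z => Complex.exp (f z)) z = Complex.exp (f z) * db j f z := by
  have h := ((Complex.hasDerivAt_exp (f z)).hasFDerivAt.restrictScalars ℝ).comp z hf.hasFDerivAt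
  have h2 : fderiv ℝ (fun z => Complex.exp (f z)) z = _ := h.fderiv
  simp only [db, h2]; simp; ring
lemma dz_neg : dz j (fun z => - f z) z = - dz j f z := by
  simp only [dz, fderiv_fun_neg, neg_apply]; ring
lemma db_neg : db j (fun z => - f z) z = - db j f z := by
  simp only [db, fderiv_fun_neg, neg_apply]; ring
lemma dz_congr (h : f =ᶠ[𝓝 z] g) : dz j f z = dz j g z := by
  simp only [dz, h.fderiv_eq]
lemma db_congr (h : f =ᶠ[𝓝 z] g) : db j f z = db j g z := by
  simp only [db, h.fderiv_eq]

lemma contDiff_fderiv_apply {n : ℕ∞} (hf : ContDiff ℝ (n+1) f) (v : EN N) :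
    ContDiff ℝ n (fun z => fderiv ℝ f z v) :=
  (hf.fderiv_right le_rfl).clm_apply contDiff_const

lemma contDiff_dz {n : ℕ∞} (hf : ContDiff ℝ (n+1) f) : ContDiff ℝ n (dz j f) := by
  unfold dz
  exact ((contDiff_fderiv_apply hf _).sub (contDiff_const.mul (contDiff_fderiv_apply hf _))).div_const _
lemma contDiff_db {n : ℕ∞} (hf : ContDiff ℝ (n+1) f) : ContDiff ℝ n (db j f) := by
  unfold db
  exact ((contDiff_fderiv_apply hf _).add (contDiff_const.mul (contDiff_fderiv_apply hf _))).div_const _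

lemma contDiff_dz2 (hf : ContDiff ℝ 2 f) : ContDiff ℝ 1 (dz j f) :=
  contDiff_dz (n := 1) (by simpa [one_add_one_eq_two] using hf)
lemma contDiff_db2 (hf : ContDiff ℝ 2 f) : ContDiff ℝ 1 (db j f) :=
  contDiff_db (n := 1) (by simpa [one_add_one_eq_two] using hf)

lemma continuous_dz (hf : ContDiff ℝ 1 f) : Continuous (dz j f) :=
  (contDiff_dz (n := 0) (by simpa using hf)).continuous
lemma continuous_db (hf : ContDiff ℝ 1 f) : Continuous (db j f) :=
  (contDiff_db (n := 0) (by simpa using hf)).continuous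

/-- second derivatives -/
lemma fderiv_fderiv_apply (hf : ContDiffAt ℝ 2 f z) (v w : EN N) :
    fderiv ℝ (fun z => fderiv ℝ f z v) z w = fderiv ℝ (fderiv ℝ f) z w v := by
  have h : DifferentiableAt ℝ (fderiv ℝ f) z :=
    (hf.fderiv_right (m := 1) (by norm_num)).differentiableAt (by norm_num)
  have := h.hasFDerivAt.clm_apply (hasFDerivAt_const v z)
  rw [this.fderiv]; simp

lemma diffAt_fderiv_apply (hf : ContDiffAt ℝ 2 f z) (v : EN N) :
    DifferentiableAt ℝ (fun z => fderiv ℝ f z v) z := by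
  have h : DifferentiableAt ℝ (fderiv ℝ f) z :=
    (hf.fderiv_right (m := 1) (by norm_num)).differentiableAt (by norm_num)
  exact (h.hasFDerivAt.clm_apply (hasFDerivAt_const v z)).differentiableAt

lemma fderiv_dz (hf : ContDiffAt ℝ 2 f z) (w : EN N) :
    fderiv ℝ (dz j f) z w = (fderiv ℝ (fderiv ℝ f) z w (bv j)
      - Complex.I * fderiv ℝ (fderiv ℝ f) z w (Complex.I • bv j)) / 2 := by
  have h1 := (diffAt_fderiv_apply hf (bv j)).hasFDerivAt
  have h2 := (diffAt_fderiv_apply hf (Complex.I • bv j)).hasFDerivAt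
  have h3 : HasFDerivAt (dz j f) _ z := (h1.sub (h2.const_mul Complex.I)).mul_const (2:ℂ)⁻¹
  rw [h3.fderiv]
  simp [fderiv_fderiv_apply hf]; ring
lemma fderiv_db (hf : ContDiffAt ℝ 2 f z) (w : EN N) :
    fderiv ℝ (db j f) z w = (fderiv ℝ (fderiv ℝ f) z w (bv j)
      + Complex.I * fderiv ℝ (fderiv ℝ f) z w (Complex.I • bv j)) / 2 := by
  have h1 := (diffAt_fderiv_apply hf (bv j)).hasFDerivAt
  have h2 := (diffAt_fderiv_apply hf (Complex.I • bv j)).hasFDerivAt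
  have h3 : HasFDerivAt (db j f) _ z := (h1.add (h2.const_mul Complex.I)).mul_const (2:ℂ)⁻¹
  rw [h3.fderiv]
  simp [fderiv_fderiv_apply hf]; ring

lemma db_dz_comm (hf : ContDiffAt ℝ 2 f z) : db k (dz j f) z = dz j (db k f) z := by
  have hs : IsSymmSndFDerivAt ℝ f z := hf.isSymmSndFDerivAt (by simp)
  rw [db, dz, fderiv_dz hf, fderiv_dz hf, fderiv_db hf, fderiv_db hf]
  rw [hs (bv k) (bv j), hs (bv k) (Complex.I • bv j), hs (Complex.I • bv k) (bv j),
    hs (Complex.I • bv k) (Complex.I • bv j)]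
  ring

lemma db_db_comm (hf : ContDiffAt ℝ 2 f z) : db k (db j f) z = db j (db k f) z := by
  have hs : IsSymmSndFDerivAt ℝ f z := hf.isSymmSndFDerivAt (by simp)
  simp only [db]
  change (fderiv ℝ (db j f) z _ + _ * fderiv ℝ (db j f) z _)/2 = (fderiv ℝ (db k f) z _ + _ * fderiv ℝ (db k f) z _)/2
  rw [fderiv_db hf, fderiv_db hf, fderiv_db hf, fderiv_db hf]
  rw [hs (bv k) (bv j), hs (bv k) (Complex.I • bv j), hs (Complex.I • bv k) (bv j),
    hs (Complex.I • bv k) (Complex.I • bv j)]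
  ring
lemma dz_dz_comm (hf : ContDiffAt ℝ 2 f z) : dz k (dz j f) z = dz j (dz k f) z := by
  have hs : IsSymmSndFDerivAt ℝ f z := hf.isSymmSndFDerivAt (by simp)
  simp only [dz]
  change (fderiv ℝ (dz j f) z _ - _ * fderiv ℝ (dz j f) z _)/2 = (fderiv ℝ (dz k f) z _ - _ * fderiv ℝ (dz k f) z _)/2
  rw [fderiv_dz hf, fderiv_dz hf, fderiv_dz hf, fderiv_dz hf]
  rw [hs (bv k) (bv j), hs (bv k) (Complex.I • bv j), hs (Complex.I • bv k) (bv j),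
    hs (Complex.I • bv k) (Complex.I • bv j)]
  ring

lemma support_fderiv_zero (hz : z ∉ tsupport f) : fderiv ℝ f z = 0 := by
  have : f =ᶠ[𝓝 z] fun _ => 0 := notMem_tsupport_iff_eventuallyEq.mp hz
  rw [this.fderiv_eq]; simp
lemma dz_zero_of (hz : z ∉ tsupport f) : dz j f z = 0 := by
  simp [dz, support_fderiv_zero hz]
lemma db_zero_of (hz : z ∉ tsupport f) : db j f z = 0 := by
  simp [db, support_fderiv_zero hz]
lemma tsupport_dz : tsupport (dz j f) ⊆ tsupport f :=
  closure_minimal (fun z hz => by by_contra h; exact hz (dz_zero_of h)) (isClosed_tsupport f)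
lemma tsupport_db : tsupport (db j f) ⊆ tsupport f :=
  closure_minimal (fun z hz => by by_contra h; exact hz (db_zero_of h)) (isClosed_tsupport f)
lemma hcs_dz (h : HasCompactSupport f) : HasCompactSupport (dz j f) :=
  IsCompact.of_isClosed_subset h (isClosed_tsupport _) tsupport_dz
lemma hcs_db (h : HasCompactSupport f) : HasCompactSupport (db j f) :=
  IsCompact.of_isClosed_subset h (isClosed_tsupport _) tsupport_db

variable {μ : Measure (EN N)} [μ.IsAddHaarMeasure]
lemma integral_fderiv_zero (hf : ContDiff ℝ 1 f) (hc : HasCompactSupport f) (v : EN N) :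
    ∫ z, fderiv ℝ f z v ∂μ = 0 := by
  have hd : Continuous (fun z => fderiv ℝ f z v) :=
    ((hf.continuous_fderiv (by norm_num)).clm_apply continuous_const)
  have hcd : HasCompactSupport (fun z => fderiv ℝ f z v) := hc.fderiv_apply (𝕜 := ℝ) v
  have := integral_mul_fderiv_eq_neg_fderiv_mul_of_integrable (𝕜 := ℂ) (μ := μ) (f := fun _ : EN N => (1:ℂ)) (g := f) (v := v)
    (by simp) (by simpa using hd.integrable_of_hasCompactSupport hcd)
    (by simpa using hf.continuous.integrable_of_hasCompactSupport hc) (fun x _ => by fun_prop) (fun x _ => hf.differentiable (by norm_num) x)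
  simpa using this
lemma integral_dz_zero (hf : ContDiff ℝ 1 f) (hc : HasCompactSupport f) :
    ∫ z, dz j f z ∂μ = 0 := by
  have hI : ∀ v, Integrable (fun z => fderiv ℝ f z v) μ := fun v =>
    ((hf.continuous_fderiv (by norm_num)).clm_apply continuous_const).integrable_of_hasCompactSupport
      (hc.fderiv_apply (𝕜 := ℝ) v)
  simp only [dz]
  rw [integral_div, integral_sub (hI _) ((hI _).const_mul _), integral_const_mul,
    integral_fderiv_zero hf hc, integral_fderiv_zero hf hc]; simp
lemma integral_db_zero (hf : ContDiff ℝ 1 f) (hc : HasCompactSupport f) :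
    ∫ z, db j f z ∂μ = 0 := by
  have hI : ∀ v, Integrable (fun z => fderiv ℝ f z v) μ := fun v =>
    ((hf.continuous_fderiv (by norm_num)).clm_apply continuous_const).integrable_of_hasCompactSupport
      (hc.fderiv_apply (𝕜 := ℝ) v)
  simp only [db]
  rw [integral_div, integral_add (hI _) ((hI _).const_mul _), integral_const_mul,
    integral_fderiv_zero hf hc, integral_fderiv_zero hf hc]; simp
end basic
end DFW
end

open Set Filter Topology Metric MeasureTheory
open scoped ENNReal NNReal InnerProductSpace ComplexConjugate
noncomputable section
namespace DFW

/-- complexification of a real function -/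
def cx {N : ℕ} (φ : EN N → ℝ) : EN N → ℂ := fun z => (φ z : ℂ)

section apriori
variable {N : ℕ} {j k : Fin N} {z : EN N}

lemma contDiff_cx {n : WithTop ℕ∞} {φ : EN N → ℝ} (h : ContDiff ℝ n φ) : ContDiff ℝ n (cx φ) :=
  Complex.ofRealCLM.contDiff.comp h

lemma conj_dz_cx {φ : EN N → ℝ} (h : DifferentiableAt ℝ (cx φ) z) :
    conj (dz j (cx φ) z) = db j (cx φ) z := by
  rw [← db_conj h]; congr 1; ext w; simp [cx]

lemma sum_sq_identity (A : Fin N → Fin N → ℂ) :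
    (∑ j, ∑ k, A j k * conj (A k j)).re =
      ∑ j, ∑ k, ‖A j k‖^2 - (1/2) * ∑ j, ∑ k, ‖A j k - A k j‖^2 := by
  have h : ∀ j k, ‖A j k - A k j‖^2 = ‖A j k‖^2 + ‖A k j‖^2 - 2 * (A j k * conj (A k j)).re := by
    intro j k
    simp only [← Complex.normSq_eq_norm_sq]
    rw [Complex.normSq_sub]
  simp only [h, Finset.sum_sub_distrib, Finset.sum_add_distrib]
  rw [Finset.sum_comm (f := fun j k => ‖A k j‖^2)]
  simp only [← Finset.mul_sum, Complex.re_sum]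
  ring

variable {μ : Measure (EN N)} [μ.IsAddHaarMeasure]

/-- the twisted derivative -/
def del (φ : EN N → ℝ) (j : Fin N) (a : EN N → ℂ) (z : EN N) : ℂ :=
  dz j a z - dz j (cx φ) z * a z

lemma pointwise_identity {φ : EN N → ℝ} (hφ : ContDiff ℝ 2 φ) {a b : EN N → ℂ}
    (ha : ContDiff ℝ 2 a) (hb : ContDiff ℝ 2 b) (z : EN N) :
    (del φ j a z * conj (del φ k b z) - db k a z * conj (db j b z)
      - db k (dz j (cx φ)) z * a z * conj (b z)) * Complex.exp (-(cx φ z)) =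
    db k (fun z => del φ j a z * (conj (b z) * Complex.exp (-(cx φ z)))) z -
    dz j (fun z => db k a z * (conj (b z) * Complex.exp (-(cx φ z)))) z := by
  have hφ' := contDiff_cx hφ
  have dφ : DifferentiableAt ℝ (cx φ) z := hφ'.differentiable (by norm_num) z
  have da : DifferentiableAt ℝ a z := ha.differentiable (by norm_num) z
  have dB : DifferentiableAt ℝ b z := hb.differentiable (by norm_num) z
  have d1 : DifferentiableAt ℝ (dz j a) z := (contDiff_dz2 ha).differentiable (by norm_num) z
  have d2 : DifferentiableAt ℝ (dz j (cx φ)) z := (contDiff_dz2 hφ').differentiable (by norm_num) z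
  have d3 : DifferentiableAt ℝ (db k a) z := (contDiff_db2 ha).differentiable (by norm_num) z
  have d4 : DifferentiableAt ℝ (fun z => -(cx φ z)) z := dφ.neg
  have d5 : DifferentiableAt ℝ (fun z => conj (b z)) z :=
    Complex.conjCLE.toContinuousLinearMap.differentiableAt.comp z dB
  have d6 : DifferentiableAt ℝ (fun z => Complex.exp (-(cx φ z))) z := d4.cexp
  have d7 : DifferentiableAt ℝ (fun z => dz j a z - dz j (cx φ) z * a z) z := d1.sub (d2.fun_mul da)
  rw [show (fun z => del φ j a z * (conj (b z) * Complex.exp (-(cx φ z)))) =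
    (fun z => (dz j a z - dz j (cx φ) z * a z) * (conj (b z) * Complex.exp (-(cx φ z)))) from rfl]
  rw [db_mul d7 (d5.fun_mul d6), db_mul d5 d6, db_sub d1 (d2.fun_mul da), db_mul d2 da,
    dz_mul d3 (d5.fun_mul d6), dz_mul d5 d6, db_conj dB, dz_conj dB, dz_cexp d4, db_cexp d4,
    dz_neg, db_neg, db_dz_comm ha.contDiffAt]
  simp only [del, map_sub, map_mul, conj_dz_cx dφ]
  ring

lemma apriori_global {φ : EN N → ℝ} (hφ : ContDiff ℝ 2 φ) {h : Fin N → EN N → ℂ}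
    (hh : ∀ j, ContDiff ℝ 2 (h j)) (hc : ∀ j, HasCompactSupport (h j)) :
    0 ≤ ∫ z, Real.exp (-φ z) * (‖∑ j, del φ j (h j) z‖^2 +
      (1/2) * ∑ j, ∑ k, ‖db k (h j) z - db j (h k) z‖^2
      - (∑ j, ∑ k, db k (dz j (cx φ)) z * h j z * conj (h k z)).re) ∂μ := by
  have hφ' := contDiff_cx hφ
  have hexp : ContDiff ℝ 2 (fun z => Complex.exp (-(cx φ z))) := hφ'.neg.cexp
  have hconj : ∀ k, ContDiff ℝ 2 (fun z => conj (h k z)) := fun k =>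
    Complex.conjCLE.toContinuousLinearMap.contDiff.comp (hh k)
  have hcc : ∀ k, HasCompactSupport (fun z => conj (h k z) * Complex.exp (-(cx φ z))) := by
    intro k
    have : HasCompactSupport (fun z => conj (h k z)) := (hc k).comp_left (map_zero conj)
    exact this.mul_right
  have hdel : ∀ j, ContDiff ℝ 1 (del φ j (h j)) := fun j =>
    (contDiff_dz2 (hh j)).sub ((contDiff_dz2 hφ').mul ((hh j).of_le (by norm_num)))
  have hw : ∀ k, ContDiff ℝ 1 (fun z => conj (h k z) * Complex.exp (-(cx φ z))) := fun k =>
    ((hconj k).mul hexp).of_le (by norm_num)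
  let X : Fin N → Fin N → EN N → ℂ := fun j k z => del φ j (h j) z * (conj (h k z) * Complex.exp (-(cx φ z)))
  let Y : Fin N → Fin N → EN N → ℂ := fun j k z => db k (h j) z * (conj (h k z) * Complex.exp (-(cx φ z)))
  have hX : ∀ j k, ContDiff ℝ 1 (X j k) := fun j k => (hdel j).mul (hw k)
  have hY : ∀ j k, ContDiff ℝ 1 (Y j k) := fun j k => (contDiff_db2 (hh j)).mul (hw k)
  have hXc : ∀ j k, HasCompactSupport (X j k) := fun j k => (hcc k).mul_left
  have hYc : ∀ j k, HasCompactSupport (Y j k) := fun j k => (hcc k).mul_left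
  have iX : ∀ j k, Integrable (db k (X j k)) μ := fun j k =>
    (continuous_db (hX j k)).integrable_of_hasCompactSupport (hcs_db (hXc j k))
  have iY : ∀ j k, Integrable (dz j (Y j k)) μ := fun j k =>
    (continuous_dz (hY j k)).integrable_of_hasCompactSupport (hcs_dz (hYc j k))
  have iXY : ∀ j k, Integrable (fun z => db k (X j k) z - dz j (Y j k) z) μ := fun j k =>
    (iX j k).sub (iY j k)
  have hzero : ∫ z, ∑ j, ∑ k, (db k (X j k) z - dz j (Y j k) z) ∂μ = 0 := by
    rw [integral_finsetSum _ (fun j _ => integrable_finsetSum _ (fun k _ => iXY j k))]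
    refine Finset.sum_eq_zero fun j _ => ?_
    rw [integral_finsetSum _ (fun k _ => iXY j k)]
    refine Finset.sum_eq_zero fun k _ => ?_
    rw [integral_sub (iX j k) (iY j k), integral_db_zero (hX j k) (hXc j k),
      integral_dz_zero (hY j k) (hYc j k), sub_zero]
  have hIntg : Integrable (fun z => ∑ j, ∑ k, (db k (X j k) z - dz j (Y j k) z)) μ :=
    integrable_finsetSum _ (fun j _ => integrable_finsetSum _ (fun k _ => iXY j k))
  have hre : ∫ z, (∑ j, ∑ k, (db k (X j k) z - dz j (Y j k) z)).re ∂μ = 0 := by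
    have := integral_re hIntg
    simp only [RCLike.re_to_complex] at this
    rw [this, hzero]; simp
  -- pointwise
  have hpt : ∀ z, (∑ j, ∑ k, (db k (X j k) z - dz j (Y j k) z)).re =
      Real.exp (-φ z) * (‖∑ j, del φ j (h j) z‖^2 +
      (1/2) * ∑ j, ∑ k, ‖db k (h j) z - db j (h k) z‖^2
      - (∑ j, ∑ k, db k (dz j (cx φ)) z * h j z * conj (h k z)).re)
      - Real.exp (-φ z) * ∑ j, ∑ k, ‖db k (h j) z‖^2 := by
    intro z
    have e1 : Complex.exp (-(cx φ z)) = ((Real.exp (-φ z) : ℝ) : ℂ) := by simp [cx]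
    have h1 : ∑ j, ∑ k, (db k (X j k) z - dz j (Y j k) z) =
        ((∑ j, del φ j (h j) z) * conj (∑ j, del φ j (h j) z)
          - ∑ j, ∑ k, db k (h j) z * conj (db j (h k) z)
          - ∑ j, ∑ k, db k (dz j (cx φ)) z * h j z * conj (h k z)) * ((Real.exp (-φ z) : ℝ) : ℂ) := by
      rw [← e1, map_sum, Finset.sum_mul_sum, ← Finset.sum_sub_distrib, ← Finset.sum_sub_distrib,
        Finset.sum_mul]
      refine Finset.sum_congr rfl fun j _ => ?_
      rw [← Finset.sum_sub_distrib, ← Finset.sum_sub_distrib, Finset.sum_mul]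
      exact Finset.sum_congr rfl fun k _ => (pointwise_identity hφ (hh j) (hh k) z).symm
    rw [h1, Complex.re_mul_ofReal, Complex.sub_re, Complex.sub_re,
      sum_sq_identity (fun j k => db k (h j) z), Complex.mul_conj, Complex.ofReal_re,
      Complex.normSq_eq_norm_sq]
    ring
  have hnn : Continuous fun z => Real.exp (-φ z) * ∑ j, ∑ k, ‖db k (h j) z‖^2 := by
    refine (Real.continuous_exp.comp hφ.continuous.neg).mul ?_
    refine continuous_finsetSum _ fun j _ => continuous_finsetSum _ fun k _ => ?_
    exact (continuous_db ((hh j).of_le (by norm_num))).norm.pow 2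
  have hncs : HasCompactSupport fun z => Real.exp (-φ z) * ∑ j, ∑ k, ‖db k (h j) z‖^2 := by
    have hK : IsCompact (⋃ j, tsupport (h j)) := isCompact_iUnion hc
    refine HasCompactSupport.intro hK fun z hz => ?_
    simp only [mem_iUnion, not_exists] at hz
    simp [db_zero_of (hz _)]
  have hni := hnn.integrable_of_hasCompactSupport hncs (μ := μ)
  have hri : Integrable (fun z => (∑ j, ∑ k, (db k (X j k) z - dz j (Y j k) z)).re) μ := hIntg.re
  have : ∀ z, Real.exp (-φ z) * (‖∑ j, del φ j (h j) z‖^2 +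
      (1/2) * ∑ j, ∑ k, ‖db k (h j) z - db j (h k) z‖^2
      - (∑ j, ∑ k, db k (dz j (cx φ)) z * h j z * conj (h k z)).re) =
      (∑ j, ∑ k, (db k (X j k) z - dz j (Y j k) z)).re + Real.exp (-φ z) * ∑ j, ∑ k, ‖db k (h j) z‖^2 := by
    intro z; rw [hpt]; ring
  simp_rw [this]
  rw [integral_add hri hni, hre, zero_add]
  exact integral_nonneg fun z => by positivity
end apriori
end DFW
end

open Set Filter Topology Metric MeasureTheory
open scoped ENNReal NNReal InnerProductSpace ComplexConjugate
noncomputable section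
namespace DFW

lemma two_le_infty : (2 : WithTop ℕ∞) ≤ ((⊤:ℕ∞) : WithTop ℕ∞) :=
  WithTop.coe_le_coe.mpr (le_top : (2:ℕ∞) ≤ ⊤)

open scoped Manifold ContDiff in
lemma exists_cutoff {E : Type*} [NormedAddCommGroup E] [NormedSpace ℝ E] [FiniteDimensional ℝ E]
    {K U : Set E} (hK : IsCompact K) (hU : IsOpen U) (hKU : K ⊆ U) :
    ∃ χ : E → ℝ, ContDiff ℝ ∞ χ ∧ HasCompactSupport χ ∧ tsupport χ ⊆ U ∧
      (∀ᶠ z in 𝓝ˢ K, χ z = 1) ∧ ∀ z, χ z ∈ Icc (0:ℝ) 1 := by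
  have : ProperSpace E := FiniteDimensional.proper ℝ E
  obtain ⟨L, hL, hKL, hLU⟩ := exists_compact_between hK hU hKU
  obtain ⟨f, h1, h0, hf⟩ := exists_contMDiffMap_one_nhds_of_subset_interior (n := ⊤) 𝓘(ℝ, E)
    hK.isClosed hKL
  have hs : tsupport f ⊆ L := closure_minimal (fun x hx => by
    by_contra h; exact hx (h0 x h)) hL.isClosed
  refine ⟨f, f.contMDiff.contDiff, hL.of_isClosed_subset (isClosed_tsupport _) hs, hs.trans hLU, h1, hf⟩

lemma contDiff_of_tsupport_subset {E F : Type*} [NormedAddCommGroup E] [NormedSpace ℝ E]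
    [NormedAddCommGroup F] [NormedSpace ℝ F] {n : WithTop ℕ∞} {U : Set E} (hU : IsOpen U)
    {f : E → F} (hf : ContDiffOn ℝ n f U) (hs : tsupport f ⊆ U) : ContDiff ℝ n f := by
  rw [contDiff_iff_contDiffAt]
  intro z
  by_cases hz : z ∈ tsupport f
  · exact hf.contDiffAt (hU.mem_nhds (hs hz))
  · have : f =ᶠ[𝓝 z] fun _ => 0 := notMem_tsupport_iff_eventuallyEq.mp hz
    exact contDiffAt_const.congr_of_eventuallyEq this

lemma contDiff_smul_of_tsupport_subset {E F : Type*} [NormedAddCommGroup E] [NormedSpace ℝ E]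
    [NormedAddCommGroup F] [NormedSpace ℝ F] {n : WithTop ℕ∞} {U : Set E} (hU : IsOpen U)
    {χ : E → ℝ} {f : E → F} (hχ : ContDiff ℝ n χ) (hf : ContDiffOn ℝ n f U) (hs : tsupport χ ⊆ U) :
    ContDiff ℝ n (fun z => χ z • f z) :=
  contDiff_of_tsupport_subset hU (hχ.contDiffOn.smul hf)
    ((tsupport_smul_subset_left χ f).trans hs)

lemma exists_extension {E F : Type*} [NormedAddCommGroup E] [NormedSpace ℝ E]
    [FiniteDimensional ℝ E]
    [NormedAddCommGroup F] [NormedSpace ℝ F] {U K : Set E} (hK : IsCompact K) (hU : IsOpen U)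
    (hKU : K ⊆ U) {f : E → F} (hf : ContDiffOn ℝ 2 f U) :
    ∃ g : E → F, ContDiff ℝ 2 g ∧ HasCompactSupport g ∧ ∀ z ∈ K, g =ᶠ[𝓝 z] f := by
  obtain ⟨χ, h1, h2, h3, h4, -⟩ := exists_cutoff hK hU hKU
  refine ⟨fun z => χ z • f z, contDiff_smul_of_tsupport_subset hU (h1.of_le two_le_infty) hf h3,
    h2.smul_right, fun z hz => ?_⟩
  filter_upwards [(eventually_nhdsSet_iff_forall.mp h4) z hz] with w hw
  simp [hw]

section local_apriori
variable {N : ℕ} {z : EN N} {μ : Measure (EN N)} [μ.IsAddHaarMeasure]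

/-- the Levi lower bound used in the weighted estimates -/
def LeviBound (φ ψ : EN N → ℝ) (z : EN N) : Prop :=
  ∀ w : Fin N → ℂ, 2 * (∑ j, ‖dz j (cx ψ) z‖^2 + Real.exp (ψ z)) * ∑ j, ‖w j‖^2 ≤
    (∑ j, ∑ k, db k (dz j (cx φ)) z * w j * conj (w k)).re

lemma cx_congr {φ φ' : EN N → ℝ} (h : φ =ᶠ[𝓝 z] φ') : cx φ =ᶠ[𝓝 z] cx φ' := by
  filter_upwards [h] with w hw; simp [cx, hw]

lemma dz_eventuallyEq {f g : EN N → ℂ} {j : Fin N} (h : f =ᶠ[𝓝 z] g) : dz j f =ᶠ[𝓝 z] dz j g := by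
  filter_upwards [h.eventuallyEq_nhds] with w hw using dz_congr hw
lemma db_eventuallyEq {f g : EN N → ℂ} {j : Fin N} (h : f =ᶠ[𝓝 z] g) : db j f =ᶠ[𝓝 z] db j g := by
  filter_upwards [h.eventuallyEq_nhds] with w hw using db_congr hw

/-- Cauchy-Schwarz for finite sums of complex numbers. -/
lemma norm_sum_mul_sq_le {ι : Type*} (s : Finset ι) (a b : ι → ℂ) :
    ‖∑ j ∈ s, a j * b j‖^2 ≤ (∑ j ∈ s, ‖a j‖^2) * ∑ j ∈ s, ‖b j‖^2 := by
  have h1 : ‖∑ j ∈ s, a j * b j‖ ≤ ∑ j ∈ s, ‖a j‖ * ‖b j‖ :=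
    (norm_sum_le _ _).trans (le_of_eq (Finset.sum_congr rfl fun j _ => norm_mul _ _))
  calc _ ≤ (∑ j ∈ s, ‖a j‖ * ‖b j‖)^2 := by gcongr
    _ ≤ _ := Finset.sum_mul_sq_le_sq_mul_sq _ _ _

lemma apriori {U : Set (EN N)} (hU : IsOpen U) {φ ψ : EN N → ℝ} (hφ : ContDiffOn ℝ 2 φ U)
    (hψ : ContDiffOn ℝ 2 ψ U) (hL : ∀ z ∈ U, LeviBound φ ψ z) {h : Fin N → EN N → ℂ}
    (hh : ∀ j, ContDiff ℝ 2 (h j)) (hc : ∀ j, HasCompactSupport (h j))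
    (hs : ∀ j, tsupport (h j) ⊆ U) :
    0 ≤ ∫ z, Real.exp (-φ z) * (‖∑ j, (dz j (h j) z - dz j (cx (φ - ψ)) z * h j z)‖^2 +
      (1/4) * ∑ j, ∑ k, ‖db k (h j) z - db j (h k) z‖^2
      - Real.exp (ψ z) * ∑ j, ‖h j z‖^2) ∂μ := by
  have hK : IsCompact (⋃ j, tsupport (h j)) := isCompact_iUnion hc
  obtain ⟨φ', c1, -, e1⟩ := exists_extension hK hU (iUnion_subset hs) hφ
  obtain ⟨ψ', c2, -, e2⟩ := exists_extension hK hU (iUnion_subset hs) hψ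
  have key := apriori_global (μ := μ) c1 hh hc
  have hz0 : ∀ z, z ∉ (⋃ j, tsupport (h j)) → (∀ j, h j z = 0) ∧ (∀ i j, dz i (h j) z = 0) ∧
      ∀ i j, db i (h j) z = 0 := by
    intro z hz
    simp only [mem_iUnion, not_exists] at hz
    exact ⟨fun j => image_eq_zero_of_notMem_tsupport (hz j), fun i j => dz_zero_of (hz j),
      fun i j => db_zero_of (hz j)⟩
  have hcs : ∀ G : EN N → ℝ, (∀ z, z ∉ (⋃ j, tsupport (h j)) → G z = 0) → HasCompactSupport G :=
    fun G hG => HasCompactSupport.intro hK hG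
  have cφ := contDiff_cx c1
  have cψ := contDiff_cx c2
  have cφψ := contDiff_cx (c1.sub c2)
  have ch : ∀ j, Continuous (h j) := fun j => (hh j).continuous
  have ch1 : ∀ i j, Continuous (dz i (h j)) := fun i j => continuous_dz ((hh j).of_le (by norm_num))
  have ch2 : ∀ i j, Continuous (db i (h j)) := fun i j => continuous_db ((hh j).of_le (by norm_num))
  have ch3 : ∀ i, Continuous (dz i (cx φ')) := fun i => continuous_dz (cφ.of_le (by norm_num))
  have ch4 : ∀ i, Continuous (dz i (cx (φ' - ψ'))) := fun i => continuous_dz (cφψ.of_le (by norm_num))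
  have ch5 : ∀ i k, Continuous (db k (dz i (cx φ'))) := fun i k => continuous_db (contDiff_dz2 cφ)
  have ch6 : ∀ k, Continuous (fun z => conj (h k z)) := fun k => Complex.continuous_conj.comp (ch k)
  have cont1 := c1.continuous
  have cont2 := c2.continuous
  have heq : ∀ z, Real.exp (-φ z) * (‖∑ j, (dz j (h j) z - dz j (cx (φ - ψ)) z * h j z)‖^2 +
      (1/4) * ∑ j, ∑ k, ‖db k (h j) z - db j (h k) z‖^2
      - Real.exp (ψ z) * ∑ j, ‖h j z‖^2) =
      Real.exp (-φ' z) * (‖∑ j, (dz j (h j) z - dz j (cx (φ' - ψ')) z * h j z)‖^2 +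
      (1/4) * ∑ j, ∑ k, ‖db k (h j) z - db j (h k) z‖^2
      - Real.exp (ψ' z) * ∑ j, ‖h j z‖^2) := by
    intro z
    by_cases hz : z ∈ ⋃ j, tsupport (h j)
    · have := e1 z hz
      have h2 := e2 z hz
      have h3 : cx (φ' - ψ') =ᶠ[𝓝 z] cx (φ - ψ) := cx_congr (this.sub h2)
      simp only [this.eq_of_nhds, h2.eq_of_nhds, dz_congr h3]
    · obtain ⟨a, b, c⟩ := hz0 z hz
      simp [a, b, c]
  simp_rw [heq]
  have mono : ∀ z, Real.exp (-φ' z) * (‖∑ j, del φ' j (h j) z‖^2 +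
      (1/2) * ∑ j, ∑ k, ‖db k (h j) z - db j (h k) z‖^2
      - (∑ j, ∑ k, db k (dz j (cx φ')) z * h j z * conj (h k z)).re) ≤
      2 * (Real.exp (-φ' z) * (‖∑ j, (dz j (h j) z - dz j (cx (φ' - ψ')) z * h j z)‖^2 +
      (1/4) * ∑ j, ∑ k, ‖db k (h j) z - db j (h k) z‖^2
      - Real.exp (ψ' z) * ∑ j, ‖h j z‖^2)) := by
    intro z
    by_cases hz : z ∈ ⋃ j, tsupport (h j)
    swap
    · obtain ⟨a, b, c⟩ := hz0 z hz
      simp [a, b, c, del]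
    have hzU : z ∈ U := iUnion_subset hs hz
    have h1 := e1 z hz
    have h2 := e2 z hz
    have hLv := hL z hzU (fun j => h j z)
    have hLv' : 2 * (∑ j, ‖dz j (cx ψ') z‖^2 + Real.exp (ψ' z)) * ∑ j, ‖h j z‖^2 ≤
        (∑ j, ∑ k, db k (dz j (cx φ')) z * h j z * conj (h k z)).re := by
      simp only [dz_congr (cx_congr h2), h2.eq_of_nhds, db_congr (dz_eventuallyEq (cx_congr h1))]
      exact hLv
    have hdd : ∀ j, dz j (cx (φ' - ψ')) z = dz j (cx φ') z - dz j (cx ψ') z := by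
      intro j
      rw [← dz_sub (cφ.differentiable (by norm_num) z) (cψ.differentiable (by norm_num) z)]
      congr 1; ext w; simp [cx]
    set m := ∑ j, (dz j (h j) z - dz j (cx (φ' - ψ')) z * h j z) with hm
    have hsum : ∑ j, del φ' j (h j) z = m - ∑ j, dz j (cx ψ') z * h j z := by
      rw [hm, ← Finset.sum_sub_distrib]
      refine Finset.sum_congr rfl fun j _ => ?_
      rw [hdd, del]; ring
    have hcs := norm_sum_mul_sq_le Finset.univ (fun j => dz j (cx ψ') z) (fun j => h j z)
    have hpar : ‖∑ j, del φ' j (h j) z‖^2 ≤ 2 * ‖m‖^2 + 2 * ‖∑ j, dz j (cx ψ') z * h j z‖^2 := by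
      rw [hsum]
      have := norm_sub_le m (∑ j, dz j (cx ψ') z * h j z)
      have h0 := norm_nonneg (m - ∑ j, dz j (cx ψ') z * h j z)
      nlinarith [sq_nonneg (‖m‖ - ‖∑ j, dz j (cx ψ') z * h j z‖), norm_nonneg m, norm_nonneg (∑ j, dz j (cx ψ') z * h j z)]
    have he := Real.exp_pos (-φ' z)
    rw [mul_left_comm]
    refine mul_le_mul_of_nonneg_left ?_ he.le
    nlinarith
  have i1 : Integrable (fun z => Real.exp (-φ' z) * (‖∑ j, del φ' j (h j) z‖^2 +
      (1/2) * ∑ j, ∑ k, ‖db k (h j) z - db j (h k) z‖^2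
      - (∑ j, ∑ k, db k (dz j (cx φ')) z * h j z * conj (h k z)).re)) μ := by
    refine Continuous.integrable_of_hasCompactSupport ?_ (hcs _ fun z hz => ?_)
    · unfold del
      have : Continuous fun z => (∑ j, ∑ k, db k (dz j (cx φ')) z * h j z * conj (h k z)) := by fun_prop
      have := Complex.continuous_re.comp this
      have e := Real.continuous_exp
      fun_prop
    · obtain ⟨a, b, c⟩ := hz0 z hz
      simp [a, b, c, del]
  have i2 : Integrable (fun z => Real.exp (-φ' z) * (‖∑ j, (dz j (h j) z - dz j (cx (φ' - ψ')) z * h j z)‖^2 +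
      (1/4) * ∑ j, ∑ k, ‖db k (h j) z - db j (h k) z‖^2
      - Real.exp (ψ' z) * ∑ j, ‖h j z‖^2)) μ := by
    refine Continuous.integrable_of_hasCompactSupport ?_ (hcs _ fun z hz => ?_)
    · have e := Real.continuous_exp
      fun_prop
    · obtain ⟨a, b, c⟩ := hz0 z hz
      simp [a, b, c]
  have := integral_mono i1 (i2.const_mul 2) mono
  rw [integral_const_mul] at this
  linarith
end local_apriori
end DFW
end

open Set Filter Topology Metric MeasureTheory
open scoped ENNReal NNReal InnerProductSpace ComplexConjugate
noncomputable section
namespace DFW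

section mollify
variable {N : ℕ} {μ : Measure (EN N)} [μ.IsAddHaarMeasure]

/-- a sequence of bumps shrinking to the origin -/
def bmp (N n : ℕ) : ContDiffBump (0 : EN N) :=
  ⟨1 / (n + 1 : ℝ), 2 / (n + 1 : ℝ), by positivity, by
    rw [div_lt_div_iff_of_pos_right (by positivity)]; norm_num⟩

lemma bmp_rOut (N : ℕ) : Tendsto (fun n => (bmp N n).rOut) atTop (𝓝 0) := by
  have := (tendsto_one_div_add_atTop_nhds_zero_nat (𝕜 := ℝ)).const_mul 2
  simp only [mul_zero] at this
  refine this.congr fun n => ?_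
  simp [bmp]; ring

/-- mollification -/
def mol (μ : Measure (EN N)) (ρ : ContDiffBump (0 : EN N)) (f : EN N → ℂ) : EN N → ℂ :=
  convolution f (ρ.normed μ) (ContinuousLinearMap.lsmul ℝ ℝ).flip μ

variable {ρ : ContDiffBump (0 : EN N)} {f : EN N → ℂ}

lemma mol_eq : mol μ ρ f = convolution (ρ.normed μ) f (ContinuousLinearMap.lsmul ℝ ℝ) μ :=
  convolution_flip _

lemma mol_apply (x : EN N) : mol μ ρ f x = ∫ w, (ρ.normed μ (x - w) : ℂ) * f w ∂μ := by
  simp [mol, convolution_def]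

lemma contDiff_mol (hf : LocallyIntegrable f μ) : ContDiff ℝ 2 (mol μ ρ f) :=
  ρ.hasCompactSupport_normed.contDiff_convolution_right _ hf (n := 2) ρ.contDiff_normed

lemma fderiv_mol (hf : LocallyIntegrable f μ) (x v : EN N) :
    fderiv ℝ (mol μ ρ f) x v = - ∫ w, f w * fderiv ℝ (fun w => (ρ.normed μ (x - w) : ℂ)) w v ∂μ := by
  have h1 := ρ.hasCompactSupport_normed.hasFDerivAt_convolution_right
    (ContinuousLinearMap.lsmul ℝ ℝ).flip hf ((ρ.contDiff_normed (n := 1) : ContDiff ℝ _ (ρ.normed μ))) x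
  have h2 : fderiv ℝ (mol μ ρ f) x = _ := h1.fderiv
  have hcd : Continuous (fderiv ℝ (ρ.normed μ)) :=
    (ρ.contDiff_normed (n := 1) : ContDiff ℝ _ (ρ.normed μ)).continuous_fderiv (by norm_num)
  rw [h2, convolution_precompR_apply _ hf (ρ.hasCompactSupport_normed.fderiv ℝ) hcd, convolution_def,
    ← integral_neg]
  refine integral_congr_ae (Eventually.of_forall fun w => ?_)
  have h3 : DifferentiableAt ℝ (ρ.normed μ) (x - w) :=
    ((ρ.contDiff_normed (n := 1) : ContDiff ℝ _ (ρ.normed μ))).differentiable (by norm_num) _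
  have h4 : HasFDerivAt (fun w => (ρ.normed μ (x - w) : ℂ))
    (Complex.ofRealCLM.comp ((fderiv ℝ (ρ.normed μ) (x - w)).comp (-ContinuousLinearMap.id ℝ (EN N)))) w := by
    have h5 : HasFDerivAt (fun w => x - w) (-ContinuousLinearMap.id ℝ (EN N)) w := by
      simpa using (hasFDerivAt_id w).const_sub x
    exact Complex.ofRealCLM.hasFDerivAt.comp w (h3.hasFDerivAt.comp w h5)
  simp [h4.fderiv, mul_comm]

/-- the translated bump -/
def tb (μ : Measure (EN N)) (ρ : ContDiffBump (0 : EN N)) (x : EN N) : EN N → ℂ :=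
  fun w => (ρ.normed μ (x - w) : ℂ)

lemma contDiff_tb (x : EN N) {n : ℕ∞} : ContDiff ℝ n (tb μ ρ x) := by
  have : ContDiff ℝ n (ρ.normed μ) := ρ.contDiff_normed
  exact Complex.ofRealCLM.contDiff.comp (this.comp (contDiff_const.sub contDiff_id))

lemma tb_zero (x w : EN N) (h : w ∉ ball x ρ.rOut) : tb μ ρ x w = 0 := by
  have : x - w ∉ Function.support (ρ.normed μ) := by
    rw [ρ.support_normed_eq]; simpa [dist_eq_norm, norm_sub_rev] using h
  simp [tb, Function.notMem_support.mp this]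

lemma tsupport_tb (x : EN N) : tsupport (tb μ ρ x) ⊆ closedBall x ρ.rOut :=
  closure_minimal (fun w hw => by
    by_contra h
    exact hw (tb_zero x w fun h' => h (ball_subset_closedBall h'))) isClosed_closedBall

lemma hcs_tb (x : EN N) : HasCompactSupport (tb μ ρ x) :=
  (isCompact_closedBall x ρ.rOut).of_isClosed_subset (isClosed_tsupport _) (tsupport_tb x)

lemma integrable_mul_tb {g : EN N → ℂ} (hf : LocallyIntegrable f μ) (hg : Continuous g)
    (hc : HasCompactSupport g) : Integrable (fun w => f w * g w) μ := by
  have := hf.integrable_smul_right_of_hasCompactSupport hg hc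
  simpa [mul_comm] using this

lemma dz_mol (hf : LocallyIntegrable f μ) (x : EN N) (j : Fin N) :
    dz j (mol μ ρ f) x = - ∫ w, f w * dz j (tb μ ρ x) w ∂μ := by
  have hI : ∀ v, Integrable (fun w => f w * fderiv ℝ (tb μ ρ x) w v) μ := fun v =>
    integrable_mul_tb hf (((contDiff_tb (n := 1) x).continuous_fderiv (by norm_num)).clm_apply
      continuous_const) ((hcs_tb x).fderiv_apply (𝕜 := ℝ) v)
  rw [dz, fderiv_mol hf, fderiv_mol hf]
  change (-∫ w, f w * fderiv ℝ (tb μ ρ x) w _ ∂μ - _ * (-∫ w, f w * fderiv ℝ (tb μ ρ x) w _ ∂μ)) / 2 = _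
  have : ∀ w, f w * dz j (tb μ ρ x) w = (f w * fderiv ℝ (tb μ ρ x) w (bv j) - Complex.I * (f w * fderiv ℝ (tb μ ρ x) w (Complex.I • bv j))) / 2 := by
    intro w; rw [dz]; ring
  simp_rw [this]
  rw [integral_div, integral_sub (hI _) ((hI _).const_mul _), integral_const_mul]
  ring
lemma db_mol (hf : LocallyIntegrable f μ) (x : EN N) (j : Fin N) :
    db j (mol μ ρ f) x = - ∫ w, f w * db j (tb μ ρ x) w ∂μ := by
  have hI : ∀ v, Integrable (fun w => f w * fderiv ℝ (tb μ ρ x) w v) μ := fun v =>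
    integrable_mul_tb hf (((contDiff_tb (n := 1) x).continuous_fderiv (by norm_num)).clm_apply
      continuous_const) ((hcs_tb x).fderiv_apply (𝕜 := ℝ) v)
  rw [db, fderiv_mol hf, fderiv_mol hf]
  change (-∫ w, f w * fderiv ℝ (tb μ ρ x) w _ ∂μ + _ * (-∫ w, f w * fderiv ℝ (tb μ ρ x) w _ ∂μ)) / 2 = _
  have : ∀ w, f w * db j (tb μ ρ x) w = (f w * fderiv ℝ (tb μ ρ x) w (bv j) + Complex.I * (f w * fderiv ℝ (tb μ ρ x) w (Complex.I • bv j))) / 2 := by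
    intro w; rw [db]; ring
  simp_rw [this]
  rw [integral_div, integral_add (hI _) ((hI _).const_mul _), integral_const_mul]
  ring

lemma mol_tb (x : EN N) : mol μ ρ f x = ∫ w, f w * tb μ ρ x w ∂μ := by
  rw [mol_apply]; simp [tb, mul_comm]

lemma mol_zero_of {K : Set (EN N)} (hK : ∀ z, z ∉ K → f z = 0) (x : EN N)
    (hx : x ∉ cthickening ρ.rOut K) : mol μ ρ f x = 0 := by
  rw [mol_tb]
  refine integral_eq_zero_of_ae (Eventually.of_forall fun w => ?_)
  by_cases hw : w ∈ K
  · show f w * tb μ ρ x w = 0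
    rw [tb_zero, mul_zero]
    intro h
    refine hx (mem_cthickening_of_dist_le x w _ K hw ?_)
    rw [dist_comm]; exact (mem_ball.mp h).le
  · simp [hK w hw]

lemma mol_sub {g : EN N → ℂ} (hf : LocallyIntegrable f μ) (hg : LocallyIntegrable g μ) :
    mol μ ρ (f - g) = mol μ ρ f - mol μ ρ g := by
  ext x
  have hc := (contDiff_tb (μ := μ) (ρ := ρ) (n := 0) x).continuous
  simp only [mol_tb, Pi.sub_apply, sub_mul]
  exact integral_sub (integrable_mul_tb hf hc (hcs_tb x)) (integrable_mul_tb hg hc (hcs_tb x))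

/-- L² contraction -/
lemma eLpNorm_mol_le (hf : MemLp f 2 μ) : eLpNorm (mol μ ρ f) 2 μ ≤ eLpNorm f 2 μ := by
  obtain ⟨g, hg, hfg⟩ := hf.1
  have h1 : mol μ ρ f = mol μ ρ g := convolution_congr _ hfg (EventuallyEq.refl _ _)
  rw [h1, eLpNorm_congr_ae hfg]
  let d : EN N → ℝ≥0 := fun t => (ρ.normed μ t).toNNReal
  have hd : Measurable d := ρ.continuous_normed.measurable.real_toNNReal
  let ν : Measure (EN N) := μ.withDensity fun t => (d t : ℝ≥0∞)
  have hν : IsProbabilityMeasure ν := by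
    constructor
    have := ofReal_integral_eq_lintegral_ofReal (ρ.integrable_normed (μ := μ))
      (Eventually.of_forall ρ.nonneg_normed)
    rw [withDensity_apply _ MeasurableSet.univ, Measure.restrict_univ]
    rw [ρ.integral_normed] at this
    simpa [d, ENNReal.ofReal] using this.symm
  have hm : ∀ x, mol μ ρ g x = ∫ t, g (x - t) ∂ν := by
    intro x
    rw [mol_eq, convolution_def, integral_withDensity_eq_integral_smul hd]
    refine integral_congr_ae (Eventually.of_forall fun t => ?_)
    simp [d, NNReal.smul_def, Real.coe_toNNReal _ (ρ.nonneg_normed t)]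
  have hgm : Measurable g := hg.measurable
  have hb : ∀ x, ‖mol μ ρ g x‖ₑ ^ 2 ≤ ∫⁻ t, ‖g (x - t)‖ₑ ^ 2 ∂ν := by
    intro x
    rw [hm]
    have hae : AEStronglyMeasurable (fun t => g (x - t)) ν :=
      (hgm.comp (measurable_const.sub measurable_id)).aestronglyMeasurable
    have a1 : ‖∫ t, g (x - t) ∂ν‖ₑ ≤ eLpNorm (fun t => g (x - t)) 1 ν := by
      rw [eLpNorm_one_eq_lintegral_enorm]; exact enorm_integral_le_lintegral_enorm _
    have a2 := eLpNorm_le_eLpNorm_of_exponent_le (p := 1) (q := 2) (by norm_num) hae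
    have a3 := eLpNorm_nnreal_pow_eq_lintegral (μ := ν) (f := fun t => g (x - t)) (p := 2) (by norm_num)
    calc _ ≤ (eLpNorm (fun t => g (x - t)) 2 ν) ^ 2 := by gcongr; exact a1.trans a2
      _ = _ := by simpa using a3
  have e1 := eLpNorm_nnreal_pow_eq_lintegral (μ := μ) (f := mol μ ρ g) (p := 2) (by norm_num)
  have e2 := eLpNorm_nnreal_pow_eq_lintegral (μ := μ) (f := g) (p := 2) (by norm_num)
  have hle : (eLpNorm (mol μ ρ g) 2 μ) ^ 2 ≤ (eLpNorm g 2 μ) ^ 2 := by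
    have e1' : (eLpNorm (mol μ ρ g) 2 μ) ^ 2 = ∫⁻ x, ‖mol μ ρ g x‖ₑ ^ 2 ∂μ := by simpa using e1
    have e2' : (eLpNorm g 2 μ) ^ 2 = ∫⁻ x, ‖g x‖ₑ ^ 2 ∂μ := by simpa using e2
    rw [e1', e2']
    calc _ ≤ ∫⁻ x, ∫⁻ t, ‖g (x - t)‖ₑ ^ 2 ∂ν ∂μ := lintegral_mono hb
      _ = ∫⁻ t, ∫⁻ x, ‖g (x - t)‖ₑ ^ 2 ∂μ ∂ν := by
        refine lintegral_lintegral_swap ?_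
        exact ((hgm.comp (measurable_fst.sub measurable_snd)).enorm.pow_const 2).aemeasurable
      _ = ∫⁻ t, ∫⁻ x, ‖g x‖ₑ ^ 2 ∂μ ∂ν := by
        refine lintegral_congr fun t => ?_
        exact lintegral_sub_right_eq_self (fun x => ‖g x‖ₑ ^ 2) t
      _ = _ := by simp
  exact (ENNReal.pow_le_pow_left_iff (by norm_num)).mp hle

lemma mol_tendsto (hf : MemLp f 2 μ) :
    Tendsto (fun n => eLpNorm (mol μ (bmp N n) f - f) 2 μ) atTop (𝓝 0) := by
  rw [ENNReal.tendsto_nhds_zero]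
  intro ε hε
  wlog hεt : ε ≠ ⊤ generalizing ε
  · filter_upwards [this 1 (by norm_num) (by norm_num)] with n hn
    push Not at hεt; simp [hεt]
  have hε3 : ε / 3 ≠ 0 := (ENNReal.div_pos hε.ne' (by norm_num)).ne'
  obtain ⟨g, hgc, hfg, hg, hgL⟩ := hf.exists_hasCompactSupport_eLpNorm_sub_le (by norm_num) hε3
  have huc : UniformContinuous g := hgc.uniformContinuous_of_continuous hg
  let S := cthickening 2 (tsupport g)
  have hS : IsCompact S := hgc.cthickening
  have hSm : μ S ≠ ⊤ := hS.measure_lt_top.ne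
  obtain ⟨c, hc0, hc⟩ : ∃ c : ℝ, 0 < c ∧ ENNReal.ofReal c * μ S ^ (1 / (2:ℝ≥0∞).toReal) ≤ ε / 3 := by
    have hfin : μ S ^ (1 / (2:ℝ≥0∞).toReal) ≠ ⊤ := ENNReal.rpow_ne_top_of_nonneg (by positivity) hSm
    have ht : Tendsto (fun c : ℝ => ENNReal.ofReal c * μ S ^ (1 / (2:ℝ≥0∞).toReal)) (𝓝[>] 0) (𝓝 0) := by
      have h1 : Tendsto (fun c : ℝ => ENNReal.ofReal c) (𝓝[>] 0) (𝓝 (ENNReal.ofReal 0)) :=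
        (ENNReal.continuous_ofReal.tendsto 0).mono_left nhdsWithin_le_nhds
      have := ENNReal.Tendsto.mul_const h1 (Or.inr hfin)
      simpa using this
    have h2 := (ENNReal.tendsto_nhds_zero.mp ht) (ε / 3) (pos_iff_ne_zero.mpr hε3)
    obtain ⟨c, h3, h4⟩ := (h2.and self_mem_nhdsWithin).exists
    exact ⟨c, h4, h3⟩
  obtain ⟨δ, hδ, hδ'⟩ := Metric.uniformContinuous_iff.mp huc c hc0
  have hr := bmp_rOut N
  filter_upwards [(hr.eventually (gt_mem_nhds hδ)), hr.eventually (gt_mem_nhds (show (0:ℝ) < 2 by norm_num))]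
    with n hn hn2
  have hfl : LocallyIntegrable f μ := hf.locallyIntegrable (by norm_num)
  have hgl : LocallyIntegrable g μ := hg.locallyIntegrable
  have h1 : eLpNorm (mol μ (bmp N n) g - g) 2 μ ≤ ε / 3 := by
    refine (eLpNorm_sub_le_of_dist_bdd μ (by norm_num) hS.isClosed.measurableSet hc0.le ?_ ?_ ?_).trans hc
    · intro x
      rw [mol_eq]
      refine ContDiffBump.dist_normed_convolution_le hg.aestronglyMeasurable fun y hy => ?_
      exact (hδ' ((mem_ball.mp hy).trans hn)).le
    · intro x hx
      by_contra h
      refine hx (mol_zero_of (K := tsupport g) (fun z hz => image_eq_zero_of_notMem_tsupport hz) x fun h' => h ?_)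
      exact cthickening_mono hn2.le _ h'
    · exact (subset_tsupport g).trans (self_subset_cthickening _)
  have h2 : eLpNorm (mol μ (bmp N n) (f - g)) 2 μ ≤ ε / 3 := (eLpNorm_mol_le (hf.sub hgL)).trans hfg
  have h3 : mol μ (bmp N n) f - f = mol μ (bmp N n) (f - g) + (mol μ (bmp N n) g - g) - (f - g) := by
    rw [mol_sub hfl hgl]; abel
  have m1 : AEStronglyMeasurable (mol μ (bmp N n) (f - g)) μ :=
    (contDiff_mol (hfl.sub hgl)).continuous.aestronglyMeasurable
  have m2 : AEStronglyMeasurable (mol μ (bmp N n) g - g) μ :=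
    ((contDiff_mol hgl).continuous.sub hg).aestronglyMeasurable
  rw [h3]
  calc _ ≤ eLpNorm (mol μ (bmp N n) (f - g) + (mol μ (bmp N n) g - g)) 2 μ + eLpNorm (f - g) 2 μ :=
        eLpNorm_sub_le (m1.add m2) (hf.sub hgL).1 (by norm_num)
    _ ≤ (eLpNorm (mol μ (bmp N n) (f - g)) 2 μ + eLpNorm (mol μ (bmp N n) g - g) 2 μ) + eLpNorm (f - g) 2 μ := by
        gcongr; exact eLpNorm_add_le m1 m2 (by norm_num)
    _ ≤ ε / 3 + ε / 3 + ε / 3 := by gcongr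
    _ = ε := ENNReal.add_thirds ε
end mollify
end DFW
end

open Set Filter Topology Metric MeasureTheory
open scoped ENNReal NNReal InnerProductSpace ComplexConjugate
noncomputable section
namespace DFW

section L2T
variable {N : ℕ} {μ : Measure (EN N)}

/-- convergence in L² of functions -/
def L2T (μ : Measure (EN N)) (F : ℕ → EN N → ℂ) (f : EN N → ℂ) : Prop :=
  (∀ n, MemLp (F n) 2 μ) ∧ MemLp f 2 μ ∧ Tendsto (fun n => eLpNorm (F n - f) 2 μ) atTop (𝓝 0)

lemma L2T.sub {F G : ℕ → EN N → ℂ} {f g : EN N → ℂ} (hF : L2T μ F f) (hG : L2T μ G g) :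
    L2T μ (fun n => F n - G n) (f - g) := by
  refine ⟨fun n => (hF.1 n).sub (hG.1 n), hF.2.1.sub hG.2.1, ?_⟩
  have h := hF.2.2.add hG.2.2
  rw [add_zero] at h
  refine tendsto_of_tendsto_of_tendsto_of_le_of_le tendsto_const_nhds h (fun _ => zero_le) fun n => ?_
  have : (fun n => F n - G n) n - (f - g) = (F n - f) - (G n - g) := by
    simp only; abel
  rw [this]
  exact eLpNorm_sub_le ((hF.1 n).sub hF.2.1).1 ((hG.1 n).sub hG.2.1).1 (by norm_num)

lemma L2T.add {F G : ℕ → EN N → ℂ} {f g : EN N → ℂ} (hF : L2T μ F f) (hG : L2T μ G g) :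
    L2T μ (fun n => F n + G n) (f + g) := by
  refine ⟨fun n => (hF.1 n).add (hG.1 n), hF.2.1.add hG.2.1, ?_⟩
  have h := hF.2.2.add hG.2.2
  rw [add_zero] at h
  refine tendsto_of_tendsto_of_tendsto_of_le_of_le tendsto_const_nhds h (fun _ => zero_le) fun n => ?_
  have : (fun n => F n + G n) n - (f + g) = (F n - f) + (G n - g) := by
    simp only; abel
  rw [this]
  exact eLpNorm_add_le ((hF.1 n).sub hF.2.1).1 ((hG.1 n).sub hG.2.1).1 (by norm_num)

lemma L2T.zero : L2T μ (fun _ => 0) 0 := by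
  refine ⟨fun n => MemLp.zero, MemLp.zero, by simp⟩

lemma L2T.sum {ι : Type*} (s : Finset ι) {F : ι → ℕ → EN N → ℂ} {f : ι → EN N → ℂ}
    (h : ∀ i, L2T μ (F i) (f i)) : L2T μ (fun n => ∑ i ∈ s, F i n) (∑ i ∈ s, f i) := by
  classical
  induction s using Finset.induction_on with
  | empty => simpa using L2T.zero
  | insert a s ha ih =>
    simp only [Finset.sum_insert ha]
    exact (h a).add ih

lemma MemLp.bdd_mul' {f c : EN N → ℂ} {C : ℝ} (hf : MemLp f 2 μ) (hc : AEStronglyMeasurable c μ)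
    (hC : ∀ z, ‖c z‖ ≤ C) : MemLp (c * f) 2 μ := by
  refine MemLp.of_le_mul (c := C) hf (hc.mul hf.1) (Eventually.of_forall fun z => ?_)
  rw [Pi.mul_apply, norm_mul]
  gcongr; exact hC z

lemma L2T.bdd_mul {F : ℕ → EN N → ℂ} {f c : EN N → ℂ} {C : ℝ} (hF : L2T μ F f)
    (hc : AEStronglyMeasurable c μ) (hC : ∀ z, ‖c z‖ ≤ C) : L2T μ (fun n => c * F n) (c * f) := by
  refine ⟨fun n => MemLp.bdd_mul' (hF.1 n) hc hC, MemLp.bdd_mul' hF.2.1 hc hC, ?_⟩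
  have h : Tendsto (fun n => ENNReal.ofReal C * eLpNorm (F n - f) 2 μ) atTop (𝓝 0) := by
    have := ENNReal.Tendsto.const_mul hF.2.2 (a := ENNReal.ofReal C) (Or.inr ENNReal.ofReal_ne_top)
    simpa using this
  refine tendsto_of_tendsto_of_tendsto_of_le_of_le tendsto_const_nhds h (fun _ => zero_le) fun n => ?_
  refine eLpNorm_le_mul_eLpNorm_of_ae_le_mul (Eventually.of_forall fun z => ?_) 2
  simp only [Pi.sub_apply, Pi.mul_apply, ← mul_sub, norm_mul]
  gcongr; exact hC z

lemma integral_normsq_eq {f : EN N → ℂ} (hf : MemLp f 2 μ) :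
    ∫ z, ‖f z‖^2 ∂μ = (eLpNorm f 2 μ).toReal ^ 2 := by
  have h := hf.eLpNorm_eq_integral_rpow_norm (by norm_num) (by norm_num)
  rw [h, ENNReal.toReal_ofReal (by positivity)]
  simp only [ENNReal.toReal_ofNat, Real.rpow_ofNat]
  rw [← Real.rpow_natCast, ← Real.rpow_mul (integral_nonneg fun _ => by positivity)]
  norm_num

lemma integrable_normsq {f : EN N → ℂ} (hf : MemLp f 2 μ) : Integrable (fun z => ‖f z‖^2) μ := by
  have := hf.integrable_norm_rpow (by norm_num) (by norm_num)
  simpa using this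

lemma L2T.norm_tendsto {F : ℕ → EN N → ℂ} {f : EN N → ℂ} (hF : L2T μ F f) :
    Tendsto (fun n => (eLpNorm (F n) 2 μ).toReal) atTop (𝓝 (eLpNorm f 2 μ).toReal) := by
  have h0 : Tendsto (fun n => (eLpNorm (F n - f) 2 μ).toReal) atTop (𝓝 0) := by
    have := (ENNReal.tendsto_toReal (a := 0) (by simp)).comp hF.2.2
    simpa [Function.comp_def] using this
  rw [tendsto_iff_dist_tendsto_zero]
  refine squeeze_zero (fun _ => dist_nonneg) (fun n => ?_) h0
  have hn := hF.1 n
  have hd := hn.sub hF.2.1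
  rw [Real.dist_eq, abs_le]
  constructor
  · have h1 : eLpNorm f 2 μ ≤ eLpNorm (F n) 2 μ + eLpNorm (F n - f) 2 μ := by
      have := eLpNorm_sub_le hn.1 hd.1 (p := 2) (by norm_num)
      simpa using this
    have h2 := ENNReal.toReal_mono (ENNReal.add_ne_top.mpr ⟨hn.2.ne, hd.2.ne⟩) h1
    rw [ENNReal.toReal_add hn.2.ne hd.2.ne] at h2
    linarith
  · have h1 : eLpNorm (F n) 2 μ ≤ eLpNorm f 2 μ + eLpNorm (F n - f) 2 μ := by
      have := eLpNorm_add_le hF.2.1.1 hd.1 (p := 2) (by norm_num)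
      simpa using this
    have h2 := ENNReal.toReal_mono (ENNReal.add_ne_top.mpr ⟨hF.2.1.2.ne, hd.2.ne⟩) h1
    rw [ENNReal.toReal_add hF.2.1.2.ne hd.2.ne] at h2
    linarith

lemma L2T.integral {F : ℕ → EN N → ℂ} {f : EN N → ℂ} (hF : L2T μ F f) :
    Tendsto (fun n => ∫ z, ‖F n z‖^2 ∂μ) atTop (𝓝 (∫ z, ‖f z‖^2 ∂μ)) := by
  simp_rw [integral_normsq_eq (hF.1 _), integral_normsq_eq hF.2.1]
  exact hF.norm_tendsto.pow 2

end L2T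

section weak
variable {N : ℕ} {μ : Measure (EN N)} [μ.IsAddHaarMeasure]

lemma memLp_locInt {f : EN N → ℂ} (hf : MemLp f 2 μ) : LocallyIntegrable f μ :=
  hf.locallyIntegrable (by norm_num)

lemma L2T_mol {f : EN N → ℂ} (hf : MemLp f 2 μ) : L2T μ (fun n => mol μ (bmp N n) f) f := by
  refine ⟨fun n => ⟨((contDiff_mol (memLp_locInt hf)).continuous).aestronglyMeasurable,
    (eLpNorm_mol_le hf).trans_lt hf.2⟩, hf, mol_tendsto hf⟩

lemma weak_apriori {U : Set (EN N)} (hU : IsOpen U) {φ ψ : EN N → ℝ} (hφ : ContDiffOn ℝ 2 φ U)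
    (hψ : ContDiffOn ℝ 2 ψ U) (hL : ∀ z ∈ U, LeviBound φ ψ z) {K : Set (EN N)} (hK : IsCompact K)
    (hKU : K ⊆ U) {h : Fin N → EN N → ℂ} {d : EN N → ℂ} {s : Fin N → Fin N → EN N → ℂ}
    (hh : ∀ j, MemLp (h j) 2 μ) (hd : MemLp d 2 μ) (hs : ∀ j k, MemLp (s j k) 2 μ)
    (hh0 : ∀ j, ∀ z ∉ K, h j z = 0) (hd0 : ∀ z ∉ K, d z = 0) (hs0 : ∀ j k, ∀ z ∉ K, s j k z = 0)
    (hdw : ∀ b : EN N → ℂ, ContDiff ℝ 2 b → HasCompactSupport b →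
      ∑ j, ∫ z, h j z * dz j b z ∂μ = - ∫ z, d z * b z ∂μ)
    (hsw : ∀ b : EN N → ℂ, ContDiff ℝ 2 b → HasCompactSupport b → ∀ j k,
      ∫ z, h j z * db k b z ∂μ - ∫ z, h k z * db j b z ∂μ = - ∫ z, s j k z * b z ∂μ) :
    ∑ j, ∫ z, ‖(Real.exp ((ψ z - φ z) / 2) : ℂ) * h j z‖^2 ∂μ ≤
      ∫ z, ‖(Real.exp (-φ z / 2) : ℂ) * (d z - ∑ j, dz j (cx (φ - ψ)) z * h j z)‖^2 ∂μ +
      (1/4) * ∑ j, ∑ k, ∫ z, ‖(Real.exp (-φ z / 2) : ℂ) * s j k z‖^2 ∂μ := by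
  obtain ⟨δ, hδ, hδU⟩ := hK.exists_cthickening_subset_open hU hKU
  set K' := cthickening δ K with hK'
  have hK'c : IsCompact K' := hK.cthickening
  have hKK' : K ⊆ K' := self_subset_cthickening K
  -- truncated weights
  have key : ∀ c : EN N → ℂ, ContinuousOn c K' →
      AEStronglyMeasurable (K'.indicator c) μ ∧ ∃ C, ∀ z, ‖K'.indicator c z‖ ≤ C := by
    intro c hc
    refine ⟨(aestronglyMeasurable_indicator_iff hK'c.measurableSet).mpr
      (hc.aestronglyMeasurable hK'c.measurableSet), ?_⟩
    obtain ⟨C, hC⟩ := hK'c.exists_bound_of_continuousOn hc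
    refine ⟨max C 0, fun z => ?_⟩
    by_cases hz : z ∈ K'
    · rw [indicator_of_mem hz]; exact (hC z hz).trans (le_max_left _ _)
    · rw [indicator_of_notMem hz]; simp
  have hφc : ContinuousOn φ K' := hφ.continuousOn.mono hδU
  have hψc : ContinuousOn ψ K' := hψ.continuousOn.mono hδU
  set E1 : EN N → ℂ := fun z => (Real.exp (-φ z / 2) : ℂ) with hE1
  set E2 : EN N → ℂ := fun z => (Real.exp ((ψ z - φ z) / 2) : ℂ) with hE2
  have hE1c : ContinuousOn E1 K' := by
    apply Complex.continuous_ofReal.comp_continuousOn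
    exact Real.continuous_exp.comp_continuousOn (hφc.neg.div_const 2)
  have hE2c : ContinuousOn E2 K' := by
    apply Complex.continuous_ofReal.comp_continuousOn
    exact Real.continuous_exp.comp_continuousOn ((hψc.sub hφc).div_const 2)
  have hcj : ∀ j : Fin N, ContinuousOn (dz j (cx (φ - ψ))) K' := by
    intro j
    have h1 : ContDiffOn ℝ 2 (cx (φ - ψ)) U :=
      Complex.ofRealCLM.contDiff.comp_contDiffOn (hφ.sub hψ)
    have h2 : ContinuousOn (fderiv ℝ (cx (φ - ψ))) U :=
      h1.continuousOn_fderiv_of_isOpen hU (by norm_num)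
    have h3 : ∀ v, ContinuousOn (fun z => fderiv ℝ (cx (φ - ψ)) z v) K' := fun v =>
      (h2.mono hδU).clm_apply continuousOn_const
    exact ((h3 _).sub (continuousOn_const.mul (h3 _))).div_const _
  obtain ⟨hE1m, C1, hC1⟩ := key E1 hE1c
  obtain ⟨hE2m, C2, hC2⟩ := key E2 hE2c
  have hcm : ∀ j, AEStronglyMeasurable (K'.indicator (dz j (cx (φ - ψ)))) μ := fun j => (key _ (hcj j)).1
  have hcC : ∀ j, ∃ C, ∀ z, ‖K'.indicator (dz j (cx (φ - ψ))) z‖ ≤ C := fun j => (key _ (hcj j)).2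
  choose C3 hC3 using hcC
  -- convergences
  have T1 : ∀ j, L2T μ (fun n => K'.indicator E2 * mol μ (bmp N n) (h j)) (K'.indicator E2 * h j) :=
    fun j => (L2T_mol (hh j)).bdd_mul hE2m hC2
  have T2 : ∀ j k, L2T μ (fun n => K'.indicator E1 * mol μ (bmp N n) (s j k)) (K'.indicator E1 * s j k) :=
    fun j k => (L2T_mol (hs j k)).bdd_mul hE1m hC1
  have T3 : L2T μ (fun n => K'.indicator E1 * (mol μ (bmp N n) d -
      ∑ j, K'.indicator (dz j (cx (φ - ψ))) * mol μ (bmp N n) (h j)))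
      (K'.indicator E1 * (d - ∑ j, K'.indicator (dz j (cx (φ - ψ))) * h j)) :=
    ((L2T_mol hd).sub (L2T.sum Finset.univ fun j => (L2T_mol (hh j)).bdd_mul (hcm j) (hC3 j))).bdd_mul
      hE1m hC1
  have hlim := (T3.integral.add ((tendsto_finsetSum Finset.univ fun j _ =>
    tendsto_finsetSum Finset.univ fun k _ => (T2 j k).integral).const_mul (1/4))).sub
      (tendsto_finsetSum Finset.univ fun j _ => (T1 j).integral)
  have hpos := ge_of_tendsto' (b := 0) (hlim.comp (tendsto_add_atTop_nat
    ((eventually_atTop.mp ((bmp_rOut N).eventually (gt_mem_nhds hδ))).choose))) (fun n => ?_)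
  · have e1 : ∀ j z, (K'.indicator E2 * h j) z = E2 z * h j z := by
      intro j z
      by_cases hz : z ∈ K'
      · simp [indicator_of_mem hz]
      · simp [hh0 j z (fun h => hz (hKK' h))]
    have e2 : ∀ j k z, (K'.indicator E1 * s j k) z = E1 z * s j k z := by
      intro j k z
      by_cases hz : z ∈ K'
      · simp [indicator_of_mem hz]
      · simp [hs0 j k z (fun h => hz (hKK' h))]
    have e3 : ∀ z, (K'.indicator E1 * (d - ∑ j, K'.indicator (dz j (cx (φ - ψ))) * h j)) z =
        E1 z * (d z - ∑ j, dz j (cx (φ - ψ)) z * h j z) := by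
      intro z
      by_cases hz : z ∈ K'
      · simp [indicator_of_mem hz, Finset.sum_apply]
      · have hz' : z ∉ K := fun h => hz (hKK' h)
        simp [hz, hd0 z hz', fun j => hh0 j z hz']
    simp_rw [e1, e2, e3] at hpos
    linarith
  · have hn := (eventually_atTop.mp ((bmp_rOut N).eventually (gt_mem_nhds hδ))).choose_spec
      (n + (eventually_atTop.mp ((bmp_rOut N).eventually (gt_mem_nhds hδ))).choose) (by omega)
    simp only [Function.comp]
    generalize (n + (eventually_atTop.mp ((bmp_rOut N).eventually (gt_mem_nhds hδ))).choose) = m at hn ⊢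
    set ρ := bmp N m
    have hz0 : ∀ f : EN N → ℂ, (∀ z ∉ K, f z = 0) → ∀ z ∉ K', mol μ ρ f z = 0 := fun f hf z hz =>
      mol_zero_of hf z (fun h => hz (cthickening_mono hn.le K h))
    have hts : ∀ f : EN N → ℂ, (∀ z ∉ K, f z = 0) → tsupport (mol μ ρ f) ⊆ K' := fun f hf =>
      closure_minimal (fun z hz => by by_contra h; exact hz (hz0 f hf z h)) hK'c.isClosed
    have A := apriori (μ := μ) hU hφ hψ hL (h := fun j => mol μ ρ (h j))
      (fun j => contDiff_mol (memLp_locInt (hh j)))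
      (fun j => hK'c.of_isClosed_subset (isClosed_tsupport _) (hts _ (hh0 j)))
      (fun j => (hts _ (hh0 j)).trans hδU)
    have i1 : ∀ z, ∑ j, dz j (mol μ ρ (h j)) z = mol μ ρ d z := by
      intro z
      have := hdw (tb μ ρ z) (contDiff_tb (n := 2) z) (hcs_tb z)
      simp_rw [dz_mol (memLp_locInt (hh _)), mol_tb, Finset.sum_neg_distrib]
      rw [this, neg_neg]
    have i2 : ∀ z j k, db k (mol μ ρ (h j)) z - db j (mol μ ρ (h k)) z = mol μ ρ (s j k) z := by
      intro z j k
      have := hsw (tb μ ρ z) (contDiff_tb (n := 2) z) (hcs_tb z) j k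
      rw [db_mol (memLp_locInt (hh _)), db_mol (memLp_locInt (hh _)), mol_tb]
      linear_combination -this
    refine A.trans (le_of_eq ?_)
    rw [← integral_finsetSum _ (fun j _ => integrable_normsq ((T1 j).1 m))]
    have hsum : ∑ j, ∑ k, ∫ z, ‖(K'.indicator E1 * mol μ ρ (s j k)) z‖^2 ∂μ =
        ∫ z, ∑ j, ∑ k, ‖(K'.indicator E1 * mol μ ρ (s j k)) z‖^2 ∂μ := by
      rw [integral_finsetSum _ (fun j _ => integrable_finsetSum _ fun k _ =>
        integrable_normsq ((T2 j k).1 m))]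
      refine Finset.sum_congr rfl fun j _ => ?_
      rw [integral_finsetSum _ (fun k _ => integrable_normsq ((T2 j k).1 m))]
    rw [hsum, ← integral_const_mul, ← integral_add
        (integrable_normsq (T3.1 m)), ← integral_sub]
    · refine integral_congr_ae (Eventually.of_forall fun z => ?_)
      simp only [Finset.sum_sub_distrib, i1, i2]
      by_cases hz : z ∈ K'
      · have q1 : Real.exp (-φ z) = ‖E1 z‖^2 := by
          rw [hE1]; simp only [Complex.norm_real, Real.norm_eq_abs, Real.abs_exp, ← Real.exp_nat_mul]
          congr 1; push_cast; ring
        have q2 : Real.exp (-φ z) * Real.exp (ψ z) = ‖E2 z‖^2 := by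
          rw [hE2]; simp only [Complex.norm_real, Real.norm_eq_abs, Real.abs_exp, ← Real.exp_nat_mul, ← Real.exp_add]
          congr 1; push_cast; ring
        simp only [Pi.mul_apply, Pi.sub_apply, Finset.sum_apply, indicator_of_mem hz, norm_mul, mul_pow]
        simp only [← q1, ← q2, ← Finset.mul_sum]
        ring
      · simp [hz, hz0 _ hd0 z hz, hz0 _ (hh0 _) z hz, hz0 _ (hs0 _ _) z hz]
    · exact (integrable_normsq (T3.1 m)).add ((integrable_finsetSum _ fun j _ =>
        integrable_finsetSum _ fun k _ => integrable_normsq ((T2 j k).1 m)).const_mul _)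
    · exact integrable_finsetSum _ fun j _ => integrable_normsq ((T1 j).1 m)
    · exact (integrable_finsetSum _ fun j _ =>
        integrable_finsetSum _ fun k _ => integrable_normsq ((T2 j k).1 m)).const_mul _
end weak
end DFW
end

open Set Filter Topology Metric MeasureTheory
open scoped ENNReal NNReal InnerProductSpace ComplexConjugate
noncomputable section
namespace DFW
variable {N : ℕ} {μ : Measure (EN N)} [μ.IsAddHaarMeasure]

lemma cont_mul_of_tsupport {U : Set (EN N)} (hU : IsOpen U) {χ f : EN N → ℂ} (hχ : Continuous χ)
    (hf : ContinuousOn f U) (hs : tsupport χ ⊆ U) : Continuous (fun z => χ z * f z) := by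
  rw [continuous_iff_continuousAt]
  intro z
  by_cases hz : z ∈ U
  · exact hχ.continuousAt.mul (hf.continuousAt (hU.mem_nhds hz))
  · have h0 : χ =ᶠ[𝓝 z] fun _ => 0 := notMem_tsupport_iff_eventuallyEq.mp fun h => hz (hs h)
    have : (fun z => χ z * f z) =ᶠ[𝓝 z] fun _ => 0 := by
      filter_upwards [h0] with w hw; simp [hw]
    exact (continuousAt_const).congr this.symm

lemma memLp_cc_mul {c G : EN N → ℂ} (hc : Continuous c) (hcs : HasCompactSupport c)
    (hG : MemLp G 2 μ) : MemLp (fun z => c z * G z) 2 μ := by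
  obtain ⟨C, hC⟩ := hc.bounded_above_of_compact_support hcs
  exact MemLp.bdd_mul' hG hc.aestronglyMeasurable hC

/-- an exhausting sequence of cutoffs, with gradients controlled by `exp ψ` -/
structure Cutoffs (U : Set (EN N)) (ψ : EN N → ℝ) (η : ℕ → EN N → ℝ) : Prop where
  smooth : ∀ n, ContDiff ℝ 2 (η n)
  cpt : ∀ n, HasCompactSupport (η n)
  supp : ∀ n, tsupport (η n) ⊆ U
  mem : ∀ n z, η n z ∈ Icc (0:ℝ) 1
  grad : ∀ n, ∀ z ∈ U, ∑ j, ‖dz j (cx (η n)) z‖^2 ≤ Real.exp (ψ z)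
  lim : ∀ z ∈ U, ∀ᶠ n in atTop, η n =ᶠ[𝓝 z] fun _ => 1

lemma tsupport_cx {φ : EN N → ℝ} : tsupport (cx φ) = tsupport φ := by
  have : Function.support (cx φ) = Function.support φ := by
    ext z; simp [cx]
  rw [tsupport, this]; rfl

lemma proj_bound_cutoff {U : Set (EN N)} (hU : IsOpen U) {φ ψ : EN N → ℝ} (hφ : ContDiffOn ℝ 2 φ U)
    (hψ : ContDiffOn ℝ 2 ψ U) (hL : ∀ z ∈ U, LeviBound φ ψ z) {η : EN N → ℝ}
    (hη : ContDiff ℝ 2 η) (hηc : HasCompactSupport η) (hηU : tsupport η ⊆ U)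
    {G : Fin N → EN N → ℂ} (hG : ∀ j, MemLp (G j) 2 μ) (hG0 : ∀ j, ∀ z ∉ U, G j z = 0)
    {m : EN N → ℂ} (hm : Continuous m) (hmU : tsupport m ⊆ U) (hmc : HasCompactSupport m)
    (hGK : ∀ b : EN N → ℂ, ContDiff ℝ 2 b → HasCompactSupport b → tsupport b ⊆ U → ∀ j k,
      ∫ z, Complex.exp (cx (φ - ψ) z / 2) * G j z * db k b z ∂μ -
        ∫ z, Complex.exp (cx (φ - ψ) z / 2) * G k z * db j b z ∂μ = 0)
    (hGP : ∀ b : EN N → ℂ, ContDiff ℝ 2 b → HasCompactSupport b → tsupport b ⊆ U →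
      ∑ j, ∫ z, Complex.exp (-cx (φ - ψ) z / 2) * G j z * dz j b z ∂μ =
        - ∫ z, Complex.exp (-cx (φ - ψ) z) * m z * b z ∂μ) :
    ∑ j, ∫ z, ‖(η z : ℂ) * G j z‖^2 ∂μ ≤
      ∫ z, ‖(η z : ℂ) * (Complex.exp (-cx φ z / 2) * m z) +
        Complex.exp (-cx ψ z / 2) * ∑ j, dz j (cx η) z * G j z‖^2 ∂μ +
      (1/4) * ∑ j, ∑ k, ∫ z, ‖Complex.exp (-cx ψ z / 2) *
        (db k (cx η) z * G j z - db j (cx η) z * G k z)‖^2 ∂μ := by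
  set q : EN N → ℝ := φ - ψ with hq
  have hqU : ContDiffOn ℝ 2 (cx q) U := Complex.ofRealCLM.contDiff.comp_contDiffOn (hφ.sub hψ)
  have hqd : ∀ z ∈ U, DifferentiableAt ℝ (cx q) z := fun z hz =>
    (hqU.differentiableOn (by norm_num)).differentiableAt (hU.mem_nhds hz)
  have hcη : ContDiff ℝ 2 (cx η) := contDiff_cx hη
  have hcη1 : ContDiff ℝ 1 (cx η) := hcη.of_le (by norm_num)
  have hcηc : HasCompactSupport (cx η) := by rw [HasCompactSupport, tsupport_cx]; exact hηc
  have hcηU : tsupport (cx η) ⊆ U := by rw [tsupport_cx]; exact hηU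
  set e : EN N → ℂ := fun z => Complex.exp (cx q z / 2) with he
  have heU : ContDiffOn ℝ 2 e U := (hqU.div_const 2).cexp
  have hec : ContinuousOn e U := heU.continuousOn
  have hdq : ∀ j : Fin N, ContinuousOn (dz j (cx q)) U := by
    intro j
    have h2 : ContinuousOn (fderiv ℝ (cx q)) U := hqU.continuousOn_fderiv_of_isOpen hU (by norm_num)
    have h3 : ∀ v, ContinuousOn (fun z => fderiv ℝ (cx q) z v) U := fun v =>
      h2.clm_apply continuousOn_const
    exact ((h3 _).sub (continuousOn_const.mul (h3 _))).div_const _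
  have hsd : ∀ j : Fin N, tsupport (dz j (cx η)) ⊆ U := fun j => tsupport_dz.trans hcηU
  have hsb : ∀ j : Fin N, tsupport (db j (cx η)) ⊆ U := fun j => tsupport_db.trans hcηU
  -- general tool
  have mem : ∀ (χ f : EN N → ℂ) j, Continuous χ → HasCompactSupport χ → tsupport χ ⊆ U →
      ContinuousOn f U → MemLp (fun z => χ z * f z * G j z) 2 μ := fun χ f j h1 h2 h3 h4 =>
    memLp_cc_mul (cont_mul_of_tsupport hU h1 h4 h3) h2.mul_right (hG j)
  have mem_d : ∀ j, MemLp (fun z => dz j (cx η) z * e z * G j z) 2 μ := fun j =>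
    mem _ _ _ (continuous_dz hcη1) (hcs_dz hcηc) (hsd j) hec
  have mem_b : ∀ k j, MemLp (fun z => db k (cx η) z * e z * G j z) 2 μ := fun k j =>
    mem _ _ _ (continuous_db hcη1) (hcs_db hcηc) (hsb k) hec
  have mem_h : ∀ j, MemLp (fun z => cx η z * e z * G j z) 2 μ := fun j =>
    mem _ _ _ hcη.continuous hcηc hcηU hec
  have mem_q : ∀ j, MemLp (fun z => cx η z * (e z * dz j (cx q) z) * G j z) 2 μ := fun j =>
    mem _ _ _ hcη.continuous hcηc hcηU (hec.mul (hdq j))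
  have mem_m : MemLp (fun z => cx η z * m z) 2 μ :=
    (hcη.continuous.mul hm).memLp_of_hasCompactSupport hcηc.mul_right
  set h : Fin N → EN N → ℂ := fun j z => cx η z * e z * G j z with hh
  set d : EN N → ℂ := fun z => cx η z * m z + ∑ j, (dz j (cx η) z * e z * G j z +
    cx η z * (e z * dz j (cx q) z) * G j z) with hd
  set s : Fin N → Fin N → EN N → ℂ := fun j k z => db k (cx η) z * e z * G j z -
    db j (cx η) z * e z * G k z with hs
  have hz1 : ∀ z ∉ tsupport η, cx η z = 0 := fun z hz =>
    image_eq_zero_of_notMem_tsupport (by rwa [tsupport_cx])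
  have hz2 : ∀ z ∉ tsupport η, ∀ j, dz j (cx η) z = 0 := fun z hz j =>
    dz_zero_of (by rwa [tsupport_cx])
  have hz3 : ∀ z ∉ tsupport η, ∀ j, db j (cx η) z = 0 := fun z hz j =>
    db_zero_of (by rwa [tsupport_cx])
  have hI : ∀ (f : EN N → ℂ), MemLp f 2 μ → ∀ b : EN N → ℂ, Continuous b → HasCompactSupport b →
      Integrable (fun z => f z * b z) μ := fun f hf b hb hbc =>
    integrable_mul_tb (memLp_locInt hf) hb hbc
  have W := weak_apriori (μ := μ) hU hφ hψ hL (K := tsupport η) hηc hηU (h := h) (d := d) (s := s)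
    mem_h (mem_m.add (memLp_finsetSum _ fun j _ => (mem_d j).add (mem_q j)))
    (fun j k => (mem_b k j).sub (mem_b j k))
    (fun j z hz => by simp [hh, hz1 z hz]) (fun z hz => by simp [hd, hz1 z hz, hz2 z hz])
    (fun j k z hz => by simp [hs, hz3 z hz]) ?_ ?_
  · have ee1 : ∀ z, (Real.exp ((ψ z - φ z) / 2) : ℂ) * e z = 1 := by
      intro z; rw [he]; simp only [Complex.ofReal_exp, ← Complex.exp_add]
      rw [← Complex.exp_zero]; congr 1; simp [cx, hq]; ring
    have ee2 : ∀ z, (Real.exp (-φ z / 2) : ℂ) * e z = Complex.exp (-cx ψ z / 2) := by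
      intro z; rw [he]; simp only [Complex.ofReal_exp, ← Complex.exp_add]
      congr 1; simp [cx, hq]; ring
    have ee3 : ∀ z, (Real.exp (-φ z / 2) : ℂ) = Complex.exp (-cx φ z / 2) := by
      intro z; simp [cx]
    refine le_of_eq_of_le ?_ (W.trans (le_of_eq ?_))
    · refine Finset.sum_congr rfl fun j _ => integral_congr_ae (Eventually.of_forall fun z => ?_)
      simp only [hh]
      congr 2
      rw [show (η z : ℂ) = cx η z from rfl]
      linear_combination - (cx η z * G j z) * ee1 z
    · congr 1
      · refine integral_congr_ae (Eventually.of_forall fun z => ?_)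
        simp only [hd, hh]
        congr 2
        rw [← ee2 z, ← ee3 z, Finset.sum_add_distrib]
        have : ∑ j, dz j (cx q) z * (cx η z * e z * G j z) = ∑ j, cx η z * (e z * dz j (cx q) z) * G j z :=
          Finset.sum_congr rfl fun j _ => by ring
        rw [this]
        have : ∑ j, dz j (cx η) z * e z * G j z = e z * ∑ j, dz j (cx η) z * G j z := by
          rw [Finset.mul_sum]; exact Finset.sum_congr rfl fun j _ => by ring
        rw [this, show (η z : ℂ) = cx η z from rfl]
        ring
      · congr 1
        refine Finset.sum_congr rfl fun j _ => Finset.sum_congr rfl fun k _ =>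
          integral_congr_ae (Eventually.of_forall fun z => ?_)
        simp only [hs]
        congr 2
        rw [← ee2 z]; ring
  · intro b hb hbc
    have ha : ContDiff ℝ 2 (fun z => cx η z * (Complex.exp (cx q z) * b z)) := by
      have := contDiff_smul_of_tsupport_subset hU hη (hqU.cexp.mul hb.contDiffOn) hηU
      simpa [cx] using this
    have hts : tsupport (fun z => cx η z * (Complex.exp (cx q z) * b z)) ⊆ tsupport (cx η) :=
      tsupport_mul_subset_left
    have P := hGP _ ha (hcηc.of_isClosed_subset (isClosed_tsupport _) hts) (hts.trans hcηU)
    have p1 : ∀ j z, Complex.exp (-cx q z / 2) * G j z * dz j (fun z => cx η z * (Complex.exp (cx q z) * b z)) z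
        = h j z * dz j b z + (dz j (cx η) z * e z * G j z + cx η z * (e z * dz j (cx q) z) * G j z) * b z := by
      intro j z
      by_cases hz : z ∈ U
      · have hbd : DifferentiableAt ℝ b z := (hb.differentiable (by norm_num)) z
        have hexd : DifferentiableAt ℝ (fun z => Complex.exp (cx q z)) z := (hqd z hz).cexp
        rw [dz_mul ((hcη.differentiable (by norm_num)) z) (hexd.fun_mul hbd), dz_mul hexd hbd, dz_cexp (hqd z hz)]
        simp only [hh, he]
        have e1 : Complex.exp (cx q z) = Complex.exp (cx q z / 2) * Complex.exp (cx q z / 2) := by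
          rw [← Complex.exp_add]; congr 1; ring
        have e2 : Complex.exp (-cx q z / 2) * Complex.exp (cx q z / 2) = 1 := by
          rw [← Complex.exp_add, ← Complex.exp_zero]; congr 1; ring
        rw [e1]
        linear_combination (G j z * Complex.exp (cx q z/2) * (dz j (cx η) z * b z + cx η z * (dz j (cx q) z * b z + dz j b z))) * e2
      · simp [hh, hG0 j z hz]
    have p2 : ∀ z, Complex.exp (-cx q z) * m z * (cx η z * (Complex.exp (cx q z) * b z)) = cx η z * m z * b z := by
      intro z
      have e2 : Complex.exp (-cx q z) * Complex.exp (cx q z) = 1 := by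
        rw [← Complex.exp_add, ← Complex.exp_zero]; congr 1; ring
      linear_combination (m z * cx η z * b z) * e2
    simp_rw [p1, p2] at P
    have hb1 : ContDiff ℝ 1 b := hb.of_le (by norm_num)
    have i1 : ∀ j, Integrable (fun z => h j z * dz j b z) μ := fun j =>
      hI _ (mem_h j) _ (continuous_dz hb1) (hcs_dz hbc)
    have i2 : ∀ j, Integrable (fun z => (dz j (cx η) z * e z * G j z + cx η z * (e z * dz j (cx q) z) * G j z) * b z) μ :=
      fun j => hI _ ((mem_d j).add (mem_q j)) _ hb.continuous hbc
    have i3 : Integrable (fun z => cx η z * m z * b z) μ := hI _ mem_m _ hb.continuous hbc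
    simp_rw [integral_add (i1 _) (i2 _), Finset.sum_add_distrib] at P
    have : ∫ z, d z * b z ∂μ = ∫ z, cx η z * m z * b z ∂μ + ∑ j, ∫ z, (dz j (cx η) z * e z * G j z + cx η z * (e z * dz j (cx q) z) * G j z) * b z ∂μ := by
      rw [← integral_finsetSum _ (fun j _ => i2 j), ← integral_add i3 (integrable_finsetSum _ fun j _ => i2 j)]
      refine integral_congr_ae (Eventually.of_forall fun z => ?_)
      simp only [hd, add_mul, Finset.sum_mul]
    rw [this]
    linear_combination P
  · intro b hb hbc j k
    have ha : ContDiff ℝ 2 (fun z => cx η z * b z) := hcη.mul hb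
    have hts : tsupport (fun z => cx η z * b z) ⊆ tsupport (cx η) := tsupport_mul_subset_left
    have P := hGK _ ha (hcηc.of_isClosed_subset (isClosed_tsupport _) hts) (hts.trans hcηU) j k
    have p1 : ∀ j k z, Complex.exp (cx q z / 2) * G j z * db k (fun z => cx η z * b z) z =
        h j z * db k b z + db k (cx η) z * e z * G j z * b z := by
      intro j k z
      rw [db_mul ((hcη.differentiable (by norm_num)) z) ((hb.differentiable (by norm_num)) z)]
      simp only [hh, he]; ring
    simp_rw [p1] at P
    have hb1 : ContDiff ℝ 1 b := hb.of_le (by norm_num)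
    have i1 : ∀ j k, Integrable (fun z => h j z * db k b z) μ := fun j k =>
      hI _ (mem_h j) _ (continuous_db hb1) (hcs_db hbc)
    have i2 : ∀ j k, Integrable (fun z => db k (cx η) z * e z * G j z * b z) μ := fun j k =>
      hI _ (mem_b k j) _ hb.continuous hbc
    rw [integral_add (i1 j k) (i2 j k), integral_add (i1 k j) (i2 k j)] at P
    have : ∫ z, s j k z * b z ∂μ = ∫ z, db k (cx η) z * e z * G j z * b z ∂μ - ∫ z, db j (cx η) z * e z * G k z * b z ∂μ := by
      rw [← integral_sub (i2 j k) (i2 k j)]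
      refine integral_congr_ae (Eventually.of_forall fun z => ?_)
      simp only [hs, sub_mul]
    rw [this]
    linear_combination P
end DFW
end

open Set Filter Topology Metric MeasureTheory
open scoped ENNReal NNReal InnerProductSpace ComplexConjugate
noncomputable section
namespace DFW
variable {N : ℕ} {μ : Measure (EN N)} [μ.IsAddHaarMeasure]

lemma proj_bound {U : Set (EN N)} (hU : IsOpen U) {φ ψ : EN N → ℝ} (hφ : ContDiffOn ℝ 2 φ U)
    (hψ : ContDiffOn ℝ 2 ψ U) (hL : ∀ z ∈ U, LeviBound φ ψ z) {η : ℕ → EN N → ℝ}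
    (hη : Cutoffs U ψ η)
    {G : Fin N → EN N → ℂ} (hG : ∀ j, MemLp (G j) 2 μ) (hG0 : ∀ j, ∀ z ∉ U, G j z = 0)
    {m : EN N → ℂ} (hm : Continuous m) (hmU : tsupport m ⊆ U) (hmc : HasCompactSupport m)
    (hGK : ∀ b : EN N → ℂ, ContDiff ℝ 2 b → HasCompactSupport b → tsupport b ⊆ U → ∀ j k,
      ∫ z, Complex.exp (cx (φ - ψ) z / 2) * G j z * db k b z ∂μ -
        ∫ z, Complex.exp (cx (φ - ψ) z / 2) * G k z * db j b z ∂μ = 0)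
    (hGP : ∀ b : EN N → ℂ, ContDiff ℝ 2 b → HasCompactSupport b → tsupport b ⊆ U →
      ∑ j, ∫ z, Complex.exp (-cx (φ - ψ) z / 2) * G j z * dz j b z ∂μ =
        - ∫ z, Complex.exp (-cx (φ - ψ) z) * m z * b z ∂μ) :
    ∑ j, ∫ z, ‖G j z‖^2 ∂μ ≤ ∫ z, ‖Complex.exp (-cx φ z / 2) * m z‖^2 ∂μ := by
  have hcxU : ∀ {f : EN N → ℝ}, ContDiffOn ℝ 2 f U → ContinuousOn (cx f) U := fun hf =>
    (Complex.ofRealCLM.contDiff.comp_contDiffOn hf).continuousOn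
  have ha : Continuous (fun z => m z * Complex.exp (-cx φ z / 2)) :=
    cont_mul_of_tsupport hU hm ((hcxU hφ).neg.div_const 2).cexp hmU
  have haL : MemLp (fun z => Complex.exp (-cx φ z / 2) * m z) 2 μ := by
    have := ha.memLp_of_hasCompactSupport (μ := μ) (p := 2) hmc.mul_right
    simpa [mul_comm] using this
  have hm0 : ∀ z ∉ U, m z = 0 := fun z hz => image_eq_zero_of_notMem_tsupport fun h => hz (hmU h)
  have hcη : ∀ n, ContDiff ℝ 1 (cx (η n)) := fun n => contDiff_cx ((hη.smooth n).of_le (by norm_num))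
  have hEm : AEStronglyMeasurable (U.indicator fun z => Complex.exp (-cx ψ z / 2)) μ :=
    (aestronglyMeasurable_indicator_iff hU.measurableSet).mpr
      (((hcxU hψ).neg.div_const 2).cexp.aestronglyMeasurable hU.measurableSet)
  have hE : ∀ z, ‖Complex.exp (-cx ψ z / 2)‖^2 = Real.exp (-ψ z) := by
    intro z
    rw [Complex.norm_exp, ← Real.exp_nat_mul]; congr 1; simp [cx]; ring
  have hηn : ∀ n z, ‖(η n z : ℂ)‖ ≤ 1 := by
    intro n z
    rw [Complex.norm_real, Real.norm_eq_abs, abs_of_nonneg (hη.mem n z).1]; exact (hη.mem n z).2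
  have hdb : ∀ n z j, ‖db j (cx (η n)) z‖ = ‖dz j (cx (η n)) z‖ := by
    intro n z j
    rw [← conj_dz_cx ((hcη n).differentiable (by norm_num) z), RCLike.norm_conj]
  have hlim1 : ∀ z ∈ U, ∀ᶠ n in atTop, η n z = 1 ∧ (∀ j, dz j (cx (η n)) z = 0) ∧ ∀ j, db j (cx (η n)) z = 0 := by
    intro z hz
    filter_upwards [hη.lim z hz] with n hn
    have h1 : cx (η n) =ᶠ[𝓝 z] fun _ => 1 := by
      filter_upwards [hn] with w hw; simp [cx, hw]
    refine ⟨hn.eq_of_nhds, fun j => ?_, fun j => ?_⟩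
    · rw [dz_congr h1]; simp [dz]
    · rw [db_congr h1]; simp [db]
  have hGm : ∀ j, AEStronglyMeasurable (G j) μ := fun j => (hG j).1
  have hGi : Integrable (fun z => ∑ j, ‖G j z‖^2) μ :=
    integrable_finsetSum _ fun j _ => integrable_normsq (hG j)
  -- the three limits
  have L1 : ∀ j, Tendsto (fun n => ∫ z, ‖(η n z : ℂ) * G j z‖^2 ∂μ) atTop (𝓝 (∫ z, ‖G j z‖^2 ∂μ)) := by
    intro j
    refine tendsto_integral_of_dominated_convergence (fun z => ‖G j z‖^2) (fun n => ?_)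
      (integrable_normsq (hG j)) (fun n => Eventually.of_forall fun z => ?_)
      (Eventually.of_forall fun z => ?_)
    · exact (((hcη n).continuous.aestronglyMeasurable.mul (hGm j)).norm.pow 2)
    · rw [Real.norm_eq_abs, abs_of_nonneg (by positivity), norm_mul, mul_pow]
      have := hηn n z
      have h2 : ‖(η n z : ℂ)‖^2 ≤ 1 := pow_le_one₀ (norm_nonneg _) this
      nlinarith [sq_nonneg ‖G j z‖]
    · by_cases hz : z ∈ U
      · refine tendsto_const_nhds.congr' ?_
        filter_upwards [hlim1 z hz] with n hn
        simp [hn.1]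
      · simp [hG0 j z hz]
  have hgrad : ∀ n z, z ∈ U → Real.exp (-ψ z) * ∑ j, ‖dz j (cx (η n)) z‖^2 ≤ 1 := by
    intro n z hz
    calc _ ≤ Real.exp (-ψ z) * Real.exp (ψ z) := by gcongr; exact hη.grad n z hz
      _ = 1 := by rw [← Real.exp_add]; simp
  have L2 : Tendsto (fun n => ∫ z, ‖(η n z : ℂ) * (Complex.exp (-cx φ z / 2) * m z) +
        Complex.exp (-cx ψ z / 2) * ∑ j, dz j (cx (η n)) z * G j z‖^2 ∂μ) atTop
        (𝓝 (∫ z, ‖Complex.exp (-cx φ z / 2) * m z‖^2 ∂μ)) := by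
    refine tendsto_integral_of_dominated_convergence
      (fun z => 2 * ‖Complex.exp (-cx φ z / 2) * m z‖^2 + 2 * ∑ j, ‖G j z‖^2) (fun n => ?_)
      (((integrable_normsq haL).const_mul 2).add (hGi.const_mul 2))
      (fun n => Eventually.of_forall fun z => ?_)
      (Eventually.of_forall fun z => ?_)
    · have : (fun z => (η n z : ℂ) * (Complex.exp (-cx φ z / 2) * m z) +
        Complex.exp (-cx ψ z / 2) * ∑ j, dz j (cx (η n)) z * G j z) =
        fun z => cx (η n) z * (Complex.exp (-cx φ z / 2) * m z) +
        (U.indicator fun z => Complex.exp (-cx ψ z / 2)) z * ∑ j, dz j (cx (η n)) z * G j z := by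
        ext z
        by_cases hz : z ∈ U
        · simp [hz, cx]
        · simp [hz, hm0 z hz, hG0 _ z hz]
      refine AEStronglyMeasurable.pow (AEStronglyMeasurable.norm ?_) 2
      rw [this]
      refine (((hcη n).continuous.aestronglyMeasurable.mul haL.1).add (hEm.mul ?_))
      exact Finset.aestronglyMeasurable_fun_sum _ fun j _ =>
        (continuous_dz (hcη n)).aestronglyMeasurable.mul (hGm j)
    · rw [Real.norm_eq_abs, abs_of_nonneg (by positivity)]
      by_cases hz : z ∈ U
      · have t1 : ‖(η n z : ℂ) * (Complex.exp (-cx φ z / 2) * m z)‖ ≤ ‖Complex.exp (-cx φ z / 2) * m z‖ := by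
          rw [norm_mul]
          exact mul_le_of_le_one_left (norm_nonneg _) (hηn n z)
        have t2 : ‖Complex.exp (-cx ψ z / 2) * ∑ j, dz j (cx (η n)) z * G j z‖^2 ≤ ∑ j, ‖G j z‖^2 := by
          rw [norm_mul, mul_pow, hE]
          calc _ ≤ Real.exp (-ψ z) * ((∑ j, ‖dz j (cx (η n)) z‖^2) * ∑ j, ‖G j z‖^2) := by
                gcongr; exact norm_sum_mul_sq_le _ _ _
            _ = (Real.exp (-ψ z) * (∑ j, ‖dz j (cx (η n)) z‖^2)) * ∑ j, ‖G j z‖^2 := by ring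
            _ ≤ 1 * ∑ j, ‖G j z‖^2 := by
                gcongr; exact hgrad n z hz
            _ = _ := one_mul _
        have t3 := norm_add_le ((η n z : ℂ) * (Complex.exp (-cx φ z / 2) * m z)) (Complex.exp (-cx ψ z / 2) * ∑ j, dz j (cx (η n)) z * G j z)
        have t4 : ‖(η n z : ℂ) * (Complex.exp (-cx φ z / 2) * m z)‖^2 ≤ ‖Complex.exp (-cx φ z / 2) * m z‖^2 := by gcongr
        have t5 := pow_le_pow_left₀ (norm_nonneg _) t3 2
        refine t5.trans ?_
        refine (add_sq_le).trans ?_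
        linarith
      · simp [hm0 z hz, hG0 _ z hz]
    · by_cases hz : z ∈ U
      · refine tendsto_const_nhds.congr' ?_
        filter_upwards [hlim1 z hz] with n hn
        simp [hn.1, hn.2.1]
      · simp [hG0 _ z hz, hm0 z hz]
  have L3 : ∀ j k, Tendsto (fun n => ∫ z, ‖Complex.exp (-cx ψ z / 2) *
        (db k (cx (η n)) z * G j z - db j (cx (η n)) z * G k z)‖^2 ∂μ) atTop (𝓝 (∫ z, (0:ℝ) ∂μ)) := by
    intro j k
    refine tendsto_integral_of_dominated_convergence
      (fun z => 2 * (‖G j z‖^2 + ‖G k z‖^2)) (fun n => ?_)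
      (((integrable_normsq (hG j)).add (integrable_normsq (hG k))).const_mul 2)
      (fun n => Eventually.of_forall fun z => ?_)
      (Eventually.of_forall fun z => ?_)
    · have : (fun z => Complex.exp (-cx ψ z / 2) *
        (db k (cx (η n)) z * G j z - db j (cx (η n)) z * G k z)) =
        fun z => (U.indicator fun z => Complex.exp (-cx ψ z / 2)) z * (db k (cx (η n)) z * G j z - db j (cx (η n)) z * G k z) := by
        ext z
        by_cases hz : z ∈ U
        · simp [hz]
        · simp [hz, hG0 _ z hz]
      refine AEStronglyMeasurable.pow (AEStronglyMeasurable.norm ?_) 2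
      rw [this]
      exact (hEm.mul (((continuous_db (hcη n)).aestronglyMeasurable.mul (hGm j)).sub
        ((continuous_db (hcη n)).aestronglyMeasurable.mul (hGm k))))
    · rw [Real.norm_eq_abs, abs_of_nonneg (by positivity)]
      by_cases hz : z ∈ U
      · have hone : ∀ i, Real.exp (-ψ z) * ‖dz i (cx (η n)) z‖^2 ≤ 1 := fun i => by
          refine le_trans ?_ (hgrad n z hz)
          gcongr
          exact Finset.single_le_sum (f := fun j => ‖dz j (cx (η n)) z‖^2) (fun _ _ => by positivity) (Finset.mem_univ i)
        rw [norm_mul, mul_pow, hE]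
        have t3 := norm_sub_le (db k (cx (η n)) z * G j z) (db j (cx (η n)) z * G k z)
        have t5 := (pow_le_pow_left₀ (norm_nonneg _) t3 2).trans add_sq_le
        rw [norm_mul, norm_mul, hdb, hdb, mul_pow, mul_pow] at t5
        calc _ ≤ Real.exp (-ψ z) * (2 * (‖dz k (cx (η n)) z‖^2 * ‖G j z‖^2 + ‖dz j (cx (η n)) z‖^2 * ‖G k z‖^2)) := by gcongr
          _ = 2 * ((Real.exp (-ψ z) * ‖dz k (cx (η n)) z‖^2) * ‖G j z‖^2 + (Real.exp (-ψ z) * ‖dz j (cx (η n)) z‖^2) * ‖G k z‖^2) := by ring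
          _ ≤ 2 * (1 * ‖G j z‖^2 + 1 * ‖G k z‖^2) := by
            gcongr
            · exact hone k
            · exact hone j
          _ = _ := by ring
      · simp [hG0 _ z hz]
    · by_cases hz : z ∈ U
      · refine tendsto_const_nhds.congr' ?_
        filter_upwards [hlim1 z hz] with n hn
        simp [hn.2.2]
      · simp [hG0 _ z hz]
  have R := L2.add ((tendsto_finsetSum Finset.univ fun j _ =>
    tendsto_finsetSum Finset.univ fun k _ => L3 j k).const_mul (1/4))
  have L := tendsto_finsetSum Finset.univ fun j _ => L1 j
  have := le_of_tendsto_of_tendsto' L R fun n =>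
    proj_bound_cutoff hU hφ hψ hL (hη.smooth n) (hη.cpt n) (hη.supp n) hG hG0 hm hmU hmc hGK hGP
  simpa using this
end DFW
end

open Set Filter Topology Metric MeasureTheory
open scoped ENNReal NNReal InnerProductSpace ComplexConjugate
noncomputable section
namespace DFW

lemma hilbert_solve {X H1 H2 : Type*} [AddCommGroup X] [Module ℂ X] [NormedAddCommGroup H1]
    [InnerProductSpace ℂ H1] [CompleteSpace H1] [NormedAddCommGroup H2] [InnerProductSpace ℂ H2]
    (K : Submodule ℂ H2) [K.HasOrthogonalProjection] (ι : X →ₗ[ℂ] H2) (τ : X →ₗ[ℂ] H1)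
    (h : ∀ f, ‖K.starProjection (ι f)‖ ≤ ‖τ f‖) {w : H2} (hw : w ∈ K) :
    ∃ u : H1, ∀ f, ⟪u, τ f⟫_ℂ = ⟪w, ι f⟫_ℂ := by
  have hb : ∀ f, ‖⟪w, ι f⟫_ℂ‖ ≤ ‖w‖ * ‖τ f‖ := by
    intro f
    have : ⟪w, ι f⟫_ℂ = ⟪w, K.starProjection (ι f)⟫_ℂ := by
      rw [← Submodule.inner_starProjection_left_eq_right, Submodule.starProjection_eq_self_iff.mpr hw]
    rw [this]
    exact (norm_inner_le_norm _ _).trans (by gcongr; exact h f)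
  let L : X →ₗ[ℂ] ℂ := (innerSL ℂ w).toLinearMap ∘ₗ ι
  have hker : LinearMap.ker τ ≤ LinearMap.ker L := by
    intro f hf
    rw [LinearMap.mem_ker] at hf ⊢
    have := hb f
    rw [hf, norm_zero, mul_zero] at this
    exact norm_le_zero_iff.mp this
  let M : LinearMap.range τ →ₗ[ℂ] ℂ :=
    ((LinearMap.ker τ).liftQ L hker) ∘ₗ (LinearMap.quotKerEquivRange τ).symm.toLinearMap
  have hM : ∀ f, M ⟨τ f, LinearMap.mem_range_self τ f⟩ = ⟪w, ι f⟫_ℂ := by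
    intro f
    have : (LinearMap.quotKerEquivRange τ).symm ⟨τ f, LinearMap.mem_range_self τ f⟩ =
        (LinearMap.ker τ).mkQ f := by
      rw [LinearEquiv.symm_apply_eq]; rfl
    simp only [M, LinearMap.comp_apply, LinearEquiv.coe_coe]
    rw [this]; rfl
  let Mc : LinearMap.range τ →L[ℂ] ℂ := M.mkContinuous ‖w‖ (by
    rintro ⟨_, f, rfl⟩
    rw [hM]; exact hb f)
  obtain ⟨g, hg, -⟩ := exists_extension_norm_eq (LinearMap.range τ) Mc
  refine ⟨(InnerProductSpace.toDual ℂ H1).symm g, fun f => ?_⟩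
  rw [InnerProductSpace.toDual_symm_apply, ← hM f]
  exact hg ⟨τ f, LinearMap.mem_range_self τ f⟩

variable {N : ℕ} {μ : Measure (EN N)} 

/-- test functions -/
def Tst (U : Set (EN N)) : Submodule ℂ (EN N → ℂ) where
  carrier := {b | ContDiff ℝ 2 b ∧ HasCompactSupport b ∧ tsupport b ⊆ U}
  add_mem' {a b} ha hb := ⟨ha.1.add hb.1, ha.2.1.add hb.2.1,
    (tsupport_add a b).trans (union_subset ha.2.2 hb.2.2)⟩
  zero_mem' := ⟨contDiff_const, HasCompactSupport.zero, by simp [tsupport]⟩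
  smul_mem' c b hb := ⟨hb.1.const_smul c, hb.2.1.smul_left (f := fun _ => c),
    (tsupport_smul_subset_right (fun _ => c) b).trans hb.2.2⟩

/-- linear map into L² from a linear map into functions -/
def mkL {X : Type*} [AddCommGroup X] [Module ℂ X] {ν : Measure (EN N)} (O : X →ₗ[ℂ] (EN N → ℂ))
    (h : ∀ b, MemLp (O b) 2 ν) : X →ₗ[ℂ] Lp ℂ 2 ν where
  toFun b := (h b).toLp (O b)
  map_add' a b := by
    rw [← MemLp.toLp_add]; congr 1; simp
  map_smul' c b := by
    rw [RingHom.id_apply, ← MemLp.toLp_const_smul]; congr 1; simp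

lemma inner_toLp {ν : Measure (EN N)} {c : EN N → ℂ} (hc : MemLp c 2 ν) (G : Lp ℂ 2 ν) :
    ⟪hc.toLp c, G⟫_ℂ = ∫ z, conj (c z) * G z ∂ν := by
  rw [L2.inner_def]
  refine integral_congr_ae ?_
  filter_upwards [hc.coeFn_toLp] with z hz
  rw [hz]; simp [mul_comm]

lemma Lp_norm_sq {ν : Measure (EN N)} (G : Lp ℂ 2 ν) : ‖G‖^2 = ∫ z, ‖G z‖^2 ∂ν := by
  rw [integral_normsq_eq (Lp.memLp G), Lp.norm_def]

lemma dz_smul {f : EN N → ℂ} {z : EN N} {j : Fin N} (c : ℂ) (hf : DifferentiableAt ℝ f z) :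
    dz j (c • f) z = c * dz j f z := by
  simp only [dz, fderiv_const_smul hf c, smul_apply, smul_eq_mul]; ring

lemma db_smul {f : EN N → ℂ} {z : EN N} {j : Fin N} (c : ℂ) (hf : DifferentiableAt ℝ f z) :
    db j (c • f) z = c * db j f z := by
  simp only [db, fderiv_const_smul hf c, smul_apply, smul_eq_mul]; ring

lemma Tst.conj_mem {U : Set (EN N)} {b : EN N → ℂ} (hb : b ∈ Tst U) :
    (fun z => conj (b z)) ∈ Tst U := by
  have hs : Function.support (fun z => conj (b z)) = Function.support b := by
    ext z; simp
  have hts : tsupport (fun z => conj (b z)) = tsupport b := by rw [tsupport, hs]; rfl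
  refine ⟨Complex.conjCLE.contDiff.comp hb.1, ?_, ?_⟩
  · rw [HasCompactSupport, hts]; exact hb.2.1
  · rw [hts]; exact hb.2.2

/-- integration by parts for test functions -/
lemma dbar_closed [μ.IsAddHaarMeasure] {U : Set (EN N)} {a b : EN N → ℂ} (ha : a ∈ Tst U) (hb : b ∈ Tst U) (j k : Fin N) :
    ∫ z, db j a z * db k b z ∂μ = ∫ z, db k a z * db j b z ∂μ := by
  have hd : ∀ z, DifferentiableAt ℝ a z := fun z => ha.1.differentiable (by norm_num) z
  have h1 : ∀ j k : Fin N, ∫ z, db j a z * db k b z ∂μ = - ∫ z, a z * db j (db k b) z ∂μ := by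
    intro j k
    have hkb : ContDiff ℝ 1 (db k b) := contDiff_db2 hb.1
    have h := integral_db_zero (μ := μ) (j := j) ((ha.1.of_le (by norm_num)).mul hkb) ha.2.1.mul_right
    have e : ∀ z, db j (fun z => a z * db k b z) z = db j a z * db k b z + a z * db j (db k b) z :=
      fun z => db_mul (hd z) (hkb.differentiable (by norm_num) z)
    simp_rw [e] at h
    rw [integral_add] at h
    · linear_combination h
    · exact ((continuous_db (ha.1.of_le (by norm_num))).mul hkb.continuous).integrable_of_hasCompactSupport
        (hcs_db ha.2.1).mul_right
    · exact (ha.1.continuous.mul (continuous_db hkb)).integrable_of_hasCompactSupport ha.2.1.mul_right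
  rw [h1, h1]
  congr 2; ext z
  rw [db_db_comm hb.1.contDiffAt]
end DFW
end

open Set Filter Topology Metric MeasureTheory
open scoped ENNReal NNReal InnerProductSpace ComplexConjugate
noncomputable section
namespace DFW
variable {N : ℕ} {μ : Measure (EN N)} [μ.IsAddHaarMeasure]

lemma Tst.mul_mem {U : Set (EN N)} (hU : IsOpen U) {b g : EN N → ℂ} (hb : b ∈ Tst U)
    (hg : ContDiffOn ℝ 2 g U) : (fun z => b z * g z) ∈ Tst U := by
  have hs : tsupport (fun z => b z * g z) ⊆ tsupport b := tsupport_mul_subset_left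
  exact ⟨contDiff_of_tsupport_subset hU (hb.1.contDiffOn.mul hg) (hs.trans hb.2.2),
    hb.2.1.mul_right, hs.trans hb.2.2⟩

lemma Tst.c1 {U : Set (EN N)} {b : EN N → ℂ} (hb : b ∈ Tst U) : ContDiff ℝ 1 b := hb.1.of_le (by norm_num)
lemma Tst.diff {U : Set (EN N)} {b : EN N → ℂ} (hb : b ∈ Tst U) (z : EN N) : DifferentiableAt ℝ b z :=
  hb.1.differentiable (by norm_num) z

lemma memLp_test {U : Set (EN N)} (hU : IsOpen U) {c f : EN N → ℂ} (hc : Continuous c)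
    (hcs : HasCompactSupport c) (hs : tsupport c ⊆ U) (hf : ContinuousOn f U) :
    MemLp (fun z => c z * f z) 2 (μ.restrict U) :=
  ((cont_mul_of_tsupport hU hc hf hs).memLp_of_hasCompactSupport hcs.mul_right).restrict U

lemma continuousOn_dz {U : Set (EN N)} (hU : IsOpen U) {g : EN N → ℂ} (hg : ContDiffOn ℝ 2 g U)
    (j : Fin N) : ContinuousOn (dz j g) U := by
  have h := hg.continuousOn_fderiv_of_isOpen hU (by norm_num)
  unfold dz
  exact ((h.clm_apply continuousOn_const).sub (continuousOn_const.mul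
    (h.clm_apply continuousOn_const))).div_const 2

lemma integral_restrict_of_zero {U : Set (EN N)} {f : EN N → ℂ}
    (h : ∀ z ∉ U, f z = 0) : ∫ z, f z ∂(μ.restrict U) = ∫ z, f z ∂μ :=
  setIntegral_eq_integral_of_forall_compl_eq_zero h

lemma integral_indic {U : Set (EN N)} (hU : IsOpen U) {f g c : EN N → ℂ} :
    ∫ z, f z * U.indicator g z * c z ∂μ = ∫ z, f z * g z * c z ∂(μ.restrict U) := by
  rw [← integral_indicator hU.measurableSet]
  congr 1; ext z
  by_cases hz : z ∈ U <;> simp [hz]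

lemma conj_cx_exp (q : EN N → ℝ) (z : EN N) (s : ℝ) :
    conj (Complex.exp (s * cx q z)) = Complex.exp (s * cx q z) := by
  rw [← Complex.exp_conj]; simp [cx, Complex.conj_ofNat]

/-- **Existence theorem** for the weighted dbar equation (weak form). -/
theorem dbar_exists {U : Set (EN N)} (hU : IsOpen U) {φ ψ : EN N → ℝ} (hφ : ContDiffOn ℝ 2 φ U)
    (hψ : ContDiffOn ℝ 2 ψ U) (hL : ∀ z ∈ U, LeviBound φ ψ z) {η : ℕ → EN N → ℝ}
    (hη : Cutoffs U ψ η) {ω : Fin N → EN N → ℂ}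
    (hω : ∀ j, MemLp (fun z => ω j z * Complex.exp (-cx (φ - ψ) z / 2)) 2 (μ.restrict U))
    (hcl : ∀ b ∈ Tst U, ∀ j k, ∫ z, ω j z * db k b z ∂μ = ∫ z, ω k z * db j b z ∂μ) :
    ∃ u : EN N → ℂ, LocallyIntegrableOn u U μ ∧
      ∀ b ∈ Tst U, ∀ i, ∫ z, u z * db i b z ∂μ = - ∫ z, ω i z * b z ∂μ := by
  set q : EN N → ℝ := φ - ψ with hq
  have hqU : ContDiffOn ℝ 2 (cx q) U := Complex.ofRealCLM.contDiff.comp_contDiffOn (hφ.sub hψ)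
  have hφU : ContDiffOn ℝ 2 (cx φ) U := Complex.ofRealCLM.contDiff.comp_contDiffOn hφ
  have hqd : ∀ z ∈ U, DifferentiableAt ℝ (cx q) z := fun z hz =>
    (hqU.differentiableOn (by norm_num)).differentiableAt (hU.mem_nhds hz)
  have hEp : ContDiffOn ℝ 2 (fun z => Complex.exp (cx q z / 2)) U := (hqU.div_const 2).cexp
  have hEm : ContDiffOn ℝ 2 (fun z => Complex.exp (-cx q z / 2)) U := (hqU.neg.div_const 2).cexp
  have hE2 : ContDiffOn ℝ 2 (fun z => Complex.exp (cx q z)) U := hqU.cexp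
  have hEm2 : ContDiffOn ℝ 2 (fun z => Complex.exp (-cx q z)) U := hqU.neg.cexp
  have hF : ContDiffOn ℝ 2 (fun z => Complex.exp (-cx φ z / 2)) U := (hφU.neg.div_const 2).cexp
  have cEp : ∀ z, conj (Complex.exp (cx q z / 2)) = Complex.exp (cx q z / 2) := fun z => by
    rw [← Complex.exp_conj]; simp [cx, Complex.conj_ofNat]
  have cEm : ∀ z, conj (Complex.exp (-cx q z / 2)) = Complex.exp (-cx q z / 2) := fun z => by
    rw [← Complex.exp_conj]; simp [cx, Complex.conj_ofNat]
  have cF : ∀ z, conj (Complex.exp (-cx φ z / 2)) = Complex.exp (-cx φ z / 2) := fun z => by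
    rw [← Complex.exp_conj]; simp [cx, Complex.conj_ofNat]
  have epm : ∀ z, Complex.exp (cx q z / 2) * Complex.exp (-cx q z / 2) = 1 := fun z => by
    rw [← Complex.exp_add]; simp [neg_div]
  have emm : ∀ z, Complex.exp (-cx q z / 2) * Complex.exp (-cx q z / 2) = Complex.exp (-cx q z) := fun z => by
    rw [← Complex.exp_add]; congr 1; ring
  have e2m : ∀ z, Complex.exp (cx q z) * Complex.exp (-cx q z / 2) = Complex.exp (cx q z / 2) := fun z => by
    rw [← Complex.exp_add]; congr 1; ring
  set ν := μ.restrict U with hν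
  have zU : ∀ {b : EN N → ℂ}, tsupport b ⊆ U → ∀ z ∉ U, b z = 0 := fun hb z hz =>
    image_eq_zero_of_notMem_tsupport fun h => hz (hb h)
  -- the closed subspace
  have hA : ∀ b ∈ Tst U, ∀ k, MemLp (fun z => conj (db k b z) * Complex.exp (cx q z / 2)) 2 ν := by
    intro b hb k
    have e : ∀ z, conj (db k b z) = dz k (fun z => conj (b z)) z := fun z => (dz_conj (Tst.diff hb z)).symm
    simp_rw [e]
    have hb' := Tst.conj_mem hb
    exact memLp_test hU (continuous_dz (Tst.c1 hb')) (hcs_dz hb'.2.1) (tsupport_dz.trans hb'.2.2) hEp.continuousOn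
  have iA : ∀ b (hb : b ∈ Tst U) k (G : Lp ℂ 2 ν), ⟪(hA b hb k).toLp _, G⟫_ℂ =
      ∫ z, Complex.exp (cx q z / 2) * G z * db k b z ∂ν := by
    intro b hb k G
    rw [inner_toLp]
    congr 1; ext z; rw [map_mul, cEp, Complex.conj_conj]; ring
  let K : Submodule ℂ (PiLp 2 (fun _ : Fin N => Lp ℂ 2 ν)) :=
    { carrier := {G | ∀ b (hb : b ∈ Tst U) j k, ⟪(hA b hb k).toLp _, G j⟫_ℂ = ⟪(hA b hb j).toLp _, G k⟫_ℂ}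
      add_mem' := by
        intro G G' h h' b hb j k
        simp only [PiLp.add_apply, inner_add_right, h b hb j k, h' b hb j k]
      zero_mem' := by intro b hb j k; simp
      smul_mem' := by
        intro c G h b hb j k
        simp only [PiLp.smul_apply, inner_smul_right, h b hb j k] }
  have hKc : IsClosed (K : Set (PiLp 2 (fun _ : Fin N => Lp ℂ 2 ν))) := by
    have : (K : Set (PiLp 2 (fun _ : Fin N => Lp ℂ 2 ν))) = ⋂ (b) (hb : b ∈ Tst U) (j) (k),
        {G | ⟪(hA b hb k).toLp _, G j⟫_ℂ = ⟪(hA b hb j).toLp _, G k⟫_ℂ} := by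
      ext G; simp only [mem_iInter]; rfl
    rw [this]
    refine isClosed_iInter fun b => isClosed_iInter fun hb => isClosed_iInter fun j =>
      isClosed_iInter fun k => isClosed_eq ?_ ?_
    · exact (innerSL ℂ ((hA b hb k).toLp _)).continuous.comp (PiLp.continuous_apply 2 _ j)
    · exact (innerSL ℂ ((hA b hb j).toLp _)).continuous.comp (PiLp.continuous_apply 2 _ k)
  have : CompleteSpace K := hKc.completeSpace_coe
  have : K.HasOrthogonalProjection := inferInstance
  -- the operators
  let Oι : Fin N → (Fin N → Tst U) →ₗ[ℂ] (EN N → ℂ) := fun j =>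
    { toFun := fun f z => (f j : EN N → ℂ) z * Complex.exp (-cx q z / 2)
      map_add' := by intro f g; ext z; simp [add_mul]
      map_smul' := by intro c f; ext z; simp [mul_assoc] }
  have hOι : ∀ j f, MemLp (Oι j f) 2 ν := fun j f =>
    memLp_test hU (f j).2.1.continuous (f j).2.2.1 (f j).2.2.2 hEm.continuousOn
  let ι : (Fin N → Tst U) →ₗ[ℂ] PiLp 2 (fun _ : Fin N => Lp ℂ 2 ν) :=
    (WithLp.linearEquiv 2 ℂ (Fin N → Lp ℂ 2 ν)).symm.toLinearMap ∘ₗ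
      LinearMap.pi fun j => mkL (Oι j) (hOι j)
  let m : (Fin N → Tst U) →ₗ[ℂ] (EN N → ℂ) :=
    { toFun := fun f z => ∑ j, (dz j (f j : EN N → ℂ) z - (f j : EN N → ℂ) z * dz j (cx q) z)
      map_add' := by
        intro f g; ext z
        simp only [Pi.add_apply, Submodule.coe_add, ← Finset.sum_add_distrib]
        refine Finset.sum_congr rfl fun j _ => ?_
        have : dz j ((f j : EN N → ℂ) + (g j : EN N → ℂ)) z = dz j (f j : EN N → ℂ) z + dz j (g j : EN N → ℂ) z :=
          dz_add (Tst.diff (f j).2 z) (Tst.diff (g j).2 z)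
        rw [this]; ring
      map_smul' := by
        intro c f; ext z
        simp only [Pi.smul_apply, Submodule.coe_smul, RingHom.id_apply, smul_eq_mul, Finset.mul_sum]
        refine Finset.sum_congr rfl fun j _ => ?_
        rw [dz_smul c (Tst.diff (f j).2 z)]; ring }
  have hmc : ∀ f, Continuous (m f) := fun f => continuous_finsetSum (f := fun j z => dz j (f j : EN N → ℂ) z - (f j : EN N → ℂ) z * dz j (cx q) z) Finset.univ fun j _ =>
    (continuous_dz (Tst.c1 (f j).2)).sub
      (cont_mul_of_tsupport hU (f j).2.1.continuous (continuousOn_dz hU hqU j) (f j).2.2.2)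
  have hms : ∀ f, tsupport (m f) ⊆ ⋃ j, tsupport (f j : EN N → ℂ) := by
    intro f
    refine closure_minimal (fun z hz => ?_) (isClosed_iUnion_of_finite fun j => isClosed_tsupport _)
    by_contra h
    simp only [mem_iUnion, not_exists] at h
    refine hz ?_
    change ∑ j, (dz j (f j : EN N → ℂ) z - (f j : EN N → ℂ) z * dz j (cx q) z) = 0
    refine Finset.sum_eq_zero fun j _ => ?_
    rw [dz_zero_of (h j), image_eq_zero_of_notMem_tsupport (h j)]; simp
  have hmU : ∀ f, tsupport (m f) ⊆ U := fun f => (hms f).trans (iUnion_subset fun j => (f j).2.2.2)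
  have hmcs : ∀ f, HasCompactSupport (m f) := fun f =>
    (isCompact_iUnion fun j => (f j).2.2.1).of_isClosed_subset (isClosed_tsupport _) (hms f)
  let Oτ : (Fin N → Tst U) →ₗ[ℂ] (EN N → ℂ) :=
    { toFun := fun f z => m f z * Complex.exp (-cx φ z / 2)
      map_add' := by intro f g; ext z; simp [add_mul]
      map_smul' := by intro c f; ext z; simp [mul_assoc] }
  have hOτ : ∀ f, MemLp (Oτ f) 2 ν := fun f =>
    memLp_test hU (hmc f) (hmcs f) (hmU f) hF.continuousOn
  let τ : (Fin N → Tst U) →ₗ[ℂ] Lp ℂ 2 ν := mkL Oτ hOτ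
  -- elements of K from exact forms
  have hv : ∀ a ∈ Tst U, ∀ j, MemLp (fun z => db j a z * Complex.exp (-cx q z / 2)) 2 ν := fun a ha j =>
    memLp_test hU (continuous_db (Tst.c1 ha)) (hcs_db ha.2.1) (tsupport_db.trans ha.2.2) hEm.continuousOn
  have hvK : ∀ a (ha : a ∈ Tst U), WithLp.toLp 2 (fun j => (hv a ha j).toLp _) ∈ K := by
    intro a ha b hb j k
    have key : ∀ j k : Fin N, ⟪(hA b hb k).toLp _, (hv a ha j).toLp _⟫_ℂ = ∫ z, db j a z * db k b z ∂μ := by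
      intro j k
      rw [iA b hb, ← integral_restrict_of_zero (μ := μ) (U := U)]
      · refine integral_congr_ae ?_
        filter_upwards [(hv a ha j).coeFn_toLp] with z hz
        rw [hz]; linear_combination (db j a z * db k b z) * epm z
      · intro z hz
        rw [db_zero_of (fun h => hz (hb.2.2 h)), mul_zero]
    change ⟪(hA b hb k).toLp _, (hv a ha j).toLp _⟫_ℂ = ⟪(hA b hb j).toLp _, (hv a ha k).toLp _⟫_ℂ
    rw [key, key, dbar_closed ha hb]
  have hbound : ∀ f, ‖K.starProjection (ι f)‖ ≤ ‖τ f‖ := by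
    intro f
    set G := K.starProjection (ι f) with hG
    have hGK : G ∈ K := Submodule.starProjection_apply_mem K (ι f)
    have h := proj_bound (μ := μ) hU hφ hψ hL hη (G := fun j => U.indicator (G j)) (m := m f)
      (fun j => (memLp_indicator_iff_restrict hU.measurableSet).mpr (Lp.memLp (G j)))
      (fun j z hz => indicator_of_notMem hz _) (hmc f) (hmU f) (hmcs f)
      (by
        intro b h1 h2 h3 j k
        have hb : b ∈ Tst U := ⟨h1, h2, h3⟩
        rw [integral_indic hU, integral_indic hU, sub_eq_zero]
        have := hGK b hb j k
        rwa [iA b hb, iA b hb] at this)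
      (by
        intro b h1 h2 h3
        have hb : b ∈ Tst U := ⟨h1, h2, h3⟩
        have hb' := Tst.conj_mem hb
        have e1 := (Submodule.inner_starProjection_left_eq_right K (WithLp.toLp 2 (fun j => (hv _ hb' j).toLp _)) (ι f)).symm
        rw [Submodule.starProjection_eq_self_iff.mpr (hvK _ hb'), ← hG, PiLp.inner_apply, PiLp.inner_apply] at e1
        have ec : ∀ j z, conj (db j (fun z => conj (b z)) z) = dz j b z := fun j z => by
          rw [db_conj (Tst.diff hb z), Complex.conj_conj]
        have e2 : ∀ (j : Fin N) (g : Lp ℂ 2 ν), ⟪(hv _ hb' j).toLp _, g⟫_ℂ =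
            ∫ z, Complex.exp (-cx q z / 2) * g z * dz j b z ∂ν := by
          intro j g
          rw [inner_toLp]
          congr 1; ext z; rw [map_mul, cEm, ec]; ring
        have e3 : ∀ j, ∫ z, Complex.exp (-cx q z / 2) * (hOι j f).toLp _ z * dz j b z ∂ν =
            - ∫ z, Complex.exp (-cx q z) * (dz j (f j : EN N → ℂ) z - (f j : EN N → ℂ) z * dz j (cx q) z) * b z ∂μ := by
          intro j
          have hfj := (f j).2
          have hg := Tst.mul_mem hU hfj hEm2
          have h0 := integral_dz_zero (μ := μ) (j := j) ((Tst.c1 hb).mul (Tst.c1 hg)) hb.2.1.mul_right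
          have e4 : ∀ z, dz j (fun z => b z * ((f j : EN N → ℂ) z * Complex.exp (-cx q z))) z =
              dz j b z * ((f j : EN N → ℂ) z * Complex.exp (-cx q z)) +
              Complex.exp (-cx q z) * (dz j (f j : EN N → ℂ) z - (f j : EN N → ℂ) z * dz j (cx q) z) * b z := by
            intro z
            rw [dz_mul (Tst.diff hb z) (Tst.diff hg z)]
            by_cases hz : z ∈ U
            · rw [dz_mul (Tst.diff hfj z) ((hqd z hz).fun_neg.cexp), dz_cexp (hqd z hz).fun_neg, dz_neg]
              ring
            · rw [zU hb.2.2 z hz]; simp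
          simp_rw [e4] at h0
          rw [integral_add] at h0
          · rw [← eq_neg_iff_add_eq_zero] at h0
            rw [← h0, ← integral_restrict_of_zero (μ := μ) (U := U)]
            · refine integral_congr_ae ?_
              filter_upwards [(hOι j f).coeFn_toLp] with z hz
              rw [hz]
              change Complex.exp (-cx q z / 2) * ((f j : EN N → ℂ) z * Complex.exp (-cx q z / 2)) * dz j b z = _
              linear_combination ((f j : EN N → ℂ) z * dz j b z) * emm z
            · intro z hz; rw [zU hfj.2.2 z hz]; simp
          · exact ((continuous_dz (Tst.c1 hb)).mul hg.1.continuous).integrable_of_hasCompactSupport (hcs_dz hb.2.1).mul_right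
          · have hc1 : Continuous (fun z => (dz j (f j : EN N → ℂ) z - (f j : EN N → ℂ) z * dz j (cx q) z)) :=
              (continuous_dz (Tst.c1 hfj)).sub
                (cont_mul_of_tsupport hU hfj.1.continuous (continuousOn_dz hU hqU j) hfj.2.2)
            have hc2 := hc1.mul (Tst.mul_mem hU hb hEm2).1.continuous
            refine (hc2.integrable_of_hasCompactSupport (Tst.mul_mem hU hb hEm2).2.1.mul_left).congr
              (Eventually.of_forall fun z => ?_)
            simp only [Pi.mul_apply]; ring
        simp_rw [integral_indic hU]
        refine (Finset.sum_congr rfl (fun j _ => (e2 j (G j)).symm)).trans (e1.trans ?_)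
        rw [Finset.sum_congr rfl (fun j _ => (e2 j (ι f j)).trans (e3 j)), Finset.sum_neg_distrib,
          ← integral_finsetSum]
        · congr 2; ext z
          change _ = Complex.exp (-cx q z) * (∑ j, (dz j (f j : EN N → ℂ) z - (f j : EN N → ℂ) z * dz j (cx q) z)) * b z
          rw [Finset.mul_sum, Finset.sum_mul]
        · intro j _
          have hfj := (f j).2
          have hc1 : Continuous (fun z => (dz j (f j : EN N → ℂ) z - (f j : EN N → ℂ) z * dz j (cx q) z)) :=
              (continuous_dz (Tst.c1 hfj)).sub
                (cont_mul_of_tsupport hU hfj.1.continuous (continuousOn_dz hU hqU j) hfj.2.2)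
          have hc2 := hc1.mul (Tst.mul_mem hU hb hEm2).1.continuous
          refine (hc2.integrable_of_hasCompactSupport (Tst.mul_mem hU hb hEm2).2.1.mul_left).congr
            (Eventually.of_forall fun z => ?_)
          simp only [Pi.mul_apply]; ring)
    have hn1 : ‖G‖^2 = ∑ j, ∫ z, ‖U.indicator (G j) z‖^2 ∂μ := by
      rw [PiLp.norm_sq_eq_of_L2]
      refine Finset.sum_congr rfl fun j _ => ?_
      rw [Lp_norm_sq, ← integral_indicator hU.measurableSet]
      congr 1; ext z; by_cases hz : z ∈ U <;> simp [hz]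
    have hn2 : ‖τ f‖^2 = ∫ z, ‖Complex.exp (-cx φ z / 2) * m f z‖^2 ∂μ := by
      rw [Lp_norm_sq, ← setIntegral_eq_integral_of_forall_compl_eq_zero (μ := μ) (s := U)]
      · refine integral_congr_ae ?_
        filter_upwards [(hOτ f).coeFn_toLp] with z hz
        change ‖(hOτ f).toLp _ z‖^2 = _
        rw [hz, mul_comm (Complex.exp _)]; rfl
      · intro z hz
        rw [zU (hmU f) z hz]; simp
    rw [← hn1, ← hn2] at h
    exact le_of_sq_le_sq h (norm_nonneg _)
  have hωK : WithLp.toLp 2 (fun j => (hω j).toLp _) ∈ K := by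
    intro b hb j k
    have key : ∀ j k : Fin N, ⟪(hA b hb k).toLp _, (hω j).toLp _⟫_ℂ = ∫ z, ω j z * db k b z ∂μ := by
      intro j k
      rw [iA b hb, ← integral_restrict_of_zero (μ := μ) (U := U)]
      · refine integral_congr_ae ?_
        filter_upwards [(hω j).coeFn_toLp] with z hz
        rw [hz]; linear_combination (ω j z * db k b z) * epm z
      · intro z hz
        rw [db_zero_of (fun h => hz (hb.2.2 h)), mul_zero]
    change ⟪(hA b hb k).toLp _, (hω j).toLp _⟫_ℂ = ⟪(hA b hb j).toLp _, (hω k).toLp _⟫_ℂ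
    rw [key, key, hcl b hb]
  obtain ⟨u, hu⟩ := hilbert_solve K ι τ hbound hωK
  refine ⟨fun z => -(Complex.exp (cx q z) * Complex.exp (-cx φ z / 2)) * u z, ?_, ?_⟩
  · have h1 : LocallyIntegrableOn (u : EN N → ℂ) U μ := by
      intro z hz
      obtain ⟨K', hK', hzK, hKU⟩ := exists_compact_subset hU hz
      refine ⟨K', mem_nhdsWithin_of_mem_nhds (mem_interior_iff_mem_nhds.mp hzK), ?_⟩
      have h2 : MemLp (u : EN N → ℂ) 2 (μ.restrict K') :=
        (Lp.memLp u).mono_measure (Measure.restrict_mono hKU le_rfl)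
      have : IsFiniteMeasure (μ.restrict K') := ⟨by simpa using hK'.measure_lt_top⟩
      exact h2.integrable (by norm_num)
    exact h1.continuousOn_mul (hE2.continuousOn.mul hF.continuousOn).neg hU.isLocallyClosed
  · intro b hb i
    have hb' := Tst.conj_mem hb
    let f : Fin N → Tst U := Pi.single i ⟨_, Tst.mul_mem hU hb' hE2⟩
    have hfi : (f i : EN N → ℂ) = fun z => conj (b z) * Complex.exp (cx q z) := by simp [f]
    have hfj : ∀ j ≠ i, f j = 0 := fun j hj => by simp [f, hj]
    have h := congrArg conj (hu f)
    rw [inner_conj_symm, inner_conj_symm] at h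
    have hm1 : ∀ z ∈ U, m f z = Complex.exp (cx q z) * conj (db i b z) := by
      intro z hz
      change ∑ j, (dz j (f j : EN N → ℂ) z - (f j : EN N → ℂ) z * dz j (cx q) z) = _
      rw [Finset.sum_eq_single i]
      · rw [hfi, dz_mul (Tst.diff hb' z) (hqd z hz).cexp, dz_cexp (hqd z hz), dz_conj (Tst.diff hb z)]
        ring
      · intro j _ hj
        rw [hfj j hj]; simp [dz]
      · simp
    have hl : ⟪τ f, u⟫_ℂ = ∫ z, Complex.exp (cx q z) * Complex.exp (-cx φ z / 2) * u z * db i b z ∂μ := by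
      change ⟪(hOτ f).toLp _, u⟫_ℂ = _
      rw [inner_toLp, ← integral_restrict_of_zero (μ := μ) (U := U)]
      · refine setIntegral_congr_fun hU.measurableSet fun z hz => ?_
        change conj (m f z * Complex.exp (-cx φ z / 2)) * u z = _
        rw [hm1 z hz, map_mul, map_mul, cF, Complex.conj_conj, ← Complex.exp_conj]
        simp only [cx, Complex.conj_ofReal]; ring
      · intro z hz
        rw [db_zero_of (fun h => hz (hb.2.2 h)), mul_zero]
    have hr : ⟪ι f, WithLp.toLp 2 (fun j => (hω j).toLp _)⟫_ℂ = ∫ z, ω i z * b z ∂μ := by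
      rw [PiLp.inner_apply, Finset.sum_eq_single i]
      · change ⟪(hOι i f).toLp _, (hω i).toLp _⟫_ℂ = _
        rw [inner_toLp, ← integral_restrict_of_zero (μ := μ) (U := U)]
        · refine integral_congr_ae ?_
          filter_upwards [(hω i).coeFn_toLp] with z hz
          rw [hz]
          change conj ((f i : EN N → ℂ) z * Complex.exp (-cx q z / 2)) * _ = _
          rw [hfi, mul_assoc, e2m, map_mul, cEp, Complex.conj_conj]
          linear_combination (ω i z * b z) * epm z
        · intro z hz; rw [zU hb.2.2 z hz, mul_zero]
      · intro j _ hj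
        have : ι f j = 0 := by
          change (hOι j f).toLp _ = 0
          have : Oι j f = 0 := by
            ext z
            change (f j : EN N → ℂ) z * _ = 0
            rw [hfj j hj]; simp
          simp only [this]
          exact MemLp.toLp_zero _
        rw [this, inner_zero_left]
      · simp
    rw [hl, hr] at h
    rw [← h, ← integral_neg]
    congr 1; ext z; ring
end DFW
end

open Set Filter Topology Metric MeasureTheory
open scoped ENNReal NNReal InnerProductSpace ComplexConjugate
noncomputable section
namespace DFW
variable {N : ℕ}

lemma sum_bv (w : EN N) : w = ∑ j, w j • bv j := by
  ext k
  simp [bv, Finset.sum_apply, Pi.single_apply]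

lemma real_smul_eq (a : ℝ) (w : EN N) : a • w = (a : ℂ) • w := by
  ext k; simp

/-- a real-linear map commuting with `I` is complex linear -/
def toCLin {F : Type*} [NormedAddCommGroup F] [NormedSpace ℂ F] (L : EN N →L[ℝ] F)
    (h : ∀ w, L (Complex.I • w) = Complex.I • L w) : EN N →L[ℂ] F :=
  { toFun := L
    map_add' := L.map_add
    map_smul' := by
      intro c w
      have : c • w = c.re • w + c.im • (Complex.I • w) := by
        rw [real_smul_eq, real_smul_eq, smul_smul, ← add_smul, Complex.re_add_im]
      rw [this, map_add, map_smul, map_smul, h]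
      rw [RingHom.id_apply]
      have e : ∀ (a : ℝ) (v : F), a • v = (a : ℂ) • v := fun a v => by
        simpa using RCLike.real_smul_eq_coe_smul (K := ℂ) a v
      rw [e, e, smul_smul, ← add_smul, Complex.re_add_im]
    cont := L.cont }

lemma commutes_of_basis {F : Type*} [NormedAddCommGroup F] [NormedSpace ℂ F] (L : EN N →L[ℝ] F)
    (h : ∀ j, L (Complex.I • bv j) = Complex.I • L (bv j)) (w : EN N) :
    L (Complex.I • w) = Complex.I • L w := by
  have e : ∀ (a : ℝ) (v : F), a • v = (a : ℂ) • v := fun a v => by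
    simpa using RCLike.real_smul_eq_coe_smul (K := ℂ) a v
  have h1 : ∀ (j : Fin N) (c : ℂ), L (c • bv j) = c • L (bv j) := by
    intro j c
    have : c • bv j = c.re • bv j + c.im • (Complex.I • bv j) := by
      rw [real_smul_eq, real_smul_eq, smul_smul, ← add_smul, Complex.re_add_im]
    rw [this, map_add, map_smul, map_smul, h, e, e, smul_smul, ← add_smul, Complex.re_add_im]
  conv_lhs => rw [sum_bv w]
  conv_rhs => rw [sum_bv w]
  rw [Finset.smul_sum, map_sum, map_sum, Finset.smul_sum]
  refine Finset.sum_congr rfl fun j _ => ?_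
  rw [smul_smul, h1, h1, smul_smul]

lemma differentiableAt_of_db {f : EN N → ℂ} {z : EN N} (hf : DifferentiableAt ℝ f z)
    (h : ∀ j, db j f z = 0) : DifferentiableAt ℂ f z := by
  rw [differentiableAt_iff_restrictScalars ℝ hf]
  refine ⟨toCLin (fderiv ℝ f z) (commutes_of_basis _ fun j => ?_), by ext w; rfl⟩
  have := h j
  simp only [db] at this
  have h2 : fderiv ℝ f z (bv j) + Complex.I * fderiv ℝ f z (Complex.I • bv j) = 0 := by
    simpa using this
  rw [smul_eq_mul]
  linear_combination (-Complex.I) * h2 + (fderiv ℝ f z (Complex.I • bv j)) * Complex.I_mul_I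

lemma db_of_differentiableAt {f : EN N → ℂ} {z : EN N} (hf : DifferentiableAt ℂ f z) (j : Fin N) :
    db j f z = 0 := by
  have : fderiv ℝ f z = (fderiv ℂ f z).restrictScalars ℝ := (hf.hasFDerivAt.restrictScalars ℝ).fderiv
  simp only [db, this, ContinuousLinearMap.coe_restrictScalars', map_smul, smul_eq_mul]
  rw [← mul_assoc, Complex.I_mul_I]; ring

variable {μ : Measure (EN N)} [μ.IsAddHaarMeasure]

lemma measurePreserving_rot (c : ℂ) (hc : ‖c‖ = 1) :
    MeasurePreserving (fun w : EN N => c • w) μ μ := by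
  have hc0 : c ≠ 0 := by rintro rfl; simp at hc
  let e : EN N ≃L[ℝ] EN N := (ContinuousLinearEquiv.smulLeft (Units.mk0 c hc0) : EN N ≃L[ℂ] EN N).restrictScalars ℝ
  have he : ∀ w, e w = c • w := fun w => rfl
  have hmeas : Measurable (fun w : EN N => c • w) := (continuous_const_smul c).measurable
  refine ⟨hmeas, ?_⟩
  have : (μ.map e).IsAddHaarMeasure := e.isAddHaarMeasure_map μ
  have hu := Measure.isAddLeftInvariant_eq_smul (μ.map e) μ
  set k := Measure.addHaarScalarFactor (μ.map e) μ
  have hb : (μ.map e) (ball 0 1) = μ (ball 0 1) := by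
    rw [Measure.map_apply e.continuous.measurable measurableSet_ball]
    congr 1; ext w; simp [he, norm_smul, hc]
  rw [hu] at hb
  have hpos : μ (ball (0 : EN N) 1) ≠ 0 := (measure_ball_pos μ 0 one_pos).ne'
  have hfin : μ (ball (0 : EN N) 1) ≠ ⊤ := measure_ball_lt_top.ne
  have hk : (k : ℝ≥0∞) = 1 := by
    have h1 : (k : ℝ≥0∞) * μ (ball 0 1) = 1 * μ (ball 0 1) := by
      rw [one_mul]; exact hb
    exact (ENNReal.mul_left_inj hpos hfin).mp h1
  have hk1 : k = 1 := by exact_mod_cast hk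
  change μ.map e = μ
  rw [hu, hk1, one_smul]

lemma circle_mean {σ : EN N → ℝ} (hσ : Continuous σ) {r R : ℝ} (hrR : r < R)
    (hs : ∀ w, r < ‖w‖ → σ w = 0) (hrot : ∀ (c : ℂ) w, ‖c‖ = 1 → σ (c • w) = σ w)
    (h1 : ∫ w, σ w ∂μ = 1) {h : EN N → ℂ} (hc : Continuous h) {x : EN N}
    (hh : DifferentiableOn ℂ h (ball x R)) : ∫ w, (σ w : ℂ) * h (x - w) ∂μ = h x := by
  set I := ∫ w, (σ w : ℂ) * h (x - w) ∂μ with hI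
  have hrot' : ∀ θ : ℝ, I = ∫ w in closedBall 0 r, (σ w : ℂ) * h (x - circleMap 0 1 θ • w) ∂μ := by
    intro θ
    have hn : ‖circleMap 0 1 θ‖ = 1 := by simp
    have hmp := measurePreserving_rot (μ := μ) (circleMap 0 1 θ) hn
    have hemb : MeasurableEmbedding (fun w : EN N => circleMap 0 1 θ • w) :=
      (Homeomorph.smulOfNeZero (circleMap 0 1 θ) (by intro h0; simp [h0] at hn)).measurableEmbedding
    rw [setIntegral_eq_integral_of_forall_compl_eq_zero, hI,
      ← hmp.integral_comp hemb (fun w => (σ w : ℂ) * h (x - w))]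
    · congr 1; ext w; rw [hrot _ _ hn]
    · intro w hw; rw [hs w (by simpa using hw)]; simp
  clear_value I
  have h2 : ∫ θ in (0:ℝ)..(2 * Real.pi), I = ∫ θ in (0:ℝ)..(2*Real.pi),
      ∫ w in closedBall 0 r, (σ w : ℂ) * h (x - circleMap 0 1 θ • w) ∂μ := by
    refine intervalIntegral.integral_congr fun θ _ => hrot' θ
  have hcont : Continuous (fun p : ℝ × EN N => (σ p.2 : ℂ) * h (x - circleMap 0 1 p.1 • p.2)) := by
    have : Continuous (fun p : ℝ × EN N => circleMap 0 1 p.1) := (continuous_circleMap 0 1).comp continuous_fst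
    fun_prop
  rw [intervalIntegral.integral_of_le (by positivity), intervalIntegral.integral_of_le (by positivity),
    integral_integral_swap] at h2
  · have h3 : ∀ w ∈ closedBall (0 : EN N) r, ∫ θ in Ioc (0:ℝ) (2 * Real.pi), (σ w : ℂ) * h (x - circleMap 0 1 θ • w) =
        (2 * Real.pi : ℂ) * h x * (σ w : ℂ) := by
      intro w hw
      have hd : DiffContOnCl ℂ (fun ζ : ℂ => h (x - ζ • w)) (ball 0 |1|) := by
        refine DifferentiableOn.diffContOnCl fun ζ hζ => ?_
        have hζ1 : ‖ζ‖ ≤ 1 := by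
          have := closure_ball_subset_closedBall hζ
          simpa using this
        have hm : x - ζ • w ∈ ball x R := by
          rw [mem_ball, dist_eq_norm]
          calc ‖x - ζ • w - x‖ = ‖ζ‖ * ‖w‖ := by rw [sub_sub_cancel_left, norm_neg, norm_smul]
            _ ≤ 1 * r := by
              have : ‖w‖ ≤ r := by simpa using hw
              gcongr
            _ < R := by linarith
        have hA : DifferentiableAt ℂ h (x - ζ • w) := hh.differentiableAt (isOpen_ball.mem_nhds hm)
        have hB : DifferentiableAt ℂ (fun ζ : ℂ => x - ζ • w) ζ := by fun_prop
        exact (hA.comp ζ hB).differentiableWithinAt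
      have h4 := hd.circleAverage
      rw [Real.circleAverage_def, intervalIntegral.integral_of_le (by positivity)] at h4
      rw [integral_const_mul]
      have hpi : (Real.pi : ℂ) ≠ 0 := by exact_mod_cast Real.pi_ne_zero
      have h5 : ∫ θ in Ioc (0:ℝ) (2 * Real.pi), h (x - circleMap 0 1 θ • w) = 2 * Real.pi * h x := by
        rw [zero_smul, sub_zero] at h4
        rw [← h4, Complex.real_smul]; push_cast
        field_simp
      rw [h5]; ring
    rw [setIntegral_congr_fun measurableSet_closedBall h3, integral_const_mul] at h2
    have h6 : ∫ w in closedBall 0 r, (σ w : ℂ) ∂μ = 1 := by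
      rw [setIntegral_eq_integral_of_forall_compl_eq_zero, integral_complex_ofReal, h1]; · simp
      intro w hw; rw [hs w (by simpa using hw)]; simp
    rw [h6] at h2
    have h7 : ∫ θ in Ioc (0:ℝ) (2 * Real.pi), I = 2 * Real.pi * I := by
      rw [← intervalIntegral.integral_of_le (by positivity), intervalIntegral.integral_const]
      simp
    rw [h7] at h2
    have hpi : (2 * Real.pi : ℂ) ≠ 0 := by
      have : (Real.pi : ℂ) ≠ 0 := by exact_mod_cast Real.pi_ne_zero
      simp [this]
    apply mul_left_cancel₀ hpi
    rw [h2]; ring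
  · rw [Measure.prod_restrict]
    have := hcont.continuousOn.integrableOn_compact (μ := (volume : Measure ℝ).prod μ)
      ((isCompact_Icc (a := (0:ℝ)) (b := 2 * Real.pi)).prod (isCompact_closedBall (0 : EN N) r))
    exact this.mono_set (prod_mono Ioc_subset_Icc_self le_rfl)

lemma exists_radial (μ : Measure (EN N)) [μ.IsAddHaarMeasure] {r : ℝ} (hr : 0 < r) :
    ∃ σ : EN N → ℝ, ContDiff ℝ 2 σ ∧ (∀ w, r < ‖w‖ → σ w = 0) ∧
    (∀ (c : ℂ) w, ‖c‖ = 1 → σ (c • w) = σ w) ∧ ∫ w, σ w ∂μ = 1 ∧ HasCompactSupport σ ∧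
    tsupport σ ⊆ closedBall 0 r := by
  let s : EN N → ℝ := fun w => Real.smoothTransition (1 - ‖w‖^2 / r^2)
  have hs : ContDiff ℝ 2 s := by
    have : ContDiff ℝ 2 (fun w : EN N => ‖w‖^2) := contDiff_norm_sq ℂ
    exact Real.smoothTransition.contDiff.comp (contDiff_const.sub (this.div_const _))
  have h0 : ∀ w, r < ‖w‖ → s w = 0 := by
    intro w hw
    apply Real.smoothTransition.zero_of_nonpos
    rw [sub_nonpos, one_le_div (by positivity)]; gcongr
  have hts : tsupport s ⊆ closedBall 0 r := closure_minimal (fun w hw => by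
    by_contra h; exact hw (h0 w (by simpa using h))) isClosed_closedBall
  have hcs : HasCompactSupport s := (isCompact_closedBall 0 r).of_isClosed_subset (isClosed_tsupport _) hts
  have hpos : 0 < ∫ w, s w ∂μ := by
    rw [integral_pos_iff_support_of_nonneg (fun w => Real.smoothTransition.nonneg _)
      (hs.continuous.integrable_of_hasCompactSupport hcs)]
    refine hs.continuous.isOpen_support.measure_pos μ ⟨0, ?_⟩
    simp [s]
  refine ⟨fun w => (∫ w, s w ∂μ)⁻¹ * s w, contDiff_const.mul hs, fun w hw => ?_, fun c w hc => ?_, ?_, hcs.mul_left, ?_⟩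
  · simp [h0 w hw]
  · simp [s, norm_smul, hc]
  · rw [integral_const_mul, inv_mul_cancel₀ hpos.ne']
  · exact (tsupport_mul_subset_right).trans hts
end DFW
end

open Set Filter Topology Metric MeasureTheory
open scoped ENNReal NNReal InnerProductSpace ComplexConjugate Convolution
noncomputable section
namespace DFW
variable {N : ℕ} {μ : Measure (EN N)} [μ.IsAddHaarMeasure]

lemma conv_assoc {a b : EN N → ℝ} {g : EN N → ℂ} (ha : Continuous a) (hac : HasCompactSupport a)
    (hb : Continuous b) (hbc : HasCompactSupport b) (hg : LocallyIntegrable g μ) (x : EN N) :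
    convolution (convolution a b (ContinuousLinearMap.lsmul ℝ ℝ) μ) g (ContinuousLinearMap.lsmul ℝ ℝ) μ x =
    convolution a (convolution b g (ContinuousLinearMap.lsmul ℝ ℝ) μ) (ContinuousLinearMap.lsmul ℝ ℝ) μ x := by
  have hgn : LocallyIntegrable (fun x => ‖g x‖) μ := fun x => (hg x).norm
  have hcn : HasCompactSupport (fun x => ‖b x‖) := hbc.norm
  have hca : HasCompactSupport (fun x => ‖a x‖) := hac.norm
  refine convolution_assoc _ _ _ _ ?_ ha.aestronglyMeasurable hb.aestronglyMeasurable
    hg.aestronglyMeasurable ?_ ?_ ?_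
  · intro x y z; simp [mul_smul]
  · exact Eventually.of_forall fun y => hac.convolutionExists_left _ ha hb.locallyIntegrable y
  · exact Eventually.of_forall fun y => hcn.convolutionExists_left _ hb.norm hgn y
  · have : Continuous ((fun x => ‖b x‖) ⋆[ContinuousLinearMap.mul ℝ ℝ, μ] fun x => ‖g x‖) :=
      hcn.continuous_convolution_left _ hb.norm hgn
    exact hca.convolutionExists_left _ ha.norm this.locallyIntegrable x

lemma conv_comm3 {a b : EN N → ℝ} {g : EN N → ℂ} (ha : Continuous a) (hac : HasCompactSupport a)
    (hb : Continuous b) (hbc : HasCompactSupport b) (hg : LocallyIntegrable g μ) (x : EN N) :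
    convolution a (convolution b g (ContinuousLinearMap.lsmul ℝ ℝ) μ) (ContinuousLinearMap.lsmul ℝ ℝ) μ x =
    convolution b (convolution a g (ContinuousLinearMap.lsmul ℝ ℝ) μ) (ContinuousLinearMap.lsmul ℝ ℝ) μ x := by
  rw [← conv_assoc ha hac hb hbc hg, ← conv_assoc hb hbc ha hac hg]
  congr 1
  rw [← convolution_flip]
  congr 1; ext; simp [mul_comm]

lemma fderiv_conv {σ : EN N → ℝ} (hσ : ContDiff ℝ 2 σ) (hc : HasCompactSupport σ) {f : EN N → ℂ}
    (hf : LocallyIntegrable f μ) (x v : EN N) :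
    DifferentiableAt ℝ (convolution f σ (ContinuousLinearMap.lsmul ℝ ℝ).flip μ) x ∧
    fderiv ℝ (convolution f σ (ContinuousLinearMap.lsmul ℝ ℝ).flip μ) x v =
      - ∫ w, f w * fderiv ℝ (fun w => (σ (x - w) : ℂ)) w v ∂μ := by
  have hσ1 : ContDiff ℝ 1 σ := hσ.of_le (by norm_num)
  have h1 := hc.hasFDerivAt_convolution_right (ContinuousLinearMap.lsmul ℝ ℝ).flip hf hσ1 x
  have h2 : fderiv ℝ (convolution f σ (ContinuousLinearMap.lsmul ℝ ℝ).flip μ) x = _ := h1.fderiv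
  refine ⟨h1.differentiableAt, ?_⟩
  rw [h2, convolution_precompR_apply _ hf (hc.fderiv ℝ) (hσ1.continuous_fderiv (by norm_num)), convolution_def,
    ← integral_neg]
  refine integral_congr_ae (Eventually.of_forall fun w => ?_)
  have h3 : DifferentiableAt ℝ σ (x - w) := hσ1.differentiable (by norm_num) _
  have h4 : HasFDerivAt (fun w => (σ (x - w) : ℂ))
    (Complex.ofRealCLM.comp ((fderiv ℝ σ (x - w)).comp (-ContinuousLinearMap.id ℝ (EN N)))) w := by
    have h5 : HasFDerivAt (fun w => x - w) (-ContinuousLinearMap.id ℝ (EN N)) w := by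
      simpa using (hasFDerivAt_id w).const_sub x
    exact Complex.ofRealCLM.hasFDerivAt.comp w (h3.hasFDerivAt.comp w h5)
  simp [h4.fderiv, mul_comm]

lemma db_conv {σ : EN N → ℝ} (hσ : ContDiff ℝ 2 σ) (hc : HasCompactSupport σ) {f : EN N → ℂ}
    (hf : LocallyIntegrable f μ) (x : EN N) (j : Fin N) (hcx : HasCompactSupport (fun w => (σ (x - w) : ℂ))) :
    db j (convolution f σ (ContinuousLinearMap.lsmul ℝ ℝ).flip μ) x =
      - ∫ w, f w * db j (fun w => (σ (x - w) : ℂ)) w ∂μ := by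
  have hs : ContDiff ℝ 1 (fun w => (σ (x - w) : ℂ)) :=
    Complex.ofRealCLM.contDiff.comp ((hσ.of_le (by norm_num)).comp (contDiff_const.sub contDiff_id))
  have hI : ∀ v, Integrable (fun w => f w * fderiv ℝ (fun w => (σ (x - w) : ℂ)) w v) μ := fun v =>
    integrable_mul_tb hf ((hs.continuous_fderiv (by norm_num)).clm_apply
      continuous_const) (hcx.fderiv_apply (𝕜 := ℝ) v)
  rw [db, (fderiv_conv hσ hc hf x _).2, (fderiv_conv hσ hc hf x _).2]
  have : ∀ w, f w * db j (fun w => (σ (x - w) : ℂ)) w = (f w * fderiv ℝ (fun w => (σ (x - w) : ℂ)) w (bv j) + Complex.I * (f w * fderiv ℝ (fun w => (σ (x - w) : ℂ)) w (Complex.I • bv j))) / 2 := by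
    intro w; rw [db]; ring
  simp_rw [this]
  rw [integral_div, integral_add (hI _) ((hI _).const_mul _), integral_const_mul]
  ring

lemma weyl_local {g : EN N → ℂ} (hg : LocallyIntegrable g μ) {z0 : EN N} {R : ℝ} (hR : 0 < R)
    (hw : ∀ b ∈ Tst (ball z0 (4 * R)), ∀ j, ∫ z, g z * db j b z ∂μ = 0) :
    ∃ s : EN N → ℂ, DifferentiableOn ℂ s (ball z0 R) ∧ ∀ᵐ x ∂μ, x ∈ ball z0 R → g x = s x := by
  obtain ⟨σ, hσ, hσ0, hσr, hσ1, hσc, hσs⟩ := exists_radial μ hR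
  let s := convolution σ g (ContinuousLinearMap.lsmul ℝ ℝ) μ
  have hs' : s = convolution g σ (ContinuousLinearMap.lsmul ℝ ℝ).flip μ := (convolution_flip _).symm
  have hsc : Continuous s := hσc.continuous_convolution_left _ hσ.continuous hg
  have hball : ∀ x ∈ ball z0 R, closedBall x R ⊆ ball z0 (4 * R) := by
    intro x hx
    refine closedBall_subset_ball' ?_
    have := mem_ball.mp hx; linarith
  refine ⟨s, fun x hx => ?_, ?_⟩
  · have hts : tsupport (fun w => (σ (x - w) : ℂ)) ⊆ closedBall x R :=
      closure_minimal (fun w hw => by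
        by_contra h
        refine hw ?_
        have : σ (x - w) = 0 := hσ0 _ (by simpa [dist_eq_norm, norm_sub_rev] using h)
        simp [this]) isClosed_closedBall
    have hcs : HasCompactSupport (fun w => (σ (x - w) : ℂ)) :=
      (isCompact_closedBall x R).of_isClosed_subset (isClosed_tsupport _) hts
    refine (differentiableAt_of_db ?_ fun j => ?_).differentiableWithinAt
    · rw [hs']; exact (fderiv_conv hσ hσc hg x 0).1
    · rw [hs', db_conv hσ hσc hg x j hcs, neg_eq_zero]
      exact hw _ ⟨Complex.ofRealCLM.contDiff.comp (hσ.comp (contDiff_const.sub contDiff_id)), hcs,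
        hts.trans (hball x hx)⟩ j
  · have hae := ContDiffBump.ae_convolution_tendsto_right_of_locallyIntegrable (φ := bmp N) (l := atTop)
      (K := 2) (bmp_rOut N) (Eventually.of_forall fun n => by simp [bmp]; ring_nf; rfl) hg
    filter_upwards [hae] with x hx hxB
    refine tendsto_nhds_unique hx ?_
    have hlim : Tendsto (fun n => mol μ (bmp N n) s x) atTop (𝓝 (s x)) := by
      simp_rw [mol_eq]
      refine ContDiffBump.convolution_tendsto_right (g := fun _ => s) (k := fun _ => x) (bmp_rOut N)
        (Eventually.of_forall fun _ => hsc.aestronglyMeasurable) ?_ tendsto_const_nhds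
      exact (hsc.tendsto x).comp tendsto_snd
    refine hlim.congr' ?_
    have hev : ∀ᶠ n in atTop, (bmp N n).rOut < R := (bmp_rOut N).eventually_lt_const hR
    filter_upwards [hev] with n hn
    rw [mol_eq]
    change convolution _ (convolution σ g _ μ) _ μ x = _
    rw [conv_comm3 ((bmp N n).contDiff_normed (n := 1)).continuous (bmp N n).hasCompactSupport_normed
      hσ.continuous hσc hg, ← mol_eq]
    rw [convolution_def]
    have := circle_mean (μ := μ) hσ.continuous (r := R) (R := 2 * R) (by linarith) hσ0 hσr hσ1
      (h := mol μ (bmp N n) g) (contDiff_mol hg).continuous (x := x) ?_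
    · simpa using this
    · intro y hy
      refine (differentiableAt_of_db ((contDiff_mol hg).differentiable (by norm_num) y) fun j => ?_).differentiableWithinAt
      rw [db_mol hg, neg_eq_zero]
      refine hw _ ⟨contDiff_tb y (n := 2), hcs_tb y, (tsupport_tb y).trans ?_⟩ j
      refine closedBall_subset_ball' ?_
      have h1 := mem_ball.mp hxB
      have h2 := mem_ball.mp hy
      have := dist_triangle y x z0
      linarith

lemma weyl {U : Set (EN N)} (hU : IsOpen U) {u : EN N → ℂ} (hu : LocallyIntegrableOn u U μ)
    (hw : ∀ b ∈ Tst U, ∀ j, ∫ z, u z * db j b z ∂μ = 0) :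
    ∃ h : EN N → ℂ, DifferentiableOn ℂ h U ∧ ∀ᵐ x ∂μ, x ∈ U → u x = h x := by
  have hloc : ∀ z ∈ U, ∃ R > 0, ball z R ⊆ U ∧ ∃ s : EN N → ℂ, DifferentiableOn ℂ s (ball z R) ∧
      ∀ᵐ x ∂μ, x ∈ ball z R → u x = s x := by
    intro z hz
    obtain ⟨R', hR', hsub⟩ := Metric.isOpen_iff.mp hU z hz
    set R := R' / 8 with hRdef
    have hR : 0 < R := by positivity
    have hcb : closedBall z (4 * R) ⊆ U := (closedBall_subset_ball (by rw [hRdef]; linarith)).trans hsub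
    have hIntg : IntegrableOn u (closedBall z (4 * R)) μ :=
      (locallyIntegrableOn_iff hU.isLocallyClosed).mp hu _ hcb (isCompact_closedBall z _)
    have hg : Integrable ((closedBall z (4 * R)).indicator u) μ :=
      (integrable_indicator_iff measurableSet_closedBall).mpr hIntg
    obtain ⟨s, hs, hae⟩ := weyl_local hg.locallyIntegrable (z0 := z) hR (by
      intro b hb j
      rw [← hw b ⟨hb.1, hb.2.1, hb.2.2.trans (ball_subset_closedBall.trans hcb)⟩ j]
      congr 1; ext y
      by_cases hy : y ∈ closedBall z (4 * R)
      · rw [indicator_of_mem hy]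
      · rw [db_zero_of (fun h => hy (ball_subset_closedBall (hb.2.2 h)))]; simp)
    have hsub2 : ball z R ⊆ closedBall z (4 * R) :=
      (ball_subset_ball (by linarith)).trans ball_subset_closedBall
    refine ⟨R, hR, hsub2.trans hcb, s, hs, ?_⟩
    filter_upwards [hae] with x hx hxB
    rw [← hx hxB, indicator_of_mem (hsub2 hxB)]
  choose! R hR hRU s hs hae using hloc
  have key : ∀ z ∈ U, ∀ x ∈ ball z (R z), s x x = s z x := by
    intro z hz x hx
    have hxU := hRU z hz hx
    have h1 : s x =ᵐ[μ.restrict (ball z (R z) ∩ ball x (R x))] s z := by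
      rw [Filter.EventuallyEq, ae_restrict_iff' (isOpen_ball.inter isOpen_ball).measurableSet]
      filter_upwards [hae x hxU, hae z hz] with y h1 h2 hy
      rw [← h1 hy.2, ← h2 hy.1]
    exact Measure.eqOn_open_of_ae_eq h1 (isOpen_ball.inter isOpen_ball)
      ((hs x hxU).continuousOn.mono inter_subset_right) ((hs z hz).continuousOn.mono inter_subset_left)
      ⟨hx, mem_ball_self (hR x hxU)⟩
  refine ⟨fun x => s x x, fun z hz => ?_, ?_⟩
  · have h1 : (fun x => s x x) =ᶠ[𝓝 z] s z := by
      filter_upwards [ball_mem_nhds z (hR z hz)] with x hx using key z hz x hx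
    exact (((hs z hz).differentiableAt (ball_mem_nhds z (hR z hz))).congr_of_eventuallyEq h1).differentiableWithinAt
  · have h0 : μ {x | x ∈ U ∧ u x ≠ s x x} = 0 := by
      refine measure_null_of_locally_null _ fun z hz => ?_
      refine ⟨{x | ¬ (x ∈ ball z (R z) → u x = s z x)}, ?_, ?_⟩
      · filter_upwards [self_mem_nhdsWithin, mem_nhdsWithin_of_mem_nhds (ball_mem_nhds z (hR z hz.1))] with x hx hxB
        intro hcon
        exact hx.2 ((hcon hxB).trans (key z hz.1 x hxB).symm)
      · have := hae z hz.1
        rw [ae_iff] at this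
        exact this
    rw [ae_iff]
    refine measure_mono_null (fun x hx => ?_) h0
    simp only [mem_setOf_eq, Classical.not_imp] at hx
    exact hx
end DFW
end

open Set Filter Topology Metric MeasureTheory
open scoped ENNReal NNReal InnerProductSpace ComplexConjugate
noncomputable section
namespace DFW
variable {N : ℕ}

lemma diffAt_fderiv' {f : EN N → ℝ} {z : EN N} (hf : ContDiffAt ℝ 2 f z) :
    DifferentiableAt ℝ (fderiv ℝ f) z :=
  (hf.fderiv_right (m := 1) (by norm_num)).differentiableAt (by norm_num)

lemma eventually_diffAt {f : EN N → ℝ} {z : EN N} (hf : ContDiffAt ℝ 2 f z) :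
    ∀ᶠ y in 𝓝 z, DifferentiableAt ℝ f y := by
  filter_upwards [hf.eventually (by simp)] with y hy using hy.differentiableAt (by norm_num)

lemma Hess_symm {f : EN N → ℝ} {z : EN N} (hf : ContDiffAt ℝ 2 f z) (v w : EN N) :
    Hess f z v w = Hess f z w v := hf.isSymmSndFDerivAt (by simp) v w

lemma fderiv_cx {f : EN N → ℝ} {z : EN N} (hf : DifferentiableAt ℝ f z) :
    fderiv ℝ (cx f) z = Complex.ofRealCLM.comp (fderiv ℝ f z) :=
  (Complex.ofRealCLM.hasFDerivAt.comp z hf.hasFDerivAt).fderiv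

lemma contDiffAt_cx {n : WithTop ℕ∞} {f : EN N → ℝ} {z : EN N} (hf : ContDiffAt ℝ n f z) :
    ContDiffAt ℝ n (cx f) z := Complex.ofRealCLM.contDiff.contDiffAt.comp z hf

lemma hess_cx {f : EN N → ℝ} {z : EN N} (hf : ContDiffAt ℝ 2 f z) (v w : EN N) :
    fderiv ℝ (fderiv ℝ (cx f)) z v w = (Hess f z v w : ℂ) := by
  have h1 : fderiv ℝ (cx f) =ᶠ[𝓝 z] fun y => Complex.ofRealCLM.comp (fderiv ℝ f y) := by
    filter_upwards [eventually_diffAt hf] with y hy using fderiv_cx hy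
  have h2 := (ContinuousLinearMap.compL ℝ (EN N) ℝ ℂ Complex.ofRealCLM).hasFDerivAt.comp z
    (diffAt_fderiv' hf).hasFDerivAt
  have h3 : fderiv ℝ (fun y => Complex.ofRealCLM.comp (fderiv ℝ f y)) z = _ := h2.fderiv
  rw [h1.fderiv_eq, h3]; simp [Hess]

lemma clm_sum (f : EN N →L[ℂ] ℂ) (w : EN N) : f w = ∑ j, w j * f (bv j) := by
  conv_lhs => rw [sum_bv w]
  simp [map_sum]

lemma levi_eq {f : EN N → ℝ} {z : EN N} (hf : ContDiffAt ℝ 2 f z) (w : EN N) :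
    (∑ j, ∑ k, db k (dz j (cx f)) z * w j * conj (w k)).re = LeviForm f z w := by
  have II : ∀ v : EN N, Complex.I • Complex.I • v = -v := fun v => by
    rw [smul_smul, Complex.I_mul_I, neg_one_smul]
  set H := fderiv ℝ (fderiv ℝ f) z with hH
  let L : EN N → EN N →L[ℝ] ℂ := fun v => Complex.ofRealCLM.comp (H v) -
    Complex.I • Complex.ofRealCLM.comp ((H v).comp
      ((Complex.I • ContinuousLinearMap.id ℂ (EN N)).restrictScalars ℝ))
  have hL : ∀ v w, L v w = (H v w : ℂ) - Complex.I * (H v (Complex.I • w) : ℂ) := by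
    intro v w; simp [L]
  have hLI : ∀ v w, L v (Complex.I • w) = Complex.I • L v w := by
    intro v w
    rw [hL, hL, II]; simp only [map_neg, smul_eq_mul]; push_cast
    linear_combination ((H v (Complex.I • w) : ℂ)) * Complex.I_mul_I
  let M : EN N →L[ℝ] ℂ := Complex.conjCLE.toContinuousLinearMap.comp
    (Complex.ofRealCLM.comp (H.flip w) - Complex.I • Complex.ofRealCLM.comp (H.flip (Complex.I • w))
     + Complex.I • (Complex.ofRealCLM.comp (H.flip w) - Complex.I • Complex.ofRealCLM.comp (H.flip (Complex.I • w))).comp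
      ((Complex.I • ContinuousLinearMap.id ℂ (EN N)).restrictScalars ℝ))
  have hM : ∀ v, M v = conj (L v w + Complex.I * L (Complex.I • v) w) := by
    intro v; rw [hL, hL]; simp [M]
  have hMI : ∀ v, M (Complex.I • v) = Complex.I • M v := by
    intro v
    rw [hM, hM, II]
    have : L (-v) w = - L v w := by rw [hL, hL]; simp; ring
    rw [this]; simp only [map_add, map_mul, Complex.conj_I, map_neg, smul_eq_mul]
    linear_combination (conj (L (Complex.I • v) w)) * Complex.I_mul_I
  have hM2 := clm_sum (toCLin M hMI) w
  have hdb : ∀ j k, db k (dz j (cx f)) z = (L (bv k) (bv j) + Complex.I * L (Complex.I • bv k) (bv j)) / 4 := by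
    intro j k
    have hc := contDiffAt_cx hf
    rw [db, fderiv_dz hc, fderiv_dz hc, hL, hL]
    simp only [hess_cx hf, Hess, ← hH]
    ring
  have hs : ∀ k, ∑ j, db k (dz j (cx f)) z * w j * conj (w k) = conj (w k * M (bv k)) / 4 := by
    intro k
    rw [hM]
    have e1 := clm_sum (toCLin (L (bv k)) (hLI _)) w
    have e2 := clm_sum (toCLin (L (Complex.I • bv k)) (hLI _)) w
    have e1' : L (bv k) w = ∑ j, w j * L (bv k) (bv j) := e1
    have e2' : L (Complex.I • bv k) w = ∑ j, w j * L (Complex.I • bv k) (bv j) := e2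
    rw [map_mul, Complex.conj_conj, e1', e2', Finset.mul_sum, ← Finset.sum_add_distrib, Finset.mul_sum,
      Finset.sum_div]
    refine Finset.sum_congr rfl fun j _ => ?_
    rw [hdb]; ring
  rw [Finset.sum_comm, Finset.sum_congr rfl fun k _ => hs k, ← Finset.sum_div, ← map_sum]
  have hM3 : M w = ∑ k, w k * M (bv k) := hM2
  rw [← hM3, hM, Complex.conj_conj, hL, hL]
  simp [LeviForm, Hess, ← hH]

/-! Levi calculus -/
lemma Hess_add {f g : EN N → ℝ} {z : EN N} (hf : ContDiffAt ℝ 2 f z) (hg : ContDiffAt ℝ 2 g z) (v w : EN N) :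
    Hess (fun y => f y + g y) z v w = Hess f z v w + Hess g z v w := by
  have h1 : fderiv ℝ (fun y => f y + g y) =ᶠ[𝓝 z] fun y => fderiv ℝ f y + fderiv ℝ g y := by
    filter_upwards [eventually_diffAt hf, eventually_diffAt hg] with y h1 h2 using fderiv_fun_add h1 h2
  rw [Hess, h1.fderiv_eq, fderiv_fun_add (diffAt_fderiv' hf) (diffAt_fderiv' hg)]; simp [Hess]

lemma Hess_smul {f : EN N → ℝ} {z : EN N} (hf : ContDiffAt ℝ 2 f z) (a : ℝ) (v w : EN N) :
    Hess (fun y => a * f y) z v w = a * Hess f z v w := by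
  have h1 : fderiv ℝ (fun y => a * f y) =ᶠ[𝓝 z] fun y => a • fderiv ℝ f y := by
    filter_upwards [eventually_diffAt hf] with y h1 using fderiv_const_mul h1 a
  rw [Hess, h1.fderiv_eq, fderiv_fun_const_smul (diffAt_fderiv' hf)]; simp [Hess]

lemma Hess_comp {r : EN N → ℝ} {z : EN N} (hr : ContDiffAt ℝ 2 r z) {h h1 : ℝ → ℝ} {h2 : ℝ}
    (hh : ∀ᶠ t in 𝓝 (r z), HasDerivAt h (h1 t) t) (hh1 : HasDerivAt h1 h2 (r z)) (v w : EN N) :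
    Hess (fun y => h (r y)) z v w = h1 (r z) * Hess r z v w + h2 * (fderiv ℝ r z v * fderiv ℝ r z w) := by
  have e1 : fderiv ℝ (fun y => h (r y)) =ᶠ[𝓝 z] fun y => h1 (r y) • fderiv ℝ r y := by
    filter_upwards [eventually_diffAt hr, hr.continuousAt.eventually hh] with y hy hy2
    exact (hy2.comp_hasFDerivAt y hy.hasFDerivAt).fderiv
  have hd := hr.differentiableAt (by norm_num)
  have e2 := (hh1.comp_hasFDerivAt z hd.hasFDerivAt).smul (diffAt_fderiv' hr).hasFDerivAt
  have e3 : fderiv ℝ (fun y => h1 (r y) • fderiv ℝ r y) z = _ := e2.fderiv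
  rw [Hess, e1.fderiv_eq, e3]; simp [Hess]; ring

lemma fderiv_normSq (z v : EN N) : fderiv ℝ (fun y : EN N => ‖y‖^2) z v = 2 * (inner ℂ z v).re := by
  have h : (fun y : EN N => ‖y‖^2) = fun y => (inner ℂ y y).re := by
    ext y; exact (inner_self_eq_norm_sq (𝕜 := ℂ) y).symm
  have hd : DifferentiableAt ℝ (fun y : EN N => inner ℂ y y) z :=
    differentiableAt_id.inner ℂ differentiableAt_id
  have h2 := Complex.reCLM.hasFDerivAt.comp z hd.hasFDerivAt
  have h3 : fderiv ℝ (fun y : EN N => (inner ℂ y y).re) z = _ := h2.fderiv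
  rw [h, h3]
  simp only [ContinuousLinearMap.comp_apply]
  rw [fderiv_inner_apply ℂ differentiableAt_fun_id differentiableAt_fun_id]
  have : (inner ℂ v z).re = (inner ℂ z v).re := inner_re_symm (𝕜 := ℂ) v z
  simp [this]; ring

lemma Hess_normSq (z v w : EN N) : Hess (fun y : EN N => ‖y‖^2) z v w = 2 * (inner ℂ v w).re := by
  let L : EN N →L[ℝ] ℝ := (2:ℝ) • Complex.reCLM.comp ((innerSL ℂ w).restrictScalars ℝ)
  have hc : ContDiffAt ℝ 2 (fun y : EN N => ‖y‖^2) z := (contDiff_norm_sq ℂ).contDiffAt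
  have h1 : HasFDerivAt (fun y => fderiv ℝ (fun y : EN N => ‖y‖^2) y w)
    ((fderiv ℝ (fderiv ℝ (fun y : EN N => ‖y‖^2)) z).flip w) z := by
    simpa using (diffAt_fderiv' hc).hasFDerivAt.clm_apply (hasFDerivAt_const w z)
  have h2 : (fun y => fderiv ℝ (fun y : EN N => ‖y‖^2) y w) = L := by
    ext y
    rw [fderiv_normSq]
    have : (inner ℂ y w).re = (inner ℂ w y).re := inner_re_symm (𝕜 := ℂ) y w
    simp [L, this]
  rw [h2] at h1
  have h3 := h1.unique L.hasFDerivAt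
  have h4 := congrArg (fun T => T v) h3
  have : (inner ℂ v w).re = (inner ℂ w v).re := inner_re_symm (𝕜 := ℂ) v w
  simpa [L, Hess, this] using h4

lemma LeviForm_add {f g : EN N → ℝ} {z : EN N} (hf : ContDiffAt ℝ 2 f z) (hg : ContDiffAt ℝ 2 g z) (w : EN N) :
    LeviForm (fun y => f y + g y) z w = LeviForm f z w + LeviForm g z w := by
  simp only [LeviForm, Hess_add hf hg]; ring
lemma LeviForm_smul {f : EN N → ℝ} {z : EN N} (hf : ContDiffAt ℝ 2 f z) (a : ℝ) (w : EN N) :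
    LeviForm (fun y => a * f y) z w = a * LeviForm f z w := by
  simp only [LeviForm, Hess_smul hf]; ring
lemma LeviForm_comp {r : EN N → ℝ} {z : EN N} (hr : ContDiffAt ℝ 2 r z) {h h1 : ℝ → ℝ} {h2 : ℝ}
    (hh : ∀ᶠ t in 𝓝 (r z), HasDerivAt h (h1 t) t) (hh1 : HasDerivAt h1 h2 (r z)) (w : EN N) :
    LeviForm (fun y => h (r y)) z w = h1 (r z) * LeviForm r z w
      + h2 * ((fderiv ℝ r z w)^2 + (fderiv ℝ r z (Complex.I • w))^2)/4 := by
  simp only [LeviForm, Hess_comp hr hh hh1]; ring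
lemma LeviForm_normSq (z w : EN N) : LeviForm (fun y : EN N => ‖y‖^2) z w = ‖w‖^2 := by
  simp only [LeviForm, Hess_normSq]
  have h : ∀ u : EN N, (inner ℂ u u).re = ‖u‖^2 := fun u => inner_self_eq_norm_sq (𝕜 := ℂ) u
  rw [h, h, norm_smul]; simp; ring

lemma dz_cx_normSq_le {f : EN N → ℝ} {z : EN N} (hf : DifferentiableAt ℝ f z) (j : Fin N) :
    ‖dz j (cx f) z‖^2 ≤ ‖fderiv ℝ f z‖^2 := by
  have hb : ‖(bv j : EN N)‖ = 1 := by simp [bv]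
  have h1 : ‖fderiv ℝ f z (bv j)‖ ≤ ‖fderiv ℝ f z‖ := by
    simpa [hb] using (fderiv ℝ f z).le_opNorm (bv j)
  have h2 : ‖fderiv ℝ f z (Complex.I • bv j)‖ ≤ ‖fderiv ℝ f z‖ := by
    simpa [hb, norm_smul] using (fderiv ℝ f z).le_opNorm (Complex.I • bv j)
  have h3 : ‖dz j (cx f) z‖ ≤ ‖fderiv ℝ f z‖ := by
    rw [dz, fderiv_cx hf, norm_div]
    simp only [ContinuousLinearMap.comp_apply, Complex.ofRealCLM_apply]
    have := norm_sub_le ((fderiv ℝ f z (bv j) : ℝ) : ℂ) (Complex.I * ((fderiv ℝ f z (Complex.I • bv j) : ℝ) : ℂ))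
    rw [norm_mul, Complex.norm_I, one_mul, Complex.norm_real, Complex.norm_real] at this
    simp only [Complex.norm_ofNat]
    linarith
  gcongr
end DFW
end

open Set Filter Topology Metric MeasureTheory
open scoped ENNReal NNReal InnerProductSpace ComplexConjugate
noncomputable section
namespace DFW
variable {N : ℕ}

structure Geo (D : Set (EN N)) (r : EN N → ℝ) (V : Set (EN N)) (c δ : ℝ) : Prop where
  oD : IsOpen D
  bD : Bornology.IsBounded D
  oV : IsOpen V
  sub : closure D ⊆ V
  c2 : ContDiffOn ℝ 2 r V
  hD : ∀ z ∈ V, (z ∈ D ↔ r z < 0)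
  hcD : ∀ z ∈ V, (z ∈ closure D ↔ r z ≤ 0)
  hf : ∀ z ∈ V, (z ∈ frontier D ↔ r z = 0)
  cpt : ∀ s ≤ 2 * δ, IsCompact {z ∈ V | r z ≤ s}
  cpos : 0 < c
  dpos : 0 < δ
  levi : ∀ z ∈ V, |r z| ≤ 2 * δ → ∀ w, c * ‖w‖^2 ≤ LeviForm r z w
  grad : ∀ z ∈ frontier D, fderiv ℝ r z ≠ 0

lemma levi_abs_le (H : EN N →L[ℝ] EN N →L[ℝ] ℝ) (w : EN N) :
    |(H w w + H (Complex.I • w) (Complex.I • w))/4| ≤ ‖H‖ * ‖w‖^2 := by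
  have h1 := H.le_opNorm₂ w w
  have h2 := H.le_opNorm₂ (Complex.I • w) (Complex.I • w)
  rw [norm_smul, Complex.norm_I, one_mul] at h2
  rw [Real.norm_eq_abs] at h1 h2
  have := abs_add_le (H w w) (H (Complex.I • w) (Complex.I • w))
  rw [abs_div, abs_of_pos (by norm_num : (0:ℝ) < 4)]
  have h0 : 0 ≤ ‖H‖ * ‖w‖^2 := by positivity
  nlinarith

lemma continuousOn_hess {r : EN N → ℝ} {V : Set (EN N)} (hV : IsOpen V) (hr : ContDiffOn ℝ 2 r V) :
    ContinuousOn (fderiv ℝ (fderiv ℝ r)) V := by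
  intro z hz
  have h := (hr.contDiffAt (hV.mem_nhds hz)).fderiv_right (m := 1) (by norm_num)
  exact (h.fderiv_right (m := 0) (by norm_num)).continuousAt.continuousWithinAt

lemma continuousOn_fderiv' {r : EN N → ℝ} {V : Set (EN N)} (hV : IsOpen V) (hr : ContDiffOn ℝ 2 r V) :
    ContinuousOn (fderiv ℝ r) V := by
  intro z hz
  have h := (hr.contDiffAt (hV.mem_nhds hz)).fderiv_right (m := 1) (by norm_num)
  exact h.continuousAt.continuousWithinAt

lemma isOpen_norm_lt {X F : Type*} [TopologicalSpace X] [NormedAddCommGroup F] {g : X → F} {V : Set X}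
    (hg : ContinuousOn g V) (hV : IsOpen V) (a : F) (s : ℝ) :
    IsOpen (V ∩ (fun z => ‖g z - a‖) ⁻¹' Iio s) :=
  (hg.sub continuousOn_const).norm.isOpen_inter_preimage hV isOpen_Iio

lemma norm_sub_self_lt {F : Type*} [NormedAddCommGroup F] (a : F) {s : ℝ} (hs : 0 < s) : ‖a - a‖ < s := by
  simpa using hs

/-- compactness: a + K b > 0 -/
lemma exists_K {X : Type*} [TopologicalSpace X] {S : Set X} (hS : IsCompact S) {a b : X → ℝ}
    (ha : ContinuousOn a S) (hb : ContinuousOn b S) (hb0 : ∀ x ∈ S, 0 ≤ b x)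
    (hab : ∀ x ∈ S, b x = 0 → 0 < a x) :
    ∃ K > (0:ℝ), ∀ x ∈ S, 0 < a x + K * b x := by
  obtain ⟨m, hm⟩ := hS.bddBelow_image ha
  have hm' : ∀ x ∈ S, m ≤ a x := fun x hx => hm (mem_image_of_mem _ hx)
  have hT : IsCompact (S ∩ a ⁻¹' Iic 0) := by
    obtain ⟨u, hu, he⟩ := (continuousOn_iff_isClosed.1 ha) (Iic 0) isClosed_Iic
    rw [inter_comm, he, inter_comm]; exact hS.inter_right hu
  rcases (S ∩ a ⁻¹' Iic 0).eq_empty_or_nonempty with h | h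
  · refine ⟨1, one_pos, fun x hx => ?_⟩
    have : 0 < a x := by
      by_contra hc
      have : x ∈ S ∩ a ⁻¹' Iic 0 := ⟨hx, not_lt.1 hc⟩
      rw [h] at this; exact this
    have := hb0 x hx; linarith
  · obtain ⟨x0, hx0, hmin⟩ := hT.exists_isMinOn h (hb.mono inter_subset_left)
    have hb1 : 0 < b x0 := lt_of_le_of_ne (hb0 _ hx0.1) fun e => by
      have := hab x0 hx0.1 e.symm
      have h2 : a x0 ≤ 0 := hx0.2
      linarith
    refine ⟨(|m| + 1) / b x0, by positivity, fun x hx => ?_⟩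
    by_cases hax : a x ≤ 0
    · have h1 : b x0 ≤ b x := hmin ⟨hx, hax⟩
      have h2 : (|m| + 1) ≤ (|m| + 1) / b x0 * b x := by
        rw [div_mul_eq_mul_div, le_div_iff₀ hb1]; gcongr
      have := neg_abs_le m
      have := hm' x hx
      linarith
    · have := hb0 x hx
      push Not at hax
      positivity

lemma exists_neg_near {f : EN N → ℝ} {z : EN N} (hd : DifferentiableAt ℝ f z)
    (h0 : f z = 0) (hg : fderiv ℝ f z ≠ 0) {W : Set (EN N)} (hW : W ∈ 𝓝 z) : ∃ y ∈ W, f y < 0 := by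
  obtain ⟨v, hv⟩ : ∃ v, fderiv ℝ f z v < 0 := by
    by_contra hc
    push Not at hc
    apply hg; ext v
    have h1 := hc v
    have h2 := hc (-v)
    simp at h2 ⊢; linarith
  have hc : HasDerivAt (fun t : ℝ => z + t • v) v 0 := by
    simpa using ((hasDerivAt_id (0:ℝ)).smul_const v).const_add z
  have h2 : HasDerivAt (fun t : ℝ => f (z + t • v)) (fderiv ℝ f z v) 0 := by
    have := hd.hasFDerivAt
    rw [show z = z + (0:ℝ) • v by simp] at this
    have h9 := this.comp_hasDerivAt (0:ℝ) hc
    rw [show z + (0:ℝ) • v = z by simp] at h9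
    exact h9
  have h3 := h2.tendsto_slope_zero_right.eventually (gt_mem_nhds hv)
  have h4 : ∀ᶠ t : ℝ in 𝓝[>] 0, z + t • v ∈ W := by
    have := hc.continuousAt.tendsto
    simp only [zero_smul, add_zero] at this
    exact (this.mono_left nhdsWithin_le_nhds).eventually hW
  obtain ⟨t, h5, h6, h7⟩ := (h3.and (h4.and self_mem_nhdsWithin)).exists
  have h7' : (0:ℝ) < t := h7
  refine ⟨_, h6, ?_⟩
  simp only [zero_add, zero_smul, add_zero, h0, sub_zero, smul_eq_mul] at h5
  by_contra hcc
  push Not at hcc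
  have : 0 ≤ t⁻¹ * f (z + t • v) := by positivity
  linarith

theorem exists_geo {D : Set (EN N)} (hD : StrictlyPseudoconvex D) : ∃ r V c δ, Geo D r V c δ := by
  obtain ⟨ρ, ⟨hDo, hDc⟩, hDb, ⟨V, hV, hcl, hρ, hDeq, hgr⟩, hlev⟩ := hD
  have hρat : ∀ z ∈ V, ContDiffAt ℝ 2 ρ z := fun z hz => hρ.contDiffAt (hV.mem_nhds hz)
  have hDmem : ∀ z ∈ V, (z ∈ D ↔ ρ z < 0) := fun z hz => by
    rw [hDeq]; exact ⟨fun h => h.2, fun h => ⟨hz, h⟩⟩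
  have hfV : frontier D ⊆ V := frontier_subset_closure.trans hcl
  have hccpt : IsCompact (closure D) := hDb.isCompact_closure
  have hfcpt : IsCompact (frontier D) := hccpt.of_isClosed_subset isClosed_frontier frontier_subset_closure
  have hcle : ∀ z ∈ closure D, ρ z ≤ 0 := by
    intro z hz
    have h1 : (𝓝[D] z).NeBot := mem_closure_iff_nhdsWithin_neBot.1 hz
    refine le_of_tendsto ((hρat z (hcl hz)).continuousAt.tendsto.mono_left (nhdsWithin_le_nhds (s := D))) ?_
    filter_upwards [self_mem_nhdsWithin] with y hy
    exact ((hDmem y (hcl (subset_closure hy))).1 hy).le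
  have hf0 : ∀ p ∈ frontier D, ρ p = 0 := by
    intro p hp
    refine le_antisymm (hcle p (frontier_subset_closure hp)) ?_
    by_contra hc
    push Not at hc
    have : p ∈ D := (hDmem p (hfV hp)).2 hc
    rw [hDo.frontier_eq] at hp
    exact hp.2 this
  -- choose K
  have hHc := continuousOn_hess hV hρ
  have hdc := continuousOn_fderiv' hV hρ
  set S : Set (EN N × EN N) := frontier D ×ˢ sphere 0 1 with hS
  have hScpt : IsCompact S := hfcpt.prod (isCompact_sphere _ _)
  have hH1 : ContinuousOn (fun q : EN N × EN N => fderiv ℝ (fderiv ℝ ρ) q.1) S :=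
    hHc.comp continuousOn_fst fun q hq => hfV hq.1
  have hd1 : ContinuousOn (fun q : EN N × EN N => fderiv ℝ ρ q.1) S :=
    hdc.comp continuousOn_fst fun q hq => hfV hq.1
  have hI : Continuous fun q : EN N × EN N => Complex.I • q.2 := by fun_prop
  have hac : ContinuousOn (fun q : EN N × EN N => LeviForm ρ q.1 q.2) S := by
    unfold LeviForm Hess
    exact (((hH1.clm_apply continuousOn_snd).clm_apply continuousOn_snd).add
      ((hH1.clm_apply hI.continuousOn).clm_apply hI.continuousOn)).div_const 4
  have hbc : ContinuousOn (fun q : EN N × EN N => ((fderiv ℝ ρ q.1 q.2)^2 + (fderiv ℝ ρ q.1 (Complex.I • q.2))^2)/4) S :=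
    (((hd1.clm_apply continuousOn_snd).pow 2).add ((hd1.clm_apply hI.continuousOn).pow 2)).div_const 4
  obtain ⟨K, hK, hKpos⟩ := exists_K hScpt hac hbc (fun q _ => by positivity) (by
    rintro ⟨p, w⟩ ⟨hp, hw⟩ h0
    simp only at h0 hp hw ⊢
    have h1 : (fderiv ℝ ρ p w)^2 + (fderiv ℝ ρ p (Complex.I • w))^2 = 0 := by linarith
    have h2 : fderiv ℝ ρ p w = 0 := by nlinarith [sq_nonneg (fderiv ℝ ρ p w), sq_nonneg (fderiv ℝ ρ p (Complex.I • w))]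
    have h3 : fderiv ℝ ρ p (Complex.I • w) = 0 := by nlinarith [sq_nonneg (fderiv ℝ ρ p w), sq_nonneg (fderiv ℝ ρ p (Complex.I • w))]
    refine hlev p hp w ?_ ⟨h2, h3⟩
    rintro rfl; simp at hw)
  set h : ℝ → ℝ := fun t => Real.exp (K * t) - 1 with hh
  have hh1 : ∀ t, HasDerivAt h (K * Real.exp (K * t)) t := by
    intro t
    have := (((hasDerivAt_id t).const_mul K).exp).sub_const 1
    simpa [h, mul_comm] using this
  have hh2 : ∀ t, HasDerivAt (fun t => K * Real.exp (K * t)) (K * (K * Real.exp (K * t))) t := by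
    intro t
    have := (((hasDerivAt_id t).const_mul K).exp).const_mul K
    simpa [mul_comm, mul_assoc, mul_left_comm] using this
  set r : EN N → ℝ := fun z => h (ρ z) with hr
  have hrC : ContDiffOn ℝ 2 r V := by
    have : ContDiff ℝ 2 h := by unfold h; fun_prop
    exact this.comp_contDiffOn hρ
  have hrneg : ∀ z, r z < 0 ↔ ρ z < 0 := by
    intro z
    simp only [hr, hh, sub_neg, Real.exp_lt_one_iff]
    constructor
    · intro hx; by_contra hc; push Not at hc; have := mul_nonneg hK.le hc; linarith
    · intro hx; nlinarith
  have hrpos : ∀ z, r z ≤ 0 ↔ ρ z ≤ 0 := by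
    intro z
    simp only [hr, hh, sub_nonpos, Real.exp_le_one_iff]
    constructor
    · intro hx; by_contra hc; push Not at hc; have := mul_pos hK hc; linarith
    · intro hx; nlinarith
  have hrlev : ∀ q ∈ S, 0 < LeviForm r q.1 q.2 := by
    rintro ⟨p, w⟩ hq
    have h1 := hKpos _ hq
    simp only at h1 ⊢
    rw [hr, LeviForm_comp (hρat p (hfV hq.1)) (Eventually.of_forall hh1) (hh2 _), hf0 p hq.1]
    simp only [mul_zero, Real.exp_zero, mul_one]
    have := mul_pos hK h1
    nlinarith
  have hrgrad : ∀ p ∈ V, fderiv ℝ r p = (K * Real.exp (K * ρ p)) • fderiv ℝ ρ p := by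
    intro p hp
    exact ((hh1 (ρ p)).comp_hasFDerivAt p ((hρat p hp).differentiableAt (by norm_num)).hasFDerivAt).fderiv
  have hrgrad' : ∀ p ∈ frontier D, fderiv ℝ r p ≠ 0 := by
    intro p hp
    rw [hrgrad p (hfV hp)]
    exact smul_ne_zero (by positivity) (hgr p hp)
  -- lower bound c0
  have hrH := continuousOn_hess hV hrC
  have hrd := continuousOn_fderiv' hV hrC
  have hH1' : ContinuousOn (fun q : EN N × EN N => fderiv ℝ (fderiv ℝ r) q.1) S :=
    hrH.comp continuousOn_fst fun q hq => hfV hq.1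
  have hac' : ContinuousOn (fun q : EN N × EN N => LeviForm r q.1 q.2) S := by
    unfold LeviForm Hess
    exact (((hH1'.clm_apply continuousOn_snd).clm_apply continuousOn_snd).add
      ((hH1'.clm_apply hI.continuousOn).clm_apply hI.continuousOn)).div_const 4
  obtain ⟨c0, hc0, hc0'⟩ : ∃ c0 > 0, ∀ q ∈ S, c0 ≤ LeviForm r q.1 q.2 := by
    rcases S.eq_empty_or_nonempty with he | hne
    · exact ⟨1, one_pos, fun q hq => by simp [he] at hq⟩
    · obtain ⟨q0, hq0, hmin⟩ := hScpt.exists_isMinOn hne hac'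
      exact ⟨_, hrlev q0 hq0, fun q hq => hmin hq⟩
  have hc1 : ∀ p ∈ frontier D, ∀ w, c0 * ‖w‖^2 ≤ LeviForm r p w := by
    intro p hp w
    rcases eq_or_ne w 0 with rfl | hw
    · simp [LeviForm, Hess]
    · have hn : 0 < ‖w‖ := norm_pos_iff.2 hw
      have := hc0' (p, ‖w‖⁻¹ • w) ⟨hp, by simp [norm_smul, hn.ne']⟩
      have e : LeviForm r p (‖w‖⁻¹ • w) = (‖w‖^2)⁻¹ * LeviForm r p w := by
        simp only [LeviForm, Hess, smul_comm Complex.I, map_smul, smul_apply, smul_eq_mul]; field_simp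
      simp only [e] at this
      rw [← div_eq_inv_mul, le_div_iff₀ (by positivity)] at this
      exact this
  -- good neighbourhood
  set W : Set (EN N) := {z ∈ V | fderiv ℝ ρ z ≠ 0 ∧ ∃ p ∈ frontier D, ‖fderiv ℝ (fderiv ℝ r) z - fderiv ℝ (fderiv ℝ r) p‖ < c0/2} with hW
  have hWo : IsOpen W := by
    have : W = (V ∩ fderiv ℝ ρ ⁻¹' {0}ᶜ) ∩ ⋃ p ∈ frontier D, V ∩ (fun z => ‖fderiv ℝ (fderiv ℝ r) z - fderiv ℝ (fderiv ℝ r) p‖) ⁻¹' (Iio (c0/2)) := by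
      ext z
      simp only [hW, mem_setOf_eq, mem_inter_iff, mem_preimage, mem_compl_iff, mem_singleton_iff, mem_iUnion, exists_prop, mem_Iio]
      constructor
      · rintro ⟨a, b, p, hp, hh⟩; exact ⟨⟨a, b⟩, p, hp, a, hh⟩
      · rintro ⟨⟨a, b⟩, p, hp, _, hh⟩; exact ⟨a, b, p, hp, hh⟩
    rw [this]
    refine (hdc.isOpen_inter_preimage hV isOpen_compl_singleton).inter (isOpen_biUnion fun p _ => ?_)
    exact isOpen_norm_lt (F := EN N →L[ℝ] EN N →L[ℝ] ℝ) hrH hV _ _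
  have hWf : frontier D ⊆ W := fun p hp => ⟨hfV hp, hgr p hp, p, hp, norm_sub_self_lt (F := EN N →L[ℝ] EN N →L[ℝ] ℝ) _ (half_pos hc0)⟩
  have hWlev : ∀ z ∈ W, ∀ w, c0/2 * ‖w‖^2 ≤ LeviForm r z w := by
    rintro z ⟨_, _, p, hp, hlt⟩ w
    have h1 := hc1 p hp w
    have h2 := levi_abs_le (fderiv ℝ (fderiv ℝ r) z - fderiv ℝ (fderiv ℝ r) p) w
    have h3 : LeviForm r z w - LeviForm r p w = ((fderiv ℝ (fderiv ℝ r) z - fderiv ℝ (fderiv ℝ r) p) w w +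
      (fderiv ℝ (fderiv ℝ r) z - fderiv ℝ (fderiv ℝ r) p) (Complex.I • w) (Complex.I • w))/4 := by
      simp [LeviForm, Hess]; ring
    rw [← h3] at h2
    have h4 := (abs_le.1 h2).1
    have h5 : ‖fderiv ℝ (fderiv ℝ r) z - fderiv ℝ (fderiv ℝ r) p‖ * ‖w‖^2 ≤ c0/2 * ‖w‖^2 := by gcongr
    linarith
  have hWcl : ∀ z ∈ D ∪ W, ρ z ≤ 0 → z ∈ closure D := by
    rintro z (hz | hz) h0
    · exact subset_closure hz
    · rcases h0.lt_or_eq with h0 | h0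
      · exact subset_closure ((hDmem z hz.1).2 h0)
      · rw [mem_closure_iff_nhds]
        intro t ht
        obtain ⟨y, hy, hy2⟩ := exists_neg_near ((hρat z hz.1).differentiableAt (by norm_num)) h0 hz.2.1
          (inter_mem ht (hV.mem_nhds hz.1))
        exact ⟨y, hy.1, (hDmem y hy.2).2 hy2⟩
  have hclDW : closure D ⊆ D ∪ W := by
    intro z hz
    by_cases h : z ∈ D
    · exact Or.inl h
    · exact Or.inr (hWf (by rw [hDo.frontier_eq]; exact ⟨hz, h⟩))
  obtain ⟨ε, hε, hεsub⟩ := hccpt.exists_cthickening_subset_open (hDo.union hWo) hclDW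
  set Kc := cthickening ε (closure D)
  set V1 := thickening ε (closure D)
  have hKcpt : IsCompact Kc := hccpt.cthickening
  have hV1K : V1 ⊆ Kc := thickening_subset_cthickening _ _
  have hKV : Kc ⊆ V := hεsub.trans (union_subset (subset_closure.trans hcl) fun z hz => hz.1)
  have hrc : ContinuousOn r Kc := hrC.continuousOn.mono hKV
  have hclV1 : closure D ⊆ V1 := self_subset_thickening hε _
  obtain ⟨m, hm, hm'⟩ : ∃ m > 0, ∀ z ∈ Kc \ V1, m ≤ r z := by
    rcases (Kc \ V1).eq_empty_or_nonempty with he | hne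
    · exact ⟨1, one_pos, fun q hq => by simp [he] at hq⟩
    · obtain ⟨q0, hq0, hmin⟩ := (hKcpt.diff isOpen_thickening).exists_isMinOn hne (hrc.mono diff_subset)
      refine ⟨r q0, ?_, fun q hq => hmin hq⟩
      by_contra hc
      exact hq0.2 (hclV1 (hWcl q0 (hεsub hq0.1) ((hrpos _).1 (not_lt.1 hc))))
  obtain ⟨m2, hm2, hm2'⟩ : ∃ m2 > 0, ∀ z ∈ Kc \ W, r z ≤ -m2 := by
    rcases (Kc \ W).eq_empty_or_nonempty with he | hne
    · exact ⟨1, one_pos, fun q hq => by simp [he] at hq⟩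
    · obtain ⟨q0, hq0, hmin⟩ := (hKcpt.diff hWo).exists_isMaxOn hne (hrc.mono diff_subset)
      refine ⟨-r q0, ?_, fun q hq => by simpa using hmin hq⟩
      have : q0 ∈ D := by
        rcases hεsub hq0.1 with h | h
        · exact h
        · exact absurd h hq0.2
      have := (hrneg q0).2 ((hDmem q0 (hKV hq0.1)).1 this)
      linarith
  have hmm : 0 < min m m2 := lt_min hm hm2
  have hcD' : ∀ z ∈ V1, (z ∈ closure D ↔ r z ≤ 0) := fun z hz =>
    ⟨fun h => (hrpos z).2 (hcle z h), fun h => hWcl z (hεsub (hV1K hz)) ((hrpos z).1 h)⟩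
  have hD' : ∀ z ∈ V1, (z ∈ D ↔ r z < 0) := fun z hz => (hDmem z (hKV (hV1K hz))).trans (hrneg z).symm
  refine ⟨r, V1, c0/2, min m m2 / 4, hDo, hDb, isOpen_thickening, hclV1, hrC.mono (hV1K.trans hKV), hD', hcD', ?_, ?_, by positivity,
    by positivity, ?_, hrgrad'⟩
  · intro z hz
    rw [hDo.frontier_eq, mem_diff, hcD' z hz, hD' z hz]
    exact ⟨fun h => le_antisymm h.1 (not_lt.1 h.2), fun h => ⟨h.le, by simp [h]⟩⟩
  · intro s hs
    have hsm : s < m := by have := min_le_left m m2; linarith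
    have : {z ∈ V1 | r z ≤ s} = Kc ∩ r ⁻¹' Iic s := by
      ext z
      constructor
      · exact fun h => ⟨hV1K h.1, h.2⟩
      · intro h
        refine ⟨?_, h.2⟩
        by_contra hc
        have h1 := hm' z ⟨h.1, hc⟩
        have h2 : r z ≤ s := h.2
        linarith
    rw [this]
    obtain ⟨u, hu, he⟩ := (continuousOn_iff_isClosed.1 hrc) (Iic s) isClosed_Iic
    rw [inter_comm, he, inter_comm]; exact hKcpt.inter_right hu
  · intro z hz hz2 w
    refine hWlev z ?_ w
    by_contra hc
    have h1 := hm2' z ⟨hV1K hz, hc⟩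
    have h2 := (abs_le.1 hz2).1
    have := min_le_right m m2
    linarith
end DFW
end

open Set Filter Topology Metric MeasureTheory
open scoped ENNReal NNReal InnerProductSpace ComplexConjugate
noncomputable section
namespace DFW
variable {N : ℕ} {μ : Measure (EN N)} [μ.IsAddHaarMeasure]

lemma smoothTransition_deriv_bound : ∃ M > (0:ℝ), (∀ t, |deriv Real.smoothTransition t| ≤ M) ∧
    ∀ t, (t < 0 ∨ 1 < t) → deriv Real.smoothTransition t = 0 := by
  have hz : ∀ t, (t < 0 ∨ 1 < t) → deriv Real.smoothTransition t = 0 := by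
    rintro t (ht | ht)
    · have : Real.smoothTransition =ᶠ[𝓝 t] fun _ => 0 := by
        filter_upwards [Iio_mem_nhds ht] with s hs using Real.smoothTransition.zero_of_nonpos (le_of_lt hs)
      rw [this.deriv_eq]; simp
    · have : Real.smoothTransition =ᶠ[𝓝 t] fun _ => 1 := by
        filter_upwards [Ioi_mem_nhds ht] with s hs using Real.smoothTransition.one_of_one_le (le_of_lt hs)
      rw [this.deriv_eq]; simp
  have hc : Continuous (deriv Real.smoothTransition) :=
    (Real.smoothTransition.contDiff (n := 1)).continuous_deriv (by norm_num)
  obtain ⟨M, hM⟩ := (isCompact_Icc (a := (0:ℝ)) (b := 1)).exists_bound_of_continuousOn hc.continuousOn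
  refine ⟨|M| + 1, by positivity, fun t => ?_, hz⟩
  by_cases ht : t ∈ Icc (0:ℝ) 1
  · have := hM t ht
    rw [Real.norm_eq_abs] at this
    have := le_abs_self M; linarith
  · rw [hz t (by rw [mem_Icc, not_and_or] at ht; rcases ht with h | h <;> [left; right] <;> linarith)]
    simp; positivity

set_option maxHeartbeats 1000000 in
theorem dbar_geo {D : Set (EN N)} {r : EN N → ℝ} {V : Set (EN N)} {c δ : ℝ} (hg : Geo D r V c δ)
    {U : Set (EN N)} (hUdef : U = {z ∈ V | r z < δ})
    {ω : Fin N → EN N → ℂ} (hωc : ∀ j, ContinuousOn (ω j) U) {Cω : ℝ} (hωb : ∀ j, ∀ z ∈ U, ‖ω j z‖ ≤ Cω)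
    (hcl : ∀ b ∈ Tst U, ∀ j k, ∫ z, ω j z * db k b z ∂μ = ∫ z, ω k z * db j b z ∂μ) :
    ∃ u : EN N → ℂ, LocallyIntegrableOn u U μ ∧
      ∀ b ∈ Tst U, ∀ i, ∫ z, u z * db i b z ∂μ = - ∫ z, ω i z * b z ∂μ := by
  have hδ := hg.dpos
  have hc := hg.cpos
  have hU : IsOpen U := by
    rw [hUdef]; exact hg.c2.continuousOn.isOpen_inter_preimage hg.oV isOpen_Iio
  have hUV : U ⊆ V := by rw [hUdef]; exact fun z hz => hz.1
  have hUr : ∀ z ∈ U, r z < δ := by rw [hUdef]; exact fun z hz => hz.2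
  have hrat : ∀ z ∈ U, ContDiffAt ℝ 2 r z := fun z hz => hg.c2.contDiffAt (hg.oV.mem_nhds (hUV hz))
  have hrd : ∀ z ∈ U, DifferentiableAt ℝ r z := fun z hz => (hrat z hz).differentiableAt (by norm_num)
  have hKc : IsCompact {z ∈ V | r z ≤ δ} := hg.cpt δ (by linarith)
  have hUK : U ⊆ {z ∈ V | r z ≤ δ} := fun z hz => ⟨hUV hz, (hUr z hz).le⟩
  obtain ⟨G, hG⟩ := hKc.exists_bound_of_continuousOn ((continuousOn_fderiv' hg.oV hg.c2).mono (sep_subset V _))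
  obtain ⟨CH, hCH⟩ := hKc.exists_bound_of_continuousOn (E := EN N →L[ℝ] EN N →L[ℝ] ℝ) ((continuousOn_hess hg.oV hg.c2).mono (sep_subset V _))
  obtain ⟨M, hM, hMb, hMz⟩ := smoothTransition_deriv_bound
  set C1 : ℝ := Real.log (N * (2 * G * M)^2 + 1) with hC1
  have hC1e : Real.exp C1 = N * (2 * G * M)^2 + 1 := Real.exp_log (by positivity)
  set C2 : ℝ := 2 * (N * (2 * G)^2 + Real.exp C1) with hC2
  have hC2p : 0 < C2 := by positivity
  set B : ℝ := C2 / c with hB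
  have hBp : 0 < B := by positivity
  set A : ℝ := (B * |CH| + C2) / δ^2 with hA
  have hAp : 0 < A := by positivity
  set φ : EN N → ℝ := fun z => A * ‖z‖^2 + B * (δ - r z)⁻¹ with hφ
  set ψ : EN N → ℝ := fun z => -2 * Real.log (δ - r z) + C1 with hψ
  have hτ : ∀ z ∈ U, 0 < δ - r z := fun z hz => by have := hUr z hz; linarith
  have hτc : ContDiffOn ℝ 2 (fun z => δ - r z) U := contDiffOn_const.sub (hg.c2.mono hUV)
  have hinv : ContDiffOn ℝ 2 (fun z => (δ - r z)⁻¹) U := hτc.inv fun z hz => (hτ z hz).ne'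
  have hφc : ContDiffOn ℝ 2 φ U :=
    (contDiffOn_const.mul (contDiff_norm_sq ℂ).contDiffOn).add (contDiffOn_const.mul hinv)
  have hψc : ContDiffOn ℝ 2 ψ U :=
    (contDiffOn_const.mul (hτc.log fun z hz => (hτ z hz).ne')).add contDiffOn_const
  have hψe : ∀ z ∈ U, Real.exp (ψ z) = Real.exp C1 * ((δ - r z)⁻¹)^2 := by
    intro z hz
    rw [hψ]; simp only
    rw [Real.exp_add, show -2 * Real.log (δ - r z) = -Real.log (δ - r z) + -Real.log (δ - r z) by ring,
      Real.exp_add, Real.exp_neg, Real.exp_log (hτ z hz)]; ring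
  have hψd : ∀ z ∈ U, ‖fderiv ℝ ψ z‖ ≤ 2 * G * (δ - r z)⁻¹ := by
    intro z hz
    have h1 : HasFDerivAt ψ _ z := (((((hrd z hz).hasFDerivAt).const_sub δ).log (hτ z hz).ne').const_mul (-2)).add_const C1
    rw [h1.fderiv, norm_smul, norm_smul, norm_neg, norm_inv, Real.norm_of_nonneg (hτ z hz).le]
    have h2 := hG z (hUK hz)
    have h3 : 0 < (δ - r z)⁻¹ := inv_pos.2 (hτ z hz)
    norm_num
    nlinarith
  have hL : ∀ z ∈ U, LeviBound φ ψ z := by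
    intro z hz w
    have hsum : ∑ j, ‖w j‖^2 = ‖(WithLp.toLp 2 w : EN N)‖^2 := by rw [EuclideanSpace.norm_sq_eq]
    have hlev := levi_eq (hφc.contDiffAt (hU.mem_nhds hz)) (WithLp.toLp 2 w : EN N)
    simp only at hlev
    rw [hlev, hsum]
    set W : EN N := WithLp.toLp 2 w
    have hti : 0 < (δ - r z)⁻¹ := inv_pos.2 (hτ z hz)
    set ti := (δ - r z)⁻¹ with htidef
    have h1 : ∑ j, ‖dz j (cx ψ) z‖^2 ≤ N * (2 * G * ti)^2 := by
      calc _ ≤ ∑ j : Fin N, (2 * G * ti)^2 := by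
            refine Finset.sum_le_sum fun j _ => ?_
            refine (dz_cx_normSq_le ((hψc.contDiffAt (hU.mem_nhds hz)).differentiableAt (by norm_num)) j).trans ?_
            have := hψd z hz
            gcongr
        _ = _ := by simp
    have h2 : 2 * (∑ j, ‖dz j (cx ψ) z‖^2 + Real.exp (ψ z)) ≤ C2 * ti^2 := by
      rw [hψe z hz, hC2]; nlinarith
    have h3 : LeviForm φ z W = A * ‖W‖^2 + B * (ti^2 * LeviForm r z W
        + 2 * ti^3 * ((fderiv ℝ r z W)^2 + (fderiv ℝ r z (Complex.I • W))^2)/4) := by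
      rw [hφ, LeviForm_add (contDiffAt_const.mul (contDiff_norm_sq ℂ).contDiffAt)
        (contDiffAt_const.mul (hinv.contDiffAt (hU.mem_nhds hz))),
        LeviForm_smul (contDiff_norm_sq ℂ).contDiffAt, LeviForm_smul (hinv.contDiffAt (hU.mem_nhds hz)), LeviForm_normSq]
      congr 2
      have hh1 : ∀ᶠ t in 𝓝 (r z), HasDerivAt (fun t => (δ - t)⁻¹) (((δ - t)⁻¹)^2) t := by
        filter_upwards [Iio_mem_nhds (hUr z hz)] with t ht
        have : δ - t ≠ 0 := by have : t < δ := ht; linarith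
        have := ((hasDerivAt_id t).const_sub δ).inv this
        rw [show ((δ - t)⁻¹)^2 = -(-1) / (δ - t)^2 by rw [inv_pow]; simp]
        exact this
      have hh2 : HasDerivAt (fun t => ((δ - t)⁻¹)^2) (2 * ti^3) (r z) := by
        have := ((hh1.self_of_nhds).pow 2)
        rw [show 2 * ti^3 = (2:ℕ) * ((δ - r z)⁻¹)^(2-1) * ((δ - r z)⁻¹)^2 by push_cast; rw [pow_one, htidef, mul_assoc, ← pow_succ']]
        exact this
      have := LeviForm_comp (hrat z hz) hh1 hh2 W
      rw [this]
    rw [h3]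
    have hpos : 0 ≤ 2 * ti^3 * ((fderiv ℝ r z W)^2 + (fderiv ℝ r z (Complex.I • W))^2)/4 := by positivity
    have h4 : 2 * (∑ j, ‖dz j (cx ψ) z‖^2 + Real.exp (ψ z)) * ‖W‖^2 ≤ C2 * ti^2 * ‖W‖^2 := by gcongr
    refine h4.trans ?_
    by_cases hr0 : 0 ≤ r z
    · have h5 := hg.levi z (hUV hz) (by rw [abs_of_nonneg hr0]; have := hUr z hz; linarith) W
      have h6 : B * (ti^2 * (c * ‖W‖^2)) ≤ B * (ti^2 * LeviForm r z W) := by gcongr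
      have h7 : B * c = C2 := by rw [hB]; field_simp
      have h8 : B * (ti^2 * (c * ‖W‖^2)) = C2 * ti^2 * ‖W‖^2 := by rw [← h7]; ring
      have h9 : 0 ≤ A * ‖W‖^2 := by positivity
      have := mul_nonneg hBp.le hpos
      linarith
    · push Not at hr0
      have h5 : ti ≤ δ⁻¹ := by rw [htidef]; gcongr; linarith
      have h6 : |LeviForm r z W| ≤ |CH| * ‖W‖^2 := by
        refine (levi_abs_le _ W).trans ?_
        have h6' := hCH z (hUK hz)
        have := le_abs_self CH
        have h66 := h6'.trans this
        gcongr
      have h7 := (abs_le.1 h6).1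
      have h8 : ti^2 ≤ (δ⁻¹)^2 := by gcongr
      have hAe : A * ‖W‖^2 = (B * |CH| + C2) * (δ⁻¹)^2 * ‖W‖^2 := by rw [hA]; field_simp
      have h9 : (B * |CH| + C2) * ti^2 * ‖W‖^2 ≤ A * ‖W‖^2 := by rw [hAe]; gcongr
      have h10 : B * (ti^2 * (-(|CH| * ‖W‖^2))) ≤ B * (ti^2 * LeviForm r z W) := by gcongr
      have := mul_nonneg hBp.le hpos
      linarith
  -- cutoffs
  set η : ℕ → EN N → ℝ := fun n => U.indicator fun z => Real.smoothTransition ((n+1) * (δ - r z) - 1) with hη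
  have hKn : ∀ n : ℕ, tsupport (η n) ⊆ {z ∈ V | r z ≤ δ - 1/((n:ℝ)+1)} := by
    intro n
    refine closure_minimal ?_ (hg.cpt _ (by have : (0:ℝ) < 1/((n:ℝ)+1) := by positivity
                                            linarith)).isClosed
    intro z hz
    have hzU : z ∈ U := by
      by_contra hc; exact hz (by simp [hη, hc])
    refine ⟨hUV hzU, ?_⟩
    by_contra hcc
    push Not at hcc
    apply hz
    simp only [hη, indicator_of_mem hzU]
    apply Real.smoothTransition.zero_of_nonpos
    have : δ - r z < 1/((n:ℝ)+1) := by linarith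
    rw [lt_div_iff₀ (by positivity)] at this
    linarith
  have hKU : ∀ n : ℕ, {z ∈ V | r z ≤ δ - 1/((n:ℝ)+1)} ⊆ U := by
    intro n z hz
    rw [hUdef]
    refine ⟨hz.1, lt_of_le_of_lt hz.2 ?_⟩
    have : (0:ℝ) < 1/((n:ℝ)+1) := by positivity
    linarith
  have hηU : ∀ n, ∀ z ∈ U, η n =ᶠ[𝓝 z] fun z => Real.smoothTransition ((n+1) * (δ - r z) - 1) := by
    intro n z hz
    filter_upwards [hU.mem_nhds hz] with y hy
    simp [hη, hy]
  have hcut : Cutoffs U ψ η := by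
    refine ⟨fun n => ?_, fun n => ?_, fun n => (hKn n).trans (hKU n), fun n z => ?_, fun n z hz => ?_, fun z hz => ?_⟩
    · refine contDiff_of_tsupport_subset hU (fun z hz => ?_) ((hKn n).trans (hKU n))
      have h1 : ContDiffAt ℝ 2 (fun z => Real.smoothTransition ((n+1) * (δ - r z) - 1)) z :=
        (Real.smoothTransition.contDiff (n := 2)).contDiffAt.comp z
          ((contDiffAt_const.mul (contDiffAt_const.sub (hrat z hz))).sub contDiffAt_const)
      exact (h1.congr_of_eventuallyEq (hηU n z hz)).contDiffWithinAt
    · refine (hg.cpt (δ - 1/((n:ℝ)+1)) ?_).of_isClosed_subset (isClosed_tsupport _) (hKn n)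
      have : (0:ℝ) < 1/((n:ℝ)+1) := by positivity
      linarith
    · by_cases hz : z ∈ U
      · simp only [hη, indicator_of_mem hz]
        exact ⟨Real.smoothTransition.nonneg _, Real.smoothTransition.le_one _⟩
      · simp [hη, hz]
    · have hS : HasDerivAt Real.smoothTransition (deriv Real.smoothTransition ((n+1) * (δ - r z) - 1)) ((n+1) * (δ - r z) - 1) :=
        ((Real.smoothTransition.contDiff (n := 1)).differentiable (by norm_num)).differentiableAt.hasDerivAt
      have h1 : HasFDerivAt (fun z => Real.smoothTransition ((n+1) * (δ - r z) - 1)) _ z :=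
        HasDerivAt.comp_hasFDerivAt (h₂ := Real.smoothTransition) z hS (((((hrd z hz).hasFDerivAt).const_sub δ).const_mul ((n:ℝ)+1)).sub_const 1)
      have h2 := h1.congr_of_eventuallyEq (hηU n z hz)
      have hti : 0 < (δ - r z)⁻¹ := inv_pos.2 (hτ z hz)
      have h3 : ‖fderiv ℝ (η n) z‖ ≤ 2 * G * M * (δ - r z)⁻¹ := by
        rw [h2.fderiv, norm_smul, norm_smul, norm_neg]
        have hGz := hG z (hUK hz)
        have hG0 : 0 ≤ G := (norm_nonneg _).trans hGz
        by_cases h5 : ((n:ℝ)+1) * (δ - r z) - 1 < 0 ∨ 1 < ((n:ℝ)+1) * (δ - r z) - 1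
        · rw [hMz _ h5, norm_zero, zero_mul]; positivity
        · push Not at h5
          have h6 : ((n:ℝ)+1) ≤ 2 * (δ - r z)⁻¹ := by
            rw [← div_eq_mul_inv, le_div_iff₀ (hτ z hz)]; linarith
          rw [Real.norm_of_nonneg (by positivity : (0:ℝ) ≤ (n:ℝ)+1)]
          calc _ ≤ M * (2 * (δ - r z)⁻¹ * G) := by gcongr; exact hMb _
            _ = _ := by ring
      calc ∑ j, ‖dz j (cx (η n)) z‖^2 ≤ ∑ j : Fin N, (2 * G * M * (δ - r z)⁻¹)^2 := by
            refine Finset.sum_le_sum fun j _ => ?_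
            refine (dz_cx_normSq_le h2.differentiableAt j).trans ?_
            gcongr
        _ = N * (2 * G * M)^2 * ((δ - r z)⁻¹)^2 := by rw [Finset.sum_const, Finset.card_univ, Fintype.card_fin, nsmul_eq_mul]; ring
        _ ≤ Real.exp (ψ z) := by
            rw [hψe z hz, hC1e]; gcongr; linarith
    · obtain ⟨n0, hn0⟩ := exists_nat_gt (4 / (δ - r z))
      filter_upwards [eventually_ge_atTop n0] with n hn
      have hev : ∀ᶠ y in 𝓝 z, (δ - r z)/2 < δ - r y := by
        have : ContinuousAt (fun y => δ - r y) z := continuousAt_const.sub (hrat z hz).continuousAt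
        exact this.eventually (lt_mem_nhds (by have := hτ z hz; linarith))
      filter_upwards [hηU n z hz, hev] with y hy hy2
      rw [hy]
      apply Real.smoothTransition.one_of_one_le
      have hτz := hτ z hz
      rw [div_lt_iff₀ hτz] at hn0
      have : (n0:ℝ) ≤ n := by exact_mod_cast hn
      nlinarith
  refine dbar_exists hU hφc hψc hL hcut (fun j => ?_) hcl
  have hUb : μ U < ⊤ := (measure_mono hUK).trans_lt hKc.measure_lt_top
  have hfin : IsFiniteMeasure (μ.restrict U) := ⟨by simpa using hUb⟩
  refine MemLp.of_bound (C := Cω * (Real.exp (C1/2) * (2/B))) ?_ ?_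
  · refine ContinuousOn.aestronglyMeasurable ?_ hU.measurableSet
    refine (hωc j).mul (Continuous.comp_continuousOn Complex.continuous_exp ?_)
    exact ((Complex.continuous_ofReal.comp_continuousOn (hφc.continuousOn.sub hψc.continuousOn)).neg).div_const 2
  · rw [ae_restrict_iff' hU.measurableSet]
    refine Eventually.of_forall fun z hz => ?_
    have hω0 : 0 ≤ Cω := (norm_nonneg _).trans (hωb j z hz)
    rw [norm_mul]
    have h1 : ‖Complex.exp (-cx (φ - ψ) z / 2)‖ ≤ Real.exp (C1/2) * (2/B) := by
      have e : -cx (φ - ψ) z / 2 = ((-(φ z - ψ z)/2 : ℝ) : ℂ) := by simp [cx]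
      rw [e, ← Complex.ofReal_exp, Complex.norm_real, Real.norm_of_nonneg (Real.exp_pos _).le]
      have hτz := hτ z hz
      have hx : 0 < B * (δ - r z)⁻¹ / 2 := by positivity
      have e2 : -(φ z - ψ z)/2 ≤ C1/2 + (-Real.log (δ - r z)) + -(B * (δ - r z)⁻¹ / 2) := by
        simp only [hφ, hψ]
        have : 0 ≤ A * ‖z‖^2 := by positivity
        linarith
      refine (Real.exp_le_exp.2 e2).trans ?_
      rw [Real.exp_add, Real.exp_add, Real.exp_neg (Real.log _), Real.exp_log hτz, mul_assoc]
      gcongr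
      have h3 : Real.exp (-(B * (δ - r z)⁻¹ / 2)) ≤ (B * (δ - r z)⁻¹ / 2)⁻¹ := by
        rw [Real.exp_neg]; gcongr
        have := Real.add_one_le_exp (B * (δ - r z)⁻¹ / 2); linarith
      calc _ ≤ (δ - r z)⁻¹ * (B * (δ - r z)⁻¹ / 2)⁻¹ := by gcongr
        _ = 2/B := by field_simp
    exact mul_le_mul (hωb j z hz) h1 (norm_nonneg _) hω0
end DFW
end

open Set Filter Topology Metric MeasureTheory
open scoped ENNReal NNReal InnerProductSpace ComplexConjugate
noncomputable section
namespace DFW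
variable {N : ℕ}

lemma taylor2 {E : Type*} [NormedAddCommGroup E] [NormedSpace ℝ E] {f : E → ℝ} {x : E}
    (hf : ContDiffAt ℝ 2 f x) {ε : ℝ} (hε : 0 < ε) :
    ∀ᶠ z in 𝓝 x, |f z - f x - fderiv ℝ f x (z - x) - fderiv ℝ (fderiv ℝ f) x (z - x) (z - x) / 2|
      ≤ ε * ‖z - x‖^2 := by
  set H := fderiv ℝ (fderiv ℝ f) x with hH
  have hs : ∀ v w, H v w = H w v := fun v w => hf.isSymmSndFDerivAt (by simp) v w
  have hd : HasFDerivAt (fderiv ℝ f) H x :=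
    ((hf.fderiv_right (m := 1) (by norm_num)).differentiableAt (by norm_num)).hasFDerivAt
  have h1 := hd.isLittleO.def hε
  have h2 : ∀ᶠ y in 𝓝 x, DifferentiableAt ℝ f y := by
    filter_upwards [hf.eventually (by simp)] with y hy using hy.differentiableAt (by norm_num)
  obtain ⟨s, hs0, hball⟩ := Metric.eventually_nhds_iff_ball.1 (h1.and h2)
  filter_upwards [ball_mem_nhds x hs0] with z hz
  set g : E → ℝ := fun y => f y - fderiv ℝ f x (y - x) - H (y - x) (y - x) / 2 with hg
  have hsub : closedBall x ‖z - x‖ ⊆ ball x s := closedBall_subset_ball (by rw [← dist_eq_norm]; exact hz)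
  have hder : ∀ y ∈ closedBall x ‖z - x‖, HasFDerivWithinAt g (fderiv ℝ f y - fderiv ℝ f x - H (y - x)) (closedBall x ‖z - x‖) y := by
    intro y hy
    have hid : HasFDerivAt (fun y : E => y - x) (ContinuousLinearMap.id ℝ E) y := (hasFDerivAt_id y).sub_const x
    have e1 : HasFDerivAt (fun y => fderiv ℝ f x (y - x)) ((fderiv ℝ f x).comp (ContinuousLinearMap.id ℝ E)) y :=
      (fderiv ℝ f x).hasFDerivAt.comp y hid
    have e2 : HasFDerivAt (fun y => H (y - x)) (H.comp (ContinuousLinearMap.id ℝ E)) y := H.hasFDerivAt.comp y hid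
    have e3 := (e2.clm_apply hid).mul_const (2:ℝ)⁻¹
    have e4 := (((hball y (hsub hy)).2.hasFDerivAt.sub e1).sub e3).hasFDerivWithinAt (s := closedBall x ‖z - x‖)
    refine e4.congr_fderiv ?_
    ext v
    have h7 := hs v y
    have h8 := hs v x
    simp [h7, h8]; ring
  have hb : ∀ y ∈ closedBall x ‖z - x‖, ‖fderiv ℝ f y - fderiv ℝ f x - H (y - x)‖ ≤ ε * ‖z - x‖ := by
    intro y hy
    refine (hball y (hsub hy)).1.trans ?_
    have : ‖y - x‖ ≤ ‖z - x‖ := by rw [← dist_eq_norm]; exact hy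
    gcongr
  have := (convex_closedBall x ‖z - x‖).norm_image_sub_le_of_norm_hasFDerivWithin_le hder hb
    (mem_closedBall_self (norm_nonneg _)) (mem_closedBall.2 (dist_eq_norm z x).le)
  simp only [hg, sub_self, map_zero, zero_div, sub_zero, Real.norm_eq_abs] at this
  calc _ = |f z - fderiv ℝ f x (z - x) - H (z - x) (z - x) / 2 - f x| := by congr 1; ring
    _ ≤ _ := this
    _ = _ := by ring

/-- `2 ∂r` as a complex linear functional -/
def RL (r : EN N → ℝ) (x : EN N) : EN N →L[ℂ] ℂ :=
  toCLin (Complex.ofRealCLM.comp (fderiv ℝ r x) -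
    Complex.I • Complex.ofRealCLM.comp ((fderiv ℝ r x).comp
      ((Complex.I • ContinuousLinearMap.id ℂ (EN N)).restrictScalars ℝ))) (by
    intro w
    have II : Complex.I • Complex.I • w = -w := by rw [smul_smul, Complex.I_mul_I, neg_one_smul]
    simp [II]
    linear_combination ((fderiv ℝ r x (Complex.I • w) : ℝ) : ℂ) * Complex.I_mul_I)

lemma RL_apply (r : EN N → ℝ) (x w : EN N) :
    RL r x w = (fderiv ℝ r x w : ℂ) - Complex.I * (fderiv ℝ r x (Complex.I • w) : ℂ) := by
  simp [RL, toCLin]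

lemma RL_re (r : EN N → ℝ) (x w : EN N) : (RL r x w).re = fderiv ℝ r x w := by
  rw [RL_apply]; simp

/-- holomorphic second order part -/
def QL (r : EN N → ℝ) (x w : EN N) : ℂ :=
  ((Hess r x w w : ℂ) - (Hess r x (Complex.I • w) (Complex.I • w) : ℂ) - 2 * Complex.I * (Hess r x w (Complex.I • w) : ℂ))/4

lemma QL_re (r : EN N → ℝ) (x w : EN N) : (QL r x w).re = Hess r x w w / 2 - LeviForm r x w := by
  rw [QL, LeviForm]
  rw [show (4:ℂ) = ((4:ℝ):ℂ) by norm_num, Complex.div_ofReal_re]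
  simp; ring

lemma QL_hasFDerivAt {r : EN N → ℝ} {x : EN N} (hr : ContDiffAt ℝ 2 r x) (w : EN N) :
    DifferentiableAt ℂ (QL r x) w ∧ (w = 0 → fderiv ℂ (QL r x) w = 0) := by
  have hs := Hess_symm hr
  unfold Hess at hs
  set H := fderiv ℝ (fderiv ℝ r) x with hH
  let J : EN N →L[ℝ] EN N := (Complex.I • ContinuousLinearMap.id ℂ (EN N)).restrictScalars ℝ
  have hJ : ∀ v, J v = Complex.I • v := fun v => by simp [J]
  have hid : HasFDerivAt (fun y : EN N => y) (ContinuousLinearMap.id ℝ (EN N)) w := hasFDerivAt_id w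
  have hJd : HasFDerivAt (fun y : EN N => J y) J w := J.hasFDerivAt
  have a1 := (H.hasFDerivAt (x := w)).clm_apply hid
  have a2 := (H.hasFDerivAt.comp w hJd).clm_apply hJd
  have a3 := (H.hasFDerivAt (x := w)).clm_apply hJd
  have b1 := Complex.ofRealCLM.hasFDerivAt.comp w a1
  have b2 := Complex.ofRealCLM.hasFDerivAt.comp w a2
  have b3 := (Complex.ofRealCLM.hasFDerivAt.comp w a3).const_mul (2 * Complex.I)
  have b4 := ((b1.sub b2).sub b3).mul_const (4:ℂ)⁻¹
  have hQ : HasFDerivAt (QL r x) _ w := b4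
  set L := fderiv ℝ (QL r x) w with hL
  have hLv : ∀ v, L v = ((H v w : ℂ) + H w v - (H (Complex.I • v) (Complex.I • w) + H (Complex.I • w) (Complex.I • v))
      - 2 * Complex.I * (H v (Complex.I • w) + H w (Complex.I • v)))/4 := by
    intro v
    rw [hL, hQ.fderiv]
    simp [hJ]; ring
  have hc : ∀ v, L (Complex.I • v) = Complex.I • L v := by
    intro v
    have II : Complex.I • Complex.I • v = -v := by rw [smul_smul, Complex.I_mul_I, neg_one_smul]
    have e1 := hs v w
    have e2 := hs (Complex.I • v) w
    have e3 := hs (Complex.I • v) (Complex.I • w)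
    have e4 := hs (Complex.I • w) v
    rw [hLv, hLv, II]
    have n1 : H (-v) (Complex.I • w) = - H v (Complex.I • w) := by rw [map_neg]; rfl
    have n2 : H (Complex.I • w) (-v) = - H (Complex.I • w) v := map_neg _ _
    have n3 : H w (-v) = - H w v := map_neg _ _
    rw [n1, n2, n3, e1, e2, e3, e4]
    simp only [Complex.ofReal_neg, smul_eq_mul]
    linear_combination ((H w (Complex.I • v) : ℂ) + H v (Complex.I • w))/2 * Complex.I_mul_I
  have hd : HasFDerivAt (QL r x) ((toCLin L hc).restrictScalars ℝ) w := by
    have : (toCLin L hc).restrictScalars ℝ = L := by ext v; rfl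
    rw [this]; exact hQ.differentiableAt.hasFDerivAt
  have hd' := hasFDerivAt_of_restrictScalars ℝ hd rfl
  refine ⟨hd'.differentiableAt, fun h0 => ?_⟩
  rw [hd'.fderiv]
  ext v
  change L v = 0
  rw [hLv, h0]; simp

/-- Levi polynomial (with sign) -/
def LP (r : EN N → ℝ) (x z : EN N) : ℂ := -(RL r x (z - x) + QL r x (z - x))

lemma LP_diff {r : EN N → ℝ} {x : EN N} (hr : ContDiffAt ℝ 2 r x) (z : EN N) :
    DifferentiableAt ℂ (LP r x) z :=
  (((RL r x).differentiableAt.comp z (differentiableAt_id.sub_const x)).add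
    (DifferentiableAt.comp (g := QL r x) z (QL_hasFDerivAt hr (z - x)).1 (differentiableAt_id.sub_const x))).neg

lemma LP_self (r : EN N → ℝ) (x : EN N) : LP r x x = 0 := by simp [LP, QL, Hess]

lemma LP_fderiv {r : EN N → ℝ} {x : EN N} (hr : ContDiffAt ℝ 2 r x) :
    HasFDerivAt (LP r x) (-RL r x) x := by
  have h0 : HasFDerivAt (fun z : EN N => z - x) (ContinuousLinearMap.id ℂ (EN N)) x := (hasFDerivAt_id x).sub_const x
  have h1 : HasFDerivAt (fun z => RL r x (z - x)) ((RL r x).comp (ContinuousLinearMap.id ℂ (EN N))) x :=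
    (RL r x).hasFDerivAt.comp x h0
  have hq := QL_hasFDerivAt hr (x - x)
  have h2 : HasFDerivAt (fun z => QL r x (z - x)) ((fderiv ℂ (QL r x) (x - x)).comp (ContinuousLinearMap.id ℂ (EN N))) x :=
    HasFDerivAt.comp (g := QL r x) x hq.1.hasFDerivAt h0
  rw [hq.2 (sub_self x)] at h2
  have h3 : HasFDerivAt (LP r x) _ x := (h1.add h2).neg
  refine h3.congr_fderiv ?_
  ext v; simp

lemma LP_lower {r : EN N → ℝ} {x : EN N} (hr : ContDiffAt ℝ 2 r x) (h0 : r x = 0) {c : ℝ} (hc : 0 < c)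
    (hl : ∀ w, c * ‖w‖^2 ≤ LeviForm r x w) :
    ∀ᶠ z in 𝓝 x, -r z + c/2 * ‖z - x‖^2 ≤ (LP r x z).re := by
  filter_upwards [taylor2 hr (half_pos hc)] with z hz
  have h1 := hl (z - x)
  have h2 : (LP r x z).re = -(fderiv ℝ r x (z - x) + (Hess r x (z - x) (z - x) / 2 - LeviForm r x (z - x))) := by
    rw [LP, Complex.neg_re, Complex.add_re, RL_re, QL_re]
  rw [h2]
  have h3 := (abs_le.1 hz).1
  unfold Hess
  rw [h0] at h3
  linarith
end DFW
end

open Set Filter Topology Metric MeasureTheory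
open scoped ENNReal NNReal InnerProductSpace ComplexConjugate
noncomputable section
namespace DFW
variable {N : ℕ} {μ : Measure (EN N)}

lemma LP_contDiff (r : EN N → ℝ) (x : EN N) : ContDiff ℝ 2 (LP r x) := by
  have h0 : ContDiff ℝ 2 (fun z : EN N => z - x) := contDiff_id.sub contDiff_const
  have h1 : ContDiff ℝ 2 (fun z : EN N => Complex.I • (z - x)) :=
    ((Complex.I • ContinuousLinearMap.id ℂ (EN N)).restrictScalars ℝ).contDiff.comp h0
  have hR : ContDiff ℝ 2 (fun z : EN N => RL r x (z - x)) := ((RL r x).restrictScalars ℝ).contDiff.comp h0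
  have hB : ∀ f g : EN N → EN N, ContDiff ℝ 2 f → ContDiff ℝ 2 g →
      ContDiff ℝ 2 (fun z => (Hess r x (f z) (g z) : ℂ)) := fun f g hf hg =>
    Complex.ofRealCLM.contDiff.comp
      (((fderiv ℝ (fderiv ℝ r) x).contDiff.comp hf).clm_apply hg)
  unfold LP QL
  exact (hR.add ((((hB _ _ h0 h0).sub (hB _ _ h1 h1)).sub
    (contDiff_const.mul (hB _ _ h0 h1))).div_const 4)).neg

lemma Tst.mono {U V : Set (EN N)} {b : EN N → ℂ} (hb : b ∈ Tst U) (h : U ⊆ V) : b ∈ Tst V :=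
  ⟨hb.1, hb.2.1, hb.2.2.trans h⟩

lemma Tst.zero_off {U : Set (EN N)} {b : EN N → ℂ} (hb : b ∈ Tst U) {z : EN N} (hz : z ∉ U) : b z = 0 :=
  image_eq_zero_of_notMem_tsupport fun h => hz (hb.2.2 h)

lemma Tst.db_zero_off {U : Set (EN N)} {b : EN N → ℂ} (hb : b ∈ Tst U) {z : EN N} (hz : z ∉ U) (j) : db j b z = 0 :=
  db_zero_of fun h => hz (hb.2.2 h)

lemma integrable_mul_test {U : Set (EN N)} (hU : IsOpen U) {u c : EN N → ℂ}
    (hu : LocallyIntegrableOn u U μ) (hc : Continuous c) (hcc : HasCompactSupport c) (hs : tsupport c ⊆ U) :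
    Integrable (fun z => u z * c z) μ := by
  have hIntg : IntegrableOn u (tsupport c) μ :=
    (locallyIntegrableOn_iff hU.isLocallyClosed).mp hu _ hs hcc
  have h1 : IntegrableOn (fun z => u z * c z) (tsupport c) μ :=
    hIntg.mul_continuousOn hc.continuousOn hcc
  refine (integrableOn_iff_integrable_of_support_subset ?_).mp h1
  intro z hz
  by_contra h
  exact hz (by simp [image_eq_zero_of_notMem_tsupport h])

lemma db_inv_holo {P : EN N → ℂ} (hP : Differentiable ℂ P) {z : EN N} (hz : P z ≠ 0) (j : Fin N) :
    db j (fun z => (P z)⁻¹) z = 0 :=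
  db_of_differentiableAt ((hP z).inv hz) j

theorem dbar_glue [μ.IsAddHaarMeasure] {U : Set (EN N)} (hU : IsOpen U) {P : EN N → ℂ} (hP : Differentiable ℂ P)
    (hPs : ContDiff ℝ 2 P) {x : EN N} {a m : ℝ} (ha : 0 < a) (hm : 0 < m)
    (hP0 : ∀ z ∈ U, a < dist z x → dist z x < 4*a → P z ≠ 0)
    (hPm : ∀ z ∈ U, 2*a < dist z x → dist z x < 3*a → m ≤ ‖P z‖)
    (solve : ∀ (ω : Fin N → EN N → ℂ) (C : ℝ), (∀ j, ContinuousOn (ω j) U) → (∀ j, ∀ z ∈ U, ‖ω j z‖ ≤ C) →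
      (∀ b ∈ Tst U, ∀ j k, ∫ z, ω j z * db k b z ∂μ = ∫ z, ω k z * db j b z ∂μ) →
      ∃ u, LocallyIntegrableOn u U μ ∧ ∀ b ∈ Tst U, ∀ i, ∫ z, u z * db i b z ∂μ = - ∫ z, ω i z * b z ∂μ) :
    ∃ Gb Gc : EN N → ℂ, DifferentiableOn ℂ Gb (U ∩ ball x (2*a)) ∧ DifferentiableOn ℂ Gc (U \ closedBall x a) ∧
      ∀ z ∈ U, a < dist z x → dist z x < 2*a → Gc z = Gb z - (P z)⁻¹ := by
  obtain ⟨χ, χs, χc, χt, χ1, -⟩ := exists_cutoff (isCompact_closedBall x (2*a)) (isOpen_ball (x := x) (ε := 3*a))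
    (closedBall_subset_ball (by linarith))
  set X := cx χ with hX
  have Xs : ContDiff ℝ 2 X := contDiff_cx (χs.of_le two_le_infty)
  have Xt : tsupport X ⊆ ball x (3*a) := by rw [hX, tsupport_cx]; exact χt
  have Xc : HasCompactSupport X := by
    rw [HasCompactSupport, hX, tsupport_cx]; exact χc
  have XT : X ∈ Tst (univ : Set (EN N)) := ⟨Xs, Xc, subset_univ _⟩
  have X1 : ∀ z ∈ closedBall x (2*a), X =ᶠ[𝓝 z] fun _ => 1 := by
    intro z hz
    filter_upwards [eventually_nhdsSet_iff_forall.1 χ1 z hz] with y hy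
    simp [hX, cx, hy]
  have dX0 : ∀ z ∈ closedBall x (2*a), ∀ j, db j X z = 0 := by
    intro z hz j
    rw [db_congr (X1 z hz)]; simp [db]
  have dXne : ∀ z j, db j X z ≠ 0 → 2*a < dist z x ∧ dist z x < 3*a := by
    intro z j hz
    constructor
    · by_contra h; exact hz (dX0 z (mem_closedBall.2 (not_lt.1 h)) j)
    · by_contra h; exact hz (db_zero_of fun h' => h (mem_ball.1 (Xt h')))
  have dXc : ∀ j, Continuous (db j X) := fun j => continuous_db (Xs.of_le (by norm_num))
  set q : EN N → ℂ := fun z => (P z)⁻¹ with hq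
  have qs : ∀ z, P z ≠ 0 → ContDiffAt ℝ 2 q z := fun z hz => hPs.contDiffAt.inv hz
  set ω : Fin N → EN N → ℂ := fun j z => db j X z * q z with hω
  have hω0 : ∀ z ∈ closedBall x (2*a), ∀ j, ω j z = 0 := fun z hz j => by simp [hω, dX0 z hz j]
  have hωc : ∀ j, ContinuousOn (ω j) U := by
    intro j z hz
    refine ContinuousAt.continuousWithinAt ?_
    by_cases h1 : z ∈ closedBall x (2*a)
    · have : ω j =ᶠ[𝓝 z] fun _ => 0 := by
        filter_upwards [(X1 z h1).eventuallyEq_nhds] with y hy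
        have : db j X y = 0 := by rw [db_congr hy]; simp [db]
        simp [hω, this]
      exact continuousAt_const.congr this.symm
    · by_cases h2 : z ∈ tsupport X
      · have h3 : P z ≠ 0 := hP0 z hz (by have := not_le.1 (fun h => h1 (mem_closedBall.2 h)); linarith)
          (by have := mem_ball.1 (Xt h2); linarith)
        exact (dXc j).continuousAt.mul (qs z h3).continuousAt
      · have : ω j =ᶠ[𝓝 z] fun _ => 0 := by
          filter_upwards [(isClosed_tsupport X).isOpen_compl.mem_nhds h2] with y hy
          simp [hω, db_zero_of hy]
        exact continuousAt_const.congr this.symm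
  have hbd : ∀ j, ∃ C, ∀ z, ‖db j X z‖ ≤ C := fun j => (dXc j).bounded_above_of_compact_support (hcs_db Xc)
  choose C hC using hbd
  have hωb : ∀ j, ∀ z ∈ U, ‖ω j z‖ ≤ ∑ i, |C i| / m := by
    intro j z hz
    have h0 : |C j| / m ≤ ∑ i, |C i| / m :=
      Finset.single_le_sum (f := fun i => |C i| / m) (fun i _ => by positivity) (Finset.mem_univ j)
    refine le_trans ?_ h0
    by_cases h : db j X z = 0
    · simp only [hω, h, zero_mul, norm_zero]; positivity
    · have h1 := dXne z j h
      have h2 := hPm z hz h1.1 h1.2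
      simp only [hω, hq, norm_mul, norm_inv]
      rw [← div_eq_mul_inv]
      exact div_le_div₀ (abs_nonneg _) ((hC j z).trans (le_abs_self _)) hm h2
  have hcl : ∀ b ∈ Tst U, ∀ j k, ∫ z, ω j z * db k b z ∂μ = ∫ z, ω k z * db j b z ∂μ := by
    intro b hb j k
    obtain ⟨κ, κs, κc, κt, κ1, -⟩ := exists_cutoff (K := closedBall x (3*a) \ ball x (2*a)) (U := ball x (4*a) \ closedBall x a)
      ((isCompact_closedBall x (3*a)).diff isOpen_ball) (isOpen_ball.sdiff isClosed_closedBall)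
      (fun z hz => ⟨mem_ball.2 (by have := mem_closedBall.1 hz.1; linarith), fun h => hz.2 (mem_ball.2 (by have := mem_closedBall.1 h; linarith))⟩)
    set g : EN N → ℂ := fun z => cx κ z * q z with hg
    have hgs : ContDiffOn ℝ 2 g U := by
      intro z hz
      refine ContDiffAt.contDiffWithinAt ?_
      by_cases h2 : z ∈ tsupport κ
      · have h3 : P z ≠ 0 := hP0 z hz (by have := (κt h2).2; rw [mem_closedBall, not_le] at this; exact this)
          (mem_ball.1 (κt h2).1)
        exact ((contDiff_cx (κs.of_le two_le_infty)).contDiffAt).mul (qs z h3)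
      · have : g =ᶠ[𝓝 z] fun _ => 0 := by
          filter_upwards [(isClosed_tsupport κ).isOpen_compl.mem_nhds h2] with y hy
          simp [hg, cx, image_eq_zero_of_notMem_tsupport hy]
        exact contDiffAt_const.congr_of_eventuallyEq this
    have hβ := Tst.mul_mem hU hb hgs
    set β : EN N → ℂ := fun z => b z * g z with hβd
    have key : ∀ j k z, ω j z * db k b z = db j X z * db k β z := by
      intro j k z
      by_cases h : db j X z = 0
      · simp [hω, h]
      by_cases hz : z ∈ U
      · have h1 := dXne z j h
        have h3 : P z ≠ 0 := hP0 z hz (by linarith [h1.1]) (by linarith [h1.2])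
        have e : β =ᶠ[𝓝 z] fun z => b z * q z := by
          filter_upwards [eventually_nhdsSet_iff_forall.1 κ1 z ⟨mem_closedBall.2 h1.2.le, fun h => by
            have := mem_ball.1 h; linarith [h1.1]⟩] with y hy
          simp [hβd, hg, cx, hy]
        have e2 : db k (fun z => b z * q z) z = db k b z * q z + b z * db k q z :=
          db_mul (Tst.diff hb z) ((qs z h3).differentiableAt (by norm_num))
        have e3 : db k q z = 0 := db_inv_holo hP h3 k
        rw [db_congr e, e2, e3]
        simp only [hω]; ring
      · rw [Tst.db_zero_off hb hz, Tst.db_zero_off hβ hz]; simp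
    simp_rw [key]
    have := dbar_closed (μ := μ) XT (Tst.mono hβ (subset_univ _)) j k
    exact this
  obtain ⟨u, hu, hub⟩ := solve ω _ hωc hωb hcl
  have oUb : IsOpen (U ∩ ball x (2*a)) := hU.inter isOpen_ball
  have oUc : IsOpen (U \ closedBall x a) := hU.sdiff isClosed_closedBall
  obtain ⟨Gb, dGb, eGb⟩ := weyl (μ := μ) oUb (hu.mono_set inter_subset_left) (by
    intro b hb j
    rw [hub b (Tst.mono hb inter_subset_left) j, neg_eq_zero]
    rw [← integral_zero (EN N) ℂ (μ := μ)]
    congr 1; ext z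
    by_cases hz : z ∈ U ∩ ball x (2*a)
    · rw [hω0 z (ball_subset_closedBall hz.2)]; simp
    · rw [Tst.zero_off hb hz]; simp)
  have hXq : ContDiffOn ℝ 2 (fun z => X z * q z) (U \ closedBall x a) := by
    intro z hz
    refine ContDiffAt.contDiffWithinAt ?_
    by_cases h2 : z ∈ tsupport X
    · have h3 : P z ≠ 0 := hP0 z hz.1 (by have := hz.2; rw [mem_closedBall, not_le] at this; exact this)
        (by have := mem_ball.1 (Xt h2); linarith)
      exact Xs.contDiffAt.mul (qs z h3)
    · have : (fun z => X z * q z) =ᶠ[𝓝 z] fun _ => 0 := by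
        filter_upwards [(isClosed_tsupport X).isOpen_compl.mem_nhds h2] with y hy
        simp [image_eq_zero_of_notMem_tsupport hy]
      exact contDiffAt_const.congr_of_eventuallyEq this
  have hXql : LocallyIntegrableOn (fun z => X z * q z) (U \ closedBall x a) μ :=
    hXq.continuousOn.locallyIntegrableOn oUc.measurableSet
  obtain ⟨Gc, dGc, eGc⟩ := weyl (μ := μ) (u := fun z => u z - X z * q z) oUc ((hu.mono_set diff_subset).sub hXql) (by
    intro b hb j
    have hbU := Tst.mono hb (diff_subset (s := U) (t := closedBall x a))
    have i1 : Integrable (fun z => u z * db j b z) μ :=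
      integrable_mul_test hU hu (continuous_db (Tst.c1 hb)) (hcs_db hb.2.1) (tsupport_db.trans hbU.2.2)
    have i2 : Integrable (fun z => X z * q z * db j b z) μ :=
      integrable_mul_test oUc hXql (continuous_db (Tst.c1 hb)) (hcs_db hb.2.1) (tsupport_db.trans hb.2.2)
    have i3 : Integrable (fun z => ω j z * b z) μ :=
      integrable_mul_test hU ((hωc j).locallyIntegrableOn hU.measurableSet) (Tst.c1 hb).continuous hb.2.1 hbU.2.2
    simp_rw [sub_mul]
    rw [integral_sub i1 i2, hub b hbU j]
    have hβ := Tst.mul_mem oUc hb hXq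
    have h0 := integral_db_zero (μ := μ) (j := j) (Tst.c1 hβ) hβ.2.1
    have e : ∀ z, db j (fun z => b z * (X z * q z)) z = X z * q z * db j b z + ω j z * b z := by
      intro z
      by_cases hz : z ∈ U \ closedBall x a
      · rw [db_mul (Tst.diff hb z) ((hXq.contDiffAt (oUc.mem_nhds hz)).differentiableAt (by norm_num))]
        by_cases h2 : z ∈ tsupport X
        · have h3 : P z ≠ 0 := hP0 z hz.1 (by have := hz.2; rw [mem_closedBall, not_le] at this; exact this)
            (by have := mem_ball.1 (Xt h2); linarith)
          rw [db_mul (Xs.differentiable (by norm_num) z) ((qs z h3).differentiableAt (by norm_num)),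
            db_inv_holo hP h3]
          simp only [hω]; ring
        · have : (fun z => X z * q z) =ᶠ[𝓝 z] fun _ => 0 := by
            filter_upwards [(isClosed_tsupport X).isOpen_compl.mem_nhds h2] with y hy
            simp [image_eq_zero_of_notMem_tsupport hy]
          rw [db_congr this, image_eq_zero_of_notMem_tsupport h2]
          have hc0 : db j (fun _ : EN N => (0:ℂ)) z = 0 := by simp [db]
          simp only [hω, hc0, db_zero_of h2]; ring
      · rw [Tst.db_zero_off hb hz, Tst.db_zero_off hβ hz, Tst.zero_off hb hz]; simp
    simp_rw [e] at h0
    rw [integral_add i2 i3] at h0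
    linear_combination -h0)
  refine ⟨Gb, Gc, dGb, dGc, ?_⟩
  set O := (U ∩ ball x (2*a)) ∩ (U \ closedBall x a) with hO
  have oO : IsOpen O := oUb.inter oUc
  have hP0' : ∀ z ∈ O, P z ≠ 0 := fun z hz => hP0 z hz.1.1
    (by have := hz.2.2; rw [mem_closedBall, not_le] at this; exact this) (by have := mem_ball.1 hz.1.2; linarith)
  have hae : Gc =ᵐ[μ.restrict O] fun z => Gb z - q z := by
    rw [Filter.EventuallyEq, ae_restrict_iff' oO.measurableSet]
    filter_upwards [eGb, eGc] with z h1 h2 hz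
    rw [← h1 hz.1, ← h2 hz.2, (X1 z (ball_subset_closedBall hz.1.2)).eq_of_nhds, one_mul]
  have := Measure.eqOn_open_of_ae_eq hae oO ((dGc.continuousOn).mono inter_subset_right)
    ((dGb.continuousOn.mono inter_subset_left).sub fun z hz => (qs z (hP0' z hz)).continuousAt.continuousWithinAt)
  intro z hz h1 h2
  exact this ⟨⟨hz, mem_ball.2 h2⟩, hz, fun h => by have := mem_closedBall.1 h; linarith⟩
end DFW
end

open Set Filter Topology Metric MeasureTheory
open scoped ENNReal NNReal InnerProductSpace ComplexConjugate
noncomputable section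
namespace DFW
variable {N : ℕ}

lemma Geo.mono {D : Set (EN N)} {r : EN N → ℝ} {V : Set (EN N)} {c δ : ℝ} (hg : Geo D r V c δ) {δ' : ℝ}
    (h0 : 0 < δ') (h1 : δ' ≤ δ) : Geo D r V c δ' where
  oD := hg.oD
  bD := hg.bD
  oV := hg.oV
  sub := hg.sub
  c2 := hg.c2
  hD := hg.hD
  hcD := hg.hcD
  hf := hg.hf
  cpt := fun s hs => hg.cpt s (by linarith)
  cpos := hg.cpos
  dpos := h0
  levi := fun z hz hr => hg.levi z hz (by linarith)
  grad := hg.grad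

lemma cplx_key {P g : ℂ} : (P * conj (1 + g * P)).re = P.re + ‖P‖^2 * g.re := by
  rw [← Complex.normSq_eq_norm_sq, Complex.normSq_apply]
  simp; ring

lemma cplx_ne {P g : ℂ} (hP : 0 ≤ P.re) (hg : 1 ≤ g.re) : 1 + g * P ≠ 0 := by
  intro h
  have := cplx_key (P := P) (g := g)
  rw [h] at this
  simp at this
  have h2 : ‖P‖^2 ≤ ‖P‖^2 * g.re := le_mul_of_one_le_right (by positivity) hg
  have h3 : ‖P‖ = 0 := by nlinarith [norm_nonneg P]
  rw [norm_eq_zero.1 h3] at h; simp at h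

lemma cplx_re {P g : ℂ} (hP : 0 ≤ P.re) (hg : 1 ≤ g.re) {B : ℝ} (hB : ‖1 + g * P‖ ≤ B) :
    P.re / B^2 ≤ (P / (1 + g * P)).re := by
  have h0 := cplx_ne hP hg
  have h1 : (P / (1 + g * P)) = (P * conj (1 + g * P)) * (((‖1 + g * P‖^2)⁻¹ : ℝ) : ℂ) := by
    rw [div_eq_mul_inv, Complex.inv_def, Complex.normSq_eq_norm_sq]; ring
  rw [h1, Complex.re_mul_ofReal, cplx_key, ← div_eq_mul_inv]
  have h2 : 0 < ‖1 + g * P‖ := norm_pos_iff.2 h0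
  refine div_le_div₀ (by positivity) (by nlinarith [sq_nonneg ‖P‖]) (by positivity) (by gcongr)

structure Peak (D : Set (EN N)) (r : EN N → ℝ) (x : EN N) (Ω : Set (EN N)) (Φ : EN N → ℂ) (c C : ℝ) : Prop where
  cpos : 0 < c
  Cpos : 0 ≤ C
  oΩ : IsOpen Ω
  sub : closure D ⊆ Ω
  hol : DifferentiableOn ℂ Φ Ω
  zero : Φ x = 0
  der : HasFDerivAt Φ (-RL r x) x
  lower : ∀ z ∈ closure D, c * ‖z - x‖^2 ≤ (Φ z).re
  near : ∀ᶠ z in 𝓝 x, c * ‖z - x‖^2 ≤ (Φ z).re + r z + C * ‖Φ z‖^2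

set_option maxHeartbeats 1000000 in
theorem exists_peak {D : Set (EN N)} {r : EN N → ℝ} {V : Set (EN N)} {c δ : ℝ} (hg : Geo D r V c δ)
    {x : EN N} (hx : x ∈ frontier D) : ∃ Ω Φ c' C, Peak D r x Ω Φ c' C := by
  have hc := hg.cpos
  have hxc : x ∈ closure D := frontier_subset_closure hx
  have hxV := hg.sub hxc
  have hr2 : ContDiffAt ℝ 2 r x := hg.c2.contDiffAt (hg.oV.mem_nhds hxV)
  have hrx : r x = 0 := (hg.hf x hxV).1 hx
  set P := LP r x with hPd
  have hev := LP_lower hr2 hrx hc (hg.levi x hxV (by rw [hrx]; simp; exact hg.dpos.le))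
  obtain ⟨ρ, hρ, hρb⟩ := Metric.eventually_nhds_iff_ball.1 (hev.and (hg.oV.mem_nhds hxV))
  set a := ρ / 5 with had
  have ha : 0 < a := by positivity
  set c1 := c / 2 with hc1d
  have hc1 : 0 < c1 := by positivity
  have hlow : ∀ z, dist z x < 5 * a → -r z + c1 * ‖z - x‖^2 ≤ (P z).re := fun z hz =>
    (hρb z (mem_ball.2 (by rw [had] at hz; linarith))).1
  set δ' := min δ (c1 * a^2) with hδ'
  have hδ'0 : 0 < δ' := lt_min hg.dpos (by positivity)
  have hg' := hg.mono hδ'0 (min_le_left _ _)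
  set U := {z ∈ V | r z < δ'} with hUd
  have hU : IsOpen U := hg.c2.continuousOn.isOpen_inter_preimage hg.oV isOpen_Iio
  have hcU : closure D ⊆ U := fun z hz => ⟨hg.sub hz, lt_of_le_of_lt ((hg.hcD z (hg.sub hz)).1 hz) hδ'0⟩
  have hPos : ∀ z ∈ U, ∀ s, a ≤ s → s ≤ dist z x → dist z x < 5 * a → c1 * s^2 - c1 * a^2 < (P z).re := by
    intro z hz s hs h1 h2
    have h3 := hlow z h2
    have h4 : r z < c1 * a^2 := lt_of_lt_of_le hz.2 (min_le_right _ _)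
    have h5 : s^2 ≤ ‖z - x‖^2 := by rw [← dist_eq_norm]; exact pow_le_pow_left₀ (by linarith) h1 2
    nlinarith
  have hP0 : ∀ z ∈ U, a < dist z x → dist z x < 4*a → P z ≠ 0 := by
    intro z hz h1 h2 h
    have := hPos z hz a le_rfl h1.le (by linarith)
    rw [h] at this; simp at this
  have hdP : Differentiable ℂ P := LP_diff hr2
  obtain ⟨Gb, Gc, dGb, dGc, hG⟩ := dbar_glue (μ := (Measure.addHaar : Measure (EN N))) hU hdP (LP_contDiff r x) (x := x) ha (m := 3 * c1 * a^2)
    (by positivity) hP0 (by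
      intro z hz h1 h2
      have := hPos z hz (2*a) (by linarith) h1.le (by linarith)
      refine le_trans ?_ (Complex.re_le_norm _)
      nlinarith)
    (fun ω C h1 h2 h3 => dbar_geo hg' hUd h1 h2 h3)
  have oUb : IsOpen (U ∩ ball x (2*a)) := hU.inter isOpen_ball
  have oUc : IsOpen (U \ closedBall x a) := hU.sdiff isClosed_closedBall
  have cD : IsCompact (closure D) := hg.bD.isCompact_closure
  have kb : IsCompact (closure D ∩ closedBall x (3/2*a)) := cD.inter_right isClosed_closedBall
  have kc : IsCompact (closure D \ ball x (3/2*a)) := cD.diff isOpen_ball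
  have sb : closure D ∩ closedBall x (3/2*a) ⊆ U ∩ ball x (2*a) := fun z hz =>
    ⟨hcU hz.1, closedBall_subset_ball (by linarith) hz.2⟩
  have sc : closure D \ ball x (3/2*a) ⊆ U \ closedBall x a := fun z hz =>
    ⟨hcU hz.1, fun h => hz.2 (closedBall_subset_ball (by linarith) h)⟩
  obtain ⟨K1, hK1⟩ := kb.exists_bound_of_continuousOn (dGb.continuousOn.mono sb)
  obtain ⟨K2, hK2⟩ := kc.exists_bound_of_continuousOn (dGc.continuousOn.mono sc)
  set K : ℝ := max K1 K2 + 1 with hK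
  have gre : ∀ z ∈ closure D ∩ closedBall x (3/2*a), 1 ≤ ((K:ℂ) - Gb z).re := by
    intro z hz
    have h1 := (Complex.re_le_norm (Gb z)).trans (hK1 z hz)
    have h2 := le_max_left K1 K2
    rw [Complex.sub_re, Complex.ofReal_re]; linarith
  have gre2 : ∀ z ∈ closure D \ ball x (3/2*a), 1 ≤ ((K:ℂ) - Gc z).re := by
    intro z hz
    have h1 := (Complex.re_le_norm (Gc z)).trans (hK2 z hz)
    have h2 := le_max_right K1 K2
    rw [Complex.sub_re, Complex.ofReal_re]; linarith
  have Pre0 : ∀ z ∈ closure D ∩ closedBall x (3/2*a), c1 * ‖z - x‖^2 ≤ (P z).re := by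
    intro z hz
    have h1 := hlow z (by have := mem_closedBall.1 hz.2; linarith)
    have h2 := (hg.hcD z (hg.sub hz.1)).1 hz.1
    linarith
  set den : EN N → ℂ := fun z => 1 + ((K:ℂ) - Gb z) * P z with hden
  have dden : DifferentiableOn ℂ den (U ∩ ball x (2*a)) :=
    (differentiableOn_const _).add (((differentiableOn_const _).sub dGb).mul hdP.differentiableOn)
  set dec : EN N → ℂ := fun z => (K:ℂ) - Gc z with hdec
  have ddec : DifferentiableOn ℂ dec (U \ closedBall x a) := (differentiableOn_const _).sub dGc
  set Ωb := (U ∩ ball x (2*a)) ∩ den ⁻¹' {0}ᶜ with hΩb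
  set Ωc := (U \ closedBall x a) ∩ dec ⁻¹' {0}ᶜ with hΩc
  have oΩb : IsOpen Ωb := dden.continuousOn.isOpen_inter_preimage oUb isOpen_compl_singleton
  have oΩc : IsOpen Ωc := ddec.continuousOn.isOpen_inter_preimage oUc isOpen_compl_singleton
  classical
  set Φ : EN N → ℂ := fun z => if z ∈ ball x (2*a) then P z / den z else (dec z)⁻¹ with hΦ
  have Φb : ∀ z ∈ ball x (2*a), Φ z = P z / den z := fun z hz => by simp only [hΦ, hz, if_true]
  have Φc : ∀ z ∈ U \ closedBall x a, Φ z = (dec z)⁻¹ := by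
    intro z hz
    by_cases h : z ∈ ball x (2*a)
    · rw [Φb z h]
      have h1 : a < dist z x := by have := hz.2; rw [mem_closedBall, not_le] at this; exact this
      have h2 := mem_ball.1 h
      have h3 : P z ≠ 0 := hP0 z hz.1 h1 (by linarith)
      have h4 : den z = P z * dec z := by
        simp only [hden, hdec]
        rw [hG z hz.1 h1 h2]; field_simp; ring
      rw [h4]
      by_cases h5 : dec z = 0
      · simp [h5]
      · field_simp
    · simp only [hΦ, h, if_false]
  obtain ⟨B, hB⟩ := kb.exists_bound_of_continuousOn (dden.continuousOn.mono sb)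
  obtain ⟨B2, hB2⟩ := kc.exists_bound_of_continuousOn (ddec.continuousOn.mono sc)
  obtain ⟨R0, hR0⟩ := cD.exists_bound_of_continuousOn (f := fun z => z - x) (by fun_prop)
  set B' := max B 1 with hB'
  set B2' := max B2 1 with hB2'
  set R' := max R0 1 with hR'
  have hB'1 : 1 ≤ B' := le_max_right _ _
  have hB2'1 : 1 ≤ B2' := le_max_right _ _
  have hR'1 : 1 ≤ R' := le_max_right _ _
  set c' := min (c1 / B'^2) (1 / (B2'^2 * R'^2)) with hc'
  have hxball : x ∈ U ∩ ball x (2*a) := ⟨hcU hxc, mem_ball_self (by linarith)⟩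
  have hPx : P x = 0 := LP_self r x
  have hdenx : den x = 1 := by simp [hden, hPx]
  have hΦP : ∀ᶠ z in 𝓝 x, Φ z = P z / den z := by
    filter_upwards [ball_mem_nhds x (show 0 < 2*a by linarith)] with z hz using Φb z hz
  have dendiff : HasFDerivAt den (fderiv ℂ den x) x := (dden.differentiableAt (oUb.mem_nhds hxball)).hasFDerivAt
  refine ⟨Ωb ∪ Ωc, Φ, min c' c1, 2 * (‖(K:ℂ) - Gb x‖ + 1), ?_⟩
  constructor
  · exact lt_min (lt_min (by positivity) (by positivity)) hc1
  · positivity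
  · exact oΩb.union oΩc
  · intro z hz
    by_cases h : z ∈ closedBall x (3/2*a)
    · left
      refine ⟨sb ⟨hz, h⟩, ?_⟩
      exact cplx_ne ((by positivity : 0 ≤ c1 * ‖z - x‖^2).trans (Pre0 z ⟨hz, h⟩)) (gre z ⟨hz, h⟩)
    · right
      have hz' : z ∈ closure D \ ball x (3/2*a) := ⟨hz, fun h' => h (ball_subset_closedBall h')⟩
      refine ⟨sc hz', fun h0 => ?_⟩
      have := gre2 z hz'
      simp only [hdec, mem_singleton_iff] at h0
      rw [h0] at this; simp at this; linarith
  · intro z hz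
    refine DifferentiableAt.differentiableWithinAt ?_
    rcases hz with hz | hz
    · have h1 : DifferentiableAt ℂ (fun z => P z / den z) z := by
        simp_rw [div_eq_mul_inv]
        exact (hdP z).mul ((dden.differentiableAt (oUb.mem_nhds hz.1)).inv hz.2)
      refine h1.congr_of_eventuallyEq ?_
      filter_upwards [oΩb.mem_nhds hz] with y hy using Φb y hy.1.2
    · have h1 : DifferentiableAt ℂ (fun z => (dec z)⁻¹) z :=
        (ddec.differentiableAt (oUc.mem_nhds hz.1)).inv hz.2
      refine h1.congr_of_eventuallyEq ?_
      filter_upwards [oΩc.mem_nhds hz] with y hy using Φc y hy.1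
  · rw [Φb x hxball.2, hPx]; simp
  · have h1 : HasFDerivAt (fun z => P z * (den z)⁻¹) _ x :=
      (LP_fderiv hr2).mul (dendiff.differentiableAt.inv (by rw [hdenx]; exact one_ne_zero)).hasFDerivAt
    refine (h1.congr_fderiv ?_).congr_of_eventuallyEq (hΦP.mono fun z hz => by rw [hz, div_eq_mul_inv])
    rw [LP_self, hdenx]
    ext v; simp
  · intro z hz
    by_cases h : z ∈ closedBall x (3/2*a)
    · rw [Φb z (sb ⟨hz, h⟩).2]
      have h1 := Pre0 z ⟨hz, h⟩
      have h2 := cplx_re ((by positivity : 0 ≤ c1 * ‖z - x‖^2).trans h1) (gre z ⟨hz, h⟩)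
        (B := B') ((hB z ⟨hz, h⟩).trans (le_max_left _ _))
      refine le_trans ?_ h2
      calc min c' c1 * ‖z - x‖^2 ≤ (c1 / B'^2) * ‖z - x‖^2 := by
            gcongr; exact (min_le_left _ _).trans (min_le_left _ _)
        _ = (c1 * ‖z - x‖^2) / B'^2 := by ring
        _ ≤ _ := by gcongr
    · have hz' : z ∈ closure D \ ball x (3/2*a) := ⟨hz, fun h' => h (ball_subset_closedBall h')⟩
      rw [Φc z (sc hz')]
      have h1 := gre2 z hz'
      have h2 := (hB2 z hz').trans (le_max_left B2 1)
      have h0 : dec z ≠ 0 := fun h0 => by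
        simp only [hdec] at h0
        rw [h0] at h1; simp at h1; linarith
      rw [Complex.inv_re, Complex.normSq_eq_norm_sq]
      have h3 : 0 < ‖dec z‖ := norm_pos_iff.2 h0
      have h4 := (hR0 z hz).trans (le_max_left R0 1)
      calc min c' c1 * ‖z - x‖^2 ≤ (1 / (B2'^2 * R'^2)) * R'^2 := by
            gcongr; exact (min_le_left _ _).trans (min_le_right _ _)
        _ = 1 / B2'^2 := by field_simp
        _ ≤ _ := by
            refine div_le_div₀ (by linarith [h1]) h1 (by positivity) ?_
            gcongr
  · have cg : ContinuousAt (fun z => ‖(K:ℂ) - Gb z‖) x :=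
      (continuousAt_const.sub (dGb.differentiableAt (oUb.mem_nhds hxball)).continuousAt).norm
    have cd : ContinuousAt (fun z => ‖den z‖) x := dendiff.continuousAt.norm
    have e1 : ∀ᶠ z in 𝓝 x, ‖(K:ℂ) - Gb z‖ < ‖(K:ℂ) - Gb x‖ + 1 := cg.eventually_lt_const (by linarith)
    have e2 : ∀ᶠ z in 𝓝 x, ‖den z‖ < 2 := cd.eventually_lt_const (by change _ < _; simp only [hdenx]; norm_num)
    have e3 : ∀ᶠ z in 𝓝 x, 0 < ‖den z‖ := cd.eventually_const_lt (by change _ < _; simp only [hdenx]; norm_num)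
    filter_upwards [e1, e2, e3, hΦP, hev] with z h1 h2 h3 h4 h5
    have h6 : Φ z * den z = P z := by
      rw [h4]; exact div_mul_cancel₀ _ (norm_pos_iff.1 h3)
    have h7 : P z - Φ z = Φ z * (((K:ℂ) - Gb z) * P z) := by
      rw [← sub_eq_iff_eq_add'.2 (show den z = 1 + ((K:ℂ) - Gb z) * P z from rfl)]
      rw [mul_sub, h6]; ring
    have h8 : ‖P z‖ ≤ 2 * ‖Φ z‖ := by
      rw [← h6, norm_mul]; nlinarith [norm_nonneg (Φ z)]
    have h9 : ‖P z - Φ z‖ ≤ 2 * (‖(K:ℂ) - Gb x‖ + 1) * ‖Φ z‖^2 := by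
      rw [h7, norm_mul, norm_mul]
      calc ‖Φ z‖ * (‖(K:ℂ) - Gb z‖ * ‖P z‖) ≤ ‖Φ z‖ * ((‖(K:ℂ) - Gb x‖ + 1) * (2 * ‖Φ z‖)) := by gcongr
        _ = _ := by ring
    have h10 := (Complex.re_le_norm (P z - Φ z)).trans h9
    rw [Complex.sub_re] at h10
    have h11 : min c' c1 * ‖z - x‖^2 ≤ c1 * ‖z - x‖^2 := by gcongr; exact min_le_right _ _
    linarith
end DFW
end

open Set Filter Topology Metric MeasureTheory
open scoped ENNReal NNReal InnerProductSpace ComplexConjugate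
noncomputable section
namespace DFW
variable {N : ℕ}

lemma mono1 {g g' : ℝ → ℝ} {s : ℝ} (hs : 0 ≤ s) (hd : ∀ t ∈ Icc 0 s, HasDerivAt g (g' t) t)
    (h0 : ∀ t ∈ Icc 0 s, 0 ≤ g' t) : g 0 ≤ g s := by
  have : MonotoneOn g (Icc 0 s) := by
    refine monotoneOn_of_deriv_nonneg (convex_Icc 0 s) (fun t ht => (hd t ht).continuousAt.continuousWithinAt) ?_ ?_
    · intro t ht; exact (hd t (interior_subset ht)).differentiableAt.differentiableWithinAt
    · intro t ht; rw [(hd t (interior_subset ht)).deriv]; exact h0 t (interior_subset ht)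
  exact this (left_mem_Icc.2 hs) (right_mem_Icc.2 hs) hs

lemma line_deriv {F : Type*} [NormedAddCommGroup F] [NormedSpace ℝ F] {f : EN N → F} {a w : EN N} {t : ℝ}
    (hf : DifferentiableAt ℝ f (a + t • w)) :
    HasDerivAt (fun t : ℝ => f (a + t • w)) (fderiv ℝ f (a + t • w) w) t := by
  have h1 : HasDerivAt (fun t : ℝ => a + t • w) w t := by
    have := ((hasDerivAt_id t).smul_const w).const_add a
    simpa using this
  exact hf.hasFDerivAt.comp_hasDerivAt t h1

lemma seg1 {r : EN N → ℝ} {a w : EN N} {s : ℝ} (hs : 0 ≤ s)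
    (hr : ∀ t ∈ Icc 0 s, ContDiffAt ℝ 2 r (a + t • w)) (h : ∀ t ∈ Icc 0 s, 0 ≤ fderiv ℝ r (a + t • w) w) :
    r a ≤ r (a + s • w) := by
  have := mono1 (g := fun t : ℝ => r (a + t • w)) hs (fun t ht => line_deriv ((hr t ht).differentiableAt (by norm_num))) h
  simpa using this

lemma seg2 {r : EN N → ℝ} {a w : EN N} {s h : ℝ} (hs : 0 ≤ s)
    (hr : ∀ t ∈ Icc 0 s, ContDiffAt ℝ 2 r (a + t • w)) (h0 : 0 ≤ fderiv ℝ r a w)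
    (hh : ∀ t ∈ Icc 0 s, h ≤ Hess r (a + t • w) w w) :
    r a + h / 2 * s^2 ≤ r (a + s • w) := by
  have h2 : ∀ t ∈ Icc 0 s, 0 ≤ fderiv ℝ r (a + t • w) w - h * t := by
    intro t ht
    have hsub : Icc 0 t ⊆ Icc 0 s := Icc_subset_Icc le_rfl ht.2
    have := mono1 (g := fun t : ℝ => fderiv ℝ r (a + t • w) w - h * t)
      (g' := fun t => Hess r (a + t • w) w w - h) ht.1 (fun u hu => by
        have h1 := (line_deriv (diffAt_fderiv' (hr u (hsub hu)))).clm_apply (hasDerivAt_const u w)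
        have h2 : HasDerivAt (fun t : ℝ => h * t) h u := by simpa using (hasDerivAt_id u).const_mul h
        have h3 := h1.sub h2
        simp only [map_zero, add_zero] at h3
        exact h3) (fun u hu => by have := hh u (hsub hu); linarith)
    simp only [zero_smul, add_zero, mul_zero, sub_zero] at this
    linarith
  have := mono1 (g := fun t : ℝ => r (a + t • w) - h / 2 * t^2) (g' := fun t => fderiv ℝ r (a + t • w) w - h * t) hs
    (fun t ht => by
      have h1 := line_deriv (w := w) ((hr t ht).differentiableAt (by norm_num))
      have h2 : HasDerivAt (fun t : ℝ => h / 2 * t^2) (h * t) t := by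
        have := (hasDerivAt_pow 2 t).const_mul (h/2)
        refine this.congr_deriv ?_
        simp; ring
      exact h1.sub h2) h2
  simp only [zero_smul, add_zero] at this
  linarith

/-- climbing by τ from a while avoiding cl D -/
def Gain (D : Set (EN N)) (R : EN N →L[ℂ] ℂ) (a : EN N) (τ : ℝ) : Prop :=
  ∃ γ : ℝ → EN N, ContinuousOn γ (Icc 0 τ) ∧ γ 0 = a ∧ ∀ σ ∈ Icc 0 τ, R (γ σ - a) = σ ∧ γ σ ∉ closure D

lemma Gain.mono {D : Set (EN N)} {R : EN N →L[ℂ] ℂ} {a : EN N} {τ τ' : ℝ} (h : Gain D R a τ) (hτ : τ' ≤ τ) :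
    Gain D R a τ' := by
  obtain ⟨γ, h1, h2, h3⟩ := h
  have hs : Icc 0 τ' ⊆ Icc 0 τ := Icc_subset_Icc le_rfl hτ
  exact ⟨γ, h1.mono hs, h2, fun σ hσ => h3 σ (hs hσ)⟩

lemma gain_line {D : Set (EN N)} {R : EN N →L[ℂ] ℂ} {a u : EN N} {τ : ℝ} (hu : R u = 1)
    (h : ∀ σ ∈ Icc 0 τ, a + σ • u ∉ closure D) : Gain D R a τ := by
  refine ⟨fun σ => a + σ • u, by fun_prop, by simp, fun σ hσ => ⟨?_, h σ hσ⟩⟩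
  rw [add_sub_cancel_left, real_smul_eq, map_smul, hu]; simp

lemma gain_local {D : Set (EN N)} {r : EN N → ℝ} {V : Set (EN N)} {c δ : ℝ} (hg : Geo D r V c δ)
    {R : EN N →L[ℂ] ℂ} {v : EN N} (hv : R v = 1) (hker : ∃ w, w ≠ 0 ∧ R w = 0) {b : EN N} (hb : b ∈ frontier D) :
    ∃ ρ > 0, ∃ τ > 0, ∀ a ∈ ball b ρ, a ∉ closure D → Gain D R a τ := by
  have hbV := hg.sub (frontier_subset_closure hb)
  have hr2 : ContDiffAt ℝ 2 r b := hg.c2.contDiffAt (hg.oV.mem_nhds hbV)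
  have hrat : ∀ z ∈ V, ContDiffAt ℝ 2 r z := fun z hz => hg.c2.contDiffAt (hg.oV.mem_nhds hz)
  have hrb : r b = 0 := (hg.hf b hbV).1 hb
  have hpos : ∀ z ∈ V, z ∉ closure D → 0 < r z := fun z hz h => by
    by_contra h'; exact h ((hg.hcD z hz).2 (not_lt.1 h'))
  have hout : ∀ z ∈ V, 0 < r z → z ∉ closure D := fun z hz h h' => by
    have := (hg.hcD z hz).1 h'; linarith
  obtain ⟨w0, hw0, hRw0⟩ := hker
  have hlev := hg.levi b hbV (by rw [hrb]; simp; exact hg.dpos.le) w0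
  have hlev' : 0 < LeviForm r b w0 := lt_of_lt_of_le (by have := hg.cpos; have := norm_pos_iff.2 hw0; positivity) hlev
  obtain ⟨w, hRw, hHw⟩ : ∃ w, R w = 0 ∧ 0 < Hess r b w w := by
    unfold LeviForm at hlev'
    by_cases h : 0 < Hess r b w0 w0
    · exact ⟨w0, hRw0, h⟩
    · exact ⟨Complex.I • w0, by rw [map_smul, hRw0, smul_zero], by linarith⟩
  set h := Hess r b w w / 2 with hh
  have hh0 : 0 < h := by positivity
  set L := ‖fderiv ℝ r b‖ + 1 with hL
  have hL0 : 0 < L := by positivity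
  have hcH : ContinuousAt (fun z => Hess r z w w) b := by
    have h1 : ContDiffAt ℝ 1 (fderiv ℝ r) b := hr2.fderiv_right (by norm_num)
    have h2 : ContinuousAt (fderiv ℝ (fderiv ℝ r)) b := (h1.fderiv_right (m := 0) (by norm_num)).continuousAt
    exact (h2.clm_apply continuousAt_const).clm_apply continuousAt_const
  have hcL : ContinuousAt (fun z => ‖fderiv ℝ r z‖) b := (diffAt_fderiv' hr2).continuousAt.norm
  obtain ⟨ρ, hρ, hρb⟩ := Metric.eventually_nhds_iff_ball.1
    ((hcH.eventually_const_lt (show h < Hess r b w w by rw [hh]; linarith)).and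
    ((hcL.eventually_lt_const (show ‖fderiv ℝ r b‖ < L by rw [hL]; linarith)).and (hg.oV.mem_nhds hbV)))
  have hlip : ∀ y ∈ ball b ρ, ∀ z ∈ ball b ρ, r y - L * ‖z - y‖ ≤ r z := by
    intro y hy z hz
    have := (convex_ball b ρ).norm_image_sub_le_of_norm_fderiv_le (𝕜 := ℝ) (f := r) (C := L)
      (fun p hp => (hrat p (hρb p hp).2.2).differentiableAt (by norm_num)) (fun p hp => (hρb p hp).2.1.le) hy hz
    rw [Real.norm_eq_abs] at this
    linarith [(abs_le.1 this).1]
  have hw1 : 0 < ‖w‖ + 1 := by positivity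
  have hv1 : 0 < ‖v‖ + 1 := by positivity
  set s1 := ρ/4/(‖w‖+1) with hs1
  have hs10 : 0 < s1 := by positivity
  set η := h/2 * s1^2 with hη
  have hη0 : 0 < η := by positivity
  set τ := min (ρ/4/(‖v‖+1)) (η/(2 * L * (‖v‖+1))) with hτ
  have hτ0 : 0 < τ := lt_min (by positivity) (by positivity)
  refine ⟨ρ/4, by positivity, τ, hτ0, fun a ha haD => ?_⟩
  obtain ⟨w', hw'n, hRw', hH', hd'⟩ : ∃ w' : EN N, ‖w'‖ = ‖w‖ ∧ R w' = 0 ∧ (∀ z, Hess r z w' w' = Hess r z w w) ∧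
      0 ≤ fderiv ℝ r a w' := by
    by_cases h : 0 ≤ fderiv ℝ r a w
    · exact ⟨w, rfl, hRw, fun _ => rfl, h⟩
    · refine ⟨-w, norm_neg _, by rw [map_neg, hRw, neg_zero], fun z => by simp [Hess], ?_⟩
      rw [map_neg]; linarith
  have hin : ∀ t ∈ Icc 0 s1, ∀ σ ∈ Icc 0 τ, a + t • w' + σ • v ∈ ball b ρ := by
    intro t ht σ hσ
    have h1 : t * (‖w‖ + 1) ≤ ρ/4 := (le_div_iff₀ hw1).1 ht.2
    have h2 : σ * (‖v‖ + 1) ≤ ρ/4 := (le_div_iff₀ hv1).1 (hσ.2.trans (min_le_left _ _))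
    rw [mem_ball, dist_eq_norm] at ha ⊢
    calc ‖a + t • w' + σ • v - b‖ = ‖(a - b) + t • w' + σ • v‖ := by congr 1; abel
      _ ≤ ‖a - b‖ + ‖t • w'‖ + ‖σ • v‖ := norm_add₃_le
      _ = ‖a - b‖ + t * ‖w‖ + σ * ‖v‖ := by
        rw [norm_smul, norm_smul, Real.norm_of_nonneg ht.1, Real.norm_of_nonneg hσ.1, hw'n]
      _ < ρ := by nlinarith [ht.1, hσ.1]
  have hin0 : ∀ t ∈ Icc 0 s1, a + t • w' ∈ ball b ρ := fun t ht => by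
    simpa using hin t ht 0 ⟨le_rfl, hτ0.le⟩
  have haV : a ∈ V := (hρb a (by simpa using hin0 0 ⟨le_rfl, hs10.le⟩)).2.2
  have hra := hpos a haV haD
  have hseg : ∀ t ∈ Icc 0 s1, r a + h/2 * t^2 ≤ r (a + t • w') := fun t ht =>
    seg2 ht.1 (fun u hu => hrat _ (hρb _ (hin0 u ⟨hu.1, hu.2.trans ht.2⟩)).2.2) hd'
      (fun u hu => by rw [hH']; exact (hρb _ (hin0 u ⟨hu.1, hu.2.trans ht.2⟩)).1.le)
  have hfin : ∀ t ∈ Icc 0 s1, ∀ σ ∈ Icc 0 τ, r a + h/2*t^2 - L * (σ * ‖v‖) ≤ r (a + t • w' + σ • v) := by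
    intro t ht σ hσ
    have h1 := hlip _ (hin0 t ht) _ (hin t ht σ hσ)
    rw [add_sub_cancel_left, norm_smul, Real.norm_of_nonneg hσ.1] at h1
    linarith [hseg t ht]
  set κ := r a / (2 * L * (‖v‖+1)) with hκ
  have hκ0 : 0 < κ := by positivity
  have hmin : ∀ σ ∈ Icc 0 τ, min (σ/κ) 1 * s1 ∈ Icc 0 s1 := fun σ hσ =>
    ⟨mul_nonneg (le_min (div_nonneg hσ.1 hκ0.le) zero_le_one) hs10.le,
      mul_le_of_le_one_left hs10.le (min_le_right _ _)⟩
  refine ⟨fun σ => a + (min (σ/κ) 1 * s1) • w' + σ • v, ?_, by simp, fun σ hσ => ⟨?_, ?_⟩⟩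
  · refine Continuous.continuousOn ?_
    have : Continuous fun σ : ℝ => min (σ/κ) 1 := (continuous_id.div_const κ).min continuous_const
    fun_prop
  · beta_reduce
    rw [add_assoc, add_sub_cancel_left, real_smul_eq, real_smul_eq, map_add, map_smul, map_smul, hRw', hv]; simp
  · refine hout _ (hρb _ (hin _ (hmin σ hσ) σ hσ)).2.2 ?_
    refine lt_of_lt_of_le ?_ (hfin _ (hmin σ hσ) σ hσ)
    by_cases hc : σ ≤ κ
    · have h1 : σ * (2 * L * (‖v‖+1)) ≤ r a := (le_div_iff₀ (by positivity)).1 hc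
      have h2 : 0 ≤ h/2 * (min (σ/κ) 1 * s1)^2 := by positivity
      have h3 : 0 ≤ L * σ := mul_nonneg hL0.le hσ.1
      nlinarith [norm_nonneg v, mul_nonneg h3 (norm_nonneg v)]
    · have h0 : min (σ/κ) 1 = 1 := min_eq_right ((one_le_div hκ0).2 (not_le.1 hc).le)
      rw [h0, one_mul, ← hη]
      have h1 : σ * (2 * L * (‖v‖+1)) ≤ η := (le_div_iff₀ (by positivity)).1 (hσ.2.trans (min_le_right _ _))
      have h3 : 0 ≤ L * σ := mul_nonneg hL0.le hσ.1
      nlinarith [norm_nonneg v, mul_nonneg h3 (norm_nonneg v)]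
end DFW
end

open Set Filter Topology Metric MeasureTheory
open scoped ENNReal NNReal InnerProductSpace ComplexConjugate
noncomputable section
namespace DFW
variable {N : ℕ}

lemma gain_uniform {D : Set (EN N)} {r : EN N → ℝ} {V : Set (EN N)} {c δ : ℝ} (hg : Geo D r V c δ)
    {R : EN N →L[ℂ] ℂ} {v : EN N} (hv : R v = 1) (hker : ∃ w, w ≠ 0 ∧ R w = 0) :
    ∃ τ > 0, ∀ a, a ∉ closure D → Gain D R a τ := by
  have cD : IsCompact (closure D) := hg.bD.isCompact_closure
  have hv1 : 0 < ‖v‖ + 1 := by positivity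
  -- line up from a point far from `cl D`
  have hfar : ∀ (a b : EN N) (ρ : ℝ), 0 < ρ → Disjoint (ball b ρ) (closure D) → a ∈ ball b (ρ/2) →
      Gain D R a (ρ/2/(‖v‖+1)) := by
    intro a b ρ hρ hdis ha
    refine gain_line hv fun σ hσ => ?_
    refine fun h => disjoint_left.1 hdis ?_ h
    have h1 : σ * (‖v‖ + 1) ≤ ρ/2 := (le_div_iff₀ hv1).1 hσ.2
    rw [mem_ball, dist_eq_norm] at ha ⊢
    calc ‖a + σ • v - b‖ = ‖(a - b) + σ • v‖ := by congr 1; abel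
      _ ≤ ‖a - b‖ + ‖σ • v‖ := norm_add_le _ _
      _ = ‖a - b‖ + σ * ‖v‖ := by rw [norm_smul, Real.norm_of_nonneg hσ.1]
      _ < ρ := by nlinarith [hσ.1]
  obtain ⟨τ, hτ, hT⟩ : ∃ τ > 0, ∀ a ∈ cthickening 1 (closure D), a ∉ closure D → Gain D R a τ := by
    refine (cD.cthickening (r := 1)).induction_on (p := fun s => ∃ τ > 0, ∀ a ∈ s, a ∉ closure D → Gain D R a τ)
      ⟨1, one_pos, fun a ha => absurd ha (notMem_empty a)⟩ ?_ ?_ ?_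
    · rintro s t hst ⟨τ, h0, h⟩
      exact ⟨τ, h0, fun a ha => h a (hst ha)⟩
    · rintro s t ⟨τ, h0, h⟩ ⟨τ', h0', h'⟩
      refine ⟨min τ τ', lt_min h0 h0', fun a ha haD => ?_⟩
      rcases ha with ha | ha
      · exact (h a ha haD).mono (min_le_left _ _)
      · exact (h' a ha haD).mono (min_le_right _ _)
    · intro b _
      by_cases hbD : b ∈ closure D
      · by_cases hbi : b ∈ D
        · exact ⟨D, mem_nhdsWithin_of_mem_nhds (hg.oD.mem_nhds hbi), 1, one_pos,
            fun a ha h => absurd (subset_closure ha) h⟩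
        · have hbf : b ∈ frontier D := ⟨hbD, by rw [hg.oD.interior_eq]; exact hbi⟩
          obtain ⟨ρ, hρ, τ, hτ, h⟩ := gain_local hg hv hker hbf
          exact ⟨ball b ρ, mem_nhdsWithin_of_mem_nhds (ball_mem_nhds b hρ), τ, hτ, h⟩
      · obtain ⟨ρ, hρ, hsub⟩ := Metric.isOpen_iff.1 isClosed_closure.isOpen_compl b hbD
        refine ⟨ball b (ρ/2), mem_nhdsWithin_of_mem_nhds (ball_mem_nhds b (by positivity)), ρ/2/(‖v‖+1), by positivity,
          fun a ha _ => hfar a b ρ hρ (subset_compl_iff_disjoint_right.1 hsub) ha⟩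
  refine ⟨min τ (1/2/(‖v‖+1)), lt_min hτ (by positivity), fun a ha => ?_⟩
  by_cases h : a ∈ cthickening 1 (closure D)
  · exact (hT a h ha).mono (min_le_left _ _)
  · refine (hfar a a 1 one_pos ?_ (mem_ball_self (by norm_num))).mono (min_le_right _ _)
    rw [disjoint_left]
    intro z hz hzD
    exact h (mem_cthickening_of_dist_le a z 1 _ hzD (by rw [dist_comm]; exact (mem_ball.1 hz).le))

/-- cone condition at a boundary point -/
lemma cone_out {D : Set (EN N)} {r : EN N → ℝ} {V : Set (EN N)} {c δ : ℝ} (hg : Geo D r V c δ)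
    {x : EN N} (hx : x ∈ frontier D) {L : ℝ} (hL : 0 < L) :
    ∃ ρ > 0, ∃ c0 > 0, ∀ u, ‖u‖ < ρ → ‖u‖ ≤ L * fderiv ℝ r x u → ∀ z ∈ closure D,
      c0 * fderiv ℝ r x u ≤ ‖x + u - z‖ := by
  have hxV := hg.sub (frontier_subset_closure hx)
  have hr2 : ContDiffAt ℝ 2 r x := hg.c2.contDiffAt (hg.oV.mem_nhds hxV)
  have hrat : ∀ z ∈ V, ContDiffAt ℝ 2 r z := fun z hz => hg.c2.contDiffAt (hg.oV.mem_nhds hz)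
  have hrx : r x = 0 := (hg.hf x hxV).1 hx
  set Lr := ‖fderiv ℝ r x‖ + 1 with hLr
  have hLr0 : 0 < Lr := by positivity
  have hcL : ContinuousAt (fun z => ‖fderiv ℝ r z‖) x := (diffAt_fderiv' hr2).continuousAt.norm
  have hlo := (hr2.differentiableAt (by norm_num)).hasFDerivAt.isLittleO
  have hlo' : ∀ᶠ z in 𝓝 x, ‖r z - r x - fderiv ℝ r x (z - x)‖ ≤ 1/(2*L) * ‖z - x‖ := hlo.def (by positivity)
  obtain ⟨ρ, hρ, hρb⟩ := Metric.eventually_nhds_iff_ball.1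
      (hlo'.and ((hcL.eventually_lt_const (show ‖fderiv ℝ r x‖ < Lr by rw [hLr]; linarith)).and (hg.oV.mem_nhds hxV)))
  have hlip : ∀ y ∈ ball x ρ, ∀ z ∈ ball x ρ, r y - L * 0 - Lr * ‖z - y‖ ≤ r z := by
    intro y hy z hz
    have := (convex_ball x ρ).norm_image_sub_le_of_norm_fderiv_le (𝕜 := ℝ) (f := r) (C := Lr)
      (fun p hp => (hrat p (hρb p hp).2.2).differentiableAt (by norm_num)) (fun p hp => (hρb p hp).2.1.le) hy hz
    rw [Real.norm_eq_abs] at this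
    linarith [(abs_le.1 this).1]
  refine ⟨ρ/2, by positivity, min (1/(2*Lr)) (1/Lr), lt_min (by positivity) (by positivity), fun u hu hcone z hz => ?_⟩
  have hd0 : 0 ≤ fderiv ℝ r x u := by
    by_contra h
    nlinarith [norm_nonneg u, mul_neg_of_pos_of_neg hL (not_le.1 h)]
  have hxu : x + u ∈ ball x ρ := by rw [mem_ball, dist_eq_norm, add_sub_cancel_left]; linarith
  by_cases hzb : z ∈ ball x ρ
  · have h1 := hlip _ hxu z hzb
    have h2 := (hg.hcD z (hg.sub hz)).1 hz
    have h3 := (hρb _ hxu).1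
    rw [add_sub_cancel_left, hrx, Real.norm_eq_abs] at h3
    have h4 := (abs_le.1 h3).1
    have h5 : 1/(2*L) * ‖u‖ ≤ fderiv ℝ r x u / 2 := by
      calc 1/(2*L) * ‖u‖ ≤ 1/(2*L) * (L * fderiv ℝ r x u) := by gcongr
        _ = _ := by field_simp
    rw [norm_sub_rev z] at h1
    calc min (1/(2*Lr)) (1/Lr) * fderiv ℝ r x u ≤ 1/(2*Lr) * fderiv ℝ r x u := by gcongr; exact min_le_left _ _
      _ ≤ 1/(2*Lr) * (2 * (Lr * ‖x + u - z‖)) := by gcongr; linarith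
      _ = _ := by field_simp
  · have h1 : ρ ≤ ‖z - x‖ := by rw [← dist_eq_norm]; exact not_lt.1 fun h => hzb (mem_ball.2 h)
    have h2 : ‖z - x‖ ≤ ‖u‖ + ‖x + u - z‖ := by
      calc ‖z - x‖ = ‖u - (x + u - z)‖ := by congr 1; abel
        _ ≤ _ := norm_sub_le _ _
    have h3 : fderiv ℝ r x u ≤ Lr * ‖u‖ := by
      refine (le_abs_self _).trans (((fderiv ℝ r x).le_opNorm u).trans ?_)
      gcongr; rw [hLr]; linarith
    calc min (1/(2*Lr)) (1/Lr) * fderiv ℝ r x u ≤ 1/Lr * fderiv ℝ r x u := by gcongr; exact min_le_right _ _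
      _ ≤ 1/Lr * (Lr * ‖u‖) := by gcongr
      _ = ‖u‖ := by field_simp
      _ ≤ _ := by linarith

lemma exists_path {D : Set (EN N)} {r : EN N → ℝ} {V : Set (EN N)} {c δ : ℝ} (hg : Geo D r V c δ)
    {x : EN N} (hx : x ∈ frontier D) {v : EN N} (hv : RL r x v = 1) (hker : ∃ w, w ≠ 0 ∧ RL r x w = 0)
    (M : ℝ) : ∃ s0 > 0, ∃ γ : ℝ → EN N, ContinuousOn γ (Icc 0 M) ∧ (∀ σ ∈ Icc 0 M, σ ≤ s0 → γ σ = x + σ • v) ∧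
      ∀ σ ∈ Icc 0 M, RL r x (γ σ - x) = σ ∧ (0 < σ → γ σ ∉ closure D) := by
  obtain ⟨τ, hτ, hgain⟩ := gain_uniform hg hv hker
  have hv1 : 0 < ‖v‖ + 1 := by positivity
  obtain ⟨ρ, hρ, c0, hc0, hcone⟩ := cone_out hg hx hv1
  set s0 := ρ/2/(‖v‖+1) with hs0
  have hs00 : 0 < s0 := by positivity
  have hRv : ∀ σ : ℝ, RL r x (σ • v) = σ := fun σ => by rw [real_smul_eq, map_smul, hv]; simp
  have hdv : ∀ σ : ℝ, fderiv ℝ r x (σ • v) = σ := fun σ => by rw [← RL_re, hRv]; simp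
  have hind : ∀ n : ℕ, ∃ γ : ℝ → EN N, ContinuousOn γ (Icc 0 (s0 + n * τ)) ∧
      (∀ σ ∈ Icc 0 (s0 + n * τ), σ ≤ s0 → γ σ = x + σ • v) ∧
      ∀ σ ∈ Icc 0 (s0 + n * τ), RL r x (γ σ - x) = σ ∧ (0 < σ → γ σ ∉ closure D) := by
    intro n
    induction n with
    | zero =>
      refine ⟨fun σ => x + σ • v, by fun_prop, fun _ _ _ => rfl, fun σ hσ => ⟨by rw [add_sub_cancel_left, hRv], fun h0 hD => ?_⟩⟩
      simp only [Nat.cast_zero, zero_mul, add_zero] at hσ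
      have h1 : σ * (‖v‖ + 1) ≤ ρ/2 := (le_div_iff₀ hv1).1 hσ.2
      have h2 : ‖σ • v‖ = σ * ‖v‖ := by rw [norm_smul, Real.norm_of_nonneg hσ.1]
      have := hcone (σ • v) (by rw [h2]; nlinarith) (by rw [h2, hdv]; nlinarith) _ hD
      rw [hdv, sub_self, norm_zero] at this
      nlinarith
    | succ n ih =>
      obtain ⟨γ, h1, h2, h3⟩ := ih
      set T := s0 + n * τ with hT
      have hT0 : 0 < T := by positivity
      have hTs : s0 ≤ T := by rw [hT]; have : 0 ≤ n * τ := by positivity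
                              linarith
      have hTT : s0 + ((n + 1 : ℕ) : ℝ) * τ = T + τ := by rw [hT]; push_cast; ring
      have h3T := h3 T ⟨hT0.le, le_rfl⟩
      obtain ⟨γ2, g1, g2, g3⟩ := hgain (γ T) (h3T.2 hT0)
      rw [hTT]
      refine ⟨fun σ => if σ ≤ T then γ σ else γ2 (σ - T), ?_, ?_, ?_⟩
      · have hu : Icc 0 (T + τ) = Icc 0 T ∪ Icc T (T + τ) := (Icc_union_Icc_eq_Icc hT0.le (by linarith)).symm
        rw [hu]
        refine ContinuousOn.union_of_isClosed ?_ ?_ isClosed_Icc isClosed_Icc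
        · exact h1.congr fun σ hσ => by simp [hσ.2]
        · have : ContinuousOn (fun σ => γ2 (σ - T)) (Icc T (T + τ)) :=
            g1.comp (by fun_prop) fun σ hσ => ⟨by linarith [hσ.1], by linarith [hσ.2]⟩
          refine this.congr fun σ hσ => ?_
          by_cases h : σ ≤ T
          · have : σ = T := le_antisymm h hσ.1
            simp [this, g2]
          · simp [h]
      · intro σ hσ hs
        have : σ ≤ T := hs.trans hTs
        simp only [this, if_true]
        exact h2 σ ⟨hσ.1, this⟩ hs
      · intro σ hσ
        by_cases h : σ ≤ T
        · simp only [h, if_true]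
          exact h3 σ ⟨hσ.1, h⟩
        · simp only [h, if_false]
          have h' := not_le.1 h
          have g := g3 (σ - T) ⟨by linarith, by linarith [hσ.2]⟩
          refine ⟨?_, fun _ => g.2⟩
          have : γ2 (σ - T) - x = (γ2 (σ - T) - γ T) + (γ T - x) := by abel
          rw [this, map_add, g.1, h3T.1]; push_cast; ring
  obtain ⟨n, hn⟩ := exists_nat_ge (M / τ)
  have hn' : M ≤ s0 + n * τ := by have := (div_le_iff₀ hτ).1 hn; linarith
  obtain ⟨γ, h1, h2, h3⟩ := hind n
  have hs : Icc 0 M ⊆ Icc 0 (s0 + n * τ) := Icc_subset_Icc le_rfl hn'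
  exact ⟨s0, hs00, γ, h1.mono hs, fun σ hσ => h2 σ (hs hσ), fun σ hσ => h3 σ (hs hσ)⟩
end DFW
end

open Set Filter Topology Metric MeasureTheory
open scoped ENNReal NNReal InnerProductSpace ComplexConjugate
noncomputable section
namespace DFW
variable {N : ℕ}

/-- complex Bernstein basis -/
def bc (n k : ℕ) (ζ : ℂ) : ℂ := (n.choose k : ℂ) * ζ^k * (1 - ζ)^(n - k)

lemma bc_sum1 (n : ℕ) (ζ : ℂ) : ∑ k : Fin (n+1), (k : ℂ) * bc n k ζ = n * ζ := by
  have h := congrArg (Polynomial.eval ζ) (bernsteinPolynomial.sum_smul ℂ n)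
  rw [Polynomial.eval_finset_sum] at h
  rw [Fin.sum_univ_eq_sum_range (fun k => (k : ℂ) * bc n k ζ) (n+1)]
  simpa [bernsteinPolynomial, bc] using h

lemma bc_real (n k : ℕ) (t : unitInterval) : bc n k ((t : ℝ) : ℂ) = ((bernstein n k t : ℝ) : ℂ) := by
  rw [bernstein_apply, bc]; push_cast; rfl

theorem exists_curve {D : Set (EN N)} {r : EN N → ℝ} {V : Set (EN N)} {c δ : ℝ} (hg : Geo D r V c δ)
    {x : EN N} (hx : x ∈ frontier D) (hker : ∃ w, w ≠ 0 ∧ RL r x w = 0)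
    {M : ℝ} (hM : 0 < M) : ∃ Γ : ℂ → EN N, Differentiable ℂ Γ ∧ Γ 0 = 0 ∧ (∀ ζ, RL r x (Γ ζ) = ζ) ∧
      ∃ c0 > 0, ∀ s ∈ Icc 0 M, ∀ z ∈ closure D, c0 * s ≤ ‖x + Γ (s : ℝ) - z‖ := by
  obtain ⟨v, hv⟩ : ∃ v, RL r x v = 1 := by
    have h1 := hg.grad x hx
    obtain ⟨u, hu⟩ : ∃ u, fderiv ℝ r x u ≠ 0 := by
      by_contra h; push Not at h; exact h1 (ContinuousLinearMap.ext h)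
    have hu' : RL r x u ≠ 0 := fun h => hu (by rw [← RL_re, h]; rfl)
    exact ⟨(RL r x u)⁻¹ • u, by rw [map_smul, smul_eq_mul, inv_mul_cancel₀ hu']⟩
  obtain ⟨s0, hs0, γ, γc, γ0, γ1⟩ := exists_path hg hx hv hker M
  obtain ⟨B, hB⟩ := isCompact_Icc.exists_bound_of_continuousOn (f := fun σ => γ σ - x) (γc.sub continuousOn_const)
  set L := max (‖v‖ + 1) (B / s0) with hL
  have hL0 : 0 < L := lt_of_lt_of_le (by positivity) (le_max_left _ _)
  have hγL : ∀ σ ∈ Icc 0 M, ‖γ σ - x‖ ≤ L * σ := by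
    intro σ hσ
    by_cases h : σ ≤ s0
    · rw [γ0 σ hσ h, add_sub_cancel_left, norm_smul, Real.norm_of_nonneg hσ.1, mul_comm]
      exact mul_le_mul_of_nonneg_right (le_trans (by linarith) (le_max_left _ _)) hσ.1
    · refine (hB σ hσ).trans ?_
      have h' := (not_le.1 h).le
      have hB0 : 0 ≤ B := (norm_nonneg _).trans (hB σ hσ)
      calc B = B / s0 * s0 := by field_simp
        _ ≤ L * σ := mul_le_mul (le_max_right _ _) h' hs0.le hL0.le
  obtain ⟨ρ, hρ, c0, hc0, hcone⟩ := cone_out hg hx hL0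
  have hmem : ∀ t : unitInterval, M * (t : ℝ) ∈ Icc 0 M := fun t =>
    ⟨mul_nonneg hM.le t.2.1, mul_le_of_le_one_right hM.le t.2.2⟩
  let f : C(unitInterval, EN N) := ⟨fun t => γ (M * t) - x,
    ContinuousOn.comp_continuous (s := Icc 0 M) (g := fun σ => γ σ - x) (γc.sub continuousOn_const)
      (by fun_prop) hmem⟩
  have hf : ∀ t, f t = γ (M * t) - x := fun t => rfl
  set s1 := min (ρ / (2*L)) M with hs1
  have hs10 : 0 < s1 := lt_min (by positivity) hM
  -- positive distance
  obtain ⟨d, hd, hdist⟩ : ∃ d > 0, ∀ σ ∈ Icc s1 M, ∀ z ∈ closure D, d ≤ ‖γ σ - z‖ := by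
    have k1 : IsCompact (γ '' Icc s1 M) := isCompact_Icc.image_of_continuousOn (γc.mono (Icc_subset_Icc hs10.le le_rfl))
    have hdis : Disjoint (γ '' Icc s1 M) (closure D) := by
      rw [disjoint_left]
      rintro _ ⟨σ, hσ, rfl⟩
      exact (γ1 σ ⟨hs10.le.trans hσ.1, hσ.2⟩).2 (lt_of_lt_of_le hs10 hσ.1)
    obtain ⟨d, hd, h⟩ := hdis.exists_thickenings k1 isClosed_closure
    refine ⟨d, hd, fun σ hσ z hz => ?_⟩
    by_contra hlt
    refine disjoint_left.1 h (self_subset_thickening hd _ ⟨σ, hσ, rfl⟩) ?_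
    exact mem_thickening_iff.2 ⟨z, hz, by rw [dist_eq_norm]; exact not_le.1 hlt⟩
  have happ := (Metric.tendsto_nhds.1 (bernsteinApproximation_uniform f)) (d/2) (by positivity)
  obtain ⟨n, hn, hn1⟩ := (happ.and (eventually_ge_atTop 1)).exists
  have hn0 : (n : ℂ) ≠ 0 := by exact_mod_cast (by omega : n ≠ 0)
  have hn0' : (n : ℝ) ≠ 0 := by exact_mod_cast (by omega : n ≠ 0)
  have hMc : (M : ℂ) ≠ 0 := by exact_mod_cast hM.ne'
  set Γ : ℂ → EN N := fun ζ => ∑ k : Fin (n+1), bc n k (ζ / M) • f (bernstein.z k) with hΓ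
  have hzk : ∀ k : Fin (n+1), ((bernstein.z k : unitInterval) : ℝ) = (k : ℝ) / n := fun k => rfl
  have hRf : ∀ t : unitInterval, RL r x (f t) = ((M * t : ℝ) : ℂ) := fun t => by
    rw [hf]; exact (γ1 _ (hmem t)).1
  have hRΓ : ∀ ζ, RL r x (Γ ζ) = ζ := by
    intro ζ
    rw [hΓ]
    simp only [map_sum, map_smul, hRf, hzk, smul_eq_mul]
    have := bc_sum1 n (ζ / M)
    calc ∑ k : Fin (n+1), bc n k (ζ / M) * ((M * ((k : ℝ) / n) : ℝ) : ℂ)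
        = (M / n) * ∑ k : Fin (n+1), (k : ℂ) * bc n k (ζ / M) := by
          rw [Finset.mul_sum]; refine Finset.sum_congr rfl fun k _ => ?_
          push_cast; ring
      _ = ζ := by rw [this]; field_simp
  have hΓreal : ∀ t : unitInterval, Γ ((M * (t:ℝ) : ℝ) : ℂ) = bernsteinApproximation n f t := by
    intro t
    rw [bernsteinApproximation.apply, hΓ]
    refine Finset.sum_congr rfl fun k _ => ?_
    have : ((M * (t:ℝ) : ℝ) : ℂ) / M = ((t : ℝ) : ℂ) := by push_cast; field_simp
    rw [this, bc_real, ← real_smul_eq]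
  refine ⟨Γ, ?_, ?_, hRΓ, min c0 (d/(2*M)), lt_min hc0 (by positivity), ?_⟩
  · rw [hΓ]; unfold bc
    fun_prop
  · have h0 := hΓreal 0
    have : ((M * ((0 : unitInterval) : ℝ) : ℝ) : ℂ) = 0 := by simp
    rw [this, bernsteinApproximation.apply_zero, hf] at h0
    rw [h0]
    have : M * ((0 : unitInterval) : ℝ) = 0 := by simp
    rw [this, γ0 0 ⟨le_rfl, hM.le⟩ hs0.le]; simp
  · intro s hs z hz
    set t : unitInterval := ⟨s / M, div_nonneg hs.1 hM.le, div_le_one_of_le₀ hs.2 hM.le⟩ with ht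
    have hst : M * (t : ℝ) = s := by rw [ht]; field_simp
    have hΓs := hΓreal t
    rw [hst] at hΓs
    by_cases h : s < s1
    · have hnorm : ‖Γ (s:ℝ)‖ ≤ L * s := by
        rw [hΓs, bernsteinApproximation.apply]
        have hsum : ∑ k : Fin (n+1), (k : ℝ) * bernstein n k t = n * (t:ℝ) := by
          have := bc_sum1 n ((t:ℝ):ℂ)
          simp_rw [bc_real] at this
          exact_mod_cast this
        calc ‖∑ k : Fin (n+1), bernstein n k t • f (bernstein.z k)‖
            ≤ ∑ k : Fin (n+1), bernstein n k t * (L * (M * ((k:ℝ)/n))) := by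
              refine (norm_sum_le _ _).trans (Finset.sum_le_sum fun k _ => ?_)
              rw [norm_smul, Real.norm_of_nonneg bernstein_nonneg, hf, ← hzk]
              exact mul_le_mul_of_nonneg_left (hγL _ (hmem _)) bernstein_nonneg
          _ = L * M / n * ∑ k : Fin (n+1), (k : ℝ) * bernstein n k t := by
              rw [Finset.mul_sum]; refine Finset.sum_congr rfl fun k _ => ?_
              ring
          _ = L * s := by rw [hsum, ← hst]; field_simp
      have hdr : fderiv ℝ r x (Γ (s:ℝ)) = s := by rw [← RL_re, hRΓ]; simp
      have hsρ : s < ρ / (2*L) := lt_of_lt_of_le h (min_le_left _ _)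
      have h1 : L * s < ρ := by
        have := (lt_div_iff₀ (by positivity)).1 hsρ
        nlinarith [hs.1]
      have := hcone _ (lt_of_le_of_lt hnorm h1) (by rw [hdr]; exact hnorm) z hz
      rw [hdr] at this
      exact (mul_le_mul_of_nonneg_right (min_le_left _ _) hs.1).trans this
    · have h1 := hdist s ⟨not_lt.1 h, hs.2⟩ z hz
      have h2 : ‖bernsteinApproximation n f t - f t‖ < d/2 := by
        rw [← dist_eq_norm]; exact lt_of_le_of_lt (ContinuousMap.dist_apply_le_dist t) hn
      have h3 : ‖γ s - z‖ ≤ ‖x + Γ (s:ℝ) - z‖ + ‖bernsteinApproximation n f t - f t‖ := by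
        calc ‖γ s - z‖ = ‖(x + Γ (s:ℝ) - z) - (bernsteinApproximation n f t - f t)‖ := by
              rw [hΓs, hf, hst]; congr 1; abel
          _ ≤ _ := norm_sub_le _ _
      calc min c0 (d/(2*M)) * s ≤ d/(2*M) * M := mul_le_mul (min_le_right _ _) hs.2 hs.1 (by positivity)
        _ = d/2 := by field_simp
        _ ≤ _ := by linarith
end DFW
end

open Set Filter Topology Metric MeasureTheory
open scoped ENNReal NNReal InnerProductSpace ComplexConjugate
noncomputable section
namespace DFW
variable {N : ℕ}

lemma hol_contDiffAt {Φ : EN N → ℂ} {Ω : Set (EN N)} (hΩ : IsOpen Ω) (h : DifferentiableOn ℂ Φ Ω)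
    {z : EN N} (hz : z ∈ Ω) : ContDiffAt ℝ 2 Φ z := by
  let μ : Measure (EN N) := Measure.addHaar
  obtain ⟨R', hR', hsub⟩ := Metric.isOpen_iff.mp hΩ z hz
  set R := R' / 8 with hRdef
  have hR : 0 < R := by positivity
  obtain ⟨χ, χs, χc, χt, χ1, -⟩ := exists_cutoff (isCompact_closedBall z (4*R)) (isOpen_ball (x := z) (ε := R'))
    (closedBall_subset_ball (by rw [hRdef]; linarith))
  obtain ⟨σ, hσ, hσ0, hσr, hσ1, hσc, hσs⟩ := exists_radial μ hR
  let g : EN N → ℂ := fun w => (χ w : ℂ) * Φ w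
  have gc : Continuous g := by
    rw [continuous_iff_continuousAt]
    intro w
    by_cases hw : w ∈ tsupport χ
    · have : ContinuousAt Φ w := (h.differentiableAt (hΩ.mem_nhds (hsub (χt hw)))).continuousAt
      exact ((Complex.continuous_ofReal.comp χs.continuous).continuousAt).mul this
    · have : g =ᶠ[𝓝 w] fun _ => 0 := by
        filter_upwards [(isClosed_tsupport χ).isOpen_compl.mem_nhds hw] with y hy
        change (χ y : ℂ) * Φ y = 0
        rw [image_eq_zero_of_notMem_tsupport hy]; simp
      exact (continuousAt_const.congr this.symm)
  have g1 : ∀ w ∈ closedBall z (4*R), g w = Φ w := by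
    intro w hw
    have := (eventually_nhdsSet_iff_forall.mp χ1 w hw).self_of_nhds
    change (χ w : ℂ) * Φ w = Φ w
    rw [this]; simp
  have gh : DifferentiableOn ℂ g (ball z (4*R)) := by
    refine (h.mono ?_).congr fun w hw => g1 w (ball_subset_closedBall hw)
    exact (ball_subset_ball (by rw [hRdef]; linarith)).trans hsub
  let s := convolution σ g (ContinuousLinearMap.lsmul ℝ ℝ) μ
  have hs : ContDiff ℝ 2 s := hσc.contDiff_convolution_left _ hσ gc.locallyIntegrable
  refine hs.contDiffAt.congr_of_eventuallyEq ?_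
  filter_upwards [ball_mem_nhds z hR] with y hy
  have := circle_mean (μ := μ) hσ.continuous (r := R) (R := 2 * R) (by linarith) hσ0 hσr hσ1
      (h := g) gc (x := y) (gh.mono (ball_subset_ball' (by have := mem_ball.mp hy; linarith)))
  rw [← g1 y (ball_subset_closedBall (ball_subset_ball (by linarith) hy)), ← this]
  change _ = convolution _ _ _ _ _
  rw [convolution_def]
  simp

lemma hol_contDiffAt' {F : EN N → EN N} {Ω : Set (EN N)} (hΩ : IsOpen Ω) (h : DifferentiableOn ℂ F Ω)
    {z : EN N} (hz : z ∈ Ω) : ContDiffAt ℝ 2 F z := by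
  rw [contDiffAt_piLp (p := 2)]
  intro i
  refine hol_contDiffAt hΩ (Φ := fun w => F w i) ?_ hz
  exact differentiableOn_euclidean.mp h i

/-- monotonicity of the logarithm on the right half plane -/
lemma log_mono {α β : ℂ} (hα : 0 < α.re) (hβ : 0 < β.re) :
    0 ≤ ((Complex.log α - Complex.log β) * conj (α - β)).re := by
  set d := α - β with hd
  have hpos : ∀ s ∈ Icc (0:ℝ) 1, 0 < (β + s * d).re := by
    intro s hs
    have : (β + s * d).re = (1 - s) * β.re + s * α.re := by simp [hd]; ring
    rw [this]
    rcases hs.1.lt_or_eq with h | h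
    · have : 0 ≤ (1 - s) * β.re := mul_nonneg (by linarith [hs.2]) hβ.le
      have := mul_pos h hα; linarith
    · rw [← h]; simpa using hβ
  let f : ℝ → ℝ := fun s => (Complex.log (β + s * d) * conj d).re
  have hder : ∀ s ∈ Icc (0:ℝ) 1, HasDerivAt f (((β + s * d)⁻¹ * d * conj d).re) s := by
    intro s hs
    have h1 : HasDerivAt (fun s : ℝ => β + (s:ℂ) * d) d s := by
      have := ((Complex.ofRealCLM.hasDerivAt (x := s)).mul_const d).const_add β
      simpa using this
    have h2 : HasDerivAt (fun s : ℝ => Complex.log (β + (s:ℂ) * d)) (d / (β + (s:ℂ)*d)) s :=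
      h1.clog_real (Or.inl (hpos s hs))
    have h3 := (h2.mul_const (conj d))
    have h4 := Complex.reCLM.hasFDerivAt.comp_hasDerivAt s h3
    refine (h4.congr_deriv ?_)
    change (d / (β + (s:ℂ)*d) * conj d).re = _
    congr 1; rw [div_eq_mul_inv]; ring
  have hm : MonotoneOn f (Icc 0 1) := by
    refine monotoneOn_of_deriv_nonneg (convex_Icc 0 1) (fun s hs => (hder s hs).continuousAt.continuousWithinAt)
      (fun s hs => (hder s (interior_subset hs)).differentiableAt.differentiableWithinAt) ?_
    intro s hs
    rw [(hder s (interior_subset hs)).deriv, mul_assoc, Complex.mul_conj]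
    rw [Complex.re_mul_ofReal]
    refine mul_nonneg ?_ (Complex.normSq_nonneg _)
    rw [Complex.inv_re]
    exact div_nonneg (hpos s (interior_subset hs)).le (Complex.normSq_nonneg _)
  have := hm (left_mem_Icc.mpr zero_le_one) (right_mem_Icc.mpr zero_le_one) zero_le_one
  simp only [f] at this
  rw [sub_mul, Complex.sub_re]
  have e : β + (1:ℂ) * d = α := by rw [hd]; ring
  push_cast at this
  rw [e] at this
  simpa using this

lemma log_lip {α β : ℂ} {m : ℝ} (hm : 0 < m) (hα : m ≤ α.re) (hβ : m ≤ β.re) :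
    ‖Complex.log α - Complex.log β‖ ≤ m⁻¹ * ‖α - β‖ := by
  have hc : Convex ℝ {z : ℂ | m ≤ z.re} := convex_halfSpace_re_ge m
  refine hc.norm_image_sub_le_of_norm_hasDerivWithin_le (f := Complex.log) (f' := fun z => z⁻¹) ?_ ?_ hβ hα
  · intro z hz
    exact (Complex.hasDerivAt_log (Or.inl (lt_of_lt_of_le hm hz))).hasDerivWithinAt
  · intro z hz
    rw [norm_inv]
    exact inv_anti₀ hm ((show m ≤ z.re from hz).trans (Complex.re_le_norm z))

end DFW
end

open Set Filter Topology Metric MeasureTheory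
open scoped ENNReal NNReal InnerProductSpace ComplexConjugate
noncomputable section
namespace DFW
variable {N : ℕ}

/-- the exponent -/
def aF (Φ : EN N → ℂ) (ε t : ℝ) (z : EN N) : ℂ := -(ε : ℂ) * Complex.log ((t : ℂ) + Φ z)
/-- the exposing map -/
def FF (Γ : ℂ → EN N) (Φ : EN N → ℂ) (ε t : ℝ) (z : EN N) : EN N := z + Γ (aF Φ ε t z)

lemma aF_diff {Φ : EN N → ℂ} {ε t : ℝ} {z : EN N} (h : DifferentiableAt ℂ Φ z) (hp : 0 < ((t:ℂ) + Φ z).re) :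
    DifferentiableAt ℂ (aF Φ ε t) z := by
  have h1 : DifferentiableAt ℂ (fun z => (t:ℂ) + Φ z) z := h.const_add _
  exact (h1.clog (Or.inl hp)).const_mul _

lemma FF_diff {Γ : ℂ → EN N} (hΓ : Differentiable ℂ Γ) {Φ : EN N → ℂ} {ε t : ℝ} {z : EN N}
    (h : DifferentiableAt ℂ Φ z) (hp : 0 < ((t:ℂ) + Φ z).re) :
    DifferentiableAt ℂ (FF Γ Φ ε t) z :=
  differentiableAt_id.add ((hΓ _).comp z (aF_diff h hp))

lemma log_im_le {α : ℂ} (h : 0 < α.re) : |(Complex.log α).im| ≤ 2 := by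
  rw [Complex.log_im]
  have := (Complex.abs_arg_lt_pi_div_two_iff.mpr (Or.inl h)).le
  have := Real.pi_le_four
  linarith

/-- near the clamped value -/
lemma a_clamp {α : ℂ} {ε t M B : ℝ} (hε : 0 < ε) (hM : 0 < M) (ht : t = Real.exp (-M/ε)) (hB : 1 ≤ B)
    (hα : t/2 < α.re) (hn : ‖α‖ ≤ B) :
    ∃ s ∈ Icc 0 M, ‖-(ε:ℂ) * Complex.log α - (s:ℝ)‖ ≤ ε * (Real.log B + 4) := by
  have tp : 0 < t := by rw [ht]; positivity
  have hα0 : 0 < α.re := by linarith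
  have n1 : t/2 < ‖α‖ := hα.trans_le (Complex.re_le_norm α)
  have n0 : 0 < ‖α‖ := by linarith
  have lB : 0 ≤ Real.log B := Real.log_nonneg hB
  have l1 : Real.log ‖α‖ ≤ Real.log B := Real.log_le_log n0 hn
  have l2 : -M/ε - 1 ≤ Real.log ‖α‖ := by
    have h1 : Real.log (t/2) ≤ Real.log ‖α‖ := Real.log_le_log (by positivity) n1.le
    rw [Real.log_div tp.ne' (by norm_num), ht, Real.log_exp] at h1
    have := Real.log_two_lt_d9
    linarith
  have im := log_im_le hα0
  set y := -(ε * Real.log ‖α‖) with hy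
  have y1 : -(ε * Real.log B) ≤ y := by rw [hy]; exact neg_le_neg (mul_le_mul_of_nonneg_left l1 hε.le)
  have y2 : y ≤ M + ε := by
    have := mul_le_mul_of_nonneg_left l2 hε.le
    have e : ε * (-M/ε - 1) = -M - ε := by field_simp
    rw [e] at this; rw [hy]; linarith
  have εB : 0 ≤ ε * Real.log B := by positivity
  obtain ⟨s, hs, hys⟩ : ∃ s ∈ Icc 0 M, |y - s| ≤ ε * (Real.log B + 1) := by
    rcases le_total y 0 with h | h
    · refine ⟨0, ⟨le_rfl, hM.le⟩, ?_⟩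
      rw [sub_zero, abs_of_nonpos h]; linarith
    · rcases le_total y M with h' | h'
      · refine ⟨y, ⟨h, h'⟩, ?_⟩
        simp; positivity
      · refine ⟨M, ⟨hM.le, le_rfl⟩, ?_⟩
        rw [abs_of_nonneg (by linarith)]; linarith
  refine ⟨s, hs, ?_⟩
  refine (Complex.norm_le_abs_re_add_abs_im _).trans ?_
  have r1 : (-(ε:ℂ) * Complex.log α - (s:ℝ)).re = y - s := by
    simp [hy, Complex.log_re]
  have r2 : (-(ε:ℂ) * Complex.log α - (s:ℝ)).im = -(ε * (Complex.log α).im) := by simp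
  rw [r1, r2, abs_neg, abs_mul, abs_of_pos hε]
  have := mul_le_mul_of_nonneg_left im hε.le
  linarith

lemma a_small {α : ℂ} {ε m B : ℝ} (hε : 0 < ε) (hm : 0 < m) (hα : m ≤ α.re) (hn : ‖α‖ ≤ B) :
    ‖-(ε:ℂ) * Complex.log α‖ ≤ ε * (|Real.log B| + |Real.log m| + 2) := by
  have hα0 : 0 < α.re := by linarith
  have n1 : m ≤ ‖α‖ := hα.trans (Complex.re_le_norm α)
  have n0 : 0 < ‖α‖ := by linarith
  rw [norm_mul, norm_neg, Complex.norm_real, Real.norm_eq_abs, abs_of_pos hε]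
  refine mul_le_mul_of_nonneg_left ?_ hε.le
  refine (Complex.norm_le_abs_re_add_abs_im _).trans ?_
  rw [Complex.log_re]
  have l1 : Real.log ‖α‖ ≤ Real.log B := Real.log_le_log n0 hn
  have l2 : Real.log m ≤ Real.log ‖α‖ := Real.log_le_log hm n1
  have : |Real.log ‖α‖| ≤ |Real.log B| + |Real.log m| := by
    rw [abs_le]
    have := neg_abs_le (Real.log m); have := le_abs_self (Real.log B)
    have := abs_nonneg (Real.log m); have := abs_nonneg (Real.log B)
    constructor <;> linarith
  have := log_im_le hα0
  linarith

lemma lip_on_compact {E F : Type*} [NormedAddCommGroup E] [NormedSpace ℝ E] [NormedAddCommGroup F]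
    [NormedSpace ℝ F] {f : E → F} {K : Set E} (hK : IsCompact K) (h : ∀ z ∈ K, ContDiffAt ℝ 1 f z) :
    ∃ L > (0:ℝ), ∀ z ∈ K, ∀ w ∈ K, ‖f z - f w‖ ≤ L * ‖z - w‖ := by
  have : LocallyLipschitzOn K f := by
    intro z hz
    obtain ⟨k, t, ht, hl⟩ := (h z hz).exists_lipschitzOnWith
    exact ⟨k, t, mem_nhdsWithin_of_mem_nhds ht, hl⟩
  obtain ⟨k, hk⟩ := this.exists_lipschitzOnWith_of_compact hK
  refine ⟨k + 1, by positivity, fun z hz w hw => ?_⟩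
  have := hk.dist_le_mul z hz w hw
  rw [dist_eq_norm, dist_eq_norm] at this
  refine this.trans (mul_le_mul_of_nonneg_right (by linarith) (norm_nonneg _))

/-- near-near case -/
lemma inj_near {Φ : EN N → ℂ} {Γ : ℂ → EN N} {R : EN N →L[ℂ] ℂ} (hR : ∀ ζ, R (Γ ζ) = ζ) {ε t L : ℝ}
    (hε : 0 < ε) (hL : 0 < L) {z w : EN N} (hz : 0 < ((t:ℂ) + Φ z).re) (hw : 0 < ((t:ℂ) + Φ w).re)
    (hs : ‖Φ z - Φ w + R (z - w)‖ ≤ 1/(2*L) * ‖z - w‖)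
    (hl : ‖Γ (aF Φ ε t w) - Γ (aF Φ ε t z)‖ ≤ L * ‖aF Φ ε t w - aF Φ ε t z‖)
    (he : FF Γ Φ ε t z = FF Γ Φ ε t w) : z = w := by
  set a := aF Φ ε t z with ha
  set b := aF Φ ε t w with hb
  have h1 : z - w = Γ b - Γ a := by
    have : z + Γ a = w + Γ b := he
    rw [sub_eq_sub_iff_add_eq_add, this, add_comm]
  have h2 : R (z - w) = b - a := by rw [h1, map_sub, hR, hR]
  rw [h2] at hs
  have h3 : ‖Φ z - Φ w + (b - a)‖ ≤ 1/2 * ‖b - a‖ := by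
    refine hs.trans ?_
    rw [h1]
    calc 1/(2*L) * ‖Γ b - Γ a‖ ≤ 1/(2*L) * (L * ‖b - a‖) := mul_le_mul_of_nonneg_left hl (by positivity)
      _ = 1/2 * ‖b - a‖ := by field_simp
  set e := Φ z - Φ w + (b - a) with hee
  have hm := log_mono hz hw
  have e1 : (t:ℂ) + Φ z - ((t:ℂ) + Φ w) = e - (b - a) := by rw [hee]; ring
  have e2 : (ε:ℂ) * (Complex.log ((t:ℂ) + Φ z) - Complex.log ((t:ℂ) + Φ w)) = b - a := by
    simp only [ha, hb, aF]; ring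
  rw [e1] at hm
  have hm2 : 0 ≤ ((b - a) * conj (e - (b - a))).re := by
    rw [← e2, mul_assoc, Complex.re_ofReal_mul, e2]
    exact mul_nonneg hε.le hm
  rw [map_sub, mul_sub, Complex.sub_re, Complex.mul_conj, Complex.ofReal_re, Complex.normSq_eq_norm_sq] at hm2
  have h4 : ((b - a) * conj e).re ≤ ‖b - a‖ * (1/2 * ‖b - a‖) := by
    refine (Complex.re_le_norm _).trans ?_
    rw [norm_mul, RCLike.norm_conj]
    exact mul_le_mul_of_nonneg_left h3 (norm_nonneg _)
  have h5 : ‖b - a‖ = 0 := by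
    have := norm_nonneg (b - a)
    nlinarith
  have h6 : b = a := sub_eq_zero.mp (norm_eq_zero.mp h5)
  rw [h6, sub_self] at h1
  exact sub_eq_zero.mp h1

end DFW
end

open Set Filter Topology Metric MeasureTheory
open scoped ENNReal NNReal InnerProductSpace ComplexConjugate
noncomputable section
namespace DFW
variable {N : ℕ}

set_option maxHeartbeats 1000000 in
theorem exists_inj {D : Set (EN N)} {r : EN N → ℝ} {x : EN N} {Ω : Set (EN N)} {Φ : EN N → ℂ} {c C : ℝ}
    (hp : Peak D r x Ω Φ c C) (hDc : IsCompact (closure D)) (hx : x ∈ closure D)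
    {Γ : ℂ → EN N} (hΓ : Differentiable ℂ Γ) (Γ0 : Γ 0 = 0) (hR : ∀ ζ, RL r x (Γ ζ) = ζ)
    {M c0 : ℝ} (hM : 0 < M) (hc0 : 0 < c0)
    (hav : ∀ s ∈ Icc 0 M, ∀ z ∈ closure D, c0 * s ≤ ‖x + Γ (s : ℝ) - z‖) :
    ∃ ε0 > 0, ∀ ε t : ℝ, 0 < ε → ε < ε0 → t = Real.exp (-M/ε) →
      ∃ O, IsOpen O ∧ closure D ⊆ O ∧ O ⊆ Ω ∧ (∀ z ∈ O, 0 < ((t:ℂ) + Φ z).re) ∧ InjOn (FF Γ Φ ε t) O := by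
  have hΦ : ∀ z ∈ Ω, ContDiffAt ℝ 2 Φ z := fun z hz => hol_contDiffAt hp.oΩ hp.hol hz
  obtain ⟨K0, hK0, hDK, hKΩ⟩ := exists_compact_between hDc hp.oΩ hp.sub
  obtain ⟨LΦ, hLΦ, lipΦ⟩ := lip_on_compact hK0 (fun z hz => (hΦ z (hKΩ hz)).of_le (by norm_num))
  have hΓc : ContDiff ℝ 1 Γ := (hΓ.contDiff (n := 1)).restrict_scalars ℝ
  obtain ⟨L, hL, lipΓ⟩ := lip_on_compact (isCompact_closedBall (0:ℂ) (M+2)) (fun z _ => hΓc.contDiffAt)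
  obtain ⟨B1, hB1⟩ := hK0.exists_bound_of_continuousOn (f := Φ)
    (fun z hz => (hΦ z (hKΩ hz)).continuousAt.continuousWithinAt)
  set B := max 1 (1 + B1) with hB
  have hB1' : 1 ≤ B := le_max_left _ _
  -- strict differentiability
  have hstr : HasStrictFDerivAt Φ ((-RL r x).restrictScalars ℝ) x :=
    (hΦ x (hp.sub hx)).hasStrictFDerivAt' (hp.der.restrictScalars ℝ) (by norm_num)
  obtain ⟨S, hS, happ⟩ := hstr.approximates_deriv_on_nhds (c := ⟨1/(2*L), by positivity⟩)
    (Or.inr (by change (0:ℝ) < 1/(2*L); positivity))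
  obtain ⟨ρ, hρ, hρS⟩ := Metric.mem_nhds_iff.mp hS
  set K := 2 * L / c0 + 3 with hK
  have Kp : 3 ≤ K := by rw [hK]; have : 0 ≤ 2*L/c0 := by positivity
                        linarith
  set s1 := ρ / K with hs1
  have s1p : 0 < s1 := by rw [hs1]; positivity
  have hKs : K * s1 = ρ := by rw [hs1]; field_simp
  set m := c * s1^2 / 2 with hm
  have mp : 0 < m := by rw [hm]; have := hp.cpos; positivity
  -- constants
  set A := Real.log B + 4 with hA
  set A' := |Real.log B| + |Real.log m| + 2 with hA'
  have Ap : 0 < A := by rw [hA]; have := Real.log_nonneg hB1'; linarith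
  have Ap' : 0 < A' := by rw [hA']; positivity
  refine ⟨min (1/A) (min (1/A') (min (m/(L*LΦ)) (s1/(2*L*(A+A'))))), by positivity, ?_⟩
  intro ε t hε hε0 ht
  obtain ⟨e1, e2, e3, e4⟩ : ε < 1/A ∧ ε < 1/A' ∧ ε < m/(L*LΦ) ∧ ε < s1/(2*L*(A+A')) := by
    simpa [lt_min_iff] using hε0
  rw [lt_div_iff₀ (by positivity)] at e1 e2 e3 e4
  have tp : 0 < t := by rw [ht]; positivity
  have t1 : t ≤ 1 := by
    rw [ht, Real.exp_le_one_iff]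
    exact div_nonpos_of_nonpos_of_nonneg (by linarith) hε.le
  let W : Set ℂ := {ζ | -(t/2) < ζ.re}
  have hWo : IsOpen W := isOpen_lt continuous_const Complex.continuous_re
  have hWm : IsOpen {ζ : ℂ | m < ζ.re} := isOpen_lt continuous_const Complex.continuous_re
  have hΦc : ContinuousOn Φ (interior K0) := fun z hz =>
    (hΦ z (hKΩ (interior_subset hz))).continuousAt.continuousWithinAt
  let O : Set (EN N) := ((interior K0 ∩ Φ ⁻¹' W) ∩ thickening (s1/2) (closure D)) ∩
    ((interior K0 ∩ Φ ⁻¹' {ζ : ℂ | m < ζ.re}) ∪ ball x s1)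
  have Oo : IsOpen O := ((hΦc.isOpen_inter_preimage isOpen_interior hWo).inter isOpen_thickening).inter
    ((hΦc.isOpen_inter_preimage isOpen_interior hWm).union isOpen_ball)
  have OD : closure D ⊆ O := by
    intro z hz
    have h1 := hp.lower z hz
    have h0 : 0 ≤ c * ‖z - x‖^2 := by have := hp.cpos; positivity
    refine ⟨⟨⟨hDK hz, ?_⟩, self_subset_thickening (by positivity) _ hz⟩, ?_⟩
    · change -(t/2) < (Φ z).re; linarith
    · by_cases h : z ∈ ball x s1
      · exact Or.inr h
      · refine Or.inl ⟨hDK hz, ?_⟩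
        change m < (Φ z).re
        have h2 : s1 ≤ ‖z - x‖ := by simpa [dist_eq_norm] using h
        have h3 : c * s1^2 ≤ c * ‖z - x‖^2 := by
          have := hp.cpos; gcongr
        have : 0 < c * s1^2 := by have := hp.cpos; positivity
        rw [hm]; linarith
  have OK : ∀ z ∈ O, z ∈ K0 := fun z hz => interior_subset hz.1.1.1
  have Ore : ∀ z ∈ O, t/2 < ((t:ℂ) + Φ z).re := by
    intro z hz
    have : -(t/2) < (Φ z).re := hz.1.1.2
    simp; linarith
  have Obd : ∀ z ∈ O, ‖(t:ℂ) + Φ z‖ ≤ B := by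
    intro z hz
    refine (norm_add_le _ _).trans ?_
    rw [Complex.norm_real, Real.norm_eq_abs, abs_of_pos tp]
    have := hB1 z (OK z hz)
    exact (add_le_add t1 this).trans (le_max_right _ _)
  have Ofar : ∀ z ∈ O, z ∉ ball x s1 → m ≤ ((t:ℂ) + Φ z).re := by
    intro z hz h
    have h2 : m < (Φ z).re := (hz.2.resolve_right h).2
    simp; linarith
  have clamp : ∀ z ∈ O, ∃ s ∈ Icc 0 M, ‖aF Φ ε t z - (s:ℝ)‖ ≤ ε * A := fun z hz =>
    a_clamp hε hM ht hB1' (Ore z hz) (Obd z hz)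
  have small : ∀ z ∈ O, z ∉ ball x s1 → ‖aF Φ ε t z‖ ≤ ε * A' := fun z hz h =>
    a_small hε mp (Ofar z hz h) (Obd z hz)
  have sball : ∀ s ∈ Icc 0 M, ((s:ℝ):ℂ) ∈ closedBall (0:ℂ) (M+2) := by
    intro s hs
    rw [mem_closedBall_zero_iff, Complex.norm_real, Real.norm_eq_abs, abs_of_nonneg hs.1]
    linarith [hs.2]
  have aball : ∀ z ∈ O, aF Φ ε t z ∈ closedBall (0:ℂ) (M+2) := by
    intro z hz
    obtain ⟨s, hs, h⟩ := clamp z hz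
    have : aF Φ ε t z = (aF Φ ε t z - (s:ℝ)) + (s:ℝ) := by ring
    rw [mem_closedBall_zero_iff, this]
    refine (norm_add_le _ _).trans ?_
    rw [Complex.norm_real, Real.norm_eq_abs, abs_of_nonneg hs.1]
    linarith [hs.2]
  have z0ball : (0:ℂ) ∈ closedBall (0:ℂ) (M+2) := mem_closedBall_self (by linarith)
  have main : ∀ z ∈ O, ∀ w ∈ O, z ∈ ball x s1 → FF Γ Φ ε t z = FF Γ Φ ε t w → z = w := by
    intro z hz w hw hzx he
    by_cases hwx : w ∈ ball x ρ
    · have hzx' : z ∈ ball x ρ := ball_subset_ball (by rw [← hKs]; nlinarith) hzx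
      have h := happ z (hρS hzx') w (hρS hwx)
      refine inj_near hR hε hL (by have := Ore z hz; linarith) (by have := Ore w hw; linarith) ?_
        (lipΓ _ (aball w hw) _ (aball z hz)) he
      have e : Φ z - Φ w - ((-RL r x).restrictScalars ℝ) (z - w) = Φ z - Φ w + RL r x (z - w) := by
        simp; ring
      rw [e] at h
      exact h
    · exfalso
      have hwx1 : w ∉ ball x s1 := fun h => hwx (ball_subset_ball (by rw [← hKs]; nlinarith) h)
      obtain ⟨s, hs, h⟩ := clamp z hz
      have h1 := lipΓ _ (sball s hs) _ (aball z hz)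
      have h2 := lipΓ _ (aball w hw) _ z0ball
      rw [Γ0, sub_zero, sub_zero] at h2
      have h3 := small w hw hwx1
      have h4 := lipΓ _ (sball s hs) _ z0ball
      rw [Γ0, sub_zero, sub_zero, Complex.norm_real, Real.norm_eq_abs, abs_of_nonneg hs.1] at h4
      have he' : z + Γ (aF Φ ε t z) = w + Γ (aF Φ ε t w) := he
      have hzx2 : ‖z - x‖ < s1 := by simpa [dist_eq_norm] using hzx
      have h5 : ‖x + Γ (s:ℝ) - w‖ ≤ s1 + s1/2 := by
        have e : x + Γ (s:ℝ) - w = (x - z) + (Γ (s:ℝ) - Γ (aF Φ ε t z)) + Γ (aF Φ ε t w) := by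
          have : w = z + Γ (aF Φ ε t z) - Γ (aF Φ ε t w) := by rw [he']; abel
          rw [sub_eq_iff_eq_add]
          nth_rw 2 [this]; abel
        rw [e]
        refine (norm_add₃_le).trans ?_
        rw [norm_sub_rev] at h
        rw [norm_sub_rev x z]
        have h6 : L * ‖(s:ℂ) - aF Φ ε t z‖ ≤ L * (ε * A) := mul_le_mul_of_nonneg_left h hL.le
        have h7 : L * ‖aF Φ ε t w‖ ≤ L * (ε * A') := mul_le_mul_of_nonneg_left h3 hL.le
        have : L * (ε * A) + L * (ε * A') ≤ s1/2 := by nlinarith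
        linarith
      obtain ⟨w', hw', hww⟩ := mem_thickening_iff.mp hw.1.2
      rw [dist_eq_norm] at hww
      have h6 : c0 * s ≤ 2 * s1 := by
        refine (hav s hs w' hw').trans ?_
        have e : x + Γ (s:ℝ) - w' = (x + Γ (s:ℝ) - w) + (w - w') := by abel
        rw [e]
        refine (norm_add_le _ _).trans ?_
        linarith
      have h7 : s ≤ 2 * s1 / c0 := by rw [le_div_iff₀ hc0]; linarith
      have h8 : ‖Γ (s:ℝ)‖ ≤ L * (2 * s1 / c0) := h4.trans (mul_le_mul_of_nonneg_left h7 hL.le)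
      have h9 : ρ ≤ ‖w - x‖ := by simpa [dist_eq_norm] using hwx
      have h10 : ‖w - x‖ ≤ ‖Γ (s:ℝ)‖ + ‖x + Γ (s:ℝ) - w‖ := by
        have e : w - x = Γ (s:ℝ) - (x + Γ (s:ℝ) - w) := by abel
        rw [e]; exact norm_sub_le _ _
      have h11 : L * (2 * s1 / c0) + (s1 + s1/2) < K * s1 := by
        have : L * (2 * s1 / c0) = 2 * L / c0 * s1 := by ring
        rw [this, hK]; nlinarith
      linarith
  refine ⟨O, Oo, OD, fun z hz => hKΩ (OK z hz), fun z hz => by have := Ore z hz; linarith, ?_⟩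
  intro z hz w hw he
  by_cases hzx : z ∈ ball x s1
  · exact main z hz w hw hzx he
  by_cases hwx : w ∈ ball x s1
  · exact (main w hw z hz hwx he.symm).symm
  have h1 := lipΓ _ (aball w hw) _ (aball z hz)
  have he' : z + Γ (aF Φ ε t z) = w + Γ (aF Φ ε t w) := he
  have h2 : z - w = Γ (aF Φ ε t w) - Γ (aF Φ ε t z) := by
    rw [sub_eq_sub_iff_add_eq_add, he', add_comm]
  have h3 : ‖aF Φ ε t w - aF Φ ε t z‖ ≤ ε * (m⁻¹ * (LΦ * ‖z - w‖)) := by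
    have e : aF Φ ε t w - aF Φ ε t z = (ε:ℂ) * (Complex.log ((t:ℂ) + Φ z) - Complex.log ((t:ℂ) + Φ w)) := by
      simp only [aF]; ring
    rw [e, norm_mul, Complex.norm_real, Real.norm_eq_abs, abs_of_pos hε]
    refine mul_le_mul_of_nonneg_left ?_ hε.le
    refine (log_lip mp (Ofar z hz hzx) (Ofar w hw hwx)).trans (mul_le_mul_of_nonneg_left ?_ (by positivity))
    rw [add_sub_add_left_eq_sub]
    exact lipΦ z (OK z hz) w (OK w hw)
  rw [← h2] at h1
  have h4 : ‖z - w‖ ≤ L * (ε * (m⁻¹ * (LΦ * ‖z - w‖))) := h1.trans (mul_le_mul_of_nonneg_left h3 hL.le)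
  have h5 : L * (ε * (m⁻¹ * (LΦ * ‖z - w‖))) = (ε * (L * LΦ) / m) * ‖z - w‖ := by field_simp
  rw [h5] at h4
  have h6 : ε * (L * LΦ) / m < 1 := by rw [div_lt_one mp]; exact e3
  have h7 : ‖z - w‖ = 0 := by
    by_contra hne
    have : 0 < ‖z - w‖ := lt_of_le_of_ne (norm_nonneg _) (Ne.symm hne)
    nlinarith
  exact sub_eq_zero.mp (norm_eq_zero.mp h7)

end DFW
end

open Set Filter Topology Metric MeasureTheory
open scoped ENNReal NNReal InnerProductSpace ComplexConjugate
noncomputable section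
namespace DFW
variable {N : ℕ}

section generic
variable {E F : Type*} [NormedAddCommGroup E] [NormedSpace ℝ E] [NormedAddCommGroup F] [NormedSpace ℝ F]

lemma taylor2s {f : E → F} {x : E} (hf : ContDiffAt ℝ 2 f x) {η : ℝ} (hη : 0 < η) :
    ∃ ρ > 0, ∀ z ∈ ball x ρ, ∀ p ∈ ball x ρ, ‖f z - f p - fderiv ℝ f p (z - p) -
      (1/2:ℝ) • (fderiv ℝ (fderiv ℝ f) x (z - p) (z - p))‖ ≤ η * ‖z - p‖^2 := by
  have hd : ContDiffAt ℝ 1 (fderiv ℝ f) x := hf.fderiv_right (by norm_num)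
  have hstr := hd.hasStrictFDerivAt one_ne_zero
  set B := fderiv ℝ (fderiv ℝ f) x with hB
  have hsym : ∀ v w, B v w = B w v := hf.isSymmSndFDerivAt (by simp)
  obtain ⟨S, hS, happ⟩ := hstr.approximates_deriv_on_nhds (c := ⟨η, hη.le⟩) (Or.inr hη)
  have hev : ∀ᶠ y in 𝓝 x, ContDiffAt ℝ 2 f y := hf.eventually (by simp)
  obtain ⟨ρ, hρ, hρS⟩ := Metric.mem_nhds_iff.mp (inter_mem hS hev)
  refine ⟨ρ, hρ, fun z hz p hp => ?_⟩
  let g : E → F := fun y => f y - fderiv ℝ f p (y - p) - (1/2:ℝ) • (B (y - p) (y - p))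
  have hg : ∀ y ∈ ball x ρ, HasFDerivAt g (fderiv ℝ f y - fderiv ℝ f p - B (y - p)) y := by
    intro y hy
    have h1 : HasFDerivAt f (fderiv ℝ f y) y :=
      (ContDiffAt.differentiableAt (n := 2) (show ContDiffAt ℝ 2 f y from (hρS hy).2) (by norm_num)).hasFDerivAt
    have h0 : HasFDerivAt (fun y => y - p) (ContinuousLinearMap.id ℝ E) y := (hasFDerivAt_id y).sub_const p
    have h2 : HasFDerivAt (fun y => fderiv ℝ f p (y - p)) ((fderiv ℝ f p).comp (ContinuousLinearMap.id ℝ E)) y :=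
      (fderiv ℝ f p).hasFDerivAt.comp y h0
    have h3 : HasFDerivAt (fun y => B (y - p)) (B.comp (ContinuousLinearMap.id ℝ E)) y :=
      B.hasFDerivAt.comp y h0
    have h4 := h3.clm_apply h0
    refine ((h1.sub h2).sub (h4.const_smul (1/2:ℝ))).congr_fderiv ?_
    ext w
    simp only [ContinuousLinearMap.sub_apply, ContinuousLinearMap.comp_apply, ContinuousLinearMap.smul_apply,
      ContinuousLinearMap.add_apply, ContinuousLinearMap.flip_apply, ContinuousLinearMap.id_apply]
    rw [hsym w, ← two_smul ℝ (B (y - p) w), smul_smul]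
    norm_num
  have hcv : Convex ℝ (ball x ρ ∩ closedBall p ‖z - p‖) := (convex_ball x ρ).inter (convex_closedBall _ _)
  have := hcv.norm_image_sub_le_of_norm_hasFDerivWithin_le (f := g) (C := η * ‖z - p‖)
    (fun y hy => (hg y hy.1).hasFDerivWithinAt) (fun y hy => ?_)
    (x := p) (y := z) ⟨hp, mem_closedBall_self (norm_nonneg _)⟩ ⟨hz, by simp [dist_eq_norm]⟩
  · have e : g z - g p = f z - f p - fderiv ℝ f p (z - p) - (1/2:ℝ) • (B (z - p) (z - p)) := by
      simp only [g, sub_self, map_zero, smul_zero, sub_zero]; abel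
    rw [e] at this
    refine this.trans (le_of_eq (by ring))
  · have h := happ y (hρS hy.1).1 p (hρS hp).1
    refine h.trans ?_
    have : ‖y - p‖ ≤ ‖z - p‖ := by simpa [dist_eq_norm] using hy.2
    exact mul_le_mul_of_nonneg_left this hη.le

lemma taylor_quad {f : E → F} {x : E} (hf : ContDiffAt ℝ 2 f x) :
    ∃ K ≥ 0, ∃ ρ > 0, ∀ z ∈ ball x ρ, ∀ p ∈ ball x ρ, ‖f z - f p - fderiv ℝ f p (z - p)‖ ≤ K * ‖z - p‖^2 := by
  obtain ⟨ρ, hρ, h⟩ := taylor2s hf one_pos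
  set B := fderiv ℝ (fderiv ℝ f) x with hB
  refine ⟨1 + 1/2 * ‖B‖, by positivity, ρ, hρ, fun z hz p hp => ?_⟩
  have h1 := h z hz p hp
  have h2 : ‖(1/2:ℝ) • (B (z - p) (z - p))‖ ≤ 1/2 * (‖B‖ * ‖z - p‖^2) := by
    rw [norm_smul, sq, ← mul_assoc ‖B‖]
    have := B.le_opNorm₂ (z - p) (z - p)
    rw [show ‖(1/2:ℝ)‖ = 1/2 by norm_num]
    exact mul_le_mul_of_nonneg_left this (by norm_num)
  have h3 := norm_sub_norm_le (f z - f p - fderiv ℝ f p (z - p)) ((1/2:ℝ) • (B (z - p) (z - p)))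
  linarith
end generic

/-- the conclusion of the exposing construction at one boundary point -/
def Exposable (D : Set (EN N)) (r : EN N → ℝ) (x : EN N) : Prop :=
  ∃ (F : EN N → EN N) (O : Set (EN N)) (l : EN N →L[ℝ] ℝ) (C c : ℝ), IsOpen O ∧ closure D ⊆ O ∧
    DifferentiableOn ℂ F O ∧ InjOn F O ∧ (∀ w, fderiv ℝ F x w = 0 → w = 0) ∧
    (∀ z ∈ closure D, z ≠ x → l (F z) < l (F x)) ∧ 0 < c ∧
    ∀ᶠ z in 𝓝 x, c * ‖z - x‖^2 ≤ r z + C * (r z)^2 - l (F z - F x)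

lemma log_lower {ζ : ℂ} (h : ‖ζ‖ ≤ 1/2) :
    ζ.re - (ζ^2).re / 2 - ‖ζ‖^3 ≤ (Complex.log (1 + ζ)).re := by
  have h1 := Complex.norm_log_sub_logTaylor_le 2 (z := ζ) (by linarith)
  have e : Complex.logTaylor (2+1) ζ = ζ - ζ^2/2 := by
    simp [Complex.logTaylor_succ, Complex.logTaylor_zero]; ring
  rw [e] at h1
  have h2 : ‖ζ‖^(2+1) * (1 - ‖ζ‖)⁻¹ / (2+1) ≤ ‖ζ‖^3 := by
    have : (1 - ‖ζ‖)⁻¹ ≤ 2 := by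
      rw [inv_le_comm₀ (by linarith) (by norm_num)]; linarith
    have h3 := mul_le_mul_of_nonneg_left this (pow_nonneg (norm_nonneg ζ) 3)
    have := pow_nonneg (norm_nonneg ζ) 3
    norm_num
    linarith
  have h3 := (Complex.abs_re_le_norm _).trans (h1.trans (by simpa using h2))
  rw [Complex.sub_re, Complex.sub_re] at h3
  have e2 : (ζ^2/2).re = (ζ^2).re / 2 := by
    have : (ζ^2/2) = ζ^2 / ((2:ℝ):ℂ) := by norm_num
    rw [this, Complex.div_ofReal_re]
  rw [e2] at h3
  have := (abs_le.mp h3).1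
  linarith

variable {D : Set (EN N)} {r : EN N → ℝ} {x : EN N} {Ω : Set (EN N)} {Φ : EN N → ℂ} {c C : ℝ}
  {Γ : ℂ → EN N} {ε t : ℝ}

lemma re_FF (h0 : Φ x = 0) (hR : ∀ ζ, RL r x (Γ ζ) = ζ) (ht : 0 < t) (z : EN N) :
    fderiv ℝ r x (FF Γ Φ ε t z - FF Γ Φ ε t x) =
      fderiv ℝ r x (z - x) - ε * (Real.log ‖(t:ℂ) + Φ z‖ - Real.log t) := by
  rw [← RL_re, ← RL_re]
  have : FF Γ Φ ε t z - FF Γ Φ ε t x = (z - x) + Γ (aF Φ ε t z) - Γ (aF Φ ε t x) := by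
    simp only [FF]; abel
  rw [this, map_sub, map_add, hR, hR]
  simp only [aF, h0, Complex.sub_re, Complex.add_re, add_zero]
  simp [Complex.log_re, abs_of_pos ht]
  ring

lemma FF_inj (hp : Peak D r x Ω Φ c C) (hΓ : Differentiable ℂ Γ) (hR : ∀ ζ, RL r x (Γ ζ) = ζ)
    (hε : 0 < ε) (ht : 0 < t) (w : EN N) (hw : fderiv ℝ (FF Γ Φ ε t) x w = 0) : w = 0 := by
  have hlog : HasFDerivAt (fun z => Complex.log ((t:ℂ) + Φ z)) (((t:ℂ) + Φ x)⁻¹ • (-RL r x)) x :=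
    (hp.der.const_add (t:ℂ)).clog (Or.inl (by rw [hp.zero]; simpa using ht))
  have ha : HasFDerivAt (aF Φ ε t) (-(ε:ℂ) • (((t:ℂ) + Φ x)⁻¹ • (-RL r x))) x := hlog.const_mul _
  set A := -(ε:ℂ) • (((t:ℂ) + Φ x)⁻¹ • (-RL r x)) with hA
  have hAw : A w = (ε/t:ℝ) * RL r x w := by
    simp [hA, hp.zero]; ring
  set g := deriv Γ (aF Φ ε t x) with hgd
  have hG : HasDerivAt Γ g (aF Φ ε t x) := (hΓ _).hasDerivAt
  have hRg : RL r x g = 1 := by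
    have h1 := (RL r x).hasFDerivAt.comp_hasDerivAt (aF Φ ε t x) hG
    have h2 : (RL r x) ∘ Γ = id := funext hR
    rw [h2] at h1
    exact h1.unique (hasDerivAt_id _)
  have hF : HasFDerivAt (FF Γ Φ ε t) (ContinuousLinearMap.id ℂ (EN N) +
      (ContinuousLinearMap.toSpanSingleton ℂ g).comp A) x :=
    (hasFDerivAt_id x).add (hG.hasFDerivAt.comp x ha)
  rw [(hF.restrictScalars ℝ).fderiv] at hw
  have hw' : w + A w • g = 0 := by simpa using hw
  have h3 := congrArg (RL r x) hw'
  rw [map_add, map_smul, hRg, hAw, map_zero, smul_eq_mul, mul_one] at h3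
  have h4 : ((1 + ε/t : ℝ) : ℂ) * RL r x w = 0 := by rw [← h3]; push_cast; ring
  have h5 : RL r x w = 0 := by
    rcases mul_eq_zero.mp h4 with h | h
    · exfalso
      have h6 : (1 + ε/t : ℝ) = 0 := by exact_mod_cast h
      have : 0 < ε/t := by positivity
      linarith
    · exact h
  rw [hAw, h5] at hw'
  simpa using hw'

end DFW
end

open Set Filter Topology Metric MeasureTheory
open scoped ENNReal NNReal InnerProductSpace ComplexConjugate
noncomputable section
namespace DFW
variable {N : ℕ}
variable {D : Set (EN N)} {r : EN N → ℝ} {x : EN N} {Ω : Set (EN N)} {Φ : EN N → ℂ} {c C : ℝ}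
  {Γ : ℂ → EN N} {ε t : ℝ}

lemma log_bern {u s : ℝ} (hu : 0 ≤ u) (h0 : 0 ≤ s) (h1 : s ≤ 1) :
    s * Real.log (1 + u) ≤ Real.log (1 + s * u) := by
  have h := rpow_one_add_le_one_add_mul_self (s := u) (by linarith) h0 h1
  have h2 := Real.log_le_log (by positivity) h
  rwa [Real.log_rpow (by positivity)] at h2

lemma dr_bound {V : Set (EN N)} {c' δ : ℝ} (hg : Geo D r V c' δ) (hx : x ∈ frontier D)
    (hp : Peak D r x Ω Φ c C) :
    ∃ C' ≥ 0, ∀ z ∈ closure D, fderiv ℝ r x (z - x) ≤ C' * (Φ z).re := by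
  have hxV : x ∈ V := hg.sub (frontier_subset_closure hx)
  have hr : ContDiffAt ℝ 2 r x := hg.c2.contDiffAt (hg.oV.mem_nhds hxV)
  have hrx : r x = 0 := (hg.hf x hxV).mp hx
  obtain ⟨K, hK, ρ, hρ, h⟩ := taylor_quad hr
  set Λ := ‖fderiv ℝ r x‖ with hΛ
  have hΛ0 : 0 ≤ Λ := norm_nonneg _
  have cp := hp.cpos
  refine ⟨K / c + Λ / (ρ * c), by positivity, fun z hz => ?_⟩
  have hl := hp.lower z hz
  have hre : 0 ≤ (Φ z).re := le_trans (by positivity) hl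
  rw [add_mul]
  have p1 : 0 ≤ K / c * (Φ z).re := by positivity
  have p2 : 0 ≤ Λ / (ρ * c) * (Φ z).re := by positivity
  by_cases hzb : z ∈ ball x ρ
  · have h1 := h z hzb x (mem_ball_self hρ)
    rw [hrx, sub_zero, Real.norm_eq_abs] at h1
    have h2 : r z ≤ 0 := (hg.hcD z (hg.sub hz)).mp hz
    have h3 := (abs_le.mp h1).1
    have h4 : K * ‖z - x‖^2 ≤ K / c * (Φ z).re := by
      calc K * ‖z - x‖^2 = K / c * (c * ‖z - x‖^2) := by field_simp
        _ ≤ _ := mul_le_mul_of_nonneg_left hl (by positivity)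
    linarith
  · have h1 : ρ ≤ ‖z - x‖ := by simpa [dist_eq_norm] using hzb
    have h2 : fderiv ℝ r x (z - x) ≤ Λ * ‖z - x‖ :=
      (le_abs_self _).trans ((fderiv ℝ r x).le_opNorm (z - x))
    have h3 : Λ * ‖z - x‖ ≤ Λ / (ρ * c) * (Φ z).re := by
      calc Λ * ‖z - x‖ = Λ / (ρ * c) * (c * (ρ * ‖z - x‖)) := by field_simp
        _ ≤ Λ / (ρ * c) * (c * ‖z - x‖^2) := by
          refine mul_le_mul_of_nonneg_left (mul_le_mul_of_nonneg_left ?_ cp.le) (by positivity)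
          nlinarith
        _ ≤ _ := mul_le_mul_of_nonneg_left hl (by positivity)
    linarith

lemma expose_a (hp : Peak D r x Ω Φ c C) (hR : ∀ ζ, RL r x (Γ ζ) = ζ) {C' b M : ℝ} (hC' : 0 ≤ C') (hb : 1 ≤ b)
    (hdr : ∀ z ∈ closure D, fderiv ℝ r x (z - x) ≤ C' * (Φ z).re) (hbd : ∀ z ∈ closure D, (Φ z).re ≤ b)
    (hM : C' * b + 1 ≤ M) (hε : 0 < ε) (ht : t = Real.exp (-M/ε)) {z : EN N} (hz : z ∈ closure D) (hzx : z ≠ x) :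
    fderiv ℝ r x (FF Γ Φ ε t z) < fderiv ℝ r x (FF Γ Φ ε t x) := by
  have tp : 0 < t := by rw [ht]; positivity
  rw [← sub_neg, ← map_sub, re_FF hp.zero hR tp]
  have h1 := hdr z hz
  set y := (Φ z).re with hy
  have yp : 0 < y := by
    refine lt_of_lt_of_le ?_ (hp.lower z hz)
    have := hp.cpos
    have : 0 < ‖z - x‖ := norm_pos_iff.mpr (sub_ne_zero.mpr hzx)
    positivity
  have bp : 0 < b := by linarith
  have h2 : t + y ≤ ‖(t:ℂ) + Φ z‖ := by
    refine le_trans (le_of_eq ?_) (Complex.re_le_norm _)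
    simp [hy]
  have h3 : Real.log (t + y) ≤ Real.log ‖(t:ℂ) + Φ z‖ := Real.log_le_log (by positivity) h2
  have h4 : Real.log (t + y) - Real.log t = Real.log (1 + y / t) := by
    rw [← Real.log_div (by positivity) tp.ne']
    congr 1; field_simp
  have h5 : y / b * Real.log (1 + b / t) ≤ Real.log (1 + y / t) := by
    have := log_bern (u := b / t) (s := y / b) (by positivity) (by positivity)
      ((div_le_one bp).mpr (hbd z hz))
    rwa [show y / b * (b / t) = y / t by field_simp] at this
  have h6 : M / ε ≤ Real.log (1 + b / t) := by
    have e : M / ε = Real.log (1 / t) := by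
      rw [Real.log_div one_ne_zero tp.ne', Real.log_one, ht, Real.log_exp]; ring
    rw [e]
    refine Real.log_le_log (by positivity) ?_
    have : 1 / t ≤ b / t := by gcongr
    linarith
  have h7 : y / b * (M / ε) ≤ Real.log ‖(t:ℂ) + Φ z‖ - Real.log t := by
    have := mul_le_mul_of_nonneg_left h6 (show 0 ≤ y / b by positivity)
    linarith
  have h8 := mul_le_mul_of_nonneg_left h7 hε.le
  have h9 : ε * (y / b * (M / ε)) = y / b * M := by field_simp
  rw [h9] at h8
  have h10 : C' * y + y / b ≤ y / b * M := by
    calc C' * y + y / b = y / b * (C' * b + 1) := by field_simp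
      _ ≤ _ := mul_le_mul_of_nonneg_left hM (by positivity)
  have : 0 < y / b := by positivity
  linarith

set_option maxHeartbeats 1000000 in
lemma expose_b (hp : Peak D r x Ω Φ c C) (hR : ∀ ζ, RL r x (Γ ζ) = ζ) (hr : DifferentiableAt ℝ r x) (hrx : r x = 0)
    {K : ℝ} (hK : ∀ᶠ z in 𝓝 x, |r z - fderiv ℝ r x (z - x)| ≤ K * ‖z - x‖^2)
    (hε : 0 < ε) (ht : 0 < t) (h1 : 2 * t * (C + 2) ≤ 1) (h2 : t * K ≤ ε * c / 4) :
    ∃ c' > 0, ∀ᶠ z in 𝓝 x, c' * ‖z - x‖^2 ≤ r z + (2/t) * (r z)^2 -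
      ((t/(t+ε)) • fderiv ℝ r x) (FF Γ Φ ε t z - FF Γ Φ ε t x) := by
  have cp := hp.cpos
  have Cp := hp.Cpos
  set th := ε / (t + ε) with hth
  set ta := t / (t + ε) with hta
  have thp : 0 < th := by positivity
  have tap : 0 < ta := by positivity
  have sum1 : ta + th = 1 := by rw [hta, hth]; field_simp
  have rel : ta * ε = th * t := by rw [hta, hth]; field_simp
  have th1 : th ≤ 1 := by linarith
  -- little-o
  have hder : HasFDerivAt (fun z => r z + (Φ z).re) (0 : EN N →L[ℝ] ℝ) x := by
    have e1 := hr.hasFDerivAt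
    have e2 : HasFDerivAt (fun z => (Φ z).re) (Complex.reCLM.comp ((-RL r x).restrictScalars ℝ)) x :=
      Complex.reCLM.hasFDerivAt.comp x (hp.der.restrictScalars ℝ)
    refine (e1.add e2).congr_fderiv ?_
    ext w
    have := RL_re r x w
    simp [this]
  have hη : 0 < Real.sqrt (c * t / 8) := Real.sqrt_pos.mpr (by positivity)
  have hlo := hder.isLittleO.def hη
  have hΦc : ContinuousAt Φ x := hp.der.continuousAt
  have hsm : ∀ᶠ z in 𝓝 x, ‖Φ z‖ < min (t/2) (t^2) := by
    have : ContinuousAt (fun z => ‖Φ z‖) x := hΦc.norm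
    refine this.eventually_lt_const ?_
    change ‖Φ x‖ < _
    rw [hp.zero, norm_zero]; positivity
  refine ⟨th * c / 2, by positivity, ?_⟩
  filter_upwards [hlo, hsm, hK, hp.near] with z hz1 hz2 hz3 hz4
  rw [hp.zero, hrx] at hz1
  simp only [Complex.zero_re, add_zero, sub_zero, ContinuousLinearMap.zero_apply] at hz1
  obtain ⟨n1, n2⟩ := lt_min_iff.mp hz2
  have hq1 : (r z + (Φ z).re)^2 ≤ c * t / 8 * ‖z - x‖^2 := by
    have := pow_le_pow_left₀ (norm_nonneg _) hz1 2
    rw [mul_pow, Real.sq_sqrt (by positivity), Real.norm_eq_abs, sq_abs] at this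
    exact this
  set q := ‖z - x‖^2 with hq
  have qp : 0 ≤ q := by positivity
  -- log
  have hlog : Real.log ‖(t:ℂ) + Φ z‖ - Real.log t = (Complex.log (1 + Φ z / t)).re := by
    rw [Complex.log_re]
    have tc : (t:ℂ) ≠ 0 := by exact_mod_cast ht.ne'
    have e : (t:ℂ) + Φ z = (t:ℂ) * (1 + Φ z / t) := by field_simp
    rw [e, norm_mul, Complex.norm_real, Real.norm_eq_abs, abs_of_pos ht, Real.log_mul ht.ne' ?_]
    · ring
    · intro h0
      rw [norm_eq_zero] at h0
      have : ‖Φ z / t‖ = 1 := by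
        rw [show Φ z / t = -1 by linear_combination h0]; simp
      rw [norm_div, Complex.norm_real, Real.norm_eq_abs, abs_of_pos ht, div_eq_one_iff_eq ht.ne'] at this
      linarith
  have hnz : ‖Φ z / t‖ = ‖Φ z‖ / t := by
    rw [norm_div, Complex.norm_real, Real.norm_eq_abs, abs_of_pos ht]
  have hlow := log_lower (ζ := Φ z / t) (by rw [hnz, div_le_iff₀ ht]; linarith)
  rw [← hlog, hnz] at hlow
  have r1 : (Φ z / t).re = (Φ z).re / t := Complex.div_ofReal_re _ _
  have r2 : ((Φ z / t)^2).re = (2 * (Φ z).re^2 - ‖Φ z‖^2) / t^2 := by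
    have e : (Φ z / t)^2 = (Φ z)^2 / ((t^2:ℝ):ℂ) := by push_cast; rw [div_pow]
    rw [e, Complex.div_ofReal_re]
    congr 1
    rw [← Complex.normSq_eq_norm_sq, Complex.normSq_apply, sq, Complex.mul_re]; ring
  rw [r1, r2] at hlow
  set y := (Φ z).re with hy
  set n := ‖Φ z‖ with hn
  have n0 : 0 ≤ n := norm_nonneg _
  set ℓ := Real.log ‖(t:ℂ) + Φ z‖ - Real.log t with hℓ
  have hlow2 : y - (2 * y^2 - n^2) / (2 * t) - n^2 ≤ t * ℓ := by
    have h3 := mul_le_mul_of_nonneg_left hlow ht.le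
    have e : t * (y / t - (2 * y^2 - n^2) / t^2 / 2 - (n/t)^3) = y - (2 * y^2 - n^2) / (2 * t) - n^3 / t^2 := by
      field_simp
    rw [e] at h3
    have : n^3 / t^2 ≤ n^2 := by
      rw [div_le_iff₀ (by positivity)]
      have : n^2 * n ≤ n^2 * t^2 := mul_le_mul_of_nonneg_left n2.le (by positivity)
      calc n^3 = n^2 * n := by ring
        _ ≤ _ := this
    linarith
  have hl : ((ta) • fderiv ℝ r x) (FF Γ Φ ε t z - FF Γ Φ ε t x) = ta * fderiv ℝ r x (z - x) - th * (t * ℓ) := by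
    change ta * fderiv ℝ r x (FF Γ Φ ε t z - FF Γ Φ ε t x) = _
    rw [re_FF hp.zero hR ht, mul_sub, ← mul_assoc th, ← rel]; ring
  rw [hl]
  set d := fderiv ℝ r x (z - x) with hd
  have k1 : -(K * q) ≤ r z - d := (abs_le.mp hz3).1
  have k2 : ta * K ≤ th * c / 4 := by
    rw [hta, hth]
    rw [div_mul_eq_mul_div, div_mul_eq_mul_div, div_div, div_le_div_iff₀ (by positivity) (by positivity)]
    have := mul_le_mul_of_nonneg_right h2 (show 0 ≤ (t + ε) * 4 by positivity)
    linarith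
  have k3 : (2 * y^2 - n^2) / (2 * t) = y^2 / t - n^2 * (1/(2*t)) := by field_simp
  have k4 : C + 2 ≤ 1/(2*t) := by rw [le_div_iff₀ (by positivity)]; linarith
  have k5 : y^2 ≤ 2 * (r z)^2 + c * t / 4 * q := by
    have := sq_nonneg (2 * r z + y)
    have : y^2 ≤ 2 * (r z)^2 + 2 * (r z + y)^2 := by linarith
    linarith
  have k6 : y^2 / t ≤ (2/t) * (r z)^2 + c/4 * q := by
    rw [div_le_iff₀ ht]
    calc y^2 ≤ _ := k5
      _ = _ := by field_simp
  rw [k3] at hlow2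
  have k7 : n^2 * (C + 2) ≤ n^2 * (1/(2*t)) := mul_le_mul_of_nonneg_left k4 (by positivity)
  have k8 : y - (2/t) * (r z)^2 - c/4 * q + n^2 * (C + 1) ≤ t * ℓ := by linarith
  have k9 : th * (r z + y - (2/t) * (r z)^2 - c/4 * q + n^2 * (C+1)) ≤ th * (r z + t * ℓ) :=
    mul_le_mul_of_nonneg_left (by linarith) thp.le
  have k10 : th * (3/4 * c * q - (2/t) * (r z)^2) ≤
      th * (r z + y - (2/t) * (r z)^2 - c/4 * q + n^2 * (C+1)) := by
    refine mul_le_mul_of_nonneg_left ?_ thp.le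
    have : 0 ≤ n^2 := by positivity
    linarith
  have k11 : ta * (-(K*q)) ≤ ta * (r z - d) := mul_le_mul_of_nonneg_left k1 tap.le
  have k12 : ta * K * q ≤ th * c / 4 * q := mul_le_mul_of_nonneg_right k2 qp
  have k13 : th * ((2/t) * (r z)^2) ≤ (2/t) * (r z)^2 := by
    have : 0 ≤ (2/t) * (r z)^2 := by positivity
    exact mul_le_of_le_one_left this th1
  have k14 : r z = ta * r z + th * r z := by rw [← add_mul, sum1, one_mul]
  linarith

set_option maxHeartbeats 1000000 in
theorem exposable_of_ker {V : Set (EN N)} {c₁ δ : ℝ} (hg : Geo D r V c₁ δ) (hx : x ∈ frontier D)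
    (hker : ∃ w, w ≠ 0 ∧ RL r x w = 0) : Exposable D r x := by
  have hxD := frontier_subset_closure hx
  have hxV : x ∈ V := hg.sub hxD
  have hr : ContDiffAt ℝ 2 r x := hg.c2.contDiffAt (hg.oV.mem_nhds hxV)
  have hrx : r x = 0 := (hg.hf x hxV).mp hx
  have hDc : IsCompact (closure D) := hg.bD.isCompact_closure
  obtain ⟨Ω, Φ, c, C, hp⟩ := exists_peak hg hx
  obtain ⟨C', hC', hdr⟩ := dr_bound hg hx hp
  obtain ⟨b1, hb1⟩ := hDc.exists_bound_of_continuousOn (f := Φ) (hp.hol.continuousOn.mono hp.sub)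
  set b := max 1 b1 with hb
  have hbd : ∀ z ∈ closure D, (Φ z).re ≤ b := fun z hz =>
    (Complex.re_le_norm _).trans ((hb1 z hz).trans (le_max_right _ _))
  have hb1' : 1 ≤ b := le_max_left _ _
  set M := C' * b + 1 with hM
  have Mp : 0 < M := by rw [hM]; positivity
  obtain ⟨Γ, hΓ, Γ0, hR, c0, hc0, hav⟩ := exists_curve hg hx hker Mp
  obtain ⟨ε0, hε0, hinj⟩ := exists_inj hp hDc hxD hΓ Γ0 hR Mp hc0 hav
  obtain ⟨K, hK0, ρ, hρ, hK⟩ := taylor_quad hr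
  have hK' : ∀ᶠ z in 𝓝 x, |r z - fderiv ℝ r x (z - x)| ≤ K * ‖z - x‖^2 := by
    filter_upwards [ball_mem_nhds x hρ] with z hz
    have := hK z hz x (mem_ball_self hρ)
    rwa [hrx, sub_zero] at this
  -- t / ε → 0
  have hte : Tendsto (fun ε : ℝ => Real.exp (-M/ε) / ε) (𝓝[>] 0) (𝓝 0) := by
    have h1 : Tendsto (fun u : ℝ => u * Real.exp (-M * u)) atTop (𝓝 0) := by
      have := Real.tendsto_pow_mul_exp_neg_atTop_nhds_zero 1
      have h2 := (this.comp (tendsto_id.const_mul_atTop Mp)).const_mul (M⁻¹)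
      rw [mul_zero] at h2
      refine h2.congr fun u => ?_
      simp only [Function.comp, id, pow_one]
      rw [← mul_assoc, ← mul_assoc, inv_mul_cancel₀ Mp.ne', one_mul, neg_mul]
    refine (h1.comp tendsto_inv_nhdsGT_zero).congr fun ε => ?_
    simp only [Function.comp]
    rw [div_eq_mul_inv, div_eq_mul_inv, mul_comm]
  have cp := hp.cpos
  have Cp := hp.Cpos
  set ν := min (1 / (2 * (C + 2))) (c / (4 * (K + 1))) with hν
  have νp : 0 < ν := by rw [hν]; positivity
  obtain ⟨ε, h3, h4, h5⟩ := ((hte.eventually_lt_const νp).and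
    (Ioo_mem_nhdsGT (show (0:ℝ) < min ε0 1 by positivity))).exists
  set t := Real.exp (-M/ε) with ht
  obtain ⟨h6, h7⟩ := lt_min_iff.mp h5
  obtain ⟨h8, h9⟩ := lt_min_iff.mp h3
  have tp : 0 < t := by positivity
  rw [div_lt_iff₀ h4] at h8 h9
  have hc1 : 2 * t * (C + 2) ≤ 1 := by
    have : t ≤ 1 / (2 * (C + 2)) := h8.le.trans (mul_le_of_le_one_right (by positivity) h7.le)
    rw [le_div_iff₀ (by positivity)] at this; linarith
  have hc2 : t * K ≤ ε * c / 4 := by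
    have : t * (K + 1) ≤ ε * c / 4 := by
      calc t * (K+1) ≤ (c / (4 * (K+1)) * ε) * (K+1) := mul_le_mul_of_nonneg_right h9.le (by positivity)
        _ = _ := by field_simp
    nlinarith
  obtain ⟨O, Oo, OD, OΩ, Ore, Oinj⟩ := hinj ε t h4 h6 rfl
  obtain ⟨c', hc', hk⟩ := expose_b hp hR (hr.differentiableAt (by norm_num)) hrx hK' h4 tp hc1 hc2
  refine ⟨FF Γ Φ ε t, O, (t/(t+ε)) • fderiv ℝ r x, 2/t, c', Oo, OD, ?_, Oinj, FF_inj hp hΓ hR h4 tp, ?_, hc', hk⟩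
  · intro z hz
    exact (FF_diff hΓ (hp.hol.differentiableAt (hp.oΩ.mem_nhds (OΩ hz))) (Ore z hz)).differentiableWithinAt
  · intro z hz hzx
    have := expose_a hp hR hC' hb1' hdr hbd le_rfl h4 ht hz hzx
    have tt : 0 < t/(t+ε) := by positivity
    exact mul_lt_mul_of_pos_left this tt

end DFW
end

open Set Filter Topology Metric MeasureTheory
open scoped ENNReal NNReal InnerProductSpace ComplexConjugate
noncomputable section
namespace DFW
variable {N : ℕ}
variable {D : Set (EN N)} {r : EN N → ℝ} {x : EN N}

set_option maxHeartbeats 1000000 in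
theorem exposable_of_inj {V : Set (EN N)} {c₁ δ : ℝ} (hg : Geo D r V c₁ δ) (hx : x ∈ frontier D)
    (hinj : ∀ w, RL r x w = 0 → w = 0) : Exposable D r x := by
  have hxD := frontier_subset_closure hx
  have hxV : x ∈ V := hg.sub hxD
  have hr : ContDiffAt ℝ 2 r x := hg.c2.contDiffAt (hg.oV.mem_nhds hxV)
  have hrx : r x = 0 := (hg.hf x hxV).mp hx
  obtain ⟨v, hv⟩ : ∃ v, RL r x v = 1 := by
    have h1 := hg.grad x hx
    obtain ⟨u, hu⟩ : ∃ u, fderiv ℝ r x u ≠ 0 := by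
      by_contra h; push Not at h; exact h1 (ContinuousLinearMap.ext h)
    have hu' : RL r x u ≠ 0 := fun h => hu (by rw [← RL_re, h]; rfl)
    exact ⟨(RL r x u)⁻¹ • u, by rw [map_smul, smul_eq_mul, inv_mul_cancel₀ hu']⟩
  set R := RL r x with hRdef
  have hrep : ∀ w, w = R w • v := by
    intro w
    refine sub_eq_zero.mp (hinj _ ?_)
    rw [map_sub, map_smul, hv]; simp
  have v0 : 0 < ‖v‖ := by
    rw [norm_pos_iff]; intro h; rw [h, map_zero] at hv; exact zero_ne_one hv
  have hnorm : ∀ w, ‖w‖ = ‖R w‖ * ‖v‖ := by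
    intro w; conv_lhs => rw [hrep w]
    rw [norm_smul]
  obtain ⟨K1, hK1, ρ, hρ, hq⟩ := taylor_quad hr
  set K := K1 * ‖v‖^2 with hK
  have K0 : 0 ≤ K := by positivity
  have hquad : ∀ z ∈ ball x ρ, |r z - (R (z - x)).re| ≤ K * ‖R (z - x)‖^2 := by
    intro z hz
    have := hq z hz x (mem_ball_self hρ)
    rw [hrx, sub_zero, hnorm (z - x), ← RL_re] at this
    refine this.trans (le_of_eq (by rw [hK]; ring))
  set ς := min (1 / (2 * K + 3)) (ρ / (3 * ‖v‖)) with hς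
  have ςp : 0 < ς := by positivity
  have ς1 : ς ≤ 1 / (2 * K + 3) := min_le_left _ _
  have ς2 : ς * (3 * ‖v‖) ≤ ρ := by
    have : ς ≤ ρ / (3 * ‖v‖) := min_le_right _ _
    rwa [le_div_iff₀ (by positivity)] at this
  have ς3 : 2 * K + 3 ≤ 1 / ς := by
    rw [le_div_iff₀ ςp]
    rw [le_div_iff₀ (by positivity)] at ς1
    linarith
  have ςc : (ς:ℂ) ≠ 0 := by exact_mod_cast ςp.ne'
  -- the closure of D avoids the disc
  have havoid : ∀ z ∈ closure D, z ≠ x → ς < ‖(ς:ℂ) - R (z - x)‖ := by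
    intro z hz hzx
    by_contra hcon
    push Not at hcon
    set ζ := R (z - x) with hζ
    have hζ0 : 0 < ‖ζ‖ := by
      rw [norm_pos_iff]; intro h
      exact hzx (sub_eq_zero.mp (hinj _ h))
    have h1 : ‖ζ‖ ≤ 2 * ς := by
      have : ζ = (ς:ℂ) - ((ς:ℂ) - ζ) := by ring
      rw [this]
      refine (norm_sub_le _ _).trans ?_
      rw [Complex.norm_real, Real.norm_eq_abs, abs_of_pos ςp]; linarith
    have h2 : z ∈ ball x ρ := by
      rw [mem_ball, dist_eq_norm, hnorm]
      have := mul_le_mul_of_nonneg_right h1 v0.le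
      have : 0 < ς * ‖v‖ := by positivity
      linarith
    have h3 := (abs_le.mp (hquad z h2)).1
    have h4 : r z ≤ 0 := (hg.hcD z (hg.sub hz)).mp hz
    have h5 : ‖ζ‖^2 ≤ 2 * ς * ζ.re := by
      have := pow_le_pow_left₀ (norm_nonneg _) hcon 2
      rw [← Complex.normSq_eq_norm_sq, Complex.normSq_apply] at this
      rw [← Complex.normSq_eq_norm_sq, Complex.normSq_apply]
      simp at this
      nlinarith
    have h6 : ζ.re ≤ K * ‖ζ‖^2 := by linarith
    have h7 : ‖ζ‖^2 ≤ 2 * ς * (K * ‖ζ‖^2) := h5.trans (mul_le_mul_of_nonneg_left h6 (by positivity))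
    rw [le_div_iff₀ ςp] at ς3
    have h8 : 0 < ‖ζ‖^2 := by positivity
    have h9 : 0 < ‖ζ‖^2 * ς := by positivity
    have h10 := mul_le_mul_of_nonneg_left ς3 h8.le
    linarith
  let G : ℂ → ℂ := fun ζ => (ς:ℂ) / ((ς:ℂ) - ζ)
  let F : EN N → EN N := fun z => G (R (z - x)) • v
  let O : Set (EN N) := {z | R (z - x) ≠ (ς:ℂ)}
  have Rc : Continuous fun z => R (z - x) := R.continuous.comp (continuous_id.sub continuous_const)
  have Oo : IsOpen O := isOpen_ne_fun Rc continuous_const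
  have hRd : ∀ z, HasFDerivAt (fun z => R (z - x)) R z := by
    intro z
    have h0 : HasFDerivAt (fun z => z - x) (ContinuousLinearMap.id ℂ (EN N)) z := (hasFDerivAt_id z).sub_const x
    exact (R.hasFDerivAt.comp z h0).congr_fderiv (by ext; simp)
  have hGd : ∀ ζ, ζ ≠ (ς:ℂ) → HasDerivAt G ((ς:ℂ) / ((ς:ℂ) - ζ)^2) ζ := by
    intro ζ hζ
    have h0 : HasDerivAt (fun ζ => (ς:ℂ) - ζ) (-1) ζ := (hasDerivAt_id ζ).const_sub _
    have h1 := (h0.fun_inv (sub_ne_zero.mpr hζ.symm)).const_mul (ς:ℂ)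
    refine (h1.congr_deriv ?_).congr_of_eventuallyEq (Eventually.of_forall fun ζ => ?_)
    · rw [neg_neg]; ring
    · simp [G, div_eq_mul_inv]
  have hFd : ∀ z ∈ O, HasFDerivAt F ((((ς:ℂ) / ((ς:ℂ) - R (z - x))^2) • R).smulRight v) z := by
    intro z hz
    have h1 := (hGd _ hz).comp_hasFDerivAt z (hRd z)
    exact h1.smul_const v
  have hRF : ∀ z, R (F z) = G (R (z - x)) := by intro z; simp [F, hv]
  have hxO : x ∈ O := by change R (x - x) ≠ _; rw [sub_self, map_zero]; exact ςc.symm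
  have Gx : R (F x) = 1 := by rw [hRF, sub_self, map_zero]; simp [G, ςc]
  refine ⟨F, O, ς • fderiv ℝ r x, 4/ς, (2 * ‖v‖^2)⁻¹, Oo, ?_, ?_, ?_, ?_, ?_, by positivity, ?_⟩
  · intro z hz
    by_cases hzx : z = x
    · rw [hzx]; exact hxO
    · intro h
      have := havoid z hz hzx
      rw [h, sub_self, norm_zero] at this; linarith
  · exact fun z hz => (hFd z hz).differentiableAt.differentiableWithinAt
  · intro z hz w hw he
    have h1 : G (R (z - x)) = G (R (w - x)) := by rw [← hRF, ← hRF, he]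
    have z0 : (ς:ℂ) - R (z - x) ≠ 0 := sub_ne_zero.mpr (Ne.symm hz)
    have w0 : (ς:ℂ) - R (w - x) ≠ 0 := sub_ne_zero.mpr (Ne.symm hw)
    simp only [G] at h1
    rw [div_eq_div_iff z0 w0] at h1
    have h2 := mul_left_cancel₀ ςc h1
    have h3 : R (z - w) = 0 := by
      have : z - w = (z - x) - (w - x) := by abel
      rw [this, map_sub]; linear_combination h2
    exact sub_eq_zero.mp (hinj _ h3)
  · intro w hw
    rw [((hFd x hxO).restrictScalars ℝ).fderiv] at hw
    have h1 : R (((ς:ℂ) / ((ς:ℂ) - R (x - x))^2 * R w) • v) = 0 := by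
      have : ((ς:ℂ) / ((ς:ℂ) - R (x - x))^2 * R w) • v = 0 := by simpa using hw
      rw [this, map_zero]
    rw [map_smul, hv, sub_self, map_zero, sub_zero] at h1
    refine hinj w ?_
    have : (ς:ℂ)/(ς:ℂ)^2 ≠ 0 := by positivity
    simpa [ςc] using h1
  · intro z hz hzx
    change ς * fderiv ℝ r x (F z) < ς * fderiv ℝ r x (F x)
    refine mul_lt_mul_of_pos_left ?_ ςp
    rw [← RL_re, ← RL_re, ← hRdef, Gx, hRF]
    have h1 := havoid z hz hzx
    refine lt_of_le_of_lt (Complex.re_le_norm _) ?_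
    simp only [G, Complex.one_re]
    rw [norm_div, Complex.norm_real, Real.norm_eq_abs, abs_of_pos ςp, div_lt_one (by linarith)]
    exact h1
  · have hsm : ∀ᶠ z in 𝓝 x, ‖R (z - x)‖ < min (ς/2) (min (ς^2/2) (ς / (4 * (K+1)^2 + 1))) ∧ ‖R (z - x)‖ < 1 := by
      have h1 : ContinuousAt (fun z => ‖R (z - x)‖) x := Rc.continuousAt.norm
      refine (h1.eventually_lt_const ?_).and (h1.eventually_lt_const ?_)
      · change ‖R (x - x)‖ < _
        rw [sub_self, map_zero, norm_zero]; positivity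
      · change ‖R (x - x)‖ < _
        rw [sub_self, map_zero, norm_zero]; positivity
    filter_upwards [hsm, ball_mem_nhds x hρ] with z hz hzb
    obtain ⟨hz, n1⟩ := hz
    have hqz := hquad z hzb
    set ζ := R (z - x) with hζ
    set n := ‖ζ‖ with hn
    have n0 : 0 ≤ n := norm_nonneg _
    obtain ⟨m1, m23⟩ := lt_min_iff.mp hz
    obtain ⟨m2, m3⟩ := lt_min_iff.mp m23
    have hne : (ς:ℂ) - ζ ≠ 0 := by
      intro h
      have : ζ = ς := (sub_eq_zero.mp h).symm
      rw [hn, this, Complex.norm_real, Real.norm_eq_abs, abs_of_pos ςp] at m1; linarith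
    have hden : ς / 2 ≤ ‖(ς:ℂ) - ζ‖ := by
      have := norm_sub_norm_le (ς:ℂ) ζ
      rw [Complex.norm_real, Real.norm_eq_abs, abs_of_pos ςp] at this; linarith
    have hl : (ς • fderiv ℝ r x) (F z - F x) = ((ς:ℂ) * (G ζ - 1)).re := by
      change ς * fderiv ℝ r x (F z - F x) = _
      rw [← RL_re, ← hRdef, map_sub, Gx, hRF, Complex.re_ofReal_mul]
    have hexp : (ς:ℂ) * (G ζ - 1) = ζ + ζ^2 / ((ς:ℝ):ℂ) + ζ^3 / ((ς:ℂ) * ((ς:ℂ) - ζ)) := by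
      simp only [G]; field_simp; ring
    have hrem : ‖ζ^3 / ((ς:ℂ) * ((ς:ℂ) - ζ))‖ ≤ n^2 := by
      rw [norm_div, norm_pow, norm_mul, Complex.norm_real, Real.norm_eq_abs, abs_of_pos ςp,
        div_le_iff₀ (by positivity)]
      have h1 : ς * (ς/2) ≤ ς * ‖(ς:ℂ) - ζ‖ := mul_le_mul_of_nonneg_left hden ςp.le
      have h2 : n ≤ ς * ‖(ς:ℂ) - ζ‖ := by nlinarith
      calc n^3 = n^2 * n := by ring
        _ ≤ _ := mul_le_mul_of_nonneg_left h2 (by positivity)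
    have hrem' := (Complex.re_le_norm (ζ^3 / ((ς:ℂ) * ((ς:ℂ) - ζ)))).trans hrem
    have hre2 : (ζ^2 / ((ς:ℝ):ℂ)).re = (2 * ζ.re^2 - n^2) / ς := by
      rw [Complex.div_ofReal_re]
      congr 1
      rw [hn, ← Complex.normSq_eq_norm_sq, Complex.normSq_apply, sq, Complex.mul_re]; ring
    rw [hl, hexp, Complex.add_re, Complex.add_re, hre2, hnorm (z - x), mul_pow]
    have e0 : (2 * ‖v‖^2)⁻¹ * (n^2 * ‖v‖^2) = n^2 / 2 := by field_simp
    rw [e0]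
    set y := ζ.re with hy
    obtain ⟨q1, q2⟩ := abs_le.mp hqz
    have hsq : (r z - y)^2 ≤ (K * n^2)^2 := sq_le_sq' q1 q2
    have hy2 : y^2 ≤ 2 * (r z)^2 + 2 * (K * n^2)^2 := by
      have := sq_nonneg (2 * r z - y)
      linarith
    have h4 : (2 / ς) * (2 * (K * n^2)^2) ≤ n^2 := by
      rw [lt_div_iff₀ (by positivity)] at m3
      have h5 : n * (4 * K^2) ≤ ς := by nlinarith
      have h6 : n^2 * (4 * K^2) ≤ ς := by nlinarith
      rw [div_mul_eq_mul_div, div_le_iff₀ ςp]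
      calc 2 * (2 * (K * n^2)^2) = n^2 * (n^2 * (4 * K^2)) := by ring
        _ ≤ _ := mul_le_mul_of_nonneg_left h6 (by positivity)
    have h5 : (2 * y^2 - n^2) / ς ≤ 4/ς * (r z)^2 + n^2 - n^2 * (1/ς) := by
      have h6 : (2/ς) * y^2 ≤ (2/ς) * (2 * (r z)^2 + 2 * (K * n^2)^2) := mul_le_mul_of_nonneg_left hy2 (by positivity)
      have e : (2 * y^2 - n^2) / ς = (2/ς) * y^2 - n^2 * (1/ς) := by ring
      have e2 : (2/ς) * (2 * (r z)^2 + 2 * (K * n^2)^2) = 4/ς * (r z)^2 + (2/ς) * (2 * (K * n^2)^2) := by ring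
      rw [e]; linarith
    have h6 : n^2 * (2 * K+3) ≤ n^2 * (1/ς) := mul_le_mul_of_nonneg_left ς3 (by positivity)
    have : 0 ≤ n^2 := by positivity
    have : 0 ≤ n^2 * K := by positivity
    linarith

end DFW
end

open Set Filter Topology Metric MeasureTheory
open scoped ENNReal NNReal InnerProductSpace ComplexConjugate
noncomputable section
namespace DFW
variable {N : ℕ}

section generic
variable {E : Type*} [NormedAddCommGroup E] [NormedSpace ℝ E] [FiniteDimensional ℝ E]

lemma exists_lp {F : E → E} {r : E → ℝ} {x : E} (hF : ContDiffAt ℝ 2 F x) (hr : ContDiffAt ℝ 2 r x)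
    (hinj : ∀ w, fderiv ℝ F x w = 0 → w = 0) {l : E →L[ℝ] ℝ} (hl : ∀ w, l (fderiv ℝ F x w) = fderiv ℝ r x w) :
    ∃ L : E → E →L[ℝ] ℝ, L x = l ∧ ContinuousAt L x ∧
      ∀ᶠ p in 𝓝 x, ∀ w, L p (fderiv ℝ F p w) = fderiv ℝ r p w := by
  have : CompleteSpace E := FiniteDimensional.complete ℝ E
  have hi : Function.Injective (fderiv ℝ F x).toLinearMap := by
    rw [← LinearMap.ker_eq_bot, LinearMap.ker_eq_bot']
    exact hinj
  let e : E ≃L[ℝ] E := (LinearEquiv.ofInjectiveEndo _ hi).toContinuousLinearEquiv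
  have he : (e : E →L[ℝ] E) = fderiv ℝ F x := by ext w; rfl
  have hFc : ContinuousAt (fderiv ℝ F) x := (hF.fderiv_right (m := 1) (by norm_num)).continuousAt
  have hrc : ContinuousAt (fderiv ℝ r) x := (hr.fderiv_right (m := 1) (by norm_num)).continuousAt
  have hic : ContinuousAt (ContinuousLinearMap.inverse : (E →L[ℝ] E) → (E →L[ℝ] E)) (fderiv ℝ F x) := by
    rw [← he]
    exact (contDiffAt_map_inverse (n := 1) e).continuousAt
  have hevt : ∀ᶠ p in 𝓝 x, fderiv ℝ F p ∈ range ((↑) : (E ≃L[ℝ] E) → E →L[ℝ] E) := by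
    refine hFc.eventually ?_
    rw [← he]
    exact e.nhds
  have hcomp : ∀ᶠ p in 𝓝 x, ∀ w, (fderiv ℝ r p).comp (ContinuousLinearMap.inverse (fderiv ℝ F p)) (fderiv ℝ F p w)
      = fderiv ℝ r p w := by
    filter_upwards [hevt] with p hp w
    obtain ⟨e', he'⟩ := hp
    rw [← he', ContinuousLinearMap.inverse_equiv]
    simp
  refine ⟨fun p => (fderiv ℝ r p).comp (ContinuousLinearMap.inverse (fderiv ℝ F p)), ?_, ?_, hcomp⟩
  · ext w
    obtain ⟨u, hu⟩ := e.surjective w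
    have hu' : fderiv ℝ F x u = w := by rw [← he]; exact hu
    rw [← hu', hl]
    exact hcomp.self_of_nhds u
  · have h2 : ContinuousAt (fun p => ContinuousLinearMap.inverse (fderiv ℝ F p)) x :=
      ContinuousAt.comp (g := ContinuousLinearMap.inverse) hic hFc
    exact hrc.clm_comp h2

set_option maxHeartbeats 1000000 in
lemma near_generic {F : E → E} {r : E → ℝ} {x : E} (hF : ContDiffAt ℝ 2 F x) (hr : ContDiffAt ℝ 2 r x)
    (hrx : r x = 0) (hinj : ∀ w, fderiv ℝ F x w = 0 → w = 0) {l : E →L[ℝ] ℝ} {C c : ℝ} (hc : 0 < c)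
    (hk : ∀ᶠ z in 𝓝 x, c * ‖z - x‖^2 ≤ r z + C * (r z)^2 - l (F z - F x)) :
    ∃ L : E → E →L[ℝ] ℝ, L x = l ∧ ContinuousAt L x ∧ ∃ ρ > 0, ∀ p ∈ ball x ρ, ∀ z ∈ ball x ρ,
      r p = 0 → r z ≤ 0 → L p (F z - F p) ≤ -(c/4) * ‖z - p‖^2 := by
  let G : E → ℝ := fun z => r z + C * (r z)^2 - l (F z)
  have hG : ContDiffAt ℝ 2 G x :=
    (hr.add (contDiffAt_const.mul (hr.pow 2))).sub (l.contDiff.contDiffAt.comp x hF)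
  have hGd : ∀ p, DifferentiableAt ℝ r p → DifferentiableAt ℝ F p → r p = 0 →
      HasFDerivAt G (fderiv ℝ r p - l.comp (fderiv ℝ F p)) p := by
    intro p h1 h2 h0
    have e1 := h1.hasFDerivAt
    have e2 : HasFDerivAt (fun z => C * (r z)^2) (0 : E →L[ℝ] ℝ) p :=
      ((e1.pow 2).const_mul C).congr_fderiv (by ext w; simp [h0])
    have e3 : HasFDerivAt (fun z => l (F z)) (l.comp (fderiv ℝ F p)) p := l.hasFDerivAt.comp p h2.hasFDerivAt
    exact ((e1.add e2).sub e3).congr_fderiv (by simp)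
  have hkG : ∀ᶠ z in 𝓝 x, c * ‖z - x‖^2 ≤ G z - G x := by
    filter_upwards [hk] with z hz
    refine hz.trans (le_of_eq ?_)
    simp only [G, hrx, map_sub]; ring
  have hrd := hr.differentiableAt (by norm_num)
  have hFd := hF.differentiableAt (by norm_num)
  have hdG0 : fderiv ℝ G x = 0 := by
    refine IsLocalMin.fderiv_eq_zero ?_
    filter_upwards [hkG] with z hz
    have : 0 ≤ c * ‖z - x‖^2 := by positivity
    linarith
  have hl : ∀ w, l (fderiv ℝ F x w) = fderiv ℝ r x w := by
    intro w
    have h1 := (hGd x hrd hFd hrx).fderiv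
    rw [hdG0] at h1
    have h2 := congrArg (fun T : E →L[ℝ] ℝ => T w) h1
    simp at h2
    linarith
  obtain ⟨L, hLx, hLc, hL⟩ := exists_lp hF hr hinj hl
  obtain ⟨ρ1, hρ1, hT⟩ := taylor2s hG (η := c/4) (by positivity)
  obtain ⟨K, hK, ρ2, hρ2, hQ⟩ := taylor_quad hF
  set B := fderiv ℝ (fderiv ℝ G) x with hB
  have hBpos : ∀ w, 3/4 * c * ‖w‖^2 ≤ 1/2 * B w w := by
    intro w
    have ht : Tendsto (fun s : ℝ => x + s • w) (𝓝[>] 0) (𝓝 x) := by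
      have : Continuous fun s : ℝ => x + s • w := by fun_prop
      have h := this.tendsto 0
      simp only [zero_smul, add_zero] at h
      exact h.mono_left nhdsWithin_le_nhds
    obtain ⟨s, ⟨h1, h2⟩, h3⟩ := (((ht.eventually hkG).and (ht.eventually (ball_mem_nhds x hρ1))).and
      self_mem_nhdsWithin).exists
    have h4 := hT _ h2 x (mem_ball_self hρ1)
    rw [hdG0, add_sub_cancel_left] at h4
    rw [add_sub_cancel_left] at h1
    have h5 := (abs_le.mp h4).2
    simp only [ContinuousLinearMap.zero_apply, sub_zero, map_smul, ContinuousLinearMap.smul_apply, smul_eq_mul,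
      norm_smul, mul_pow, Real.norm_eq_abs, sq_abs] at h1 h5
    have hs : 0 < s^2 := by have : (0:ℝ) < s := h3
                            positivity
    have h6 : s^2 * (3/4 * c * ‖w‖^2) ≤ s^2 * (1/2 * B w w) := by
      nlinarith
    exact le_of_mul_le_mul_left h6 hs
  have ev1 : ∀ᶠ p in 𝓝 x, DifferentiableAt ℝ r p := by
    filter_upwards [hr.eventually (by simp)] with p hp using hp.differentiableAt (by norm_num)
  have ev2 : ∀ᶠ p in 𝓝 x, DifferentiableAt ℝ F p := by
    filter_upwards [hF.eventually (by simp)] with p hp using hp.differentiableAt (by norm_num)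
  have ev3 : ∀ᶠ p in 𝓝 x, ‖L p - l‖ < c / (4 * (K + 1)) := by
    have : ContinuousAt (fun p => ‖L p - l‖) x := (hLc.sub continuousAt_const).norm
    refine this.eventually_lt_const ?_
    change ‖L x - l‖ < _
    rw [hLx, sub_self, norm_zero]; positivity
  have ev4 : ∀ᶠ z in 𝓝 x, |r z| < 1 / (|C| + 1) := by
    have : ContinuousAt (fun p => |r p|) x := hr.continuousAt.abs
    refine this.eventually_lt_const ?_
    change |r x| < _
    rw [hrx, abs_zero]; positivity
  obtain ⟨ρ3, hρ3, hev⟩ := Metric.eventually_nhds_iff_ball.mp (((ev1.and ev2).and (ev3.and ev4)).and hL)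
  refine ⟨L, hLx, hLc, min ρ1 (min ρ2 ρ3), by positivity, fun p hp z hz hp0 hz0 => ?_⟩
  have hp1 := ball_subset_ball (min_le_left _ _) hp
  have hz1 := ball_subset_ball (min_le_left _ _) hz
  have hp2 := ball_subset_ball ((min_le_right _ _).trans (min_le_left _ _)) hp
  have hz2 := ball_subset_ball ((min_le_right _ _).trans (min_le_left _ _)) hz
  have hp3 := ball_subset_ball ((min_le_right _ _).trans (min_le_right _ _)) hp
  have hz3 := ball_subset_ball ((min_le_right _ _).trans (min_le_right _ _)) hz
  obtain ⟨⟨⟨d1, d2⟩, d3, -⟩, d5⟩ := hev p hp3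
  have d4 := (hev z hz3).1.2.2
  have t1 := (abs_le.mp (hT z hz1 p hp1)).1
  have t2 := hQ z hz2 p hp2
  have t3 := hBpos (z - p)
  rw [(hGd p d1 d2 hp0).fderiv] at t1
  set rem := F z - F p - fderiv ℝ F p (z - p) with hrem
  have e1 : (fderiv ℝ r p - l.comp (fderiv ℝ F p)) (z - p) =
      L p (fderiv ℝ F p (z - p)) - l (fderiv ℝ F p (z - p)) := by
    rw [d5]; rfl
  rw [e1] at t1
  have e2 : F z - F p = rem + fderiv ℝ F p (z - p) := by rw [hrem]; abel
  have e3 : G z - G p = r z + C * (r z)^2 - l (F z - F p) := by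
    simp only [G, hp0, map_sub]; ring
  rw [e3, e2, map_add] at t1
  rw [e2, map_add]
  have e4 : |(L p - l) rem| ≤ c/4 * ‖z - p‖^2 := by
    refine ((L p - l).le_opNorm rem).trans ?_
    calc ‖L p - l‖ * ‖rem‖ ≤ (c / (4 * (K+1))) * (K * ‖z - p‖^2) :=
          mul_le_mul d3.le t2 (norm_nonneg _) (by positivity)
      _ ≤ (c / (4 * (K+1))) * ((K + 1) * ‖z - p‖^2) := by gcongr; linarith
      _ = _ := by field_simp
  have e5 : (L p - l) rem = L p rem - l rem := rfl
  rw [e5] at e4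
  have e6 := (abs_le.mp e4).2
  have e7 : r z + C * (r z)^2 ≤ 0 := by
    have h1 : |C * r z| ≤ 1 := by
      rw [abs_mul]
      rw [lt_div_iff₀ (by positivity)] at d4
      have := abs_nonneg (r z)
      linarith
    have h2 := (abs_le.mp h1).1
    nlinarith
  simp only [smul_eq_mul] at t1
  linarith
end generic

end DFW
end

open Set Filter Topology Metric MeasureTheory
open scoped ENNReal NNReal InnerProductSpace ComplexConjugate
noncomputable section
namespace DFW
variable {N : ℕ}

lemma expose_near {D : Set (EN N)} {r : EN N → ℝ} {V : Set (EN N)} {c₁ δ : ℝ} {x : EN N}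
    (hg : Geo D r V c₁ δ) (hx : x ∈ frontier D) (he : Exposable D r x) :
    ∃ (F : EN N → EN N) (O : Set (EN N)) (l : EN N →L[ℝ] ℝ), IsOpen O ∧ closure D ⊆ O ∧
      DifferentiableOn ℂ F O ∧ InjOn F O ∧
      (∀ z ∈ closure D, z ≠ x → l (F z) < l (F x)) ∧
      (∃ c > 0, ∀ z ∈ closure D, l (F z - F x) ≤ - c * ‖F z - F x‖^2) ∧
      ∃ s > 0, ∀ p ∈ ball x s ∩ frontier D, ∃ l' : EN N →L[ℝ] ℝ,
        ∀ z ∈ closure D, z ≠ p → l' (F z) < l' (F p) := by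
  obtain ⟨F, O, l, C, c, hO, hDO, hF, hFi, hker, hlt, hc, hk⟩ := he
  have hxc : x ∈ closure D := frontier_subset_closure hx
  have hcpt : IsCompact (closure D) := hg.bD.isCompact_closure
  have hF2 : ∀ z ∈ O, ContDiffAt ℝ 2 F z := fun z hz => hol_contDiffAt' hO hF hz
  have hFc : ContinuousOn F (closure D) := hF.continuousOn.mono hDO
  have hrx : r x = 0 := (hg.hf x (hg.sub hxc)).1 hx
  obtain ⟨L, hLx, hLc, ρ, hρ, hL⟩ := near_generic (hF2 x (hDO hxc))
    (hg.c2.contDiffAt (hg.oV.mem_nhds (hg.sub hxc))) hrx hker hc hk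
  obtain ⟨A, hA, hAL⟩ := lip_on_compact hcpt (fun z hz => (hF2 z (hDO hz)).of_le (by norm_num))
  obtain ⟨B, hB⟩ := hcpt.exists_bound_of_continuousOn hFc
  have hB0 : 0 ≤ B := (norm_nonneg _).trans (hB x hxc)
  have hm : ∃ m > 0, ∀ z ∈ closure D, z ∉ ball x ρ → l (F z) ≤ l (F x) - m := by
    have hc2 : IsCompact (closure D \ ball x ρ) := hcpt.diff isOpen_ball
    rcases (closure D \ ball x ρ).eq_empty_or_nonempty with h | h
    · refine ⟨1, one_pos, fun z hz hz' => ?_⟩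
      have : z ∈ closure D \ ball x ρ := ⟨hz, hz'⟩
      rw [h] at this; exact this.elim
    · obtain ⟨y, hy, hmax⟩ := hc2.exists_isMaxOn h
        (l.continuous.comp_continuousOn (hFc.mono diff_subset))
      have hyx : y ≠ x := by rintro rfl; exact hy.2 (mem_ball_self hρ)
      refine ⟨l (F x) - l (F y), sub_pos.2 (hlt y hy.1 hyx), fun z hz hz' => ?_⟩
      have := hmax (show z ∈ closure D \ ball x ρ from ⟨hz, hz'⟩)
      simp only [Function.comp, mem_setOf_eq] at this
      linarith
  obtain ⟨m, hm, hfar⟩ := hm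
  refine ⟨F, O, l, hO, hDO, hF, hFi, hlt, ?_, ?_⟩
  · refine ⟨min (c/4/A^2) (m / (2*B+1)^2), by positivity, fun z hz => ?_⟩
    by_cases hzb : z ∈ ball x ρ
    · have h1 := hL x (mem_ball_self hρ) z hzb hrx ((hg.hcD z (hg.sub hz)).1 hz)
      rw [hLx] at h1
      have h2 := hAL z hz x hxc
      have h3 : ‖F z - F x‖^2 ≤ A^2 * ‖z - x‖^2 := by
        rw [← mul_pow]; exact pow_le_pow_left₀ (norm_nonneg _) h2 2
      have h4 : min (c/4/A^2) (m / (2*B+1)^2) * ‖F z - F x‖^2 ≤ (c/4/A^2) * (A^2 * ‖z - x‖^2) :=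
        mul_le_mul (min_le_left _ _) h3 (by positivity) (by positivity)
      have h5 : (c/4/A^2) * (A^2 * ‖z - x‖^2) = c/4 * ‖z - x‖^2 := by field_simp
      linarith
    · have h1 := hfar z hz hzb
      have h2 : ‖F z - F x‖ ≤ 2*B+1 := by
        have := norm_sub_le (F z) (F x)
        linarith [hB z hz, hB x hxc]
      have h3 : ‖F z - F x‖^2 ≤ (2*B+1)^2 := pow_le_pow_left₀ (norm_nonneg _) h2 2
      have h4 : min (c/4/A^2) (m / (2*B+1)^2) * ‖F z - F x‖^2 ≤ (m / (2*B+1)^2) * (2*B+1)^2 :=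
        mul_le_mul (min_le_right _ _) h3 (by positivity) (by positivity)
      have h5 : (m / (2*B+1)^2) * (2*B+1)^2 = m := by field_simp
      rw [map_sub]
      linarith
  · have ev1 : ∀ᶠ p in 𝓝 x, ‖L p - l‖ < m / (2 * (B+1)) := by
      have : ContinuousAt (fun p => ‖L p - l‖) x := (hLc.sub continuousAt_const).norm
      refine this.eventually_lt_const ?_
      change ‖L x - l‖ < _
      rw [hLx, sub_self, norm_zero]; positivity
    have ev2 : ∀ᶠ p in 𝓝 x, |L p (F p) - l (F x)| < m/2 := by
      have : ContinuousAt (fun p => |L p (F p) - l (F x)|) x :=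
        ((hLc.clm_apply (hF2 x (hDO hxc)).continuousAt).sub continuousAt_const).abs
      refine this.eventually_lt_const ?_
      change |L x (F x) - l (F x)| < _
      rw [hLx, sub_self, abs_zero]; positivity
    obtain ⟨s, hs, hev⟩ := Metric.eventually_nhds_iff_ball.mp (ev1.and ev2)
    refine ⟨min s ρ, by positivity, fun p ⟨hp, hpf⟩ => ⟨L p, fun z hz hzp => ?_⟩⟩
    have hpV := hg.sub (frontier_subset_closure hpf)
    obtain ⟨e1, e2⟩ := hev p (ball_subset_ball (min_le_left _ _) hp)
    by_cases hzb : z ∈ ball x ρ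
    · have h1 := hL p (ball_subset_ball (min_le_right _ _) hp) z hzb ((hg.hf p hpV).1 hpf)
        ((hg.hcD z (hg.sub hz)).1 hz)
      have h2 : 0 < ‖z - p‖ := norm_pos_iff.2 (sub_ne_zero.2 hzp)
      have h3 : 0 < c/4 * ‖z - p‖^2 := by positivity
      rw [map_sub] at h1
      linarith
    · have h1 := hfar z hz hzb
      have h2 := (L p - l).le_opNorm (F z)
      have h3 : ‖L p - l‖ * ‖F z‖ ≤ m / (2 * (B+1)) * (B + 1) :=
        mul_le_mul e1.le (by linarith [hB z hz]) (norm_nonneg _) (by positivity)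
      have h4 : m / (2 * (B+1)) * (B + 1) = m/2 := by field_simp
      rw [Real.norm_eq_abs] at h2
      have h5 := (abs_le.mp h2).2
      rw [ContinuousLinearMap.sub_apply] at h5
      have h6 := (abs_lt.mp e2).1
      linarith

lemma exists_normal (l : EN N →L[ℝ] ℝ) : ∃ n : EN N, ∀ w, (⟪n, w⟫_ℂ).re = l w := by
  refine ⟨(InnerProductSpace.toDual ℂ (EN N)).symm (RL l 0), fun w => ?_⟩
  rw [InnerProductSpace.toDual_symm_apply, RL_re, ContinuousLinearMap.fderiv]

lemma exists_unitary (hN : 0 < N) (n : EN N) (hn : ‖n‖ = 1) :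
    ∃ U : EN N ≃ₗᵢ[ℂ] EN N, U n = EuclideanSpace.single (⟨0, hN⟩ : Fin N) (1:ℂ) := by
  obtain ⟨b, hb⟩ := Orthonormal.exists_orthonormalBasis_extension_of_card_eq (𝕜 := ℂ) (E := EN N)
    (ι := Fin N) (by simp [EN]) (v := fun _ => n) (s := {(⟨0, hN⟩ : Fin N)}) (by
      rw [orthonormal_iff_ite]
      rintro ⟨i, hi⟩ ⟨j, hj⟩
      have hi' : i = ⟨0, hN⟩ := hi
      have hj' : j = ⟨0, hN⟩ := hj
      subst hi' hj'
      simp [inner_self_eq_norm_sq_to_K, hn])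
  refine ⟨b.repr, ?_⟩
  rw [← hb ⟨0, hN⟩ (by simp)]
  exact b.repr_self _

set_option maxHeartbeats 1000000 in
theorem final_of_exposable (hN : 0 < N) {D : Set (EN N)} {r : EN N → ℝ} {V : Set (EN N)} {c₁ δ : ℝ}
    {x : EN N} (hg : Geo D r V c₁ δ) (hx : x ∈ frontier D) (he : Exposable D r x) :
    ∃ s > (0:ℝ), ∃ (k : EN N → EN N) (Ω : Set (EN N)),
      IsOpen Ω ∧ closure D ⊆ Ω ∧ DifferentiableOn ℂ k Ω ∧ InjOn k Ω ∧
      k '' closure D ⊆ Metric.closedBall 0 1 ∧ k '' D ⊆ Metric.ball 0 1 ∧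
      k x = EuclideanSpace.single (⟨0, hN⟩ : Fin N) (1:ℂ) ∧
      ∀ p ∈ k '' (Metric.ball x s ∩ frontier D), ∃ l : EN N →L[ℝ] ℝ,
        ∀ z ∈ closure (k '' D), z ≠ p → l z < l p := by
  obtain ⟨F, O, l, hO, hDO, hF, hFi, hlt, ⟨c, hc, hq⟩, s, hs, hsx⟩ := expose_near hg hx he
  have hxc : x ∈ closure D := frontier_subset_closure hx
  have hcpt : IsCompact (closure D) := hg.bD.isCompact_closure
  have hxD : x ∉ D := by
    rw [hg.oD.frontier_eq] at hx; exact hx.2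
  obtain ⟨z₀, hz₀⟩ : D.Nonempty := closure_nonempty_iff.1 ⟨x, hxc⟩
  obtain ⟨n, hn⟩ := exists_normal l
  have hn0 : n ≠ 0 := by
    rintro rfl
    have h1 := hlt z₀ (subset_closure hz₀) (by rintro rfl; exact hxD hz₀)
    rw [← hn, ← hn] at h1
    simp at h1
  have hnp : 0 < ‖n‖ := norm_pos_iff.2 hn0
  set u : EN N := ((‖n‖⁻¹ : ℝ) : ℂ) • n with hu
  have hu1 : ‖u‖ = 1 := by
    rw [hu, norm_smul, Complex.norm_real, Real.norm_eq_abs, abs_of_pos (by positivity)]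
    field_simp
  have hul : ∀ w, (⟪u, w⟫_ℂ).re = ‖n‖⁻¹ * l w := by
    intro w
    rw [hu, inner_smul_left, Complex.conj_ofReal, Complex.re_ofReal_mul, hn]
  obtain ⟨U, hU⟩ := exists_unitary hN u hu1
  set g : ℝ := c / ‖n‖ with hgdef
  have hgp : 0 < g := by positivity
  have hgc : (g : ℂ) ≠ 0 := by exact_mod_cast hgp.ne'
  have hest : ∀ z ∈ closure D, ‖(g:ℂ) • (F z - F x) + u‖^2 ≤ 1 - g^2 * ‖F z - F x‖^2 := by
    intro z hz
    have h1 := norm_add_sq (𝕜 := ℂ) u ((g:ℂ) • (F z - F x))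
    have h2 : RCLike.re (⟪u, (g:ℂ) • (F z - F x)⟫_ℂ) = g * (‖n‖⁻¹ * l (F z - F x)) := by
      rw [inner_smul_right]
      change ((g:ℂ) * _).re = _
      rw [Complex.re_ofReal_mul, hul]
    rw [add_comm, h1, h2, hu1, norm_smul, Complex.norm_real, Real.norm_eq_abs, abs_of_pos hgp]
    have h3 : g * (‖n‖⁻¹ * l (F z - F x)) ≤ g * (‖n‖⁻¹ * (-c * ‖F z - F x‖^2)) := by
      gcongr; exact hq z hz
    have h4 : g * (‖n‖⁻¹ * (-c * ‖F z - F x‖^2)) = -(g^2 * ‖F z - F x‖^2) := by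
      rw [hgdef]; field_simp
    nlinarith
  set k : EN N → EN N := fun z => U ((g:ℂ) • (F z - F x) + u) with hkdef
  have hkn : ∀ z, ‖k z‖ = ‖(g:ℂ) • (F z - F x) + u‖ := fun z => U.norm_map _
  have hkd : DifferentiableOn ℂ k O := by
    have h1 : DifferentiableOn ℂ (fun z => (g:ℂ) • (F z - F x) + u) O :=
      by fun_prop
    exact U.toContinuousLinearEquiv.differentiable.comp_differentiableOn h1
  refine ⟨s, hs, k, O, hO, hDO, hkd, ?_, ?_, ?_, ?_, ?_⟩
  · intro a ha b hb hab
    have h1 := U.injective hab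
    have h2 := smul_right_injective _ hgc (add_right_cancel h1)
    exact hFi ha hb (sub_left_injective h2)
  · rintro _ ⟨z, hz, rfl⟩
    rw [mem_closedBall_zero_iff, hkn]
    have h1 := hest z hz
    have h2 : 0 ≤ g^2 * ‖F z - F x‖^2 := by positivity
    nlinarith [norm_nonneg ((g:ℂ) • (F z - F x) + u)]
  · rintro _ ⟨z, hz, rfl⟩
    rw [mem_ball_zero_iff, hkn]
    have h1 := hest z (subset_closure hz)
    have h3 : F z - F x ≠ 0 := by
      rw [sub_ne_zero]
      intro h
      have := hFi (hDO (subset_closure hz)) (hDO hxc) h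
      exact hxD (this ▸ hz)
    have h4 : 0 < ‖F z - F x‖ := norm_pos_iff.2 h3
    have h2 : 0 < g^2 * ‖F z - F x‖^2 := by positivity
    nlinarith [norm_nonneg ((g:ℂ) • (F z - F x) + u)]
  · simp only [hkdef, sub_self, smul_zero, zero_add]; exact hU
  · rintro _ ⟨p, hp, rfl⟩
    obtain ⟨l', hl'⟩ := hsx p hp
    refine ⟨l'.comp ((U.symm.toContinuousLinearEquiv : EN N →L[ℂ] EN N).restrictScalars ℝ), ?_⟩
    intro y hy hyp
    have hsub : closure (k '' D) ⊆ k '' closure D :=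
      closure_minimal (image_mono subset_closure)
        (hcpt.image_of_continuousOn (hkd.continuousOn.mono hDO)).isClosed
    obtain ⟨z, hz, rfl⟩ := hsub hy
    have hzp : z ≠ p := by rintro rfl; exact hyp rfl
    have h1 := hl' z hz hzp
    have hval : ∀ a, (l'.comp ((U.symm.toContinuousLinearEquiv : EN N →L[ℂ] EN N).restrictScalars ℝ)) (k a)
        = g * (l' (F a) - l' (F x)) + l' u := by
      intro a
      have h2 : U.symm (k a) = (g:ℝ) • (F a - F x) + u := by
        rw [hkdef]; simp
      change l' (U.symm (k a)) = _
      rw [h2, map_add, map_smul, map_sub, smul_eq_mul]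
    rw [hval, hval]
    have := mul_lt_mul_of_pos_left h1 hgp
    linarith

theorem final_all (hN : 0 < N) (D : Set (EN N)) (hD : StrictlyPseudoconvex D) :
    ∀ x ∈ frontier D, ∃ s > (0:ℝ), ∃ (k : EN N → EN N) (Ω : Set (EN N)),
      IsOpen Ω ∧ closure D ⊆ Ω ∧ DifferentiableOn ℂ k Ω ∧ InjOn k Ω ∧
      k '' closure D ⊆ Metric.closedBall 0 1 ∧ k '' D ⊆ Metric.ball 0 1 ∧
      k x = EuclideanSpace.single (⟨0, hN⟩ : Fin N) (1:ℂ) ∧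
      ∀ p ∈ k '' (Metric.ball x s ∩ frontier D), ∃ l : EN N →L[ℝ] ℝ,
        ∀ z ∈ closure (k '' D), z ≠ p → l z < l p := by
  intro x hx
  obtain ⟨r, V, c, δ, hg⟩ := exists_geo hD
  by_cases hker : ∃ w, w ≠ 0 ∧ RL r x w = 0
  · exact final_of_exposable hN hg hx (exposable_of_ker hg hx hker)
  · refine final_of_exposable hN hg hx (exposable_of_inj hg hx fun w hw => ?_)
    by_contra h
    exact hker ⟨w, h, hw⟩

end DFW
end

/-- **Diederich–Fornæss–Wold embedding.** Let `D ⊆ ℂ^N` be a strictly pseudoconvex domain.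
For every `x ∈ bD` there are a ball `B_x` centred at `x` and a holomorphic embedding
`k_x : cl D → cl 𝔹_N` (holomorphic and injective on a neighborhood of `cl D`) with
`k_x(x) = (1,0) ∈ ℂ × ℂ^{N-1}` and `k_x(D) ⊆ 𝔹_N`, such that every point of
`k_x(B_x ∩ bD)` is a point of strict convexity of `k_x(D)`. -/
theorem diederich_fornaess_wold {N : ℕ} (hN : 0 < N) (D : Set (EN N))
    (hD : StrictlyPseudoconvex D) :
    ∀ x ∈ frontier D, ∃ s > (0:ℝ), ∃ (k : EN N → EN N) (Ω : Set (EN N)),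
      IsOpen Ω ∧ closure D ⊆ Ω ∧ DifferentiableOn ℂ k Ω ∧ InjOn k Ω ∧
      k '' closure D ⊆ Metric.closedBall 0 1 ∧ k '' D ⊆ Metric.ball 0 1 ∧
      k x = EuclideanSpace.single (⟨0, hN⟩ : Fin N) (1:ℂ) ∧
      ∀ p ∈ k '' (Metric.ball x s ∩ frontier D), ∃ l : EN N →L[ℝ] ℝ,
        ∀ z ∈ closure (k '' D), z ≠ p → l z < l p := by
  exact DFW.final_all hN D hD
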